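/- Let d ≥ 2 and assume the family of probability measures {P^u}_{u∈(a,b)} on {0,1}^{Z^d} satisfies assumptions P1–P3 and S1–S2. Then for every u ∈ (a,b), every T > 0, and for P^u[·|0 ∈ S_∞]-almost every configuration ω, the law on C[0,T] of the rescaled linear interpolation (B̃_n(t))_{0≤t≤T} of the lazy simple random walk on S started at 0 converges weakly, as n → ∞, to the law of a Brownian motion with zero drift and non-degenerate covariance matrix. Moreover, if reflections and rotations of Z^d by π/2 preserve P^u, then the limiting Brownian motion is isotropic with positive diffusion constant. -/

import Mathlib

open MeasureTheory Filter
open scoped ENNReal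

namespace Perco

/-- A point of the lattice `ℤ^d`. -/
abbrev Pt (d : ℕ) := Fin d → ℤ

/-- A percolation configuration on `ℤ^d`. -/
abbrev Config (d : ℕ) := Pt d → Bool

variable {d : ℕ}

/-- The `ℓ¹`-distance on `ℤ^d`. -/
def dist1 (x y : Pt d) : ℕ := ∑ i, (x i - y i).natAbs

/-- The `ℓ^∞`-distance on `ℤ^d`. -/
def distInf (x y : Pt d) : ℕ := Finset.univ.sup fun i => (x i - y i).natAbs

/-- The closed `ℓ^∞`-ball of radius `R` around `x`. -/
def ballZ (x : Pt d) (R : ℕ) : Set (Pt d) := {y | distInf x y ≤ R}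

/-- Nearest-neighbour adjacency in `ℤ^d`. -/
def adj (x y : Pt d) : Prop := dist1 x y = 1

/-- The occupied set of a configuration. -/
def SS (ω : Config d) : Set (Pt d) := {x | ω x = true}

/-- One step of a nearest-neighbour path staying inside `T`. -/
def stepRel (T : Set (Pt d)) (x y : Pt d) : Prop := adj x y ∧ x ∈ T ∧ y ∈ T

/-- `x` and `y` are connected by a nearest-neighbour path inside `T`. -/
def connIn (T : Set (Pt d)) (x y : Pt d) : Prop :=
  x ∈ T ∧ y ∈ T ∧ Relation.ReflTransGen (stepRel T) x y

/-- The connected component (cluster) of `x` in `T`. -/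
def cluster (T : Set (Pt d)) (x : Pt d) : Set (Pt d) := {y | connIn T x y}

/-- `S_r`: vertices of `S(ω)` in connected components of `ℓ¹`-diameter at least `r`. -/
def Sr (ω : Config d) (r : ℝ) : Set (Pt d) :=
  {x | x ∈ SS ω ∧ ∃ y ∈ cluster (SS ω) x, ∃ z ∈ cluster (SS ω) x, r ≤ (dist1 y z : ℝ)}

/-- `S_∞`: vertices of `S(ω)` in infinite connected components. -/
def Sinf (ω : Config d) : Set (Pt d) := {x | x ∈ SS ω ∧ (cluster (SS ω) x).Infinite}

/-- The shift of a configuration by `x`. -/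
def shift (x : Pt d) (ω : Config d) : Config d := fun y => ω (x + y)

/-- An increasing event. -/
def IncreasingEvent (G : Set (Config d)) : Prop :=
  ∀ ω ω' : Config d, (∀ x, ω x = true → ω' x = true) → ω ∈ G → ω' ∈ G

/-- A decreasing event. -/
def DecreasingEvent (G : Set (Config d)) : Prop :=
  ∀ ω ω' : Config d, (∀ x, ω' x = true → ω x = true) → ω ∈ G → ω' ∈ G

/-- The event `G` depends only on the coordinates in `B`. -/
def DependsOn (G : Set (Config d)) (B : Set (Pt d)) : Prop :=
  ∀ ω ω' : Config d, (∀ x ∈ B, ω x = ω' x) → (ω ∈ G ↔ ω' ∈ G)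

/-- The edge boundary of `A` in `Sset`: (directed representatives of) edges of `ℤ^d`
with one endpoint in `A` and the other in `Sset \ A`. -/
def edgeBd (Sset A : Set (Pt d)) : Set (Pt d × Pt d) :=
  {p | adj p.1 p.2 ∧ p.1 ∈ A ∧ p.2 ∈ Sset \ A}

/-- The density `η(u) = P[0 ∈ S_∞]` of the infinite cluster. -/
noncomputable def eta (d : ℕ) (P : Measure (Config d)) : ℝ :=
  (P {ω | (0 : Pt d) ∈ Sinf ω}).toReal

/-- The first local-uniqueness event of axiom S1. -/
def locUniq1 (d : ℕ) (R : ℕ) : Set (Config d) :=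
  {ω | (Sr ω R ∩ ballZ (0 : Pt d) R).Nonempty}

/-- The second local-uniqueness event of axiom S1. -/
def locUniq2 (d : ℕ) (R : ℕ) : Set (Config d) :=
  {ω | ∀ x ∈ Sr ω ((R : ℝ)/10) ∩ ballZ (0 : Pt d) R,
       ∀ y ∈ Sr ω ((R : ℝ)/10) ∩ ballZ (0 : Pt d) R,
       connIn (SS ω ∩ ballZ (0 : Pt d) (2*R)) x y}

/-- The axioms **P1**–**P3** and **S1**–**S2** of Drewitz–Ráth–Sapozhnikov for a
one-parameter family of probability measures on `{0,1}^{ℤ^d}`. -/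
structure Axioms (d : ℕ) (a b : ℝ) (P : ℝ → Measure (Config d)) where
  /-- decoupling exponent -/
  εP : ℝ
  /-- sprinkling exponent -/
  χP : ℝ
  RP : ℕ
  LP : ℕ
  fP : ℕ → ℝ
  fS : ℝ → ℕ → ℝ
  ΔS : ℝ → ℝ
  RS : ℝ → ℕ
  prob : ∀ u ∈ Set.Ioo a b, IsProbabilityMeasure (P u)
  /-- P1: every lattice shift is measure preserving and ergodic. -/
  ergodic : ∀ u ∈ Set.Ioo a b, ∀ x : Pt d, x ≠ 0 → Ergodic (shift x) (P u)
  /-- P2: monotonicity. -/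
  mono : ∀ u ∈ Set.Ioo a b, ∀ u' ∈ Set.Ioo a b, u ≤ u' →
    ∀ G : Set (Config d), MeasurableSet G → IncreasingEvent G → P u G ≤ P u' G
  εP_pos : 0 < εP
  χP_pos : 0 < χP
  fP_lb : ∀ L : ℕ, LP ≤ L → Real.exp ((Real.log L) ^ εP) ≤ fP L
  /-- P3, decoupling for decreasing events. -/
  decoupleDec : ∀ (R L : ℕ), RP ≤ R → 1 ≤ L → ∀ x₁ x₂ : Pt d, R * L ≤ distInf x₁ x₂ →
    ∀ u uh : ℝ, uh ∈ Set.Ioo a b → u ∈ Set.Ioo a b → uh < u →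
    (1 + (R : ℝ) ^ (-χP)) * uh ≤ u →
    ∀ A₁ A₂ : Set (Config d), MeasurableSet A₁ → MeasurableSet A₂ →
      DecreasingEvent A₁ → DecreasingEvent A₂ →
      DependsOn A₁ (ballZ x₁ (10*L)) → DependsOn A₂ (ballZ x₂ (10*L)) →
      (P u (A₁ ∩ A₂)).toReal ≤ (P uh A₁).toReal * (P uh A₂).toReal + Real.exp (-(fP L))
  /-- P3, decoupling for increasing events. -/
  decoupleInc : ∀ (R L : ℕ), RP ≤ R → 1 ≤ L → ∀ x₁ x₂ : Pt d, R * L ≤ distInf x₁ x₂ →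
    ∀ u uh : ℝ, uh ∈ Set.Ioo a b → u ∈ Set.Ioo a b → uh < u →
    (1 + (R : ℝ) ^ (-χP)) * uh ≤ u →
    ∀ B₁ B₂ : Set (Config d), MeasurableSet B₁ → MeasurableSet B₂ →
      IncreasingEvent B₁ → IncreasingEvent B₂ →
      DependsOn B₁ (ballZ x₁ (10*L)) → DependsOn B₂ (ballZ x₂ (10*L)) →
      (P uh (B₁ ∩ B₂)).toReal ≤ (P u B₁).toReal * (P u B₂).toReal + Real.exp (-(fP L))
  ΔS_pos : ∀ u ∈ Set.Ioo a b, 0 < ΔS u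
  fS_lb : ∀ u ∈ Set.Ioo a b, ∀ R : ℕ, RS u ≤ R → (Real.log R) ^ (1 + ΔS u) ≤ fS u R
  /-- S1, first part. -/
  S1a : ∀ u ∈ Set.Ioo a b, ∀ R : ℕ, 1 ≤ R →
    1 - Real.exp (-(fS u R)) ≤ (P u (locUniq1 d R)).toReal
  /-- S1, second part. -/
  S1b : ∀ u ∈ Set.Ioo a b, ∀ R : ℕ, 1 ≤ R →
    1 - Real.exp (-(fS u R)) ≤ (P u (locUniq2 d R)).toReal
  /-- S2: positivity of the density of the infinite cluster. -/
  S2pos : ∀ u ∈ Set.Ioo a b, 0 < eta d (P u)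
  /-- S2: continuity of the density of the infinite cluster. -/
  S2cont : ContinuousOn (fun u => eta d (P u)) (Set.Ioo a b)


/-- The degree of `y` in `S(ω)`. -/
noncomputable def degS (ω : Config d) (y : Pt d) : ℕ := {z | adj y z ∧ z ∈ SS ω}.ncard

open scoped Classical in
/-- The transition kernel of the lazy simple random walk on `S(ω)`. -/
noncomputable def stepP (d : ℕ) (ω : Config d) (y z : Pt d) : ℝ :=
  if adj y z ∧ z ∈ SS ω then 1/(2*d)
  else if z = y then 1 - (degS ω y : ℝ)/(2*d) else 0

open scoped Classical in
/-- The `n`-step transition probabilities of the lazy simple random walk on `S(ω)`. -/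
noncomputable def walkP (d : ℕ) (ω : Config d) : ℕ → Pt d → Pt d → ℝ
  | 0, x, y => if y = x then 1 else 0
  | n+1, x, y => ∑' z : Pt d, walkP d ω n x z * stepP d ω z y

/-! ### Path space, interpolated walk, and Brownian motion law -/

/-- The path space: functions `[0,T] → ℝ^d` with the topology of uniform convergence
(on `C[0,T]` this is the supremum-norm topology). -/
abbrev PathSp (d : ℕ) (T : ℝ) := UniformFun (Set.Icc (0:ℝ) T) (Fin d → ℝ)

noncomputable instance (d : ℕ) (T : ℝ) : MeasurableSpace (PathSp d T) := borel _

/-- Extension of a finite path `p : Fin (m+1) → ℤ^d` to all times, by stopping at time `m`. -/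
def extPath (m : ℕ) (p : Fin (m+1) → Pt d) (k : ℕ) : Pt d :=
  p ⟨min k m, Nat.lt_succ_of_le (min_le_right k m)⟩

/-- The diffusively rescaled linear interpolation `B̃_n` of the path `p`, as an element of the
path space: `B̃_n(t) = n^{-1/2}(X_{⌊tn⌋} + (tn − ⌊tn⌋)(X_{⌊tn⌋+1} − X_{⌊tn⌋}))`. -/
noncomputable def interpPath (d : ℕ) (T : ℝ) (n m : ℕ) (p : Fin (m+1) → Pt d) :
    PathSp d T :=
  UniformFun.ofFun (fun t => fun i =>
    (Real.sqrt n)⁻¹ *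
      ((extPath m p (⌊t.1 * n⌋.toNat) i : ℝ) +
        (t.1 * n - ⌊t.1 * n⌋) *
          ((extPath m p (⌊t.1 * n⌋.toNat + 1) i : ℝ) - (extPath m p (⌊t.1 * n⌋.toNat) i : ℝ))))

open scoped Classical in
/-- The probability that the lazy simple random walk on `S(ω)` started at `0` follows the finite
path `p`. -/
noncomputable def pathProb (d : ℕ) (ω : Config d) (m : ℕ) (p : Fin (m+1) → Pt d) : ℝ :=
  (if p 0 = (0 : Pt d) then (1:ℝ) else 0) *
    ∏ k : Fin m, stepP d ω (p k.castSucc) (p k.succ)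

/-- The expectation of `F(B̃_n)` for the lazy simple random walk on `S(ω)` started at `0`,
where only the first `⌊Tn⌋ + 2` positions of the walk are relevant. -/
noncomputable def walkExpct (d : ℕ) (ω : Config d) (T : ℝ) (n : ℕ)
    (F : PathSp d T → ℝ) : ℝ :=
  ∑' p : Fin (⌊T * n⌋.toNat + 1 + 1) → Pt d,
    pathProb d ω (⌊T * n⌋.toNat + 1) p * F (interpPath d T n (⌊T * n⌋.toNat + 1) p)

/-- `W` is the law on `C[0,T]` of a `d`-dimensional Brownian motion with zero drift and
covariance matrix `Cov`: it is a probability measure, carried by continuous paths, whose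
finite-dimensional distributions have the Gaussian characteristic functions of Brownian
motion. -/
def IsBMLaw (d : ℕ) (T : ℝ) (Cov : Matrix (Fin d) (Fin d) ℝ) (W : Measure (PathSp d T)) :
    Prop :=
  IsProbabilityMeasure W ∧
  (∀ᵐ f ∂W, Continuous (UniformFun.toFun f)) ∧
  ∀ (n : ℕ) (t : Fin n → Set.Icc (0:ℝ) T) (θ : Fin n → Fin d → ℝ),
    ∫ f, Complex.exp (Complex.I *
        ((∑ k, ∑ i, θ k i * (UniformFun.toFun f (t k) i) : ℝ) : ℂ)) ∂W =
      Complex.exp (-(1/2 : ℂ) *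
        ((∑ k, ∑ k', min (t k).1 (t k').1 *
            ∑ i, ∑ i', θ k i * Cov i i' * θ k' i' : ℝ) : ℂ))

/-- The signed permutation of `ℤ^d` given by a permutation `π` of the coordinates and signs
`ε` (these generate the group of reflections and rotations by `π/2` of `ℤ^d`). -/
def signedPerm (π : Equiv.Perm (Fin d)) (ε : Fin d → Bool) (x : Pt d) : Pt d :=
  fun i => if ε i then -(x (π i)) else x (π i)

end Perco

namespace Perco
variable {d : ℕ}

/-! ## M1: lattice basics -/

/-- the sup norm on the lattice -/
def nrm (x : Pt d) : ℕ := Finset.univ.sup fun i => (x i).natAbs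

lemma nrm_le_iff (x : Pt d) (n : ℕ) : nrm x ≤ n ↔ ∀ i, (x i).natAbs ≤ n := by
  simp [nrm]

lemma natAbs_le_nrm (x : Pt d) (i : Fin d) : (x i).natAbs ≤ nrm x :=
  (nrm_le_iff x _).1 le_rfl i

lemma nrm_add (x y : Pt d) : nrm (x + y) ≤ nrm x + nrm y := by
  rw [nrm_le_iff]; intro i
  have := natAbs_le_nrm x i
  have := natAbs_le_nrm y i
  simp only [Pi.add_apply]; omega

lemma nrm_neg (x : Pt d) : nrm (-x) = nrm x := by
  simp [nrm]

lemma nrm_sub (x y : Pt d) : nrm (x - y) ≤ nrm x + nrm y := by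
  rw [sub_eq_add_neg, ← nrm_neg y]; exact nrm_add _ _

lemma nrm_sub_comm (x y : Pt d) : nrm (x - y) = nrm (y - x) := by
  rw [← nrm_neg, neg_sub]

@[simp] lemma nrm_zero : nrm (0 : Pt d) = 0 := by
  apply Nat.le_zero.1; rw [nrm_le_iff]; simp

lemma nrm_eq_zero {x : Pt d} (h : nrm x = 0) : x = 0 := by
  funext i
  have := natAbs_le_nrm x i
  simp only [Pi.zero_apply]; omega

lemma distInf_eq (x y : Pt d) : distInf x y = nrm (y - x) := by
  rw [nrm_sub_comm]; rfl

lemma mem_ballZ (x y : Pt d) (R : ℕ) : y ∈ ballZ x R ↔ nrm (y - x) ≤ R := by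
  rw [← distInf_eq]; rfl

lemma dist1_le (x y : Pt d) : dist1 x y ≤ d * nrm (y - x) := by
  unfold dist1
  calc ∑ i, (x i - y i).natAbs ≤ ∑ i : Fin d, nrm (y - x) := by
        apply Finset.sum_le_sum; intro i _
        have := natAbs_le_nrm (y - x) i
        simp only [Pi.sub_apply] at this; omega
    _ = d * nrm (y - x) := by simp

lemma nrm_le_dist1 (x y : Pt d) : nrm (y - x) ≤ dist1 x y := by
  rw [nrm_le_iff]; intro i
  have := Finset.single_le_sum (f := fun i => (x i - y i).natAbs) (fun _ _ => Nat.zero_le _)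
    (Finset.mem_univ i)
  unfold dist1
  simp only [Pi.sub_apply] at this ⊢
  omega

/-- the box of radius `n` -/
noncomputable def box (d n : ℕ) : Finset (Pt d) := Fintype.piFinset fun _ => Finset.Icc (-(n:ℤ)) n

lemma mem_box {n : ℕ} {x : Pt d} : x ∈ box d n ↔ nrm x ≤ n := by
  simp only [box, Fintype.mem_piFinset, Finset.mem_Icc, nrm_le_iff]
  exact forall_congr' fun i => by omega

lemma card_box (n : ℕ) : (box d n).card = (2*n+1)^d := by
  simp only [box, Fintype.card_piFinset, Int.card_Icc, Finset.prod_const, Finset.card_univ,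
    Fintype.card_fin]
  congr 1; omega

lemma box_mono {m n : ℕ} (h : m ≤ n) : box d m ⊆ box d n := by
  intro x hx; rw [mem_box] at *; omega

/-- the directions -/
abbrev Dir (d : ℕ) := Fin d × Bool

/-- the unit vector of a direction -/
def dir (e : Dir d) : Pt d := Pi.single e.1 (if e.2 then 1 else -1)

/-- the opposite direction -/
def opp (e : Dir d) : Dir d := (e.1, !e.2)

@[simp] lemma opp_opp (e : Dir d) : opp (opp e) = e := by simp [opp]

lemma dir_opp (e : Dir d) : dir (opp e) = - dir e := by
  rcases e with ⟨i, b⟩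
  cases b <;> simp [dir, opp, ← Pi.single_neg]

/-- opposite as an equivalence -/
def oppEquiv (d : ℕ) : Dir d ≃ Dir d := ⟨opp, opp, opp_opp, opp_opp⟩

lemma dir_injective : Function.Injective (dir (d := d)) := by
  rintro ⟨i, b⟩ ⟨j, c⟩ h
  have h1 := congrFun h i
  have hij : i = j := by
    by_contra hne
    simp only [dir, Pi.single_eq_same, Pi.single_eq_of_ne hne] at h1
    cases b <;> simp at h1
  subst hij
  simp only [dir, Pi.single_eq_same] at h1
  cases b <;> cases c <;> simp at h1 ⊢

lemma dir_natAbs (e : Dir d) (i : Fin d) : (dir e i).natAbs = if i = e.1 then 1 else 0 := by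
  rcases e with ⟨j, b⟩
  by_cases h : i = j
  · subst h; cases b <;> simp [dir]
  · simp [dir, h]

lemma nrm_dir (e : Dir d) : nrm (dir e) = 1 := by
  apply le_antisymm
  · rw [nrm_le_iff]; intro i; rw [dir_natAbs]; split_ifs <;> omega
  · have := natAbs_le_nrm (dir e) e.1
    rw [dir_natAbs] at this; simpa using this

lemma dir_ne_zero (e : Dir d) : dir e ≠ 0 := by
  intro h; have := nrm_dir e; rw [h] at this; simp at this

lemma adj_iff (x y : Pt d) : adj x y ↔ ∃ e, y = x + dir e := by
  constructor
  · intro h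
    unfold adj dist1 at h
    have : ∃ i, (x i - y i).natAbs ≠ 0 := by
      by_contra hc; push Not at hc
      simp [hc] at h
    obtain ⟨i, hi⟩ := this
    have h2 := Finset.add_sum_erase Finset.univ (fun i => (x i - y i).natAbs) (Finset.mem_univ i)
    have h3 : ∑ j ∈ Finset.univ.erase i, (x j - y j).natAbs = 0 := by omega
    have h4 : ∀ j, j ≠ i → x j = y j := by
      intro j hj
      have := (Finset.sum_eq_zero_iff.1 h3) j (by simp [hj])
      omega
    refine ⟨(i, decide (x i < y i)), ?_⟩
    funext j
    by_cases hj : j = i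
    · subst hj
      by_cases hlt : x j < y j <;> simp [dir, hlt] <;> omega
    · simp [dir, hj, h4 j hj]
  · rintro ⟨e, rfl⟩
    unfold adj dist1
    have : ∀ i, (x i - (x + dir e) i).natAbs = if i = e.1 then 1 else 0 := by
      intro i; rw [← dir_natAbs]; simp
    simp only [this, Finset.sum_ite_eq', Finset.mem_univ, if_true]

lemma adj_symm {x y : Pt d} (h : adj x y) : adj y x := by
  rw [adj_iff] at *
  obtain ⟨e, rfl⟩ := h
  exact ⟨opp e, by rw [dir_opp]; abel⟩

/-! ### connectivity -/
lemma connIn_refl {T : Set (Pt d)} {x : Pt d} (h : x ∈ T) : connIn T x x :=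
  ⟨h, h, Relation.ReflTransGen.refl⟩

lemma connIn_trans {T : Set (Pt d)} {x y z : Pt d} (h : connIn T x y) (h' : connIn T y z) :
    connIn T x z := ⟨h.1, h'.2.1, h.2.2.trans h'.2.2⟩

lemma stepRel_symm {T : Set (Pt d)} {x y : Pt d} (h : stepRel T x y) : stepRel T y x :=
  ⟨adj_symm h.1, h.2.2, h.2.1⟩

lemma connIn_symm {T : Set (Pt d)} {x y : Pt d} (h : connIn T x y) : connIn T y x :=
  ⟨h.2.1, h.1, by
    haveI : Std.Symm (stepRel T) := ⟨fun _ _ => stepRel_symm⟩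
    exact (Relation.ReflTransGen.stdSymm (r := stepRel T)).symm _ _ h.2.2⟩

lemma connIn_mono {T T' : Set (Pt d)} (hT : T ⊆ T') {x y : Pt d} (h : connIn T x y) :
    connIn T' x y :=
  ⟨hT h.1, hT h.2.1, Relation.ReflTransGen.mono
    (fun _ _ h => ⟨h.1, hT h.2.1, hT h.2.2⟩) _ _ h.2.2⟩

lemma connIn_step {T : Set (Pt d)} {x y : Pt d} (h : stepRel T x y) : connIn T x y :=
  ⟨h.2.1, h.2.2, Relation.ReflTransGen.single h⟩

/-- restrict a connection to a subset closed under steps -/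
lemma connIn_restrict {T T' : Set (Pt d)} {x y : Pt d} (hx : x ∈ T')
    (hcl : ∀ a b, a ∈ T' → stepRel T a b → b ∈ T') (h : connIn T x y) : connIn T' x y := by
  have : y ∈ T' ∧ Relation.ReflTransGen (stepRel T') x y := by
    have h2 := h.2.2
    induction h2 with
    | refl => exact ⟨hx, .refl⟩
    | tail hab hbc ih =>
      have hh := ih ⟨h.1, hbc.2.1, hab⟩
      have hc := hcl _ _ hh.1 hbc
      exact ⟨hc, hh.2.tail ⟨hbc.1, hh.1, hc⟩⟩
  exact ⟨hx, this.1, this.2⟩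

lemma SS_shift (x : Pt d) (ω : Config d) (y : Pt d) : y ∈ SS (shift x ω) ↔ x + y ∈ SS ω := Iff.rfl

lemma shift_shift (x y : Pt d) (ω : Config d) : shift x (shift y ω) = shift (y + x) ω := by
  funext z; simp [shift, add_assoc]

@[simp] lemma shift_zero (ω : Config d) : shift 0 ω = ω := by
  funext z; simp [shift]

lemma dist1_add (x y z : Pt d) : dist1 (x + y) (x + z) = dist1 y z := by
  simp [dist1]

lemma adj_add (x y z : Pt d) : adj (x + y) (x + z) ↔ adj y z := by
  simp [adj, dist1_add]

lemma connIn_add {T T' : Set (Pt d)} (x : Pt d) (hT : ∀ y ∈ T, x + y ∈ T') {y z : Pt d}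
    (h : connIn T y z) : connIn T' (x + y) (x + z) := by
  refine ⟨hT _ h.1, hT _ h.2.1, ?_⟩
  exact Relation.ReflTransGen.lift (fun y => x + y)
    (fun a b hab => ⟨(adj_add x a b).2 hab.1, hT _ hab.2.1, hT _ hab.2.2⟩) _ _ h.2.2

lemma connIn_shift_iff {T T' : Set (Pt d)} (x : Pt d) (hT : ∀ y, y ∈ T ↔ x + y ∈ T') (y z : Pt d) :
    connIn T y z ↔ connIn T' (x + y) (x + z) := by
  constructor
  · exact connIn_add x fun y hy => (hT y).1 hy
  · intro h
    have := connIn_add (T := T') (T' := T) (-x) (fun y hy => by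
      rw [hT]; simpa using hy) h
    simpa using this

lemma cluster_shift (x : Pt d) (ω : Config d) (y z : Pt d) :
    z ∈ cluster (SS (shift x ω)) y ↔ x + z ∈ cluster (SS ω) (x + y) :=
  connIn_shift_iff x (fun w => SS_shift x ω w) y z

lemma Sinf_shift (x : Pt d) (ω : Config d) (y : Pt d) :
    y ∈ Sinf (shift x ω) ↔ x + y ∈ Sinf ω := by
  have : cluster (SS ω) (x + y) = (fun z => x + z) '' cluster (SS (shift x ω)) y := by
    ext z
    constructor
    · intro hz
      exact ⟨-x + z, by rw [cluster_shift]; simpa using hz, by simp⟩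
    · rintro ⟨w, hw, rfl⟩
      exact (cluster_shift x ω y w).1 hw
  unfold Sinf
  simp only [Set.mem_ofPred_eq, SS_shift, this]
  rw [Set.infinite_image_iff (add_right_injective x).injOn]

lemma Sr_shift (x : Pt d) (ω : Config d) (r : ℝ) (y : Pt d) :
    y ∈ Sr (shift x ω) r ↔ x + y ∈ Sr ω r := by
  unfold Sr
  simp only [Set.mem_ofPred_eq, SS_shift]
  refine and_congr_right fun _ => ?_
  constructor
  · rintro ⟨a, ha, b, hb, h⟩
    exact ⟨x + a, (cluster_shift x ω y a).1 ha, x + b, (cluster_shift x ω y b).1 hb,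
      by rwa [dist1_add]⟩
  · rintro ⟨a, ha, b, hb, h⟩
    refine ⟨-x + a, by rw [cluster_shift]; simpa using ha, -x + b,
      by rw [cluster_shift]; simpa using hb, by rwa [dist1_add]⟩

lemma Sinf_sub_SS {ω : Config d} {x : Pt d} (h : x ∈ Sinf ω) : x ∈ SS ω := h.1

lemma cluster_eq {T : Set (Pt d)} {x y : Pt d} (h : connIn T x y) : cluster T x = cluster T y := by
  ext z; exact ⟨fun hz => connIn_trans (connIn_symm h) hz, fun hz => connIn_trans h hz⟩

lemma Sinf_conn {ω : Config d} {x y : Pt d} (hx : x ∈ Sinf ω) (h : connIn (SS ω) x y) :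
    y ∈ Sinf ω := ⟨h.2.1, by rw [← cluster_eq h]; exact hx.2⟩

lemma Sinf_nbr {ω : Config d} {x y : Pt d} (hx : x ∈ Sinf ω) (h : adj x y) (hy : y ∈ SS ω) :
    y ∈ Sinf ω := Sinf_conn hx (connIn_step ⟨h, hx.1, hy⟩)

lemma Sinf_dir {ω : Config d} {x : Pt d} (hx : x ∈ Sinf ω) (e : Dir d) :
    x + dir e ∈ Sinf ω ↔ ω (x + dir e) = true :=
  ⟨fun h => h.1, fun h => Sinf_nbr hx ((adj_iff _ _).2 ⟨e, rfl⟩) h⟩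

/-- connection inside `S ∩ B` starting from an infinite-cluster point is in `I ∩ B`. -/
lemma connIn_Sinf {ω : Config d} {B : Set (Pt d)} {x y : Pt d} (hx : x ∈ Sinf ω)
    (h : connIn (SS ω ∩ B) x y) : connIn (Sinf ω ∩ B) x y :=
  connIn_restrict ⟨hx, h.1.2⟩
    (fun _ _ ha hab => ⟨Sinf_nbr ha.1 hab.1 hab.2.2.1, hab.2.2.2⟩) h

/-! ### path inequality -/
lemma last_exit {T : Set (Pt d)} {y z : Pt d} (h : Relation.ReflTransGen (stepRel T) y z) :
    z = y ∨ ∃ y', stepRel T y y' ∧ connIn (T \ {y}) y' z := by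
  induction h with
  | refl => left; rfl
  | @tail b c hab hbc ih =>
    by_cases hc : c = y
    · left; exact hc
    right
    by_cases hb : b = y
    · subst hb; exact ⟨c, hbc, connIn_refl ⟨hbc.2.2, hc⟩⟩
    · rcases ih with rfl | ⟨y', h1, h2⟩
      · exact absurd rfl hb
      · exact ⟨y', h1, connIn_trans h2 (connIn_step ⟨hbc.1, ⟨hbc.2.1, hb⟩, ⟨hbc.2.2, hc⟩⟩)⟩

open scoped Classical in
/-- sum of absolute gradients over the (oriented) edges inside `T` -/
noncomputable def gradSum (T : Finset (Pt d)) (f : Pt d → ℝ) : ℝ :=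
  ∑ x ∈ T, ∑ e : Dir d, if x + dir e ∈ T then |f (x + dir e) - f x| else 0

lemma path_ineq (f : Pt d → ℝ) : ∀ (T : Finset (Pt d)) (y z : Pt d), connIn (T : Set (Pt d)) y z →
    |f z - f y| ≤ gradSum T f := by
  classical
  intro T
  induction T using Finset.strongInduction with
  | H T ih =>
    intro y z h
    have hnn : ∀ T : Finset (Pt d), 0 ≤ gradSum T f := fun T =>
      Finset.sum_nonneg fun x _ => Finset.sum_nonneg fun e _ => by split_ifs <;> positivity
    rcases last_exit h.2.2 with rfl | ⟨y', h1, h2⟩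
    · simpa using hnn T
    · have hyT : y ∈ T := by simpa using h.1
      have h3 : connIn ((T.erase y : Finset (Pt d)) : Set (Pt d)) y' z := by
        rwa [Finset.coe_erase]
      have := ih (T.erase y) (Finset.erase_ssubset hyT) y' z h3
      obtain ⟨e, he⟩ := (adj_iff y y').1 h1.1
      have hy'T : y' ∈ T := by simpa using h1.2.2
      have key : |f y' - f y| + gradSum (T.erase y) f ≤ gradSum T f := by
        unfold gradSum
        rw [← Finset.add_sum_erase T _ hyT]
        apply add_le_add
        · have := Finset.single_le_sum
            (f := fun e : Dir d => if y + dir e ∈ T then |f (y + dir e) - f y| else 0)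
            (fun e _ => by split_ifs <;> positivity) (Finset.mem_univ e)
          simp only [← he, hy'T, if_true] at this
          exact this
        · refine Finset.sum_le_sum fun x _ => Finset.sum_le_sum fun e _ => ?_
          split_ifs with h1 h2 h2
          · exact le_rfl
          · exact absurd (Finset.mem_of_mem_erase h1) h2
          · positivity
          · exact le_rfl
      calc |f z - f y| = |(f z - f y') + (f y' - f y)| := by ring_nf
        _ ≤ |f z - f y'| + |f y' - f y| := abs_add_le _ _
        _ ≤ gradSum T f := by linarith

/-! ### measurability -/
lemma measurable_shift (x : Pt d) : Measurable (shift x : Config d → Config d) := by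
  apply measurable_pi_iff.2; intro y; exact measurable_pi_apply _

lemma measurableSet_SS (x : Pt d) : MeasurableSet {ω : Config d | x ∈ SS ω} := by
  have : {ω : Config d | x ∈ SS ω} = (fun ω : Config d => ω x) ⁻¹' {true} := by
    ext ω; simp [SS]
  rw [this]
  exact (measurable_pi_apply x) (measurableSet_singleton true)

lemma measurableSet_conn (B : Set (Pt d)) (x y : Pt d) :
    MeasurableSet {ω : Config d | connIn (SS ω ∩ B) x y} := by
  have hstep : ∀ z y, MeasurableSet {ω : Config d | stepRel (SS ω ∩ B) z y} := by
    intro z y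
    unfold stepRel
    refine MeasurableSet.inter (MeasurableSet.const _) (MeasurableSet.inter ?_ ?_)
    · exact (measurableSet_SS z).inter (MeasurableSet.const _)
    · exact (measurableSet_SS y).inter (MeasurableSet.const _)
  let reach : Config d → ℕ → Pt d → Prop := fun ω n =>
    Nat.rec (fun y => y = x) (fun _ r y => ∃ z, r z ∧ stepRel (SS ω ∩ B) z y) n
  have h1 : ∀ n y, MeasurableSet {ω | reach ω n y} := by
    intro n
    induction n with
    | zero => intro y; exact MeasurableSet.const _
    | succ n ih =>
      intro y
      have : {ω | reach ω (n+1) y} = ⋃ z, {ω | reach ω n z} ∩ {ω | stepRel (SS ω ∩ B) z y} := by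
        ext ω; simp [reach]
      rw [this]
      exact MeasurableSet.iUnion fun z => (ih z).inter (hstep z y)
  have h2 : ∀ ω y, Relation.ReflTransGen (stepRel (SS ω ∩ B)) x y ↔ ∃ n, reach ω n y := by
    intro ω y
    constructor
    · intro h
      induction h with
      | refl => exact ⟨0, rfl⟩
      | tail hab hbc ih => obtain ⟨n, hn⟩ := ih; exact ⟨n+1, _, hn, hbc⟩
    · rintro ⟨n, hn⟩
      induction n generalizing y with
      | zero => have : y = x := hn; subst this; exact .refl
      | succ n ih => obtain ⟨z, hz, hzy⟩ := hn; exact (ih z hz).tail hzy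
  have h3 : MeasurableSet {ω : Config d | Relation.ReflTransGen (stepRel (SS ω ∩ B)) x y} := by
    have : {ω : Config d | Relation.ReflTransGen (stepRel (SS ω ∩ B)) x y}
        = ⋃ n, {ω | reach ω n y} := by
      ext ω; simp [h2]
    rw [this]
    exact MeasurableSet.iUnion fun n => h1 n y
  exact MeasurableSet.inter ((measurableSet_SS x).inter (MeasurableSet.const _))
    (MeasurableSet.inter ((measurableSet_SS y).inter (MeasurableSet.const _)) h3)

lemma measurableSet_cluster (x y : Pt d) : MeasurableSet {ω : Config d | y ∈ cluster (SS ω) x} := by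
  have := measurableSet_conn (Set.univ) x y
  simpa [cluster] using this

lemma infinite_iff (A : Set (Pt d)) : A.Infinite ↔ ∀ n : ℕ, ∃ y, n < nrm y ∧ y ∈ A := by
  constructor
  · intro h n
    by_contra hc; push Not at hc
    apply h
    apply (box d n).finite_toSet.subset
    intro y hy
    have := hc y
    by_contra hlt
    exact this (by rw [Finset.mem_coe, mem_box] at hlt; omega) hy
  · intro h hfin
    obtain ⟨M, hM⟩ := (hfin.image nrm).bddAbove
    obtain ⟨y, hy, hyA⟩ := h M
    have := hM ⟨y, hyA, rfl⟩
    omega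

lemma measurableSet_Sinf (x : Pt d) : MeasurableSet {ω : Config d | x ∈ Sinf ω} := by
  have : {ω : Config d | x ∈ Sinf ω} = {ω | x ∈ SS ω} ∩
      ⋂ n : ℕ, ⋃ y, {ω | n < nrm y ∧ y ∈ cluster (SS ω) x} := by
    ext ω; simp [Sinf, infinite_iff]
  rw [this]
  exact (measurableSet_SS x).inter (MeasurableSet.iInter fun n => MeasurableSet.iUnion fun y =>
    (MeasurableSet.const _).inter (measurableSet_cluster x y))

lemma measurableSet_Sr (r : ℝ) (x : Pt d) : MeasurableSet {ω : Config d | x ∈ Sr ω r} := by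
  have : {ω : Config d | x ∈ Sr ω r} = {ω | x ∈ SS ω} ∩
      ⋃ y, ⋃ z, {ω | y ∈ cluster (SS ω) x} ∩ ({ω | z ∈ cluster (SS ω) x} ∩
        {_ω | r ≤ (dist1 y z : ℝ)}) := by
    ext ω; simp [Sr]
  rw [this]
  exact (measurableSet_SS x).inter (MeasurableSet.iUnion fun y => MeasurableSet.iUnion fun z =>
    (measurableSet_cluster x y).inter ((measurableSet_cluster x z).inter (MeasurableSet.const _)))

lemma measurableSet_locUniq1 (R : ℕ) : MeasurableSet (locUniq1 d R) := by
  have : locUniq1 d R = ⋃ x, {ω | x ∈ Sr ω R} ∩ {_ω | x ∈ ballZ (0 : Pt d) R} := by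
    ext ω; simp [locUniq1, Set.Nonempty]
  rw [this]
  exact MeasurableSet.iUnion fun x => (measurableSet_Sr _ x).inter (MeasurableSet.const _)

lemma measurableSet_locUniq2 (R : ℕ) : MeasurableSet (locUniq2 d R) := by
  have : locUniq2 d R = ⋂ x, ⋂ y, ({ω | x ∈ Sr ω ((R:ℝ)/10)} ∩ {_ω | x ∈ ballZ (0 : Pt d) R})ᶜ ∪
     (({ω | y ∈ Sr ω ((R:ℝ)/10)} ∩ {_ω | y ∈ ballZ (0 : Pt d) R})ᶜ ∪
      {ω | connIn (SS ω ∩ ballZ (0 : Pt d) (2*R)) x y}) := by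
    ext ω
    simp only [locUniq2, Set.mem_ofPred_eq, Set.mem_iInter, Set.mem_union, Set.mem_compl_iff,
      Set.mem_inter_iff]
    constructor
    · intro h x y
      by_cases h1 : x ∈ Sr ω ((R:ℝ)/10) ∧ x ∈ ballZ (0 : Pt d) R
      · by_cases h2 : y ∈ Sr ω ((R:ℝ)/10) ∧ y ∈ ballZ (0 : Pt d) R
        · exact Or.inr (Or.inr (h x h1 y h2))
        · exact Or.inr (Or.inl h2)
      · exact Or.inl h1
    · intro h x h1 y h2
      rcases h x y with h3 | h3 | h3
      · exact absurd h1 h3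
      · exact absurd h2 h3
      · exact h3
  rw [this]
  exact MeasurableSet.iInter fun x => MeasurableSet.iInter fun y =>
    (((measurableSet_Sr _ x).inter (MeasurableSet.const _)).compl).union
    ((((measurableSet_Sr _ y).inter (MeasurableSet.const _)).compl).union
      (measurableSet_conn _ x y))

end Perco

namespace Perco
variable {d : ℕ}

/-! ## M2: the maximal inequality on the lattice -/

/-- translated box -/
noncomputable def tbox (x : Pt d) (n : ℕ) : Finset (Pt d) := (box d n).map (addLeftEmbedding x)

lemma mem_tbox {x y : Pt d} {n : ℕ} : y ∈ tbox x n ↔ nrm (y - x) ≤ n := by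
  simp only [tbox, Finset.mem_map, mem_box, addLeftEmbedding_apply]
  constructor
  · rintro ⟨z, hz, rfl⟩; simpa using hz
  · intro h; exact ⟨y - x, h, by abel⟩

lemma card_tbox (x : Pt d) (n : ℕ) : (tbox x n).card = (2*n+1)^d := by
  simp [tbox, card_box]

lemma sum_tbox {M : Type*} [AddCommMonoid M] (x : Pt d) (n : ℕ) (F : Pt d → M) :
    ∑ y ∈ tbox x n, F y = ∑ y ∈ box d n, F (x + y) := by
  simp [tbox]

lemma tbox_zero (n : ℕ) : tbox (0 : Pt d) n = box d n := by
  ext; simp [mem_tbox, mem_box]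

open scoped Classical in
lemma vitali_count (lam : ℝ≥0∞) (F : Pt d → ℝ≥0∞) (n : Pt d → ℕ) :
    ∀ A : Finset (Pt d), (∀ x ∈ A, 1 ≤ n x) →
      (∀ x ∈ A, lam * (n x : ℝ≥0∞)^d ≤ ∑ y ∈ tbox x (n x), F y) →
      lam * (A.card : ℝ≥0∞) ≤ 5^d * ∑ z ∈ A.biUnion (fun x => tbox x (n x)), F z := by
  intro A
  induction A using Finset.strongInduction with
  | H A ih =>
    intro h1 h2
    rcases A.eq_empty_or_nonempty with rfl | hne
    · simp
    obtain ⟨x0, hx0, hmax⟩ := A.exists_max_image n hne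
    set A' := A.filter fun x => 2 * n x0 < nrm (x - x0) with hA'
    have hsub : A' ⊂ A := by
      refine Finset.ssubset_iff_subset_ne.2 ⟨Finset.filter_subset _ _, fun h => ?_⟩
      rw [← h, hA', Finset.mem_filter] at hx0
      simp at hx0
    have hI := ih A' hsub (fun x hx => h1 x (hsub.1 hx)) (fun x hx => h2 x (hsub.1 hx))
    have hcard : A.card ≤ A'.card + (5 * n x0)^d := by
      have e1 := Finset.card_filter_add_card_filter_not (s := A)
        (fun x => 2 * n x0 < nrm (x - x0))
      have e2 : (A.filter fun x => ¬ 2 * n x0 < nrm (x - x0)).card ≤ (tbox x0 (2 * n x0)).card := by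
        apply Finset.card_le_card
        intro x hx
        rw [Finset.mem_filter] at hx
        rw [mem_tbox]; omega
      rw [card_tbox] at e2
      have e3 : (2 * (2 * n x0) + 1)^d ≤ (5 * n x0)^d :=
        Nat.pow_le_pow_left (by have := h1 x0 hx0; omega) d
      rw [← hA'] at e1
      omega
    have hdisj : Disjoint (A'.biUnion (fun x => tbox x (n x))) (tbox x0 (n x0)) := by
      rw [Finset.disjoint_left]
      intro z hz hz0
      rw [Finset.mem_biUnion] at hz
      obtain ⟨x, hx, hzx⟩ := hz
      rw [mem_tbox] at hzx hz0
      rw [hA', Finset.mem_filter] at hx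
      have := hmax x hx.1
      have h3 : nrm (x - x0) ≤ nrm (z - x0) + nrm (z - x) := by
        have := nrm_sub (z - x0) (z - x)
        simpa using this
      omega
    have hcov : A'.biUnion (fun x => tbox x (n x)) ∪ tbox x0 (n x0) ⊆
        A.biUnion (fun x => tbox x (n x)) := by
      apply Finset.union_subset
      · exact Finset.biUnion_subset_biUnion_of_subset_left _ hsub.1
      · exact Finset.subset_biUnion_of_mem (fun x => tbox x (n x)) hx0
    calc lam * (A.card : ℝ≥0∞) ≤ lam * ((A'.card + (5 * n x0)^d : ℕ) : ℝ≥0∞) := by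
          gcongr
      _ = lam * (A'.card : ℝ≥0∞) + 5^d * (lam * (n x0 : ℝ≥0∞)^d) := by
          push_cast; rw [mul_pow]; ring
      _ ≤ 5^d * ∑ z ∈ A'.biUnion (fun x => tbox x (n x)), F z + 5^d * ∑ y ∈ tbox x0 (n x0), F y := by
          gcongr
          exact h2 x0 hx0
      _ = 5^d * ∑ z ∈ A'.biUnion (fun x => tbox x (n x)) ∪ tbox x0 (n x0), F z := by
          rw [Finset.sum_union hdisj, mul_add]
      _ ≤ _ := by
          gcongr

/-- stationarity under all shifts -/
def Stat (mu : Measure (Config d)) : Prop := ∀ x : Pt d, MeasurePreserving (shift x) mu mu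

lemma Stat.lintegral {mu : Measure (Config d)} (h : Stat mu) (x : Pt d) {f : Config d → ℝ≥0∞}
    (hf : Measurable f) : ∫⁻ ω, f (shift x ω) ∂mu = ∫⁻ ω, f ω ∂mu :=
  (h x).lintegral_comp hf

/-- box sums along the orbit -/
noncomputable def boxSum (Y : Config d → ℝ≥0∞) (n : ℕ) (ω : Config d) : ℝ≥0∞ :=
  ∑ x ∈ box d n, Y (shift x ω)

lemma measurable_boxSum {Y : Config d → ℝ≥0∞} (hY : Measurable Y) (n : ℕ) :
    Measurable (boxSum Y n) :=
  Finset.measurable_sum _ fun x _ => hY.comp (measurable_shift x)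

lemma maximal_ineq {mu : Measure (Config d)} [IsProbabilityMeasure mu] (hs : Stat mu)
    {Y : Config d → ℝ≥0∞} (hY : Measurable Y) (lam : ℝ≥0∞) :
    lam * mu {ω | ∃ n : ℕ, 1 ≤ n ∧ lam * (n:ℝ≥0∞)^d < boxSum Y n ω} ≤ 15^d * ∫⁻ ω, Y ω ∂mu := by
  classical
  set E : ℕ → Set (Config d) := fun N => {ω | ∃ n : ℕ, n ≤ N ∧ 1 ≤ n ∧ lam * (n:ℝ≥0∞)^d < boxSum Y n ω}
    with hE
  have hmeas : ∀ N, MeasurableSet (E N) := by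
    intro N
    have : E N = ⋃ n, {ω | (n ≤ N ∧ 1 ≤ n) ∧ lam * (n:ℝ≥0∞)^d < boxSum Y n ω} := by
      ext ω; simp [hE, and_assoc]
    rw [this]
    refine MeasurableSet.iUnion fun n => (MeasurableSet.const _).inter ?_
    exact measurableSet_lt measurable_const (measurable_boxSum hY n)
  have hU : {ω | ∃ n : ℕ, 1 ≤ n ∧ lam * (n:ℝ≥0∞)^d < boxSum Y n ω} = ⋃ N, E N := by
    ext ω
    simp only [hE, Set.mem_ofPred_eq, Set.mem_iUnion]
    constructor
    · rintro ⟨n, h⟩; exact ⟨n, n, le_rfl, h⟩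
    · rintro ⟨N, n, _, h⟩; exact ⟨n, h⟩
  have hmono : Monotone E := by
    intro M N hMN ω hω
    obtain ⟨n, h1, h2⟩ := hω
    exact ⟨n, h1.trans hMN, h2⟩
  have main : ∀ N, lam * mu (E N) ≤ 15^d * ∫⁻ ω, Y ω ∂mu := by
    intro N
    have point : ∀ ω, lam * ∑ x ∈ box d N, (E N).indicator 1 (shift x ω) ≤
        5^d * ∑ z ∈ box d (N+N), Y (shift z ω) := by
      intro ω
      have hch : ∀ x : Pt d, ∃ n : ℕ, shift x ω ∈ E N →
          n ≤ N ∧ 1 ≤ n ∧ lam * (n:ℝ≥0∞)^d < boxSum Y n (shift x ω) := by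
        intro x
        by_cases h : shift x ω ∈ E N
        · obtain ⟨n, hn⟩ := h; exact ⟨n, fun _ => hn⟩
        · exact ⟨0, fun h' => absurd h' h⟩
      choose n hn using hch
      set A := (box d N).filter fun x => shift x ω ∈ E N with hA
      have hAm : ∀ x ∈ A, shift x ω ∈ E N := fun x hx => (Finset.mem_filter.1 hx).2
      have := vitali_count lam (fun z => Y (shift z ω)) n A
        (fun x hx => (hn x (hAm x hx)).2.1) (fun x hx => by
          have := (hn x (hAm x hx)).2.2
          rw [sum_tbox]
          refine this.le.trans (le_of_eq ?_)
          simp [boxSum, shift_shift])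
      calc lam * ∑ x ∈ box d N, (E N).indicator 1 (shift x ω) = lam * (A.card : ℝ≥0∞) := by
            congr 1
            rw [hA, Finset.card_filter]
            push_cast
            refine Finset.sum_congr rfl fun x _ => ?_
            simp [Set.indicator_apply]
        _ ≤ _ := this
        _ ≤ _ := by
            gcongr
            intro z hz
            rw [Finset.mem_biUnion] at hz
            obtain ⟨x, hx, hzx⟩ := hz
            rw [mem_tbox] at hzx
            have h1 := (hn x (hAm x hx)).1
            have h2 := mem_box.1 (Finset.mem_filter.1 hx).1
            rw [mem_box]
            have := nrm_add (z - x) x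
            rw [sub_add_cancel] at this
            omega
    have hintg := lintegral_mono (μ := mu) point
    have hind : Measurable ((E N).indicator (1 : Config d → ℝ≥0∞)) := measurable_one.indicator (hmeas N)
    have hind' : ∀ x, Measurable fun ω => (E N).indicator (1 : Config d → ℝ≥0∞) (shift x ω) :=
      fun x => hind.comp (measurable_shift x)
    have hY' : ∀ x, Measurable fun ω => Y (shift x ω) := fun x => hY.comp (measurable_shift x)
    rw [lintegral_const_mul _ (Finset.measurable_sum _ fun x _ => hind' x),
      lintegral_const_mul _ (Finset.measurable_sum _ fun x _ => hY' x),
      lintegral_finsetSum _ (fun x _ => hind' x),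
      lintegral_finsetSum _ (fun x _ => hY' x)] at hintg
    simp only [hs.lintegral _ hind, hs.lintegral _ hY] at hintg
    rw [lintegral_indicator_one (hmeas N)] at hintg
    simp only [Finset.sum_const, card_box, nsmul_eq_mul] at hintg
    have hpos : ((2*N+1 : ℕ) : ℝ≥0∞)^d ≠ 0 := pow_ne_zero _ (by simp)
    have hfin : ((2*N+1 : ℕ) : ℝ≥0∞)^d ≠ ∞ := ENNReal.pow_ne_top (ENNReal.natCast_ne_top _)
    have h3 : ((2*(N+N)+1 : ℕ) : ℝ≥0∞)^d ≤ 3^d * ((2*N+1 : ℕ) : ℝ≥0∞)^d := by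
      rw [← mul_pow]
      gcongr
      norm_cast
      omega
    push_cast at hintg hpos hfin h3
    have h4 : (2*(N:ℝ≥0∞)+1)^d * (lam * mu (E N)) ≤ (2*(N:ℝ≥0∞)+1)^d * (15^d * ∫⁻ ω, Y ω ∂mu) := by
      calc (2*(N:ℝ≥0∞)+1)^d * (lam * mu (E N)) = lam * ((2*(N:ℝ≥0∞)+1)^d * mu (E N)) := by ring
        _ ≤ 5^d * ((2*((N:ℝ≥0∞)+N)+1)^d * ∫⁻ ω, Y ω ∂mu) := hintg
        _ ≤ 5^d * ((3^d * (2*(N:ℝ≥0∞)+1)^d) * ∫⁻ ω, Y ω ∂mu) := by gcongr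
        _ = (2*(N:ℝ≥0∞)+1)^d * ((5^d*3^d) * ∫⁻ ω, Y ω ∂mu) := by ring
        _ = _ := by rw [← mul_pow]; norm_num
    exact (ENNReal.mul_le_mul_iff_right hpos hfin).1 h4
  rw [hU, hmono.measure_iUnion, ENNReal.mul_iSup]
  exact iSup_le main

/-- a.s. finiteness of box averages -/
lemma ae_boxSum_le {mu : Measure (Config d)} [IsProbabilityMeasure mu] (hs : Stat mu)
    {Y : Config d → ℝ≥0∞} (hY : Measurable Y) (hfin : ∫⁻ ω, Y ω ∂mu ≠ ∞) :
    ∀ᵐ ω ∂mu, ∃ K : ℕ, ∀ n, 1 ≤ n → boxSum Y n ω ≤ K * (n:ℝ≥0∞)^d := by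
  rw [ae_iff]
  set c := 15^d * ∫⁻ ω, Y ω ∂mu
  have hc : c ≠ ∞ := ENNReal.mul_ne_top (by finiteness) hfin
  have : ∀ K : ℕ, (K : ℝ≥0∞) * mu {ω | ¬ ∃ K : ℕ, ∀ n, 1 ≤ n → boxSum Y n ω ≤ K * (n:ℝ≥0∞)^d} ≤ c := by
    intro K
    refine le_trans ?_ (maximal_ineq hs hY K)
    gcongr
    rename_i ω
    intro hω
    push Not at hω
    exact hω K
  by_contra hne
  set m := mu {ω | ¬ ∃ K : ℕ, ∀ n, 1 ≤ n → boxSum Y n ω ≤ K * (n:ℝ≥0∞)^d}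
  obtain ⟨K, hK⟩ := ENNReal.exists_nat_mul_gt hne hc
  exact absurd (this K) (not_le.2 hK)

/-- a.s. uniform smallness along fast sequences -/
lemma ae_boxSum_small {mu : Measure (Config d)} [IsProbabilityMeasure mu] (hs : Stat mu)
    {Y : ℕ → Config d → ℝ≥0∞} (hY : ∀ k, Measurable (Y k))
    (hle : ∀ k, ∫⁻ ω, Y k ω ∂mu ≤ (4⁻¹)^k) :
    ∀ᵐ ω ∂mu, ∀ᶠ k in atTop, ∀ n, 1 ≤ n → boxSum (Y k) n ω ≤ (2⁻¹)^k * (n:ℝ≥0∞)^d := by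
  have hb : ∀ k, mu {ω | ∃ n : ℕ, 1 ≤ n ∧ (2⁻¹)^k * (n:ℝ≥0∞)^d < boxSum (Y k) n ω} ≤
      15^d * (2⁻¹)^k := by
    intro k
    have h := (maximal_ineq hs (hY k) ((2⁻¹)^k)).trans (mul_le_mul_right (hle k) (15^d))
    have e : (4⁻¹ : ℝ≥0∞)^k = (2⁻¹)^k * (2⁻¹)^k := by
      rw [← mul_pow, ← ENNReal.mul_inv (by simp) (by simp)]; norm_num
    rw [e, ← mul_assoc, mul_comm _ ((2⁻¹:ℝ≥0∞)^k)] at h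
    have := (ENNReal.mul_le_mul_iff_right (pow_ne_zero _ (by simp)) (by finiteness)).1 h
    exact this
  have hsum : ∑' k, mu {ω | ∃ n : ℕ, 1 ≤ n ∧ (2⁻¹)^k * (n:ℝ≥0∞)^d < boxSum (Y k) n ω} ≠ ∞ := by
    refine ne_top_of_le_ne_top ?_ (ENNReal.tsum_le_tsum hb)
    rw [ENNReal.tsum_mul_left, ENNReal.tsum_geometric]
    refine ENNReal.mul_ne_top (by finiteness) ?_
    rw [ENNReal.one_sub_inv_two]; simp
  filter_upwards [ae_eventually_notMem hsum] with ω hω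
  filter_upwards [hω] with k hk
  intro n hn
  by_contra hc
  exact hk ⟨n, hn, not_le.1 hc⟩

end Perco

namespace Perco
variable {d : ℕ}

/-! ## M3: percolation geometry -/

/-- both local uniqueness events -/
def GG (d R : ℕ) : Set (Config d) := locUniq1 d R ∩ locUniq2 d R

/-- bad event at scales `2^j r` -/
def badE (d r : ℕ) : Set (Config d) := ⋃ j : ℕ, (GG d (2^j * r))ᶜ

lemma measurableSet_GG (R : ℕ) : MeasurableSet (GG d R) :=
  (measurableSet_locUniq1 R).inter (measurableSet_locUniq2 R)

lemma measurableSet_badE (r : ℕ) : MeasurableSet (badE d r) :=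
  MeasurableSet.iUnion fun _ => (measurableSet_GG _).compl

lemma tail_real {D : ℝ} (hD : 0 < D) (R0 : ℕ) (k : ℕ) : ∃ R1 : ℕ, R0 ≤ R1 ∧ 1 ≤ R1 ∧
    ∀ R : ℕ, R1 ≤ R → Real.exp (-((Real.log R)^(1+D))) * (R:ℝ)^k ≤ 1 := by
  have h1 : Tendsto (fun R : ℕ => (Real.log R)^D) atTop atTop :=
    (tendsto_rpow_atTop hD).comp (Real.tendsto_log_atTop.comp tendsto_natCast_atTop_atTop)
  obtain ⟨R1, hR1⟩ := eventually_atTop.1 (h1.eventually_ge_atTop (k:ℝ))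
  refine ⟨max R0 (max R1 2), le_max_left _ _, by simp, fun R hR => ?_⟩
  have hR2 : 2 ≤ R := by simp at hR; omega
  have hk := hR1 R (by simp at hR; omega)
  have hlog : 0 < Real.log R := Real.log_pos (by exact_mod_cast hR2)
  have hRpos : (0:ℝ) < R := by positivity
  have e : (R:ℝ)^k = Real.exp (k * Real.log R) := by
    rw [Real.exp_nat_mul, Real.exp_log hRpos]
  rw [e, ← Real.exp_add, Real.exp_le_one_iff, Real.rpow_add hlog, Real.rpow_one]
  nlinarith

lemma tail_G {a b : ℝ} {P : ℝ → Measure (Config d)} (Ax : Axioms d a b P) {u : ℝ}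
    (hu : u ∈ Set.Ioo a b) (k : ℕ) :
    ∃ C : ℕ, ∀ R : ℕ, 1 ≤ R → P u (GG d R)ᶜ * (R:ℝ≥0∞)^k ≤ C := by
  have := Ax.prob u hu
  obtain ⟨R1, h0, h1, hR1⟩ := tail_real (Ax.ΔS_pos u hu) (Ax.RS u) k
  refine ⟨max 2 (R1^k), fun R hR => ?_⟩
  rcases le_total R1 R with h | h
  · have key : ∀ A : Set (Config d), MeasurableSet A → 1 - Real.exp (-(Ax.fS u R)) ≤ (P u A).toReal →
        P u Aᶜ ≤ ENNReal.ofReal (Real.exp (-((Real.log R)^(1+Ax.ΔS u)))) := by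
      intro A hA hle
      rw [← ENNReal.ofReal_toReal (measure_ne_top (P u) Aᶜ)]
      apply ENNReal.ofReal_le_ofReal
      have h2 : (P u Aᶜ).toReal = 1 - (P u A).toReal := by
        have := probReal_compl_eq_one_sub (μ := P u) hA
        simpa [Measure.real] using this
      have h3 := Real.exp_le_exp.2 (neg_le_neg (Ax.fS_lb u hu R (h0.trans h)))
      linarith
    have ka := key _ (measurableSet_locUniq1 R) (Ax.S1a u hu R hR)
    have kb := key _ (measurableSet_locUniq2 R) (Ax.S1b u hu R hR)
    have hun : P u (GG d R)ᶜ ≤ 2 * ENNReal.ofReal (Real.exp (-((Real.log R)^(1+Ax.ΔS u)))) := by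
      rw [GG, Set.compl_inter, two_mul]
      exact (measure_union_le _ _).trans (add_le_add ka kb)
    have hfin := hR1 R h
    calc P u (GG d R)ᶜ * (R:ℝ≥0∞)^k
        ≤ 2 * ENNReal.ofReal (Real.exp (-((Real.log R)^(1+Ax.ΔS u)))) * (R:ℝ≥0∞)^k := by gcongr
      _ = 2 * ENNReal.ofReal (Real.exp (-((Real.log R)^(1+Ax.ΔS u))) * (R:ℝ)^k) := by
          rw [ENNReal.ofReal_mul (by positivity), ENNReal.ofReal_pow (by positivity),
            ENNReal.ofReal_natCast, mul_assoc]
      _ ≤ 2 * ENNReal.ofReal 1 := by gcongr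
      _ ≤ ((max 2 (R1^k) : ℕ) : ℝ≥0∞) := by
          rw [ENNReal.ofReal_one, mul_one]; exact_mod_cast le_max_left _ _
  · calc P u (GG d R)ᶜ * (R:ℝ≥0∞)^k ≤ 1 * (R1:ℝ≥0∞)^k := by
          gcongr
          exact prob_le_one
      _ ≤ _ := by rw [one_mul]; exact_mod_cast le_max_right _ _

/-- superpolynomial tail of the bad events -/
def TailB (mu : Measure (Config d)) : Prop :=
  ∀ k : ℕ, ∃ C : ℕ, ∀ r : ℕ, 1 ≤ r → mu (badE d r) * (r:ℝ≥0∞)^k ≤ C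

lemma tail_bad {a b : ℝ} {P : ℝ → Measure (Config d)} (Ax : Axioms d a b P) {u : ℝ}
    (hu : u ∈ Set.Ioo a b) : TailB (P u) := by
  have main : ∀ k : ℕ, ∃ C : ℕ, ∀ r : ℕ, 1 ≤ r → P u (badE d r) * (r:ℝ≥0∞)^(k+1) ≤ C := by
    intro k
    obtain ⟨C, hC⟩ := tail_G Ax hu (k+1)
    refine ⟨2 * C, fun r hr => ?_⟩
    have hj : ∀ j : ℕ, P u (GG d (2^j*r))ᶜ * (r:ℝ≥0∞)^(k+1) ≤ C * (2⁻¹)^j := by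
      intro j
      have h := hC (2^j*r) (Nat.one_le_iff_ne_zero.2 (by positivity))
      have h2 : (2:ℝ≥0∞)^j * (P u (GG d (2^j*r))ᶜ * (r:ℝ≥0∞)^(k+1)) ≤ C := by
        refine le_trans ?_ h
        push_cast
        rw [mul_pow]
        calc (2:ℝ≥0∞)^j * (P u (GG d (2^j*r))ᶜ * (r:ℝ≥0∞)^(k+1))
            = P u (GG d (2^j*r))ᶜ * ((2^j)^1 * (r:ℝ≥0∞)^(k+1)) := by ring
          _ ≤ P u (GG d (2^j*r))ᶜ * ((2^j)^(k+1) * (r:ℝ≥0∞)^(k+1)) := by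
            gcongr
            · exact one_le_pow₀ (by norm_num)
            · omega
      rw [← ENNReal.inv_pow, ← div_eq_mul_inv, ENNReal.le_div_iff_mul_le (by simp) (by simp), mul_comm]
      exact h2
    calc P u (badE d r) * (r:ℝ≥0∞)^(k+1) ≤ (∑' j, P u (GG d (2^j*r))ᶜ) * (r:ℝ≥0∞)^(k+1) := by
          gcongr; exact measure_iUnion_le _
      _ = ∑' j, P u (GG d (2^j*r))ᶜ * (r:ℝ≥0∞)^(k+1) := by rw [ENNReal.tsum_mul_right]
      _ ≤ ∑' j : ℕ, (C:ℝ≥0∞) * (2⁻¹)^j := ENNReal.tsum_le_tsum hj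
      _ = _ := by
          rw [ENNReal.tsum_mul_left, ENNReal.tsum_geometric, ENNReal.one_sub_inv_two, inv_inv]
          push_cast; ring
  intro k
  obtain ⟨C, hC⟩ := main k
  refine ⟨C, fun r hr => le_trans ?_ (hC r hr)⟩
  gcongr
  · exact_mod_cast hr
  · omega

lemma Sinf_diam {ω : Config d} {x : Pt d} (hx : x ∈ Sinf ω) (r : ℝ) : x ∈ Sr ω r := by
  obtain ⟨y, hy, hyc⟩ := (infinite_iff _).1 hx.2 (⌈r⌉₊ + nrm x)
  refine ⟨hx.1, x, connIn_refl hx.1, y, hyc, ?_⟩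
  have h1 := nrm_le_dist1 x y
  have h2 : nrm y ≤ nrm (y - x) + nrm x := by
    have := nrm_add (y - x) x; simpa using this
  calc r ≤ (⌈r⌉₊ : ℝ) := Nat.le_ceil r
    _ ≤ _ := by exact_mod_cast (by omega)

lemma Sr_mono {ω : Config d} {x : Pt d} {r r' : ℝ} (h : r ≤ r') (hx : x ∈ Sr ω r') : x ∈ Sr ω r := by
  obtain ⟨h1, y, hy, z, hz, h2⟩ := hx
  exact ⟨h1, y, hy, z, hz, h.trans h2⟩

lemma conn_of_GG {ω : Config d} {R : ℕ} (h : ω ∈ GG d R) {y z : Pt d} (hy : y ∈ Sinf ω)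
    (hz : z ∈ Sinf ω) (hyR : nrm y ≤ R) (hzR : nrm z ≤ R) :
    connIn (Sinf ω ∩ ballZ 0 (2*R)) y z :=
  connIn_Sinf hy (h.2 y ⟨Sinf_diam hy _, by rw [mem_ballZ]; simpa⟩ z
    ⟨Sinf_diam hz _, by rw [mem_ballZ]; simpa⟩)

lemma exists_of_not_bad {ω : Config d} {r : ℕ} (hr : 1 ≤ r) (h : ω ∉ badE d r) :
    ∃ p ∈ Sinf ω, nrm p ≤ r := by
  have h' : ∀ j : ℕ, ω ∈ GG d (2^j*r) := by
    intro j; by_contra hc; exact h (Set.mem_iUnion.2 ⟨j, hc⟩)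
  have hp : ∀ j : ℕ, ∃ p, p ∈ Sr ω ((2^j*r : ℕ):ℝ) ∧ nrm p ≤ 2^j*r := by
    intro j
    obtain ⟨p, hp, hpb⟩ := (h' j).1
    exact ⟨p, hp, by rw [mem_ballZ] at hpb; simpa using hpb⟩
  choose p hp1 hp2 using hp
  have hstep : ∀ j, connIn (SS ω) (p j) (p (j+1)) := by
    intro j
    have h2 := (h' (j+1)).2
    refine connIn_mono Set.inter_subset_left (h2 (p j) ⟨Sr_mono ?_ (hp1 j), ?_⟩ (p (j+1))
      ⟨Sr_mono ?_ (hp1 (j+1)), ?_⟩)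
    · push_cast; rw [pow_succ]
      have : (0:ℝ) ≤ 2^j * r := by positivity
      linarith
    · rw [mem_ballZ]; have := hp2 j; simp only [sub_zero]; rw [pow_succ]; 
      nlinarith
    · have : (0:ℝ) ≤ ((2^(j+1)*r : ℕ):ℝ) := by positivity
      linarith
    · rw [mem_ballZ]; simpa using hp2 (j+1)
  have hall : ∀ j, connIn (SS ω) (p 0) (p j) := by
    intro j
    induction j with
    | zero => exact connIn_refl (hp1 0).1
    | succ j ih => exact connIn_trans ih (hstep j)
  refine ⟨p 0, ⟨(hp1 0).1, ?_⟩, by simpa using hp2 0⟩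
  intro hfin
  obtain ⟨M, hM⟩ := (hfin.image nrm).bddAbove
  obtain ⟨_, y, hy, z, hz, hyz⟩ := hp1 (d * (M + M))
  rw [← cluster_eq (hall _)] at hy hz
  have h1 := hM ⟨y, hy, rfl⟩
  have h2 := hM ⟨z, hz, rfl⟩
  have h3 := dist1_le y z
  have h4 := nrm_sub z y
  have h5 : 2^(d * (M+M)) * r ≤ dist1 y z := by exact_mod_cast hyz
  have h6 : d * (M+M) < 2^(d * (M+M)) := Nat.lt_two_pow_self
  have h7 : d * nrm (z - y) ≤ d * (M + M) := Nat.mul_le_mul_left _ (by omega)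
  nlinarith

/-- the regularity radius -/
noncomputable def rho0 (ω : Config d) : ℕ := sInf {r | 2 ≤ r ∧ ω ∉ badE d r}

lemma rho0_le {ω : Config d} {r : ℕ} (hr : 2 ≤ r) (h : ω ∉ badE d r) : rho0 ω ≤ r :=
  Nat.sInf_le ⟨hr, h⟩

lemma rho0_spec {ω : Config d} (h : ∃ r, 2 ≤ r ∧ ω ∉ badE d r) :
    2 ≤ rho0 ω ∧ ω ∉ badE d (rho0 ω) := Nat.sInf_mem h

/-- deterministic regularity of the infinite cluster -/
structure GoodGeom (ω : Config d) (rho : Pt d → ℕ) (W : Pt d → ℕ) (K n0 : ℕ) : Prop where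
  two_le : ∀ x, 2 ≤ rho x
  near : ∀ x, ∃ p ∈ Sinf ω, nrm (p - x) ≤ rho x
  conn : ∀ x, ∀ y ∈ Sinf ω, ∀ z ∈ Sinf ω, nrm (y - x) ≤ 2 * rho x → nrm (z - x) ≤ 2 * rho x →
    connIn (Sinf ω ∩ ballZ x (4 * rho x)) y z
  cover : ∀ y, ∀ A : Finset (Pt d), (∀ x ∈ A, nrm (y - x) ≤ 4 * rho x) → A.card ≤ W y
  Wsum : ∀ n, 1 ≤ n → ∑ y ∈ box d n, (W y)^(2*d) ≤ K * n^d
  small : ∀ n, n0 ≤ n → ∀ x ∈ box d n, 4 * rho x ≤ n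
  big : ∀ n, n0 ≤ n → ∀ y ∈ Sinf ω, ∀ z ∈ Sinf ω, nrm y ≤ n → nrm z ≤ n →
    connIn (Sinf ω ∩ ballZ 0 (2*n)) y z

lemma tsum_ne_top_of_sq {f : ℕ → ℝ≥0∞} (C : ℕ) (h : ∀ n : ℕ, ((n:ℝ≥0∞)+1)^2 * f n ≤ C) :
    ∑' n, f n ≠ ∞ := by
  have h1 : ∀ n, f n ≤ C * ((((n:ℕ):ℝ≥0∞)+1)^2)⁻¹ := by
    intro n
    rw [← div_eq_mul_inv, ENNReal.le_div_iff_mul_le (by left; positivity) (by left; finiteness), mul_comm]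
    exact h n
  refine ne_top_of_le_ne_top ?_ (ENNReal.tsum_le_tsum h1)
  rw [ENNReal.tsum_mul_left]
  refine ENNReal.mul_ne_top (ENNReal.natCast_ne_top _) ?_
  have hs : Summable fun n : ℕ => (((n:NNReal)+1)^2)⁻¹ := by
    rw [← NNReal.summable_coe]
    have := (summable_nat_add_iff 1).2 (Real.summable_nat_pow_inv.2 (show 1 < 2 by norm_num))
    refine this.congr fun n => ?_
    push_cast; rfl
  have := ENNReal.tsum_coe_ne_top_iff_summable.2 hs
  refine ne_of_eq_of_ne (tsum_congr fun n => ?_) this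
  rw [ENNReal.coe_inv (by positivity)]
  push_cast; rfl

lemma tsum_nrm_le (g : ℕ → ℝ≥0∞) :
    ∑' x : Pt d, g (nrm x) ≤ ∑' n : ℕ, ((2*n+1)^d : ℕ) * g n := by
  classical
  calc ∑' x : Pt d, g (nrm x) = ∑' x : Pt d, ∑' n : ℕ, if nrm x = n then g n else 0 := by
        refine tsum_congr fun x => ?_
        rw [tsum_eq_single (nrm x)]
        · simp
        · intro n hn; simp [hn.symm]
    _ = ∑' n : ℕ, ∑' x : Pt d, if nrm x = n then g n else 0 := ENNReal.tsum_comm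
    _ ≤ _ := by
        refine ENNReal.tsum_le_tsum fun n => ?_
        rw [tsum_eq_sum (s := box d n)]
        · rw [← card_box, ← nsmul_eq_mul, ← Finset.sum_const]
          refine Finset.sum_le_sum fun x _ => ?_
          split_ifs <;> simp
        · intro x hx
          rw [mem_box] at hx
          rw [if_neg (by omega)]

/-- summability used repeatedly -/
lemma bad_sum {mu : Measure (Config d)} (ht : TailB mu) (a : ℕ) (r : ℕ → ℕ)
    (hr : ∀ n, 1 ≤ r n ∧ 2*n+3 ≤ 20 * r n) :
    ∑' n : ℕ, ((2*n+3)^a : ℕ) * mu (badE d (r n)) ≠ ∞ := by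
  obtain ⟨C, hC⟩ := ht (a+2)
  apply tsum_ne_top_of_sq (20^(a+2) * C)
  intro n
  calc ((n:ℝ≥0∞)+1)^2 * (((2*n+3)^a : ℕ) * mu (badE d (r n)))
      = (((n+1)^2*(2*n+3)^a : ℕ) : ℝ≥0∞) * mu (badE d (r n)) := by push_cast; ring
    _ ≤ (((20 * r n)^(a+2) : ℕ) : ℝ≥0∞) * mu (badE d (r n)) := by
        gcongr
        have := (hr n).2
        calc (n+1)^2*(2*n+3)^a ≤ (20*r n)^2 * (20*r n)^a := by gcongr; omega
          _ = _ := by rw [← pow_add, add_comm]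
    _ = 20^(a+2) * (mu (badE d (r n)) * (r n : ℝ≥0∞)^(a+2)) := by push_cast; rw [mul_pow]; ring
    _ ≤ _ := by push_cast; gcongr; exact hC _ (hr n).1

/-- the scale used at distance `n` -/
def scl (n : ℕ) : ℕ := if 9 ≤ n then (n-1)/4 else 2

/-- scale for boxes -/
def scl8 (n : ℕ) : ℕ := (n-8)/4+2

lemma scl_prop (n : ℕ) : 1 ≤ scl n ∧ 2*n+3 ≤ 20 * scl n := by
  unfold scl; split_ifs <;> omega

/-- integrable majorant of the moments of `W` -/
noncomputable def majW (d q : ℕ) (ω : Config d) : ℝ≥0∞ :=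
  ∑' x : Pt d, ((2*nrm x+3)^q : ℕ) * (badE d (scl (nrm x))).indicator 1 (shift x ω)

lemma measurable_majW (q : ℕ) : Measurable (majW d q) :=
  Measurable.tsum fun x => (((measurable_one.indicator (measurableSet_badE _)).comp
    (measurable_shift x)).const_mul _)

lemma lintegral_majW {mu : Measure (Config d)} (hs : Stat mu) (ht : TailB mu) (q : ℕ) :
    ∫⁻ ω, majW d q ω ∂mu ≠ ∞ := by
  have hm : ∀ x : Pt d, Measurable fun ω => (badE d (scl (nrm x))).indicator (1 : Config d → ℝ≥0∞) (shift x ω) :=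
    fun x => (measurable_one.indicator (measurableSet_badE _)).comp (measurable_shift x)
  unfold majW
  rw [lintegral_tsum fun x => ((hm x).const_mul _).aemeasurable]
  have : ∀ x : Pt d, ∫⁻ ω, ((2*nrm x+3)^q : ℕ) * (badE d (scl (nrm x))).indicator 1 (shift x ω) ∂mu
      = ((2*nrm x+3)^q : ℕ) * mu (badE d (scl (nrm x))) := by
    intro x
    rw [lintegral_const_mul _ (hm x), hs.lintegral x (measurable_one.indicator (measurableSet_badE _)),
      lintegral_indicator_one (measurableSet_badE _)]
  simp_rw [this]
  refine ne_top_of_le_ne_top (bad_sum ht (q+d) scl scl_prop)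
    ((tsum_nrm_le (fun n => ((2*n+3)^q : ℕ) * mu (badE d (scl n)))).trans ?_)
  refine ENNReal.tsum_le_tsum fun n => ?_
  rw [← mul_assoc]
  gcongr
  norm_cast
  rw [pow_add, mul_comm]
  gcongr
  omega

/-- points whose regularity ball contains the origin -/
def coverSet (ω : Config d) : Set (Pt d) := {x | nrm x ≤ 4 * rho0 (shift x ω)}

lemma coverSet_bound {ω : Config d} {q : ℕ} {x : Pt d} (hx : x ∈ coverSet ω) :
    ((2*nrm x+1)^q : ℕ) ≤ (17^q : ℕ) + majW d q ω := by
  by_cases h9 : 9 ≤ nrm x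
  · have hb : shift x ω ∈ badE d (scl (nrm x)) := by
      by_contra hc
      have h2 : scl (nrm x) = (nrm x - 1)/4 := by simp [scl, h9]
      have := rho0_le (by rw [h2]; omega) hc
      have hx' : nrm x ≤ 4 * rho0 (shift x ω) := hx
      omega
    have := ENNReal.le_tsum (f := fun x : Pt d => ((2*nrm x+3)^q : ℕ) *
      (badE d (scl (nrm x))).indicator (1 : Config d → ℝ≥0∞) (shift x ω)) x
    simp only [Set.indicator_of_mem hb, Pi.one_apply, mul_one] at this
    refine le_trans ?_ (this.trans le_add_self)
    gcongr
    omega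
  · refine le_trans ?_ le_self_add
    gcongr
    omega

lemma coverSet_card {ω : Config d} (hd : 1 ≤ d) (hfin : majW d (d*(2*d)) ω ≠ ∞) :
    (coverSet ω).Finite ∧ (((coverSet ω).ncard ^ (2*d) : ℕ) : ℝ≥0∞) ≤
      (17^(d*(2*d)) : ℕ) + majW d (d*(2*d)) ω := by
  set q := d*(2*d)
  have hq : 1 ≤ q := Nat.one_le_iff_ne_zero.2 (by positivity)
  have hF : (coverSet ω).Finite := by
    obtain ⟨M, hM⟩ := ENNReal.exists_nat_gt (r := (17^q : ℕ) + majW d q ω) (by finiteness)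
    apply (box d M).finite_toSet.subset
    intro x hx
    have h1 := (coverSet_bound (q := q) hx).trans hM.le
    have h2 : (2*nrm x+1)^q ≤ M := by exact_mod_cast h1
    rw [Finset.mem_coe, mem_box]
    have : 2 * nrm x + 1 ≤ (2*nrm x+1)^q := Nat.le_self_pow (by omega) _
    omega
  refine ⟨hF, ?_⟩
  rcases (coverSet ω).eq_empty_or_nonempty with he | hne
  · rw [he]; simp [show d ≠ 0 by omega]
  obtain ⟨x, hx, hmax⟩ := Set.exists_max_image _ nrm hF hne
  refine le_trans ?_ (coverSet_bound (q := q) hx)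
  have h1 : (coverSet ω).ncard ≤ (2*nrm x+1)^d := by
    rw [← card_box, ← Set.ncard_coe_finset]
    exact Set.ncard_le_ncard (fun y hy => by rw [Finset.mem_coe, mem_box]; exact hmax y hy)
      (Finset.finite_toSet _)
  norm_cast
  calc _ ≤ ((2*nrm x+1)^d)^(2*d) := by gcongr
    _ = _ := by rw [← pow_mul]

lemma exists_goodGeom {mu : Measure (Config d)} [IsProbabilityMeasure mu] (hd : 1 ≤ d) (hs : Stat mu)
    (ht : TailB mu) : ∀ᵐ ω ∂mu, ∃ rho W K n0, GoodGeom ω rho W K n0 := by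
  set q := d*(2*d) with hq
  -- Borel-Cantelli
  have hBC : ∀ᵐ ω ∂mu, ∀ᶠ n : ℕ in atTop, ω ∉ ⋃ x ∈ box d n, shift x ⁻¹' badE d (scl8 n) := by
    apply ae_eventually_notMem
    refine ne_top_of_le_ne_top (bad_sum ht d scl8 (fun n => by unfold scl8; omega)) ?_
    refine ENNReal.tsum_le_tsum fun n => ?_
    refine (measure_biUnion_finset_le _ _).trans ?_
    have : ∀ x : Pt d, mu (shift x ⁻¹' badE d (scl8 n)) = mu (badE d (scl8 n)) := fun x =>
      (hs x).measure_preimage (measurableSet_badE _).nullMeasurableSet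
    simp only [this, Finset.sum_const, card_box, nsmul_eq_mul]
    gcongr
    omega
  have hBC0 : ∀ᵐ ω ∂mu, ∀ᶠ n : ℕ in atTop, ω ∉ badE d (n+1) := by
    apply ae_eventually_notMem
    refine ne_top_of_le_ne_top (bad_sum ht 0 (fun n => n+1) (fun n => by omega)) ?_
    simp
  have hex : ∀ᵐ ω ∂mu, ∀ x : Pt d, ∃ r, 2 ≤ r ∧ shift x ω ∉ badE d r := by
    rw [ae_all_iff]; intro x
    filter_upwards [(hs x).quasiMeasurePreserving.ae hBC0] with ω hω
    obtain ⟨n, hn, hn1⟩ := (hω.and (eventually_ge_atTop 1)).exists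
    exact ⟨n+1, by omega, hn⟩
  have hmf : ∀ᵐ ω ∂mu, ∀ x : Pt d, majW d q (shift x ω) ≠ ∞ := by
    rw [ae_all_iff]; intro x
    have h0 : ∀ᵐ ω ∂mu, majW d q ω ≠ ∞ :=
      (ae_lt_top (measurable_majW q) (lintegral_majW hs ht q)).mono fun _ h => h.ne
    exact (hs x).quasiMeasurePreserving.ae h0
  have hY := ae_boxSum_le hs (Y := fun ω => ((17^q : ℕ) : ℝ≥0∞) + majW d q ω)
      (measurable_const.add (measurable_majW q)) (by
    rw [lintegral_add_left measurable_const]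
    refine ENNReal.add_ne_top.2 ⟨by simp, lintegral_majW hs ht q⟩)
  filter_upwards [hBC, hBC0, hex, hmf, hY] with ω h1 h2 h3 h4 ⟨K, h5⟩
  obtain ⟨n1, hn1⟩ := eventually_atTop.1 h1
  obtain ⟨n2, hn2⟩ := eventually_atTop.1 h2
  have hspec := fun x => rho0_spec (h3 x)
  refine ⟨fun x => rho0 (shift x ω), fun y => (coverSet (shift y ω)).ncard, K,
    max (n1 + 8) (n2 + 1), ?_, ?_, ?_, ?_, ?_, ?_, ?_⟩
  · intro x; exact (hspec x).1
  · intro x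
    obtain ⟨p, hp, hpr⟩ := exists_of_not_bad (by have := (hspec x).1; omega) (hspec x).2
    exact ⟨x + p, (Sinf_shift x ω p).1 hp, by simpa using hpr⟩
  · intro x y hy z hz hyr hzr
    have hG : shift x ω ∈ GG d (2 * rho0 (shift x ω)) := by
      by_contra hc
      exact (hspec x).2 (Set.mem_iUnion.2 ⟨1, by simpa using hc⟩)
    have := conn_of_GG (y := y - x) (z := z - x) hG (by rw [Sinf_shift]; simpa using hy)
      (by rw [Sinf_shift]; simpa using hz) hyr hzr
    have := connIn_add (T' := Sinf ω ∩ ballZ x (4 * rho0 (shift x ω))) x (fun w hw => by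
      refine ⟨(Sinf_shift x ω w).1 hw.1, ?_⟩
      have h := hw.2
      rw [mem_ballZ] at h ⊢
      simp only [sub_zero, add_sub_cancel_left] at h ⊢
      omega) this
    simpa using this
  · intro y A hA
    have hF := (coverSet_card hd (h4 y)).1
    have hmap : ((A.map (addRightEmbedding (-y)) : Finset (Pt d)) : Set (Pt d)) ⊆ coverSet (shift y ω) := by
      intro w hw
      rw [Finset.mem_coe, Finset.mem_map] at hw
      obtain ⟨x, hx, rfl⟩ := hw
      have := hA x hx
      change nrm (x + -y) ≤ 4 * rho0 (shift (x + -y) (shift y ω))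
      rw [shift_shift, show y + (x + -y) = x by abel, ← sub_eq_add_neg, nrm_sub_comm]
      exact this
    have := Set.ncard_le_ncard hmap hF
    rw [Set.ncard_coe_finset, Finset.card_map] at this
    exact this
  · intro n hn
    have h6 := h5 n hn
    unfold boxSum at h6
    have h7 : ∑ y ∈ box d n, (((coverSet (shift y ω)).ncard^(2*d) : ℕ) : ℝ≥0∞) ≤ K * (n:ℝ≥0∞)^d :=
      (Finset.sum_le_sum fun y _ => (coverSet_card hd (h4 y)).2).trans h6
    exact_mod_cast h7
  · intro n hn x hx
    have h6 : shift x ω ∉ badE d (scl8 n) := by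
      intro hc
      exact hn1 n (by omega) (Set.mem_iUnion₂.2 ⟨x, hx, hc⟩)
    have := rho0_le (by unfold scl8; omega) h6
    unfold scl8 at this
    omega
  · intro n hn y hy z hz hyn hzn
    have h6 := hn2 (n-1) (by omega)
    have hG : ω ∈ GG d n := by
      by_contra hc
      apply h6
      rw [show n - 1 + 1 = n by omega]
      exact Set.mem_iUnion.2 ⟨0, by simpa using hc⟩
    exact conn_of_GG hG hy hz hyn hzn

end Perco

namespace Perco
variable {d : ℕ}

/-! ## M4: Sobolev and Poincare inequalities -/

lemma pi_count_eq : (Measure.pi fun _ : Fin d => (Measure.count : Measure ℤ)) = Measure.count := by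
  apply Measure.ext_of_singleton
  intro x
  have : ({x} : Set (Pt d)) = Set.univ.pi fun i => {x i} := by
    rw [Set.univ_pi_singleton]
  rw [this, Measure.pi_pi, ← this]
  simp

lemma sobolev_ennreal (hd : 2 ≤ d) (G : Pt d → ℝ) (M : ℕ) (hG : ∀ x, M < nrm x → G x = 0) :
    ∑' x, (ENNReal.ofReal |G x|)^((d:ℝ)/(d-1)) ≤
      (∑' x, ∑ e : Dir d, ENNReal.ofReal |G (x + dir e) - G x|)^((d:ℝ)/(d-1)) := by
  have hd1 : (1:ℝ) < d := by exact_mod_cast hd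
  have hp : Real.HolderConjugate (Fintype.card (Fin d) : ℝ) ((d:ℝ)/(d-1)) := by
    rw [Fintype.card_fin]
    exact Real.HolderConjugate.conjExponent hd1
  set f : Pt d → ℝ≥0∞ := fun x => ∑ e : Dir d, ENNReal.ofReal |G (x + dir e) - G x| with hf
  have h := lintegral_prod_lintegral_pow_le (μ := fun _ : Fin d => (Measure.count : Measure ℤ)) hp
    (f := f) (measurable_of_countable f)
  rw [pi_count_eq, lintegral_count, lintegral_count] at h
  refine le_trans (ENNReal.tsum_le_tsum fun x => ?_) h
  have hline : ∀ i : Fin d, ENNReal.ofReal |G x| ≤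
      ∫⁻ t, f (Function.update x i t) ∂Measure.count := by
    intro i
    rw [lintegral_count]
    set y : ℕ → Pt d := fun s => Function.update x i (x i + s) with hy
    have hy0 : y 0 = x := by simp [hy]
    have hys : ∀ s, y (s+1) = y s + dir (i, true) := by
      intro s
      funext j
      by_cases hj : j = i
      · subst hj; simp [hy, dir]; ring
      · simp [hy, dir, hj]
    have hbig : ∃ N, G (y N) = 0 := by
      refine ⟨M + 1 + nrm x, hG _ ?_⟩
      have h1 := natAbs_le_nrm (y (M+1+nrm x)) i
      have h2 := natAbs_le_nrm x i
      have h0 : y (M+1+nrm x) i = x i + ((M+1+nrm x : ℕ) : ℤ) := by simp [hy]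
      rw [h0] at h1
      push_cast at h1
      omega
    obtain ⟨N, hN⟩ := hbig
    have htel : |G x| ≤ ∑ s ∈ Finset.range N, |G (y (s+1)) - G (y s)| := by
      have := Finset.sum_range_sub (fun s => G (y s)) N
      rw [hN, hy0] at this
      calc |G x| = |∑ s ∈ Finset.range N, (G (y (s+1)) - G (y s))| := by
            rw [this]; simp
        _ ≤ _ := Finset.abs_sum_le_sum_abs _ _
    calc ENNReal.ofReal |G x|
        ≤ ENNReal.ofReal (∑ s ∈ Finset.range N, |G (y (s+1)) - G (y s)|) :=
          ENNReal.ofReal_le_ofReal htel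
      _ = ∑ s ∈ Finset.range N, ENNReal.ofReal |G (y (s+1)) - G (y s)| :=
          ENNReal.ofReal_sum_of_nonneg fun _ _ => abs_nonneg _
      _ ≤ ∑ s ∈ Finset.range N, f (y s) := by
          refine Finset.sum_le_sum fun s _ => ?_
          rw [hys, hf]
          exact Finset.single_le_sum (f := fun e => ENNReal.ofReal |G (y s + dir e) - G (y s)|)
            (fun _ _ => zero_le) (Finset.mem_univ (i, true))
      _ ≤ ∑' s : ℕ, f (y s) := ENNReal.sum_le_tsum _
      _ ≤ ∑' t : ℤ, f (Function.update x i t) :=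
          ENNReal.tsum_comp_le_tsum_of_injective
            (f := fun s : ℕ => x i + (s:ℤ)) (fun a b hab => by simpa using hab)
            (fun t : ℤ => f (Function.update x i t))
  calc (ENNReal.ofReal |G x|)^((d:ℝ)/(d-1))
      = ∏ _i : Fin d, (ENNReal.ofReal |G x|)^((1:ℝ)/(d-1)) := by
        rw [Finset.prod_const, Finset.card_univ, Fintype.card_fin, ← ENNReal.rpow_natCast,
          ← ENNReal.rpow_mul]
        congr 1; ring
    _ ≤ _ := by
        rw [Fintype.card_fin]
        refine Finset.prod_le_prod' fun i _ => ?_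
        have : (0:ℝ) ≤ 1/((d:ℝ)-1) := by apply div_nonneg <;> linarith
        exact ENNReal.rpow_le_rpow (hline i) this

lemma sobolev_real (hd : 2 ≤ d) (G : Pt d → ℝ) (M : ℕ) (hG : ∀ x, M < nrm x → G x = 0) :
    (∑ x ∈ box d M, |G x|^((d:ℝ)/(d-1)))^(((d:ℝ)-1)/d) ≤
      ∑ x ∈ box d (M+1), ∑ e : Dir d, |G (x + dir e) - G x| := by
  have hd1 : (1:ℝ) < d := by exact_mod_cast hd
  have hp : (0:ℝ) < (d:ℝ)/(d-1) := div_pos (by linarith) (by linarith)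
  have h := sobolev_ennreal hd G M hG
  rw [tsum_eq_sum (s := box d M) (fun x hx => by
    rw [hG x (by rw [mem_box] at hx; omega)]; simp [hp]),
    tsum_eq_sum (s := box d (M+1)) (fun x hx => by
    rw [mem_box] at hx
    refine Finset.sum_eq_zero fun e _ => ?_
    have h1 : nrm x ≤ nrm (x + dir e) + 1 := by
      have := nrm_sub (x + dir e) (dir e)
      rw [nrm_dir] at this; simpa using this
    rw [hG x (by omega), hG (x + dir e) (by omega)]; simp)] at h
  have e1 : ∀ x, (ENNReal.ofReal |G x|)^((d:ℝ)/(d-1)) = ENNReal.ofReal (|G x|^((d:ℝ)/(d-1))) :=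
    fun x => ENNReal.ofReal_rpow_of_nonneg (abs_nonneg _) hp.le
  simp_rw [e1] at h
  rw [← ENNReal.ofReal_sum_of_nonneg (fun _ _ => by positivity)] at h
  have e2 : ∀ x, ∑ e : Dir d, ENNReal.ofReal |G (x + dir e) - G x| =
      ENNReal.ofReal (∑ e : Dir d, |G (x + dir e) - G x|) := fun x =>
    (ENNReal.ofReal_sum_of_nonneg (fun _ _ => abs_nonneg _)).symm
  simp_rw [e2] at h
  rw [← ENNReal.ofReal_sum_of_nonneg (fun _ _ => by positivity),
    ENNReal.ofReal_rpow_of_nonneg (by positivity) hp.le,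
    ENNReal.ofReal_le_ofReal_iff (by positivity)] at h
  have h2 := Real.rpow_le_rpow (by positivity) h (show 0 ≤ ((d:ℝ)-1)/d from
    div_nonneg (by linarith) (by linarith))
  rw [← Real.rpow_mul (by positivity)] at h2
  have : (d:ℝ)/(d-1) * (((d:ℝ)-1)/d) = 1 := by
    have : (d:ℝ) - 1 ≠ 0 := by linarith
    field_simp
  rwa [this, Real.rpow_one] at h2

/-- `L¹` Poincare by translation. -/
lemma transl_poincare (F : Pt d → ℝ) (n : ℕ) : ∀ (k : ℕ) (z : Pt d) (m : ℕ), dist1 z 0 = k → nrm z ≤ m →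
    ∑ x ∈ box d n, |F (x + z) - F x| ≤
      k * ∑ w ∈ box d (n + m), ∑ e : Dir d, |F (w + dir e) - F w| := by
  intro k
  induction k with
  | zero =>
    intro z m hz _
    have : z = 0 := by
      apply nrm_eq_zero
      have := nrm_le_dist1 0 z
      have h2 : dist1 (0 : Pt d) z = dist1 z 0 := by
        simp [dist1]
      rw [h2, hz] at this
      simpa using this
    simp [this]
  | succ k ih =>
    intro z m hz hm
    -- find a coordinate to decrease
    have : ∃ i, z i ≠ 0 := by
      by_contra hc; push Not at hc
      have : z = 0 := funext hc
      simp [this, dist1] at hz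
    obtain ⟨i, hi⟩ := this
    set e : Dir d := (i, decide (0 < z i)) with he
    set z' := z - dir e with hz'
    have hzi : ∀ j, (z' j).natAbs + (if j = i then 1 else 0) = (z j).natAbs := by
      intro j
      by_cases hj : j = i
      · subst hj
        by_cases hpos : 0 < z j
        · simp [hz', he, dir, hpos]; omega
        · simp [hz', he, dir, hpos]; omega
      · simp [hz', he, dir, hj]
    have hd1 : dist1 z' 0 = k := by
      have h1 : dist1 z 0 = ∑ j, ((z' j).natAbs + (if j = i then 1 else 0)) := by
        unfold dist1; refine Finset.sum_congr rfl fun j _ => ?_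
        rw [hzi]; simp
      rw [Finset.sum_add_distrib] at h1
      simp only [Finset.sum_ite_eq', Finset.mem_univ, if_true] at h1
      have : dist1 z' 0 = ∑ j, (z' j).natAbs := by simp [dist1]
      omega
    have hm' : nrm z' ≤ m := by
      rw [nrm_le_iff]; intro j
      have := hzi j
      have := natAbs_le_nrm z j
      omega
    have h1 := ih z' m hd1 hm'
    have h2 : ∑ x ∈ box d n, |F (x + z) - F (x + z')| ≤
        ∑ w ∈ box d (n + m), ∑ e : Dir d, |F (w + dir e) - F w| := by
      calc ∑ x ∈ box d n, |F (x + z) - F (x + z')|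
          = ∑ w ∈ tbox z' n, |F (w + dir e) - F w| := by
            rw [sum_tbox]
            refine Finset.sum_congr rfl fun x _ => ?_
            rw [show z' + x = x + z' by abel, show x + z' + dir e = x + z by rw [hz']; abel]
        _ ≤ ∑ w ∈ box d (n + m), |F (w + dir e) - F w| := by
            refine Finset.sum_le_sum_of_subset_of_nonneg ?_ fun _ _ _ => abs_nonneg _
            intro w hw
            rw [mem_tbox] at hw
            rw [mem_box]
            have := nrm_add (w - z') z'
            rw [sub_add_cancel] at this
            omega
        _ ≤ _ := by
            refine Finset.sum_le_sum fun w _ => ?_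
            exact Finset.single_le_sum (f := fun e => |F (w + dir e) - F w|)
              (fun _ _ => abs_nonneg _) (Finset.mem_univ e)
    calc ∑ x ∈ box d n, |F (x + z) - F x|
        ≤ ∑ x ∈ box d n, (|F (x + z) - F (x + z')| + |F (x + z') - F x|) := by
          refine Finset.sum_le_sum fun x _ => ?_
          calc |F (x + z) - F x| = |(F (x + z) - F (x + z')) + (F (x + z') - F x)| := by ring_nf
            _ ≤ _ := abs_add_le _ _
      _ ≤ _ := by
          rw [Finset.sum_add_distrib]; push_cast; linarith

lemma poincare_box (F : Pt d → ℝ) (n : ℕ) :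
    ∑ x ∈ box d n, ∑ y ∈ box d n, |F y - F x| ≤
      (4*n+1)^d * (2*d*n) * ∑ w ∈ box d (3*n), ∑ e : Dir d, |F (w + dir e) - F w| := by
  have h1 : ∀ x ∈ box d n, ∑ y ∈ box d n, |F y - F x| ≤ ∑ z ∈ box d (2*n), |F (x + z) - F x| := by
    intro x hx
    have hx' := mem_box.1 hx
    rw [← sum_tbox x (2*n) (fun y => |F y - F x|)]
    refine Finset.sum_le_sum_of_subset_of_nonneg ?_ fun _ _ _ => abs_nonneg _
    intro y hy
    rw [mem_tbox]
    have := nrm_sub y x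
    have := mem_box.1 hy
    omega
  refine (Finset.sum_le_sum h1).trans ?_
  rw [Finset.sum_comm]
  have h2 : ∀ z ∈ box d (2*n), ∑ x ∈ box d n, |F (x + z) - F x| ≤
      (2*d*n) * ∑ w ∈ box d (3*n), ∑ e : Dir d, |F (w + dir e) - F w| := by
    intro z hz
    have hz' := mem_box.1 hz
    have := transl_poincare F n (dist1 z 0) z (2*n) rfl hz'
    rw [show n + 2*n = 3*n by ring] at this
    refine this.trans ?_
    gcongr
    have h3 := dist1_le z 0
    rw [zero_sub, nrm_neg] at h3
    have h4 : d * nrm z ≤ d * (2*n) := Nat.mul_le_mul_left _ hz'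
    have h5 : dist1 z 0 ≤ 2*d*n := by
      calc _ ≤ d * (2*n) := h3.trans h4
        _ = _ := by ring
    exact_mod_cast h5
  refine (Finset.sum_le_sum h2).trans (le_of_eq ?_)
  rw [Finset.sum_const, card_box, nsmul_eq_mul]
  push_cast; ring

end Perco

namespace Perco
variable {d : ℕ}

/-! ## M5: deterministic analysis on a good cluster -/

open scoped Classical in
/-- gradient along the edges of `I` -/
noncomputable def grd (I : Set (Pt d)) (f : Pt d → ℝ) (x : Pt d) (e : Dir d) : ℝ :=
  if x ∈ I ∧ x + dir e ∈ I then f (x + dir e) - f x else 0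

/-- sum over the edges starting in a box -/
noncomputable def esum (d n : ℕ) (h : Pt d → Dir d → ℝ) : ℝ := ∑ x ∈ box d n, ∑ e : Dir d, h x e

lemma esum_mono {n : ℕ} {h h' : Pt d → Dir d → ℝ} (H : ∀ x ∈ box d n, ∀ e, h x e ≤ h' x e) :
    esum d n h ≤ esum d n h' := Finset.sum_le_sum fun x hx => Finset.sum_le_sum fun e _ => H x hx e

lemma esum_nonneg {n : ℕ} {h : Pt d → Dir d → ℝ} (H : ∀ x e, 0 ≤ h x e) : 0 ≤ esum d n h :=
  Finset.sum_nonneg fun x _ => Finset.sum_nonneg fun e _ => H x e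

lemma esum_mono_box {n m : ℕ} (hnm : n ≤ m) {h : Pt d → Dir d → ℝ} (H : ∀ x e, 0 ≤ h x e) :
    esum d n h ≤ esum d m h :=
  Finset.sum_le_sum_of_subset_of_nonneg (box_mono hnm) fun x _ _ => Finset.sum_nonneg fun e _ => H x e

lemma esum_add {n : ℕ} (h h' : Pt d → Dir d → ℝ) :
    esum d n (fun x e => h x e + h' x e) = esum d n h + esum d n h' := by
  simp [esum, Finset.sum_add_distrib]

lemma esum_mul {n : ℕ} (c : ℝ) (h : Pt d → Dir d → ℝ) :
    esum d n (fun x e => c * h x e) = c * esum d n h := by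
  simp [esum, Finset.mul_sum]

lemma card_Dir : Fintype.card (Dir d) = 2 * d := by
  simp [Dir, mul_comm]

lemma esum_const {n : ℕ} (g : Pt d → ℝ) :
    esum d n (fun x _ => g x) = 2 * d * ∑ x ∈ box d n, g x := by
  simp [esum, Finset.mul_sum, mul_comm (d:ℝ)]

lemma esum_swap_le {n : ℕ} {h : Pt d → Dir d → ℝ} (H : ∀ x e, 0 ≤ h x e) :
    esum d n h ≤ esum d (n+1) (fun x e => h (x + dir e) (opp e)) := by
  unfold esum
  rw [← Finset.sum_product', ← Finset.sum_product']
  set φ : Pt d × Dir d → Pt d × Dir d := fun p => (p.1 + dir p.2, opp p.2) with hφ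
  have hinv : ∀ p, φ (φ p) = p := fun p => by
    simp [hφ, dir_opp, opp_opp]
  have hinj : Set.InjOn φ (box d n ×ˢ (Finset.univ : Finset (Dir d)) : Finset _) :=
    (Function.LeftInverse.injective hinv).injOn
  have : ∑ p ∈ box d n ×ˢ (Finset.univ : Finset (Dir d)), h p.1 p.2 =
      ∑ p ∈ (box d n ×ˢ (Finset.univ : Finset (Dir d))).image φ, h (φ p).1 (φ p).2 := by
    rw [Finset.sum_image hinj]
    refine Finset.sum_congr rfl fun p _ => ?_
    rw [hinv]
  rw [this]
  refine Finset.sum_le_sum_of_subset_of_nonneg ?_ fun p _ _ => H _ _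
  intro p hp
  rw [Finset.mem_image] at hp
  obtain ⟨q, hq, rfl⟩ := hp
  rw [Finset.mem_product, mem_box] at hq ⊢
  have := nrm_add q.1 (dir q.2)
  rw [nrm_dir] at this
  exact ⟨by simp only [hφ]; omega, Finset.mem_univ _⟩

lemma grd_swap (I : Set (Pt d)) (f : Pt d → ℝ) (x : Pt d) (e : Dir d) :
    grd I f (x + dir e) (opp e) = - grd I f x e := by
  unfold grd
  have : x + dir e + dir (opp e) = x := by rw [dir_opp]; abel
  rw [this]
  by_cases h1 : x ∈ I <;> by_cases h2 : x + dir e ∈ I <;> simp [h1, h2]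

lemma exists_nearest {I : Set (Pt d)} (hI : I.Nonempty) :
    ∃ π : Pt d → Pt d, (∀ x, π x ∈ I) ∧ (∀ x, ∀ p ∈ I, nrm (π x - x) ≤ nrm (p - x)) ∧
      ∀ x ∈ I, π x = x := by
  have : ∀ x, ∃ q ∈ I, ∀ p ∈ I, nrm (q - x) ≤ nrm (p - x) := by
    intro x
    have hne : (Set.image (fun p => nrm (p - x)) I).Nonempty := hI.image _
    obtain ⟨q, hq, hq2⟩ := Nat.sInf_mem hne
    refine ⟨q, hq, fun p hp => ?_⟩
    have h3 : (fun p => nrm (p - x)) q ≤ nrm (p - x) := by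
      rw [hq2]; exact Nat.sInf_le ⟨p, hp, rfl⟩
    exact h3
  choose π h1 h2 using this
  refine ⟨π, h1, h2, fun x hx => ?_⟩
  have := h2 x x hx
  rw [sub_self, nrm_zero, Nat.le_zero] at this
  exact sub_eq_zero.1 (nrm_eq_zero this)

variable {ω : Config d} {rho W : Pt d → ℕ} {K n0 : ℕ}

lemma GoodGeom.nonempty (hg : GoodGeom ω rho W K n0) : (Sinf ω).Nonempty := by
  obtain ⟨p, hp, _⟩ := hg.near 0
  exact ⟨p, hp⟩

lemma lemmaA (hg : GoodGeom ω rho W K n0) (π : Pt d → Pt d) (h1 : ∀ x, π x ∈ Sinf ω)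
    (h2 : ∀ x, ∀ p ∈ Sinf ω, nrm (π x - x) ≤ nrm (p - x)) (f : Pt d → ℝ) (n : ℕ) (hn : n0 ≤ n) :
    esum d n (fun x e => |f (π (x + dir e)) - f (π x)|) ≤
      2 * d * esum d (2*n) (fun y e => (min (W y) (W (y + dir e)) : ℕ) * |grd (Sinf ω) f y e|) := by
  classical
  have hrho : ∀ x, nrm (π x - x) ≤ rho x := fun x => by
    obtain ⟨p, hp, hp2⟩ := hg.near x
    exact (h2 x p hp).trans hp2
  have key : ∀ x ∈ box d n, ∀ e, |f (π (x + dir e)) - f (π x)| ≤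
      esum d (2*n) (fun y e' => if nrm (y - x) ≤ 4 * rho x ∧ nrm (y + dir e' - x) ≤ 4 * rho x then
        |grd (Sinf ω) f y e'| else 0) := by
    intro x hx e
    have hr := hrho x
    have h2r := hg.two_le x
    have hr' : nrm (π (x + dir e) - x) ≤ 2 * rho x := by
      have a1 := h2 (x + dir e) (π x) (h1 x)
      have a2 : nrm (π x - (x + dir e)) ≤ nrm (π x - x) + 1 := by
        rw [← sub_sub]
        refine (nrm_sub _ _).trans ?_
        rw [nrm_dir]
      have a3 : nrm (π (x + dir e) - x) ≤ nrm (π (x + dir e) - (x + dir e)) + 1 := by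
        have : π (x + dir e) - x = (π (x + dir e) - (x + dir e)) + dir e := by abel
        rw [this]
        refine (nrm_add _ _).trans ?_
        rw [nrm_dir]
      omega
    have hc := hg.conn x (π x) (h1 x) (π (x + dir e)) (h1 _) (by omega) hr'
    set T : Finset (Pt d) := (tbox x (4 * rho x)).filter (· ∈ Sinf ω) with hT
    have hTset : (T : Set (Pt d)) = Sinf ω ∩ ballZ x (4 * rho x) := by
      ext y
      simp [hT, mem_tbox, mem_ballZ, and_comm]
    rw [← hTset] at hc
    refine (path_ineq f T _ _ hc).trans ?_
    have hTb : T ⊆ box d (2*n) := by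
      intro y hy
      simp only [hT, Finset.mem_filter, mem_tbox] at hy
      have h4 := hg.small n hn x hx
      rw [mem_box] at hx ⊢
      have : nrm y ≤ nrm (y - x) + nrm x := by
        have := nrm_add (y - x) x
        rwa [sub_add_cancel] at this
      omega
    unfold gradSum esum
    refine le_trans ?_ (Finset.sum_le_sum_of_subset_of_nonneg hTb fun y _ _ =>
      Finset.sum_nonneg fun e' _ => by dsimp only; split_ifs <;> positivity)
    refine Finset.sum_le_sum fun y hy => Finset.sum_le_sum fun e' _ => ?_
    simp only [hT, Finset.mem_filter, mem_tbox] at hy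
    simp only [hT, Finset.mem_filter, mem_tbox, grd]
    by_cases h5 : nrm (y + dir e' - x) ≤ 4 * rho x ∧ y + dir e' ∈ Sinf ω
    · simp [h5, hy]
    · rw [if_neg h5]
      split_ifs <;> positivity
  calc esum d n (fun x e => |f (π (x + dir e)) - f (π x)|)
      ≤ esum d n (fun x _ => esum d (2*n) (fun y e' =>
          if nrm (y - x) ≤ 4 * rho x ∧ nrm (y + dir e' - x) ≤ 4 * rho x then
        |grd (Sinf ω) f y e'| else 0)) := esum_mono key
    _ = 2 * d * esum d (2*n) (fun y e' => ∑ x ∈ box d n,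
          if nrm (y - x) ≤ 4 * rho x ∧ nrm (y + dir e' - x) ≤ 4 * rho x then
        |grd (Sinf ω) f y e'| else 0) := by
        rw [esum_const]
        congr 1
        unfold esum
        rw [Finset.sum_comm]
        refine Finset.sum_congr rfl fun y _ => ?_
        rw [Finset.sum_comm]
    _ ≤ _ := by
        refine mul_le_mul_of_nonneg_left (esum_mono fun y _ e' => ?_) (by positivity)
        rw [← Finset.sum_filter, Finset.sum_const, nsmul_eq_mul]
        refine mul_le_mul_of_nonneg_right ?_ (abs_nonneg _)
        norm_cast
        refine le_min ?_ ?_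
        · refine hg.cover y _ fun x hx => ?_
          simp only [Finset.mem_filter] at hx
          exact hx.2.1
        · refine hg.cover _ _ fun x hx => ?_
          simp only [Finset.mem_filter] at hx
          exact hx.2.2

end Perco

namespace Perco
variable {d : ℕ}
variable {ω : Config d} {rho W : Pt d → ℕ} {K n0 : ℕ}

lemma rec_half {b : ℕ → ℝ} {ε : ℝ} (hε : 0 < ε) {n1 : ℕ} (h : ∀ n, n1 ≤ n → b n ≤ ε + b (n/2) / 2) :
    ∃ n2, ∀ n, n2 ≤ n → b n ≤ 3 * ε := by
  set B : ℝ := ∑ i ∈ Finset.range (n1+1), |b i| with hB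
  have hB0 : 0 ≤ B := Finset.sum_nonneg fun _ _ => abs_nonneg _
  have hall : ∀ n, b n ≤ 2 * ε + B := by
    intro n
    induction n using Nat.strong_induction_on with
    | _ n ih =>
      by_cases hn : n ≤ n1
      · have : |b n| ≤ B := Finset.single_le_sum (f := fun i => |b i|) (fun _ _ => abs_nonneg _)
          (Finset.mem_range.2 (by omega))
        have := le_abs_self (b n)
        linarith
      · have h1 := ih (n/2) (by omega)
        have h2 := h n (by omega)
        linarith
  have hj : ∀ j n, (n1+1) * 2^j ≤ n → b n ≤ 2 * ε + B / 2^j := by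
    intro j
    induction j with
    | zero => intro n _; simpa using hall n
    | succ j ih =>
      intro n hn
      have h1 := ih (n/2) (by rw [pow_succ, ← mul_assoc] at hn; omega)
      have h2 := h n (by
        have : 1 ≤ 2^(j+1) := Nat.one_le_two_pow
        nlinarith)
      have : B / 2^(j+1) = (B/2^j)/2 := by rw [pow_succ]; field_simp
      rw [this]
      linarith
  obtain ⟨j, hjj⟩ := exists_pow_lt_of_lt_one (show 0 < ε / (B+1) by positivity) (show (1/2:ℝ) < 1 by norm_num)
  refine ⟨(n1+1)*2^j, fun n hn => (hj j n hn).trans ?_⟩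
  have : B / 2^j ≤ ε := by
    have h1 : B / 2^j = B * (1/2)^j := by rw [one_div, inv_pow]; rfl
    rw [h1]
    calc B * (1/2)^j ≤ (B+1) * (ε/(B+1)) := by
          apply mul_le_mul <;> first | linarith | positivity
      _ = ε := by field_simp
  linarith

lemma W_sq_le (hd : 2 ≤ d) (hg : GoodGeom ω rho W K n0) (n : ℕ) (hn : 1 ≤ n) :
    ∑ y ∈ box d n, ((W y : ℝ))^2 ≤ K * (n:ℝ)^d := by
  have h := hg.Wsum n hn
  have h2 : ∑ y ∈ box d n, (W y)^2 ≤ ∑ y ∈ box d n, (W y)^(2*d) := by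
    refine Finset.sum_le_sum fun y _ => ?_
    rcases Nat.eq_zero_or_pos (W y) with h0 | h0
    · rw [h0]; simp
    · exact Nat.pow_le_pow_right h0 (by omega)
  exact_mod_cast h2.trans h

lemma grad_l1 (hd : 2 ≤ d) (hg : GoodGeom ω rho W K n0) (π : Pt d → Pt d) (h1 : ∀ x, π x ∈ Sinf ω)
    (h2 : ∀ x, ∀ p ∈ Sinf ω, nrm (π x - x) ≤ nrm (p - x)) (f : Pt d → ℝ) (n : ℕ) (hn : n0 ≤ n)
    (hn1 : 1 ≤ n) (η : ℝ) (hη : 0 < η)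
    (hf : esum d (2*n) (fun x e => (grd (Sinf ω) f x e)^2) ≤ η^2 * ((2*n : ℕ):ℝ)^d) :
    esum d n (fun x e => |f (π (x + dir e)) - f (π x)|) ≤
      η * (2 * d * (2 * d * K + 1) * 2^d) * (n:ℝ)^d := by
  refine (lemmaA hg π h1 h2 f n hn).trans ?_
  have hA : esum d (2*n) (fun y e => (min (W y) (W (y + dir e)) : ℕ) * |grd (Sinf ω) f y e|) ≤
      esum d (2*n) (fun y e => η * (W y:ℝ)^2 + η⁻¹ * (grd (Sinf ω) f y e)^2) := by
    refine esum_mono fun y _ e => ?_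
    have a1 : ((min (W y) (W (y + dir e)) : ℕ) : ℝ) ≤ W y := by exact_mod_cast min_le_left _ _
    refine (mul_le_mul_of_nonneg_right a1 (abs_nonneg _)).trans ?_
    rw [← sq_abs (grd _ _ _ _)]
    set g := |grd (Sinf ω) f y e|
    have : η * (W y:ℝ)^2 + η⁻¹ * g^2 - W y * g = η * ((W y - η⁻¹ * g / 2)^2) + 3/4 * η⁻¹ * g^2 := by
      field_simp; ring
    have : 0 ≤ η * ((W y - η⁻¹ * g / 2)^2) + 3/4 * η⁻¹ * g^2 := by positivity
    linarith
  rw [esum_add, esum_mul, esum_mul, esum_const] at hA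
  have hW := W_sq_le hd hg (2*n) (by omega)
  have hd0 : (0:ℝ) ≤ 2 * d := by positivity
  have hinv : η⁻¹ * esum d (2*n) (fun x e => (grd (Sinf ω) f x e)^2) ≤ η * ((2*n : ℕ):ℝ)^d := by
    calc _ ≤ η⁻¹ * (η^2 * ((2*n : ℕ):ℝ)^d) := mul_le_mul_of_nonneg_left hf (by positivity)
      _ = _ := by field_simp
  have hC : esum d (2*n) (fun y e => (min (W y) (W (y + dir e)) : ℕ) * |grd (Sinf ω) f y e|) ≤
      η * (2 * d * (K * ((2*n : ℕ):ℝ)^d)) + η * ((2*n : ℕ):ℝ)^d := by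
    refine hA.trans (add_le_add ?_ hinv)
    gcongr
  calc _ ≤ 2 * d * (η * (2 * d * (K * ((2*n : ℕ):ℝ)^d)) + η * ((2*n : ℕ):ℝ)^d) := by gcongr
    _ = _ := by push_cast; rw [mul_pow]; ring

/-- the approximation property of the corrector -/
def ApproxP (I : Set (Pt d)) (χ : Pt d → ℝ) : Prop :=
  ∀ ε : ℝ, 0 < ε → ∃ ψ : Pt d → ℝ, ∃ B : ℝ, (∀ x, |ψ x| ≤ B) ∧
    ∀ n : ℕ, 1 ≤ n → esum d n (fun x e => (grd I (fun y => χ y - ψ y) x e)^2) ≤ ε * (n:ℝ)^d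

lemma l1_sublinear (hd : 2 ≤ d) (hg : GoodGeom ω rho W K n0) (π : Pt d → Pt d)
    (h1 : ∀ x, π x ∈ Sinf ω)
    (h2 : ∀ x, ∀ p ∈ Sinf ω, nrm (π x - x) ≤ nrm (p - x)) (χ : Pt d → ℝ)
    (hχ : ApproxP (Sinf ω) χ) (ε : ℝ) (hε : 0 < ε) :
    ∃ n1, ∀ n, n1 ≤ n → ∑ x ∈ box d n, |χ (π x)| ≤ ε * (n:ℝ)^(d+1) := by
  -- oscillation
  have hosc : ∀ ε : ℝ, 0 < ε → ∃ n1, 1 ≤ n1 ∧ ∀ n, n1 ≤ n →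
      ∑ x ∈ box d n, ∑ y ∈ box d n, |χ (π y) - χ (π x)| ≤ ε * (n:ℝ)^(2*d+1) := by
    intro ε hε
    set C : ℝ := 5^d * (2*d) * ((2 * d * (2 * d * K + 1) * 2^d) * 3^d) + 1 with hC
    have hCpos : 0 < C := by positivity
    set η : ℝ := ε / (2 * C) with hη
    have hηpos : 0 < η := by positivity
    obtain ⟨ψ, B, hB, hψ⟩ := hχ (η^2) (by positivity)
    have hB0 : 0 ≤ B := (abs_nonneg _).trans (hB 0)
    obtain ⟨N, hN⟩ := exists_nat_ge (2 * B * 9^d * 2 / ε)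
    refine ⟨max (max n0 1) N, by omega, fun n hn => ?_⟩
    have hn1 : 1 ≤ n := by omega
    have hnr : (1:ℝ) ≤ n := by exact_mod_cast hn1
    have hgr := grad_l1 hd hg π h1 h2 (fun y => χ y - ψ y) (3*n) (by omega) (by omega) η hηpos
      (hψ (2*(3*n)) (by omega))
    have hp := poincare_box (fun x => χ (π x) - ψ (π x)) n
    have e1 : ∑ x ∈ box d n, ∑ y ∈ box d n, |χ (π y) - χ (π x)| ≤
        ∑ x ∈ box d n, ∑ y ∈ box d n, (|χ (π y) - ψ (π y) - (χ (π x) - ψ (π x))| + 2 * B) := by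
      refine Finset.sum_le_sum fun x _ => Finset.sum_le_sum fun y _ => ?_
      have a1 := abs_le.1 (hB (π x))
      have a2 := abs_le.1 (hB (π y))
      have a3 := neg_abs_le (χ (π y) - ψ (π y) - (χ (π x) - ψ (π x)))
      have a4 := le_abs_self (χ (π y) - ψ (π y) - (χ (π x) - ψ (π x)))
      rw [abs_le]; constructor <;> linarith
    refine e1.trans ?_
    simp only [Finset.sum_add_distrib, Finset.sum_const, card_box, nsmul_eq_mul]
    have e2 : (4*(n:ℝ)+1)^d * (2*d*n) * ∑ w ∈ box d (3*n), ∑ e : Dir d,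
        |χ (π (w + dir e)) - ψ (π (w + dir e)) - (χ (π w) - ψ (π w))| ≤ ε/2 * (n:ℝ)^(2*d+1) := by
      calc _ ≤ (5*(n:ℝ))^d * (2*d*n) * (η * (2 * d * (2 * d * K + 1) * 2^d) * ((3*n : ℕ):ℝ)^d) := by
            unfold esum at hgr
            gcongr
            linarith
        _ = η * (C - 1) * (n:ℝ)^(2*d+1) := by
            rw [hC]; push_cast; simp only [mul_pow, pow_succ, pow_mul]; ring
        _ ≤ η * C * (n:ℝ)^(2*d+1) := by gcongr; linarith
        _ = _ := by rw [hη]; field_simp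
    have e3 : ((2*(n:ℝ)+1)^d) * ((2*(n:ℝ)+1)^d * (2*B)) ≤ ε/2 * (n:ℝ)^(2*d+1) := by
      have hNn : (N:ℝ) ≤ n := by exact_mod_cast (by omega : N ≤ n)
      have : 2 * B * 9^d * 2 ≤ ε * n := by
        rw [div_le_iff₀ hε] at hN; nlinarith
      calc _ ≤ ((3*(n:ℝ))^d) * ((3*(n:ℝ))^d * (2*B)) := by
            gcongr <;> linarith
        _ = (2 * B * 9^d * 2) / 2 * (n:ℝ)^(2*d) := by
            have : (9:ℝ)^d = 3^d*3^d := by rw [← mul_pow]; norm_num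
            rw [this, mul_pow, mul_comm 2 d, pow_mul] ; ring
        _ ≤ (ε * n)/2 * (n:ℝ)^(2*d) := by gcongr
        _ = _ := by rw [pow_succ]; ring
    push_cast
    linarith
  set s : ℕ → ℝ := fun n => ∑ x ∈ box d n, |χ (π x)| with hs
  have hs0 : ∀ n, 0 ≤ s n := fun n => Finset.sum_nonneg fun _ _ => abs_nonneg _
  have hanchor : ∀ m n : ℕ, m ≤ n → (2*(m:ℝ)+1)^d * s n ≤
      ∑ x ∈ box d n, ∑ y ∈ box d n, |χ (π y) - χ (π x)| + (2*(n:ℝ)+1)^d * s m := by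
    intro m n hmn
    calc (2*(m:ℝ)+1)^d * s n = ∑ x ∈ box d m, ∑ y ∈ box d n, |χ (π y)| := by
          rw [Finset.sum_const, card_box, nsmul_eq_mul]; push_cast; rfl
      _ ≤ ∑ x ∈ box d m, ∑ y ∈ box d n, (|χ (π y) - χ (π x)| + |χ (π x)|) := by
          refine Finset.sum_le_sum fun x _ => Finset.sum_le_sum fun y _ => ?_
          have := abs_add_le (χ (π y) - χ (π x)) (χ (π x))
          rwa [sub_add_cancel] at this
      _ = ∑ x ∈ box d m, ∑ y ∈ box d n, |χ (π y) - χ (π x)| + (2*(n:ℝ)+1)^d * s m := by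
          simp only [Finset.sum_add_distrib, Finset.sum_const, card_box, nsmul_eq_mul, hs,
            Finset.mul_sum]
          push_cast; rfl
      _ ≤ _ := by
          refine add_le_add ?_ le_rfl
          exact Finset.sum_le_sum_of_subset_of_nonneg (box_mono hmn) fun x _ _ =>
            Finset.sum_nonneg fun _ _ => abs_nonneg _
  set δ : ℝ := ε / (3 * 3^d) with hδ
  have hδ0 : 0 < δ := by positivity
  obtain ⟨n1, hn1, hD⟩ := hosc δ hδ0
  set b : ℕ → ℝ := fun n => s n / ((2*(n:ℝ)+1)^d * n) with hb
  have hrec : ∀ n, 2*n1 ≤ n → b n ≤ δ + b (n/2) / 2 := by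
    intro n hn
    set m := n/2 with hm
    have hm1 : (1:ℝ) ≤ m := by exact_mod_cast (by omega : 1 ≤ m)
    have hnr : (1:ℝ) ≤ n := by exact_mod_cast (by omega : 1 ≤ n)
    have hmn : (n:ℝ) ≤ 2*m+1 := by exact_mod_cast (by omega : n ≤ 2*m+1)
    have hmn2 : 2*(m:ℝ) ≤ n := by exact_mod_cast (by omega : 2*m ≤ n)
    have A := (hanchor m n (by omega)).trans (add_le_add (hD n (by omega)) le_rfl)
    have hD1 : δ * (n:ℝ)^(2*d+1) ≤ δ * ((2*(m:ℝ)+1)^d * ((2*(n:ℝ)+1)^d * n)) := by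
      have : (n:ℝ)^(2*d+1) = (n:ℝ)^d * ((n:ℝ)^d * n) := by
        rw [pow_succ, two_mul, pow_add]; ring
      rw [this]
      gcongr
      linarith
    have hb2 : b m / 2 = s m / ((2*(m:ℝ)+1)^d * (2 * m)) := by
      simp only [hb]; field_simp
    have hb3 : s m / ((2*(m:ℝ)+1)^d * n) ≤ s m / ((2*(m:ℝ)+1)^d * (2 * m)) := by
      gcongr
    rw [hb2]
    refine le_trans ?_ (add_le_add le_rfl hb3)
    have hP : (0:ℝ) < (2*(m:ℝ)+1)^d := by positivity
    have hQ : (0:ℝ) < (2*(n:ℝ)+1)^d := by positivity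
    have e1 : δ + s m / ((2*(m:ℝ)+1)^d * n) =
        (δ * ((2*(m:ℝ)+1)^d * ((2*(n:ℝ)+1)^d * n)) + (2*(n:ℝ)+1)^d * s m) /
          ((2*(m:ℝ)+1)^d * ((2*(n:ℝ)+1)^d * n)) := by field_simp
    have e2 : b n = ((2*(m:ℝ)+1)^d * s n) / ((2*(m:ℝ)+1)^d * ((2*(n:ℝ)+1)^d * n)) := by
      simp only [hb]; field_simp
    rw [e1, e2]
    refine div_le_div_of_nonneg_right ?_ (by positivity)
    linarith
  obtain ⟨n2, hn2⟩ := rec_half hδ0 hrec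
  refine ⟨max n2 1, fun n hn => ?_⟩
  have h := hn2 n (by omega)
  have hnr : (1:ℝ) ≤ n := by exact_mod_cast (by omega : 1 ≤ n)
  simp only [hb] at h
  rw [div_le_iff₀ (by positivity)] at h
  refine h.trans ?_
  calc 3 * δ * ((2*(n:ℝ)+1)^d * n) ≤ 3 * δ * ((3*(n:ℝ))^d * n) := by gcongr; linarith
    _ = _ := by rw [hδ, mul_pow, pow_succ]; field_simp

end Perco

namespace Perco
variable {d : ℕ}
variable {ω : Config d} {rho W : Pt d → ℕ} {K n0 : ℕ}

/-- Sobolev inequality on the good cluster. -/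
lemma cluster_sobolev (hd : 2 ≤ d) (hg : GoodGeom ω rho W K n0) (n : ℕ) (hn : n0 ≤ n) (hn1 : 1 ≤ n)
    (v : Pt d → ℝ) (hv0 : ∀ x, 0 ≤ v x) (hvI : ∀ x, x ∉ Sinf ω → v x = 0)
    (hvb : ∀ x, 2*n < nrm x → v x = 0) (A : Finset (Pt d)) (hA : ∀ x, v x ≠ 0 → x ∈ A) :
    (∑ x ∈ box d (2*n), (v x)^2)^d ≤ (A.card : ℝ) *
      (256 * d^3 * (K+1) * n * esum d (9*n) (fun x e => (grd (Sinf ω) v x e)^2))^d := by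
  classical
  obtain ⟨π, h1, h2, h3⟩ := exists_nearest hg.nonempty
  have hd1 : (1:ℝ) < d := by exact_mod_cast hd
  have hdne : (d:ℝ) ≠ 0 := by positivity
  have hnr : (1:ℝ) ≤ n := by exact_mod_cast hn1
  set p : ℝ := (d:ℝ)/(d-1) with hp
  have hpq : Real.HolderConjugate (d:ℝ) p := Real.HolderConjugate.conjExponent hd1
  have hp0 : 0 < p := hpq.symm.pos
  have hpinv : 1/p = ((d:ℝ)-1)/d := by rw [hp, one_div_div]
  set N : ℝ := (∑ x ∈ box d (2*n), ((v x)^2)^p)^(1/p) with hN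
  set Γ : ℝ := esum d (9*n) (fun x e => (grd (Sinf ω) v x e)^2) with hΓ
  have hsum0 : 0 ≤ ∑ x ∈ box d (2*n), ((v x)^2)^p :=
    Finset.sum_nonneg fun x _ => by positivity
  have hN0 : 0 ≤ N := Real.rpow_nonneg hsum0 _
  have hrho : ∀ x, nrm (π x - x) ≤ rho x := fun x => by
    obtain ⟨p, hp, hp2⟩ := hg.near x
    exact (h2 x p hp).trans hp2
  -- Step 1: Z^d Sobolev
  have s1 : N ≤ esum d (3*n+1) (fun x e => |(v (π (x + dir e)))^2 - (v (π x))^2|) := by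
    have hs := sobolev_real hd (fun x => (v (π x))^2) (3*n) (by
      intro x hx
      have : v (π x) = 0 := by
        apply hvb
        have a1 := hg.small (nrm x) (by omega) x (by rw [mem_box])
        have a2 := hrho x
        have a3 : nrm x ≤ nrm (π x) + nrm (π x - x) := by
          have := nrm_sub (π x) (π x - x)
          rwa [sub_sub_cancel] at this
        omega
      simp [this])
    refine le_trans ?_ hs
    rw [hN, hpinv]
    refine Real.rpow_le_rpow hsum0 ?_ (by apply div_nonneg <;> linarith)
    refine le_trans ?_ (Finset.sum_le_sum_of_subset_of_nonneg (box_mono (by omega : 2*n ≤ 3*n))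
      fun x _ _ => by positivity)
    refine Finset.sum_le_sum fun x _ => ?_
    by_cases hx : x ∈ Sinf ω
    · rw [h3 x hx, abs_of_nonneg (by positivity)]
    · rw [hvI x hx]
      simp only [ne_eq, OfNat.ofNat_ne_zero, not_false_eq_true, zero_pow]
      rw [Real.zero_rpow hp0.ne']
      positivity
  -- Step 2
  have s2 : N ≤ 4 * d * esum d (9*n) (fun y e => (W y : ℝ) * |grd (Sinf ω) v y e| * v y) := by
    refine s1.trans ((lemmaA hg π h1 h2 (fun y => (v y)^2) (3*n+1) (by omega)).trans ?_)
    have b1 : esum d (2*(3*n+1)) (fun y e => (min (W y) (W (y + dir e)) : ℕ) *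
        |grd (Sinf ω) (fun y => (v y)^2) y e|) ≤
        esum d (2*(3*n+1)) (fun y e => (W y : ℝ) * |grd (Sinf ω) v y e| * v y +
          (W (y + dir e) : ℝ) * |grd (Sinf ω) v y e| * v (y + dir e)) := by
      refine esum_mono fun y _ e => ?_
      have a1 : ((min (W y) (W (y + dir e)) : ℕ) : ℝ) ≤ W y := by exact_mod_cast min_le_left _ _
      have a2 : ((min (W y) (W (y + dir e)) : ℕ) : ℝ) ≤ W (y + dir e) := by
        exact_mod_cast min_le_right _ _
      have a3 : |grd (Sinf ω) (fun y => (v y)^2) y e| = |grd (Sinf ω) v y e| * (v y + v (y + dir e)) := by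
        unfold grd
        split_ifs
        · rw [← abs_of_nonneg (add_nonneg (hv0 y) (hv0 (y + dir e))), ← abs_mul]
          congr 1
          ring
        · simp
      rw [a3]
      have a4 : 0 ≤ |grd (Sinf ω) v y e| * v y := mul_nonneg (abs_nonneg _) (hv0 _)
      have a5 : 0 ≤ |grd (Sinf ω) v y e| * v (y + dir e) := mul_nonneg (abs_nonneg _) (hv0 _)
      have := mul_le_mul_of_nonneg_right a1 a4
      have := mul_le_mul_of_nonneg_right a2 a5
      nlinarith
    rw [esum_add] at b1
    have hnn : ∀ (y : Pt d) (e : Dir d), 0 ≤ (W y : ℝ) * |grd (Sinf ω) v y e| * v y := fun y e =>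
      mul_nonneg (by positivity) (hv0 _)
    have hnn2 : ∀ (y : Pt d) (e : Dir d), 0 ≤ (W (y + dir e) : ℝ) * |grd (Sinf ω) v y e| * v (y + dir e) :=
      fun y e => mul_nonneg (by positivity) (hv0 _)
    have b2 := esum_mono_box (d := d) (by omega : 2*(3*n+1) ≤ 9*n) hnn
    have b3 := esum_swap_le (n := 2*(3*n+1)) hnn2
    have b4 : esum d (2*(3*n+1)+1) (fun x e => (W (x + dir e + dir (opp e)) : ℝ) *
        |grd (Sinf ω) v (x + dir e) (opp e)| * v (x + dir e + dir (opp e))) =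
        esum d (2*(3*n+1)+1) (fun y e => (W y : ℝ) * |grd (Sinf ω) v y e| * v y) := by
      congr 1
      funext x e
      have : x + dir e + dir (opp e) = x := by rw [dir_opp]; abel
      rw [this, grd_swap, abs_neg]
    rw [b4] at b3
    have b5 := esum_mono_box (d := d) (by omega : 2*(3*n+1)+1 ≤ 9*n) hnn
    have b6 := b1.trans (add_le_add b2 (b3.trans b5))
    have hd2 : (0:ℝ) ≤ 2 * d := by positivity
    have := mul_le_mul_of_nonneg_left b6 hd2
    linarith
  -- Step 3
  have s3 : ∑ x ∈ box d (9*n), (W x:ℝ)^2 * (v x)^2 ≤ (K+1) * (2*n) * N := by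
    have c1 : ∑ x ∈ box d (9*n), (W x:ℝ)^2 * (v x)^2 = ∑ x ∈ box d (2*n), (W x:ℝ)^2 * (v x)^2 := by
      symm
      refine Finset.sum_subset (box_mono (by omega)) fun x _ hx => ?_
      rw [mem_box, not_le] at hx
      rw [hvb x hx]; simp
    rw [c1]
    refine (Real.inner_le_Lp_mul_Lq_of_nonneg _ hpq (fun x _ => by positivity)
      (fun x _ => by positivity)).trans ?_
    refine mul_le_mul_of_nonneg_right ?_ hN0
    have c2 : ∑ x ∈ box d (2*n), ((W x:ℝ)^2)^(d:ℝ) ≤ ((K+1) * (2*(n:ℝ)))^(d:ℝ) := by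
      have := hg.Wsum (2*n) (by omega)
      have c3 : ∑ x ∈ box d (2*n), ((W x:ℝ)^2)^(d:ℝ) = ((∑ y ∈ box d (2*n), (W y)^(2*d) : ℕ) : ℝ) := by
        push_cast
        refine Finset.sum_congr rfl fun x _ => ?_
        rw [Real.rpow_natCast, ← pow_mul]
      rw [c3, Real.rpow_natCast]
      calc ((∑ y ∈ box d (2*n), (W y)^(2*d) : ℕ) : ℝ) ≤ ((K * (2*n)^d : ℕ) : ℝ) := by exact_mod_cast this
        _ ≤ (K+1)^d * (2*(n:ℝ))^d := by
            push_cast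
            gcongr
            calc (K:ℝ) ≤ (K+1)^1 := by simp
              _ ≤ (K+1)^d := pow_le_pow_right₀ (by linarith [Nat.cast_nonneg (α := ℝ) K]) (by omega)
        _ = _ := (mul_pow _ _ _).symm
    calc (∑ x ∈ box d (2*n), ((W x:ℝ)^2)^(d:ℝ))^(1/(d:ℝ)) ≤ (((K+1) * (2*(n:ℝ)))^(d:ℝ))^(1/(d:ℝ)) :=
          Real.rpow_le_rpow (Finset.sum_nonneg fun x _ => by positivity) c2 (by positivity)
      _ = _ := by
          rw [← Real.rpow_mul (by positivity), mul_one_div, div_self hdne, Real.rpow_one]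
  have s4 : N ≤ 256 * d^3 * (K+1) * n * Γ := by
    set t : ℝ := 1 / (32 * d^2 * (K+1) * n) with ht
    have ht0 : 0 < t := by positivity
    have c1 : esum d (9*n) (fun y e => (W y : ℝ) * |grd (Sinf ω) v y e| * v y) ≤
        esum d (9*n) (fun y e => t * ((W y:ℝ)^2 * (v y)^2) + t⁻¹ * (grd (Sinf ω) v y e)^2) := by
      refine esum_mono fun y _ e => ?_
      rw [← sq_abs (grd _ _ _ _)]
      set g := |grd (Sinf ω) v y e|
      have : t * ((W y:ℝ)^2 * (v y)^2) + t⁻¹ * g^2 - W y * g * v y =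
          t * ((W y * v y - t⁻¹ * g / 2)^2) + 3/4 * t⁻¹ * g^2 := by
        field_simp; ring
      have : 0 ≤ t * ((W y * v y - t⁻¹ * g / 2)^2) + 3/4 * t⁻¹ * g^2 := by positivity
      linarith
    rw [esum_add, esum_mul, esum_mul, esum_const] at c1
    have c2 : 4 * d * esum d (9*n) (fun y e => (W y : ℝ) * |grd (Sinf ω) v y e| * v y) ≤
        4 * d * (t * (2 * d * ((K+1) * (2*n) * N)) + t⁻¹ * Γ) := by
      refine mul_le_mul_of_nonneg_left (c1.trans ?_) (by positivity)
      refine add_le_add ?_ le_rfl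
      gcongr
    have c3 : 4 * d * (t * (2 * d * ((K+1) * (2*n) * N)) + t⁻¹ * Γ) =
        N / 2 + 128 * d^3 * (K+1) * n * Γ := by
      rw [ht]; field_simp; ring
    have := s2.trans (c2.trans c3.le)
    linarith
  have s5 : ∑ x ∈ box d (2*n), (v x)^2 ≤ (A.card : ℝ)^(1/(d:ℝ)) * N := by
    have c1 : ∑ x ∈ box d (2*n), (v x)^2 = ∑ x ∈ box d (2*n), (if x ∈ A then (1:ℝ) else 0) * (v x)^2 := by
      refine Finset.sum_congr rfl fun x _ => ?_
      by_cases hx : x ∈ A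
      · simp [hx]
      · have : v x = 0 := by by_contra h; exact hx (hA x h)
        simp [this]
    rw [c1]
    refine (Real.inner_le_Lp_mul_Lq_of_nonneg _ hpq (fun x _ => by split_ifs <;> simp)
      (fun x _ => by positivity)).trans ?_
    refine mul_le_mul_of_nonneg_right ?_ hN0
    refine Real.rpow_le_rpow (Finset.sum_nonneg fun x _ => by positivity) ?_ (by positivity)
    calc ∑ x ∈ box d (2*n), (if x ∈ A then (1:ℝ) else 0)^(d:ℝ) =
          ∑ x ∈ box d (2*n), (if x ∈ A then (1:ℝ) else 0) := by
          refine Finset.sum_congr rfl fun x _ => ?_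
          split_ifs
          · simp
          · rw [Real.zero_rpow hdne]
      _ = (((box d (2*n)).filter (· ∈ A)).card : ℝ) := by rw [Finset.sum_boole]
      _ ≤ A.card := by
          exact_mod_cast Finset.card_le_card fun x hx => (Finset.mem_filter.1 hx).2
  have hs50 : 0 ≤ ∑ x ∈ box d (2*n), (v x)^2 := Finset.sum_nonneg fun x _ => by positivity
  calc (∑ x ∈ box d (2*n), (v x)^2)^d ≤ ((A.card : ℝ)^(1/(d:ℝ)) * N)^d := by gcongr
    _ = (A.card:ℝ) * N^d := by
        rw [mul_pow, ← Real.rpow_natCast ((A.card : ℝ)^(1/(d:ℝ))), ← Real.rpow_mul (by positivity),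
          one_div_mul_cancel hdne, Real.rpow_one]
    _ ≤ _ := by gcongr

end Perco

namespace Perco
variable {d : ℕ}
variable {ω : Config d} {rho W : Pt d → ℕ} {K n0 : ℕ}

lemma esum_eq_tsum (M : ℕ) (g : Pt d → Dir d → ℝ) (h : ∀ x e, g x e ≠ 0 → nrm x ≤ M) :
    esum d M g = ∑' p : Pt d × Dir d, g p.1 p.2 := by
  unfold esum
  rw [← Finset.sum_product', tsum_eq_sum]
  intro p hp
  by_contra h0
  exact hp (by simpa [mem_box] using h _ _ h0)

lemma esum_swap_eq (M : ℕ) (g : Pt d → Dir d → ℝ)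
    (h : ∀ x e, g x e ≠ 0 → nrm x ≤ M ∧ nrm (x + dir e) ≤ M) :
    esum d M g = esum d M (fun x e => g (x + dir e) (opp e)) := by
  have hinv : ∀ p : Pt d × Dir d, (p.1 + dir p.2 + dir (opp p.2), opp (opp p.2)) = p := fun p => by
    simp [dir_opp, opp_opp]
  set φ : Pt d × Dir d ≃ Pt d × Dir d :=
    ⟨fun p => (p.1 + dir p.2, opp p.2), fun p => (p.1 + dir p.2, opp p.2), hinv, hinv⟩ with hφ
  rw [esum_eq_tsum M g fun x e h0 => (h x e h0).1, esum_eq_tsum M _ fun x e h0 => ?_]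
  · exact (φ.tsum_eq (fun p => g p.1 p.2)).symm
  · have := (h _ _ h0).2
    rwa [show x + dir e + dir (opp e) = x by rw [dir_opp]; abel] at this

lemma sum_by_parts (I : Set (Pt d)) (v Φ : Pt d → ℝ) (M : ℕ) (hv : ∀ x, M ≤ nrm x → v x = 0)
    (hvI : ∀ x, x ∉ I → v x = 0)
    (hΦ : ∀ x ∈ I, ∑ e, grd I Φ x e = 0) :
    esum d M (fun x e => grd I v x e * grd I Φ x e) = 0 := by
  have h0 : esum d M (fun x e => v x * grd I Φ x e) = 0 := by
    unfold esum
    refine Finset.sum_eq_zero fun x _ => ?_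
    rw [← Finset.mul_sum]
    by_cases hx : x ∈ I
    · rw [hΦ x hx, mul_zero]
    · rw [hvI x hx, zero_mul]
  have h1 : esum d M (fun x e => v (x + dir e) * grd I Φ x e) = 0 := by
    rw [esum_swap_eq]
    · have : (fun x e => v (x + dir e + dir (opp e)) * grd I Φ (x + dir e) (opp e)) =
          fun (x : Pt d) (e : Dir d) => (-1) * (v x * grd I Φ x e) := by
        funext x e
        rw [show x + dir e + dir (opp e) = x by rw [dir_opp]; abel, grd_swap]; ring
      rw [this, esum_mul, h0, mul_zero]
    · intro x e hne
      have a1 : nrm (x + dir e) < M := by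
        by_contra hc
        exact hne (by rw [hv _ (not_lt.1 hc), zero_mul])
      refine ⟨?_, a1.le⟩
      have := nrm_sub (x + dir e) (dir e)
      rw [add_sub_cancel_right, nrm_dir] at this
      omega
  have h2 : (fun x e => grd I v x e * grd I Φ x e) =
      fun (x : Pt d) (e : Dir d) => v (x + dir e) * grd I Φ x e + (-1) * (v x * grd I Φ x e) := by
    funext x e
    unfold grd
    split_ifs <;> ring
  rw [h2, esum_add, esum_mul, h0, h1]; simp

open scoped Classical in
/-- truncated function -/
noncomputable def trunc (I : Set (Pt d)) (χ : Pt d → ℝ) (n : ℕ) (s k : ℝ) (x : Pt d) : ℝ :=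
  if x ∈ I ∧ nrm x ≤ 2*n then max (χ x - s * ((nrm x - n : ℕ):ℝ) - k) 0 else 0

open scoped Classical in
noncomputable def levelS (I : Set (Pt d)) (χ : Pt d → ℝ) (n : ℕ) (s k : ℝ) : Finset (Pt d) :=
  (box d (2*n)).filter fun x => x ∈ I ∧ k < χ x - s * ((nrm x - n : ℕ):ℝ)

lemma trunc_ne {I : Set (Pt d)} {χ : Pt d → ℝ} {n : ℕ} {s k : ℝ} {x : Pt d}
    (h : trunc I χ n s k x ≠ 0) : x ∈ levelS I χ n s k := by
  classical
  unfold trunc at h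
  unfold levelS
  split_ifs at h with h1
  · rw [Finset.mem_filter, mem_box]
    refine ⟨h1.2, h1.1, ?_⟩
    by_contra hc
    exact h (max_eq_right (by linarith))
  · exact absurd rfl h

lemma caccio_aux1 (a b : ℝ) : (max b 0 - max a 0)^2 ≤ (max b 0 - max a 0) * (b - a) := by
  rcases le_total a 0 with h1 | h1 <;> rcases le_total b 0 with h2 | h2 <;>
    simp only [max_eq_left, max_eq_right, h1, h2] <;> nlinarith

lemma caccio_aux2 {g q P L t : ℝ} (f1 : g^2 ≤ g * (P - q)) (f2 : |q| ≤ L) (ht : 1 ≤ t) :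
    g^2 ≤ g * P + ((1/2) * g^2 + (L^2/2) * t) := by
  have f4 : -(g * q) ≤ 1/2 * g^2 + L^2/2 := by
    have : q^2 ≤ L^2 := sq_le_sq' (by linarith [neg_abs_le q]) (by linarith [le_abs_self q])
    nlinarith [sq_nonneg (g + q)]
  have f5 : L^2/2 ≤ L^2/2 * t := le_mul_of_one_le_right (by positivity) ht
  have : g * (P - q) = g * P - g * q := by ring
  linarith

lemma caccio (I : Set (Pt d)) (χ l : Pt d → ℝ) (n : ℕ) (hn1 : 1 ≤ n) (R k : ℝ) (hR : 0 ≤ R)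
    (hk : 0 ≤ k) (hχR : ∀ x ∈ I, nrm x ≤ 2*n → χ x ≤ R)
    (hl : ∀ x e, |l (x + dir e) - l x| ≤ 1)
    (hharm : ∀ x ∈ I, ∑ e, grd I (fun y => χ y + l y) x e = 0) :
    esum d (9*n) (fun x e => (grd I (trunc I χ n (R/n) k) x e)^2) ≤
      4 * d * (1 + R/n)^2 * (levelS I χ n (R/n) k).card := by
  classical
  have hnr : (1:ℝ) ≤ n := by exact_mod_cast hn1
  set s := R/n with hs
  have hs0 : 0 ≤ s := by positivity
  have hsn : s * n = R := by rw [hs]; field_simp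
  set v := trunc I χ n s k with hv
  set A := levelS I χ n s k with hA
  set Λ := 1 + s with hΛ
  have hvz : ∀ x, 2*n ≤ nrm x → v x = 0 := by
    intro x hx
    simp only [hv, trunc]
    split_ifs with h
    · have h2 : nrm x = 2*n := le_antisymm h.2 hx
      have h3 : nrm x - n = n := by omega
      rw [h3, hsn]
      have := hχR x h.1 h.2
      exact max_eq_right (by linarith)
    · rfl
  have hvI : ∀ x, x ∉ I → v x = 0 := fun x hx => by simp [hv, trunc, hx]
  have hpos : ∀ x ∈ I, nrm x ≤ 2*n → v x = max (χ x - s * ((nrm x - n : ℕ):ℝ) - k) 0 :=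
    fun x hx hx2 => by simp [hv, trunc, hx, hx2]
  have hsbp := sum_by_parts I v (fun y => χ y + l y) (9*n) (fun x hx => hvz x (by omega)) hvI hharm
  set ind : Pt d → ℝ := fun x => if x ∈ A then 1 else 0 with hind
  have hind0 : ∀ x, 0 ≤ ind x := fun x => by simp only [hind]; split_ifs <;> simp
  have hpt : ∀ (x : Pt d) (e : Dir d), (grd I v x e)^2 ≤
      grd I v x e * grd I (fun y => χ y + l y) x e + ((1/2) * (grd I v x e)^2 +
        (Λ^2/2) * (ind x + ind (x + dir e))) := by
    intro x e
    have hR0 : 0 ≤ (Λ^2/2) * (ind x + ind (x + dir e)) :=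
      mul_nonneg (by positivity) (add_nonneg (hind0 _) (hind0 _))
    by_cases hxI : x ∈ I ∧ x + dir e ∈ I
    swap
    · simp only [grd, if_neg hxI]; simpa using hR0
    by_cases hz : v x = 0 ∧ v (x + dir e) = 0
    · have : grd I v x e = 0 := by simp [grd, hz]
      rw [this]; simpa using hR0
    have n1 : nrm (x + dir e) ≤ nrm x + 1 := by
      have := nrm_add x (dir e); rwa [nrm_dir] at this
    have n2 : nrm x ≤ nrm (x + dir e) + 1 := by
      have := nrm_sub (x + dir e) (dir e)
      rwa [add_sub_cancel_right, nrm_dir] at this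
    have hb : nrm x ≤ 2*n ∧ nrm (x + dir e) ≤ 2*n := by
      by_contra hc
      apply hz
      constructor <;> apply hvz <;> omega
    have hi1 : 1 ≤ ind x + ind (x + dir e) := by
      by_cases h0 : v x = 0
      · have h00 : v (x + dir e) ≠ 0 := fun h => hz ⟨h0, h⟩
        have : ind (x + dir e) = 1 := if_pos (trunc_ne h00)
        linarith [hind0 x]
      · have : ind x = 1 := if_pos (trunc_ne h0)
        linarith [hind0 (x + dir e)]
    have e1 : grd I v x e = v (x + dir e) - v x := by simp [grd, hxI]
    have e2 : grd I (fun y => χ y + l y) x e = χ (x + dir e) + l (x + dir e) - (χ x + l x) := by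
      simp [grd, hxI]
    have e3 : |(((nrm (x + dir e) - n : ℕ)):ℝ) - ((nrm x - n : ℕ):ℝ)| ≤ 1 := by
      have m1 : ((nrm (x + dir e) - n : ℕ):ℝ) ≤ ((nrm x - n : ℕ):ℝ) + 1 := by
        exact_mod_cast (by omega : nrm (x + dir e) - n ≤ nrm x - n + 1)
      have m2 : ((nrm x - n : ℕ):ℝ) ≤ ((nrm (x + dir e) - n : ℕ):ℝ) + 1 := by
        exact_mod_cast (by omega : nrm x - n ≤ nrm (x + dir e) - n + 1)
      rw [abs_le]; constructor <;> linarith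
    rw [e1, e2, hpos x hxI.1 hb.1, hpos _ hxI.2 hb.2]
    set θ1 := ((nrm x - n : ℕ):ℝ)
    set θ2 := ((nrm (x + dir e) - n : ℕ):ℝ)
    set a := χ x - s * θ1 - k with ha
    set b := χ (x + dir e) - s * θ2 - k with hb'
    have f1 := caccio_aux1 a b
    have hle := hl x e
    set q := (l (x + dir e) - l x) + s * (θ2 - θ1) with hq
    have f2 : |q| ≤ Λ := by
      refine (abs_add_le _ _).trans ?_
      rw [abs_mul, abs_of_nonneg hs0, hΛ]
      have := mul_le_mul_of_nonneg_left e3 hs0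
      linarith
    have f3 : (b - a) = (χ (x + dir e) + l (x + dir e) - (χ x + l x)) - q := by
      rw [ha, hb', hq]; ring
    rw [f3] at f1
    exact caccio_aux2 f1 f2 hi1
  have hsum := esum_mono (d := d) (n := 9*n) fun x _ e => hpt x e
  rw [esum_add, esum_add, esum_mul, esum_mul, esum_add, hsbp] at hsum
  have hcard : ∀ m, ∑ x ∈ box d m, ind x ≤ A.card := by
    intro m
    simp only [hind]
    rw [Finset.sum_boole]
    exact_mod_cast Finset.card_le_card fun x hx => (Finset.mem_filter.1 hx).2
  have i1 : esum d (9*n) (fun x _ => ind x) ≤ 2 * d * A.card := by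
    rw [esum_const]; exact mul_le_mul_of_nonneg_left (hcard _) (by positivity)
  have i2 : esum d (9*n) (fun x e => ind (x + dir e)) ≤ 2 * d * A.card := by
    refine (esum_swap_le fun x e => hind0 _).trans ?_
    have : (fun (x : Pt d) (e : Dir d) => ind (x + dir e + dir (opp e))) = fun x _ => ind x := by
      funext x e; rw [show x + dir e + dir (opp e) = x by rw [dir_opp]; abel]
    rw [this, esum_const]; exact mul_le_mul_of_nonneg_left (hcard _) (by positivity)
  have i3 := mul_le_mul_of_nonneg_left (add_le_add i1 i2) (by positivity : 0 ≤ Λ^2/2)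
  nlinarith

end Perco

namespace Perco
variable {d : ℕ}
variable {ω : Config d} {rho W : Pt d → ℕ} {K n0 : ℕ}

lemma stamp_step (hd : 2 ≤ d) (hg : GoodGeom ω rho W K n0) (n : ℕ) (hn : n0 ≤ n) (hn1 : 1 ≤ n)
    (χ l : Pt d → ℝ) (R k k' : ℝ) (hR : 0 ≤ R)
    (hk : 0 ≤ k) (hkk : k ≤ k') (hχR : ∀ x ∈ Sinf ω, nrm x ≤ 2*n → χ x ≤ R)
    (hl : ∀ x e, |l (x + dir e) - l x| ≤ 1)
    (hharm : ∀ x ∈ Sinf ω, ∑ e, grd (Sinf ω) (fun y => χ y + l y) x e = 0) :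
    ((k' - k)^2 * (levelS (Sinf ω) χ n (R/n) k').card)^d ≤
      (levelS (Sinf ω) χ n (R/n) k).card *
        ((1024 * d^4 * (K+1)) * n * (1 + R/n)^2 * (levelS (Sinf ω) χ n (R/n) k).card)^d := by
  classical
  set v := trunc (Sinf ω) χ n (R/n) k with hv
  have h1 := cluster_sobolev hd hg n hn hn1 v
    (fun x => by simp only [hv, trunc]; split_ifs <;> simp)
    (fun x hx => by simp [hv, trunc, hx])
    (fun x hx => by simp [hv, trunc, not_le.2 hx]) (levelS (Sinf ω) χ n (R/n) k)
    (fun x hx => trunc_ne hx)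
  have h2 := caccio (Sinf ω) χ l n hn1 R k hR hk hχR hl hharm
  have h3 : (k' - k)^2 * (levelS (Sinf ω) χ n (R/n) k').card ≤ ∑ x ∈ box d (2*n), (v x)^2 := by
    have hsub : levelS (Sinf ω) χ n (R/n) k' ⊆ box d (2*n) := Finset.filter_subset _ _
    refine le_trans ?_ (Finset.sum_le_sum_of_subset_of_nonneg hsub fun x _ _ => by positivity)
    rw [mul_comm, ← nsmul_eq_mul]
    refine Finset.card_nsmul_le_sum _ _ _ fun x hx => ?_
    simp only [levelS, Finset.mem_filter, mem_box] at hx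
    have : v x = max (χ x - R/n * ((nrm x - n : ℕ):ℝ) - k) 0 := by simp [hv, trunc, hx.1, hx.2.1]
    have h4 : k' - k ≤ v x := by
      rw [this]; exact le_max_of_le_left (by linarith [hx.2.2])
    exact pow_le_pow_left₀ (by linarith) h4 2
  have h5 : 0 ≤ (k' - k)^2 * ((levelS (Sinf ω) χ n (R/n) k').card : ℝ) := by positivity
  refine (pow_le_pow_left₀ h5 h3 d).trans (h1.trans ?_)
  refine mul_le_mul_of_nonneg_left (pow_le_pow_left₀ ?_ ?_ d) (by positivity)
  · exact mul_nonneg (by positivity) (esum_nonneg fun _ _ => by positivity)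
  · calc _ ≤ 256 * (d:ℝ)^3 * (K+1) * n * (4 * d * (1 + R/n)^2 * (levelS (Sinf ω) χ n (R/n) k).card) := by
          gcongr
      _ = _ := by ring

lemma stamp_iter (hd : 1 ≤ d) (a : ℕ → ℝ) (ha : ∀ j, 0 ≤ a j) (B : ℝ) (hB : 0 ≤ B)
    (h : ∀ j, (a (j+1))^d ≤ (4^(j+1) * B)^d * (a j)^(d+1))
    (h0 : 4^d * B^d * a 0 ≤ ((1/4:ℝ)^d)^d) : ∀ j, a j ≤ a 0 * ((1/4:ℝ)^d)^j := by
  intro j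
  induction j with
  | zero => simp
  | succ j ih =>
    have hq : (0:ℝ) ≤ (1/4:ℝ)^d := by positivity
    refine le_of_pow_le_pow_left₀ (by omega : d ≠ 0) (mul_nonneg (ha 0) (by positivity)) ?_
    have ha0 := ha 0
    calc (a (j+1))^d ≤ (4^(j+1) * B)^d * (a j)^(d+1) := h j
      _ ≤ (4^(j+1) * B)^d * (a 0 * ((1/4:ℝ)^d)^j)^(d+1) := by
          gcongr
          exact ha j
      _ = (4^d * B^d * a 0) * ((a 0)^d * (((1/4:ℝ)^d)^j)^d) * (4^(j*d) * (1/4:ℝ)^(j*d)) := by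
          have f1 : ((4:ℝ)^(j+1))^d = 4^d * 4^(j*d) := by rw [← pow_mul, ← pow_add]; congr 1; ring
          have f2 : ((1/4:ℝ)^d)^j = (1/4)^(j*d) := by rw [← pow_mul, mul_comm]
          rw [pow_succ (a 0 * _) d, mul_pow (a 0), mul_pow _ B, f1, f2]
          ring
      _ = (4^d * B^d * a 0) * ((a 0)^d * (((1/4:ℝ)^d)^j)^d) := by
          have : (4:ℝ)^(j*d) * (1/4)^(j*d) = 1 := by rw [← mul_pow]; norm_num
          rw [this, mul_one]
      _ ≤ ((1/4:ℝ)^d)^d * ((a 0)^d * (((1/4:ℝ)^d)^j)^d) := by gcongr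
      _ = _ := by rw [mul_pow, pow_succ _ j, mul_pow]; ring

lemma sup_step (hd : 2 ≤ d) (hg : GoodGeom ω rho W K n0) (χ l : Pt d → ℝ)
    (hχ : ApproxP (Sinf ω) χ) (hl : ∀ x e, |l (x + dir e) - l x| ≤ 1)
    (hharm : ∀ x ∈ Sinf ω, ∑ e, grd (Sinf ω) (fun y => χ y + l y) x e = 0) (δ : ℝ) (hδ : 0 < δ) :
    ∃ n1, ∀ n, n1 ≤ n → ∀ R, 0 ≤ R → (∀ x ∈ Sinf ω, nrm x ≤ 2*n → χ x ≤ R) →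
      ∀ x ∈ Sinf ω, nrm x ≤ n → χ x ≤ 2 * δ * (n + R) := by
  classical
  obtain ⟨π, h1, h2, h3⟩ := exists_nearest hg.nonempty
  set C : ℝ := 1024 * d^4 * (K+1) with hC
  have hd0 : (0:ℝ) < d := by exact_mod_cast (by omega : 0 < d)
  have hC0 : 0 < C := by positivity
  set ε : ℝ := ((1/4:ℝ)^d)^d * δ / (2^(d+1) * (4^d * (C/δ^2)^d)) with hε
  have hε0 : 0 < ε := by positivity
  obtain ⟨n1, hn1⟩ := l1_sublinear hd hg π h1 h2 χ hχ ε hε0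
  refine ⟨max (max n1 n0) 1, fun n hn R hR hχR x hx hxn => ?_⟩
  have hnr : (1:ℝ) ≤ n := by exact_mod_cast (by omega : 1 ≤ n)
  by_contra hcon
  rw [not_le] at hcon
  set h : ℝ := δ * (n + R) with hh
  have hhpos : 0 < h := by positivity
  set kk : ℕ → ℝ := fun j => h + h * (1 - (1/2)^j) with hkk
  set a : ℕ → ℝ := fun j => ((levelS (Sinf ω) χ n (R/n) (kk j)).card : ℝ) with ha
  have hkdiff : ∀ j, kk (j+1) - kk j = h * (1/2)^(j+1) := by
    intro j; simp only [hkk, pow_succ]; ring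
  have hp1 : ∀ j : ℕ, (1/2:ℝ)^j ≤ 1 := fun j => pow_le_one₀ (by norm_num) (by norm_num)
  have hk0 : ∀ j, 0 ≤ kk j := by
    intro j
    have := hp1 j
    simp only [hkk]
    have : 0 ≤ h * (1 - (1/2)^j) := mul_nonneg hhpos.le (by linarith)
    linarith
  have hstep : ∀ j, (a (j+1))^d ≤ (4^(j+1) * (C/(δ^2*n)))^d * (a j)^(d+1) := by
    intro j
    have hs := stamp_step hd hg n (by omega) (by omega) χ l R (kk j) (kk (j+1)) hR (hk0 j)
      (by have := hkdiff j
          have : 0 < h * (1/2)^(j+1) := by positivity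
          linarith) hχR hl hharm
    rw [hkdiff] at hs
    have hΛ : 1 + R/n = (n+R)/n := by field_simp
    set Q : ℝ := C * n * (1 + R/n)^2 with hQ
    set D : ℝ := (h * (1/2)^(j+1))^2 with hD
    have hD0 : 0 < D := by positivity
    have e1 : Q = (4^(j+1) * (C/(δ^2*n))) * D := by
      rw [hQ, hD, hΛ, hh]
      have : ((1/2:ℝ)^(j+1))^2 = 1/4^(j+1) := by
        rw [← pow_mul, mul_comm, pow_mul, ← one_div_pow]
        norm_num
      rw [mul_pow, this]
      field_simp
    have e2 : (D * a (j+1))^d ≤ a j * (Q * a j)^d := hs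
    rw [e1] at e2
    have e3 : D^d * (a (j+1))^d ≤ D^d * ((4^(j+1) * (C/(δ^2*n)))^d * (a j)^(d+1)) := by
      calc D^d * (a (j+1))^d = (D * a (j+1))^d := by rw [mul_pow]
        _ ≤ _ := e2
        _ = _ := by simp only [mul_pow, pow_succ]; ring
    exact le_of_mul_le_mul_left e3 (by positivity)
  have ha0 : a 0 ≤ ε * 2^(d+1) * (n:ℝ)^d / δ := by
    have hl1 := hn1 (2*n) (by omega)
    have : a 0 * (δ * n) ≤ ∑ x ∈ box d (2*n), |χ (π x)| := by
      have hsub : levelS (Sinf ω) χ n (R/n) (kk 0) ⊆ box d (2*n) := Finset.filter_subset _ _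
      refine le_trans ?_ (Finset.sum_le_sum_of_subset_of_nonneg hsub fun x _ _ => by positivity)
      simp only [ha]
      rw [← nsmul_eq_mul]
      refine Finset.card_nsmul_le_sum _ _ _ fun y hy => ?_
      simp only [levelS, Finset.mem_filter, mem_box] at hy
      rw [h3 y hy.2.1]
      refine le_trans ?_ (le_abs_self _)
      have q1 := hy.2.2
      have q2 : 0 ≤ R/n * ((nrm y - n : ℕ):ℝ) := by positivity
      have q3 : kk 0 = h := by simp [hkk]
      have q4 : δ * n ≤ h := by rw [hh]; gcongr; linarith
      linarith
    rw [le_div_iff₀ hδ]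
    have h5 : a 0 * δ * n ≤ ε * 2^(d+1) * (n:ℝ)^d * n := by
      calc a 0 * δ * n = a 0 * (δ * n) := by ring
        _ ≤ _ := this.trans hl1
        _ = _ := by push_cast; rw [mul_pow, pow_succ (n:ℝ)]; ring
    exact le_of_mul_le_mul_right h5 (by linarith)
  have hit := stamp_iter (by omega : 1 ≤ d) a (fun j => by simp only [ha]; positivity)
    (C/(δ^2*n)) (by positivity) hstep (by
      calc 4^d * (C/(δ^2*n))^d * a 0 ≤ 4^d * (C/(δ^2*n))^d * (ε * 2^(d+1) * (n:ℝ)^d / δ) := by gcongr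
        _ = ((1/4:ℝ)^d)^d := by
            have : (C/(δ^2*n))^d = (C/δ^2)^d / (n:ℝ)^d := by rw [← div_pow, div_div]
            rw [this, hε]
            field_simp
        _ ≤ _ := le_rfl)
  have hge : ∀ j, 1 ≤ a j := by
    intro j
    simp only [ha]
    have : x ∈ levelS (Sinf ω) χ n (R/n) (kk j) := by
      simp only [levelS, Finset.mem_filter, mem_box]
      refine ⟨by omega, hx, ?_⟩
      rw [show nrm x - n = 0 by omega]
      have : kk j ≤ 2 * h := by
        have : 0 ≤ h * (1/2)^j := by positivity
        simp only [hkk]; linarith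
      have : 2 * δ * (n + R) = 2 * h := by rw [hh]; ring
      push_cast
      linarith
    exact_mod_cast Finset.card_pos.2 ⟨x, this⟩
  have hlim : Tendsto (fun j => a 0 * ((1/4:ℝ)^d)^j) atTop (nhds (a 0 * 0)) := by
    refine Tendsto.const_mul _ (tendsto_pow_atTop_nhds_zero_of_lt_one (by positivity) ?_)
    exact pow_lt_one₀ (by norm_num) (by norm_num) (by omega)
  have := ge_of_tendsto' hlim fun j => (hge j).trans (hit j)
  linarith

lemma grd_neg (I : Set (Pt d)) (f : Pt d → ℝ) (x : Pt d) (e : Dir d) :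
    grd I (fun y => - f y) x e = - grd I f x e := by
  unfold grd; split_ifs <;> ring

lemma ApproxP.neg {I : Set (Pt d)} {χ : Pt d → ℝ} (h : ApproxP I χ) : ApproxP I (fun y => - χ y) := by
  intro ε hε
  obtain ⟨ψ, B, h1, h2⟩ := h ε hε
  refine ⟨fun y => - ψ y, B, fun x => by rw [abs_neg]; exact h1 x, fun n hn => ?_⟩
  have : (fun y => - χ y - - ψ y) = fun y => - (χ y - ψ y) := by funext y; ring
  rw [this]
  simp only [grd_neg, neg_sq]
  exact h2 n hn

lemma apriori (hd : 2 ≤ d) (hg : GoodGeom ω rho W K n0) (χ : Pt d → ℝ)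
    (hχ : ApproxP (Sinf ω) χ) (h0 : (0 : Pt d) ∈ Sinf ω) (hχ0 : χ 0 = 0) :
    ∃ C : ℝ, 0 ≤ C ∧ ∀ n : ℕ, n0 ≤ n → 1 ≤ n → ∀ x ∈ Sinf ω, nrm x ≤ n → |χ x| ≤ C * (n:ℝ)^(d+1) := by
  classical
  obtain ⟨ψ, B, hB, hψ⟩ := hχ 1 one_pos
  have hB0 : 0 ≤ B := (abs_nonneg _).trans (hB 0)
  refine ⟨2^d + 2*d*((1 + 2*B) * 5^d), by positivity, fun n hn hn1 x hx hxn => ?_⟩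
  have hnr : (1:ℝ) ≤ n := by exact_mod_cast hn1
  have hc := hg.big n hn 0 h0 x hx (by rw [nrm_zero]; omega) hxn
  set T : Finset (Pt d) := (box d (2*n)).filter (· ∈ Sinf ω) with hT
  have hTset : (T : Set (Pt d)) = Sinf ω ∩ ballZ 0 (2*n) := by
    ext y
    simp [hT, mem_box, mem_ballZ, and_comm]
  rw [← hTset] at hc
  have hp := path_ineq χ T _ _ hc
  rw [hχ0, sub_zero] at hp
  have h1 : gradSum T χ ≤ esum d (2*n) (fun x e =>
      (grd (Sinf ω) (fun y => χ y - ψ y) x e)^2 + (1 + 2 * B)) := by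
    unfold gradSum esum
    have hnn : ∀ (x : Pt d) (e : Dir d), 0 ≤ (grd (Sinf ω) (fun y => χ y - ψ y) x e)^2 + (1 + 2 * B) :=
      fun x e => by positivity
    refine le_trans ?_ (Finset.sum_le_sum_of_subset_of_nonneg (Finset.filter_subset _ _ : T ⊆ _)
      fun y _ _ => Finset.sum_nonneg fun e _ => hnn y e)
    refine Finset.sum_le_sum fun y hy => Finset.sum_le_sum fun e _ => ?_
    split_ifs with hye
    · have a1 : y ∈ Sinf ω := (Finset.mem_filter.1 hy).2
      have a2 : y + dir e ∈ Sinf ω := (Finset.mem_filter.1 hye).2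
      have a3 : grd (Sinf ω) (fun y => χ y - ψ y) y e =
        χ (y + dir e) - ψ (y + dir e) - (χ y - ψ y) := by simp [grd, a1, a2]
      show _ ≤ (grd (Sinf ω) (fun y => χ y - ψ y) y e)^2 + (1 + 2 * B)
      rw [a3]
      have b1 := abs_le.1 (hB y)
      have b2 := abs_le.1 (hB (y + dir e))
      set t := χ (y + dir e) - ψ (y + dir e) - (χ y - ψ y) with ht
      have : χ (y + dir e) - χ y = t + (ψ (y + dir e) - ψ y) := by rw [ht]; ring
      rw [this, abs_le]
      constructor <;> nlinarith [sq_nonneg (t - 1), sq_nonneg (t+1)]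
    · exact hnn y e
  rw [esum_add, esum_const, Finset.sum_const, card_box, nsmul_eq_mul] at h1
  have h2 := hψ (2*n) (by omega)
  calc |χ x| ≤ _ := hp.trans h1
    _ ≤ 1 * ((2*n : ℕ):ℝ)^d + 2 * d * ((5 * (n:ℝ))^d * (1 + 2*B)) := by
        push_cast at h2 ⊢
        gcongr
        linarith
    _ = (2^d + 2*d*((1 + 2*B) * 5^d)) * (n:ℝ)^d := by push_cast; simp only [mul_pow]; ring
    _ ≤ _ := by
        gcongr
        omega

theorem sup_sublinear (hd : 2 ≤ d) (hg : GoodGeom ω rho W K n0) (χ l : Pt d → ℝ)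
    (hχ : ApproxP (Sinf ω) χ) (hl : ∀ x e, |l (x + dir e) - l x| ≤ 1)
    (hharm : ∀ x ∈ Sinf ω, ∑ e, grd (Sinf ω) (fun y => χ y + l y) x e = 0)
    (h0 : (0 : Pt d) ∈ Sinf ω) (hχ0 : χ 0 = 0) (ε : ℝ) (hε : 0 < ε) :
    ∃ n1, ∀ n, n1 ≤ n → ∀ x ∈ Sinf ω, nrm x ≤ n → |χ x| ≤ ε * n := by
  set δ : ℝ := min (min (ε/4) (1/8)) (1/2^(d+3)) with hδ
  have hδ0 : 0 < δ := by rw [hδ]; positivity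
  have hδ1 : δ ≤ ε/4 := (min_le_left _ _).trans (min_le_left _ _)
  have hδ2 : δ ≤ 1/8 := (min_le_left _ _).trans (min_le_right _ _)
  have hδ3 : δ ≤ 1/2^(d+3) := min_le_right _ _
  obtain ⟨n1, hn1⟩ := sup_step hd hg χ l hχ hl hharm δ hδ0
  obtain ⟨n2, hn2⟩ := sup_step hd hg (fun y => - χ y) (fun y => - l y) hχ.neg
    (fun x e => by rw [show - l (x + dir e) - - l x = -(l (x + dir e) - l x) by ring, abs_neg]; exact hl x e)
    (fun x hx => by
      have : (fun y => - χ y + - l y) = fun y => - (χ y + l y) := by funext y; ring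
      rw [this]
      simp only [grd_neg, Finset.sum_neg_distrib, hharm x hx, neg_zero]) δ hδ0
  obtain ⟨C, hC, hap⟩ := apriori hd hg χ hχ h0 hχ0
  have key : ∀ j n : ℕ, max (max n1 n2) (max n0 1) ≤ n → ∀ x ∈ Sinf ω, nrm x ≤ n →
      |χ x| ≤ 4 * δ * n + C * (n:ℝ)^(d+1) * (1/2)^j := by
    intro j
    induction j with
    | zero =>
      intro n hn x hx hxn
      have := hap n (by omega) (by omega) x hx hxn
      have : 0 ≤ 4 * δ * n := by positivity
      simp; linarith
    | succ j ih =>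
      intro n hn x hx hxn
      set R : ℝ := 4 * δ * ((2*n : ℕ):ℝ) + C * ((2*n : ℕ):ℝ)^(d+1) * (1/2)^j with hR
      have hR0 : 0 ≤ R := by positivity
      have i1 := hn1 n (by omega) R hR0
        (fun y hy hyn => (le_abs_self _).trans (ih (2*n) (by omega) y hy hyn)) x hx hxn
      have i2 := hn2 n (by omega) R hR0
        (fun y hy hyn => (neg_le_abs _).trans (ih (2*n) (by omega) y hy hyn)) x hx hxn
      have i3 : 2 * δ * (n + R) ≤ 4 * δ * n + C * (n:ℝ)^(d+1) * (1/2)^(j+1) := by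
        have e1 : 2 * δ * R = 16 * δ * δ * n + (2 * δ * 2^(d+1)) * (C * (n:ℝ)^(d+1) * (1/2)^j) := by
          rw [hR]; push_cast; rw [mul_pow]; ring
        have e2 : 2 * δ * 2^(d+1) ≤ 1/2 := by
          calc 2 * δ * 2^(d+1) ≤ 2 * (1/2^(d+3)) * 2^(d+1) := by gcongr
            _ = 1/2 := by rw [pow_add, pow_add]; field_simp
        have e3 := mul_le_mul_of_nonneg_right e2 (by positivity : 0 ≤ C * (n:ℝ)^(d+1) * (1/2)^j)
        have e4 : 16 * δ * δ * n ≤ 2 * δ * n := by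
          have : 16 * δ * δ ≤ 2 * δ := by nlinarith
          gcongr
        have e5 : C * (n:ℝ)^(d+1) * (1/2)^(j+1) = 1/2 * (C * (n:ℝ)^(d+1) * (1/2)^j) := by
          rw [pow_succ (1/2:ℝ)]; ring
        rw [mul_add, e1, e5]
        linarith
      rw [abs_le]
      constructor <;> linarith
  refine ⟨max (max n1 n2) (max n0 1), fun n hn x hx hxn => ?_⟩
  have hlim : Tendsto (fun j : ℕ => 4 * δ * n + C * (n:ℝ)^(d+1) * (1/2:ℝ)^j) atTop
      (nhds (4 * δ * n + C * (n:ℝ)^(d+1) * 0)) :=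
    Tendsto.const_add _ (Tendsto.const_mul _
      (tendsto_pow_atTop_nhds_zero_of_lt_one (by norm_num) (by norm_num)))
  have h1 := ge_of_tendsto' hlim fun j => key j n hn x hx hxn
  have : 4 * δ * n ≤ ε * n := by gcongr; linarith
  linarith

end Perco

namespace Perco
variable {d : ℕ}

/-- Hilbert projection at the level of functions. -/
lemma hilbert_proj {α : Type*} [MeasurableSpace α] (ν : Measure α) (V : Submodule ℝ (α → ℝ))
    (hV : ∀ v ∈ V, MemLp v 2 ν) (u : α → ℝ) (hu : MemLp u 2 ν) :
    ∃ f : α → ℝ, Measurable f ∧ MemLp f 2 ν ∧ (∀ v ∈ V, ∫ x, (u x - f x) * v x ∂ν = 0) ∧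
      ∀ ε > 0, ∃ v ∈ V, ∫ x, (f x - v x)^2 ∂ν ≤ ε := by
  classical
  let L : V →ₗ[ℝ] Lp ℝ 2 ν :=
    { toFun := fun v => (hV v.1 v.2).toLp v.1
      map_add' := fun v w => rfl
      map_smul' := fun c v => rfl }
  let K : Submodule ℝ (Lp ℝ 2 ν) := (LinearMap.range L).topologicalClosure
  have : CompleteSpace K := (Submodule.isClosed_topologicalClosure _).completeSpace_coe
  set U : Lp ℝ 2 ν := hu.toLp u with hU
  set F : Lp ℝ 2 ν := (K.orthogonalProjectionOnto U : Lp ℝ 2 ν) with hF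
  have hFm : F ∈ K := (K.orthogonalProjectionOnto U).2
  refine ⟨F, (Lp.stronglyMeasurable F).measurable, Lp.memLp F, fun v hv => ?_, fun ε hε => ?_⟩
  · have h1 : inner ℝ (L ⟨v, hv⟩) (U - F) = 0 :=
      (Submodule.sub_starProjection_mem_orthogonal (K := K) U) _
        (Submodule.le_topologicalClosure _ ⟨⟨v, hv⟩, rfl⟩)
    rw [L2.inner_def] at h1
    rw [← h1]
    refine integral_congr_ae ?_
    filter_upwards [Lp.coeFn_sub U F, hu.coeFn_toLp, (hV v hv).coeFn_toLp] with x h2 h3 h4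
    have h5 : (L ⟨v, hv⟩ : α → ℝ) x = v x := h4
    rw [h5, h2]
    simp only [Pi.sub_apply, hU, h3]
    rfl
  · have h1 : F ∈ closure (LinearMap.range L : Set (Lp ℝ 2 ν)) := hFm
    rw [Metric.mem_closure_iff] at h1
    obtain ⟨_, ⟨⟨v, hv⟩, rfl⟩, h2⟩ := h1 (Real.sqrt ε) (Real.sqrt_pos.2 hε)
    refine ⟨v, hv, ?_⟩
    have h3 : ∫ x, (F x - v x)^2 ∂ν = ‖F - L ⟨v, hv⟩‖^2 := by
      rw [← real_inner_self_eq_norm_sq, L2.inner_def]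
      refine integral_congr_ae ?_
      filter_upwards [Lp.coeFn_sub F (L ⟨v, hv⟩), (hV v hv).coeFn_toLp] with x h2 h4
      have h5 : (L ⟨v, hv⟩ : α → ℝ) x = v x := h4
      rw [h2, Pi.sub_apply, h5, real_inner_self_eq_norm_sq, Real.norm_eq_abs, sq_abs]
    rw [h3, ← dist_eq_norm]
    calc _ ≤ (Real.sqrt ε)^2 := by gcongr
      _ = ε := Real.sq_sqrt hε.le

/-- indicator that `0` and `dir e` both lie in the infinite cluster -/
noncomputable def ei (e : Dir d) : Config d → ℝ :=
  Set.indicator {ω | (0 : Pt d) ∈ Sinf ω ∧ dir e ∈ Sinf ω} (fun _ => 1)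

lemma ei_meas (e : Dir d) : Measurable (ei e) :=
  measurable_const.indicator ((measurableSet_Sinf 0).inter (measurableSet_Sinf _))

lemma ei_one {e : Dir d} {ω : Config d} (h : (0 : Pt d) ∈ Sinf ω) (h' : dir e ∈ Sinf ω) : ei e ω = 1 :=
  Set.indicator_of_mem (show ω ∈ {ω | (0 : Pt d) ∈ Sinf ω ∧ dir e ∈ Sinf ω} from ⟨h, h'⟩) _

lemma ei_zero {e : Dir d} {ω : Config d} (h : ¬ ((0 : Pt d) ∈ Sinf ω ∧ dir e ∈ Sinf ω)) : ei e ω = 0 :=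
  Set.indicator_of_notMem (show ω ∉ {ω | (0 : Pt d) ∈ Sinf ω ∧ dir e ∈ Sinf ω} from h) _

lemma ei_cases (e : Dir d) (ω : Config d) : ei e ω = 0 ∨ ei e ω = 1 := by
  by_cases h : (0 : Pt d) ∈ Sinf ω ∧ dir e ∈ Sinf ω
  · exact Or.inr (ei_one h.1 h.2)
  · exact Or.inl (ei_zero h)

lemma ei_sq (e : Dir d) (ω : Config d) : ei e ω * ei e ω = ei e ω := by
  rcases ei_cases e ω with h | h <;> simp [h]

lemma ei_nonneg (e : Dir d) (ω : Config d) : 0 ≤ ei e ω := by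
  rcases ei_cases e ω with h | h <;> simp [h]

lemma ei_abs_le (e : Dir d) (ω : Config d) : |ei e ω| ≤ 1 := by
  rcases ei_cases e ω with h | h <;> simp [h]

/-- bounded measurable functions -/
def BM (ψ : Config d → ℝ) : Prop := Measurable ψ ∧ ∃ B : ℝ, ∀ ω, |ψ ω| ≤ B

lemma integral_dir {mu : Measure (Config d)} [IsProbabilityMeasure mu] (f : Config d → Dir d → ℝ)
    (hf : ∀ e, Integrable (fun ω => f ω e) mu) (hm : Measurable (fun p : Config d × Dir d => f p.1 p.2)) :
    ∫ p, f p.1 p.2 ∂(mu.prod Measure.count) = ∫ ω, ∑ e, f ω e ∂mu := by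
  have hi : Integrable (fun p : Config d × Dir d => f p.1 p.2) (mu.prod Measure.count) := by
    rw [integrable_prod_iff hm.aestronglyMeasurable]
    refine ⟨Eventually.of_forall fun ω => Integrable.of_finite, ?_⟩
    simp only [integral_count]
    exact integrable_finsetSum _ fun e _ => (hf e).norm
  rw [integral_prod _ hi]
  simp only [integral_count]

lemma memLp_dir {mu : Measure (Config d)} [IsProbabilityMeasure mu] (f : Config d → Dir d → ℝ)
    (hm : Measurable (fun p : Config d × Dir d => f p.1 p.2)) :
    MemLp (fun p : Config d × Dir d => f p.1 p.2) 2 (mu.prod Measure.count) ↔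
      ∀ e, MemLp (fun ω => f ω e) 2 mu := by
  have hm' : ∀ e, Measurable (fun ω => f ω e) := fun e => hm.comp (measurable_id.prodMk measurable_const)
  rw [memLp_two_iff_integrable_sq hm.aestronglyMeasurable,
    integrable_prod_iff (hm.pow_const 2).aestronglyMeasurable]
  simp only [memLp_two_iff_integrable_sq (hm' _).aestronglyMeasurable, integral_count, norm_pow]
  constructor
  · rintro ⟨_, h⟩ e
    refine h.mono' ((hm' e).pow_const 2).aestronglyMeasurable (Eventually.of_forall fun ω => ?_)
    rw [norm_pow]
    exact Finset.single_le_sum (f := fun e => ‖f ω e‖^2) (fun e _ => by positivity) (Finset.mem_univ e)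
  · intro h
    refine ⟨Eventually.of_forall fun ω => Integrable.of_finite, integrable_finsetSum _ fun e _ => ?_⟩
    simpa using (h e).norm

lemma corr_exists {mu : Measure (Config d)} [IsProbabilityMeasure mu] (u : Dir d → ℝ) :
    ∃ h : Config d → Dir d → ℝ, (∀ e, Measurable fun ω => h ω e) ∧ (∀ e, MemLp (fun ω => h ω e) 2 mu) ∧
      (∀ ψ, BM ψ → ∫ ω, ∑ e, ei e ω * (u e + h ω e) * (ψ (shift (dir e) ω) - ψ ω) ∂mu = 0) ∧
      ∃ ψ : ℕ → Config d → ℝ, (∀ k, BM (ψ k)) ∧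
        ∀ k, ∫ ω, ∑ e, ei e ω * (h ω e - (ψ k (shift (dir e) ω) - ψ k ω))^2 ∂mu ≤ (1/4)^k := by
  classical
  let V : Submodule ℝ (Config d × Dir d → ℝ) :=
    { carrier := {v | ∃ ψ, BM ψ ∧ v = fun p => ei p.2 p.1 * (ψ (shift (dir p.2) p.1) - ψ p.1)}
      add_mem' := by
        rintro _ _ ⟨ψ, ⟨h1, B, hB⟩, rfl⟩ ⟨φ, ⟨h2, B', hB'⟩, rfl⟩
        refine ⟨fun ω => ψ ω + φ ω, ⟨h1.add h2, B + B', fun ω => (abs_add_le _ _).trans (add_le_add (hB ω) (hB' ω))⟩, ?_⟩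
        funext p; simp only [Pi.add_apply]; ring
      zero_mem' := ⟨fun _ => 0, ⟨measurable_const, 0, by simp⟩, by funext p; simp⟩
      smul_mem' := by
        rintro c _ ⟨ψ, ⟨h1, B, hB⟩, rfl⟩
        refine ⟨fun ω => c * ψ ω, ⟨h1.const_mul c, |c| * B, fun ω => ?_⟩, ?_⟩
        · rw [abs_mul]; exact mul_le_mul_of_nonneg_left (hB ω) (abs_nonneg c)
        · funext p; simp only [Pi.smul_apply, smul_eq_mul]; ring }
  have hGm : ∀ ψ : Config d → ℝ, BM ψ → ∀ e, Measurable fun ω => ψ (shift (dir e) ω) - ψ ω :=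
    fun ψ h e => (h.1.comp (measurable_shift _)).sub h.1
  have hGL : ∀ ψ : Config d → ℝ, BM ψ → ∀ e, MemLp (fun ω => ei e ω * (ψ (shift (dir e) ω) - ψ ω)) 2 mu := by
    intro ψ h e
    obtain ⟨B, hB⟩ := h.2
    refine MemLp.of_bound ((ei_meas e).mul (hGm ψ h e)).aestronglyMeasurable (1 * (B + B)) (Eventually.of_forall fun ω => ?_)
    rw [Real.norm_eq_abs, abs_mul]
    exact mul_le_mul (ei_abs_le e ω) ((abs_sub _ _).trans (add_le_add (hB _) (hB _))) (abs_nonneg _) zero_le_one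
  have hVL : ∀ v ∈ V, MemLp v 2 (mu.prod Measure.count) := by
    rintro _ ⟨ψ, h, rfl⟩
    exact (memLp_dir (fun ω e => ei e ω * (ψ (shift (dir e) ω) - ψ ω))
      (measurable_from_prod_countable_left fun e => (ei_meas e).mul (hGm ψ h e))).2 (hGL ψ h)
  have huL : ∀ e, MemLp (fun ω => - (ei e ω * u e)) 2 mu := by
    intro e
    refine MemLp.of_bound ((ei_meas e).mul_const _).neg.aestronglyMeasurable (1 * |u e|) (Eventually.of_forall fun ω => ?_)
    rw [Real.norm_eq_abs, abs_neg, abs_mul]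
    exact mul_le_mul_of_nonneg_right (ei_abs_le e ω) (abs_nonneg _)
  obtain ⟨f, hfm, hfL, hfo, hfa⟩ := hilbert_proj (mu.prod Measure.count) V hVL
    (fun p : Config d × Dir d => - (ei p.2 p.1 * u p.2))
    ((memLp_dir (fun ω e => - (ei e ω * u e))
      (measurable_from_prod_countable_left fun e => ((ei_meas e).mul_const (u e)).neg)).2 huL)
  have hm' : ∀ e, Measurable (fun ω => f (ω, e)) := fun e => hfm.comp (measurable_id.prodMk measurable_const)
  have hL := (memLp_dir (fun ω e => f (ω, e)) hfm).1 hfL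
  refine ⟨fun ω e => f (ω, e), hm', hL, fun ψ hψ => ?_, ?_⟩
  · have h1 := hfo _ ⟨ψ, hψ, rfl⟩
    rw [integral_dir (fun ω e => (-(ei e ω * u e) - f (ω, e)) * (ei e ω * (ψ (shift (dir e) ω) - ψ ω)))] at h1
    · have h2 : (fun ω => ∑ e, ei e ω * (u e + f (ω, e)) * (ψ (shift (dir e) ω) - ψ ω)) = fun ω =>
        - ∑ e, (-(ei e ω * u e) - f (ω, e)) * (ei e ω * (ψ (shift (dir e) ω) - ψ ω)) := by
        funext ω
        rw [← Finset.sum_neg_distrib]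
        refine Finset.sum_congr rfl fun e _ => ?_
        linear_combination (-(u e) * (ψ (shift (dir e) ω) - ψ ω)) * ei_sq e ω
      rw [h2, integral_neg, h1, neg_zero]
    · intro e
      exact ((huL e).sub (hL e)).integrable_mul (hGL ψ hψ e)
    · exact measurable_from_prod_countable_left fun e => ((((ei_meas e).mul_const (u e)).neg).sub (hm' e)).mul
        ((ei_meas e).mul (hGm ψ hψ e))
  · have : ∀ k : ℕ, ∃ ψ, BM ψ ∧ ∫ ω, ∑ e, ei e ω * (f (ω, e) - (ψ (shift (dir e) ω) - ψ ω))^2 ∂mu ≤ (1/4)^k := by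
      intro k
      obtain ⟨_, ⟨ψ, hψ, rfl⟩, h1⟩ := hfa ((1/4)^k) (by positivity)
      refine ⟨ψ, hψ, le_trans ?_ h1⟩
      rw [integral_dir (fun ω e => (f (ω, e) - ei e ω * (ψ (shift (dir e) ω) - ψ ω))^2)]
      · refine integral_mono_of_nonneg (Eventually.of_forall fun ω => Finset.sum_nonneg fun e _ =>
          mul_nonneg (ei_nonneg e ω) (sq_nonneg _)) ?_ (Eventually.of_forall fun ω => Finset.sum_le_sum fun e _ => ?_)
        · exact integrable_finsetSum _ fun e _ => ((hL e).sub (hGL ψ hψ e)).integrable_sq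
        · rcases ei_cases e ω with h | h <;> simp [h]
          positivity
      · exact fun e => ((hL e).sub (hGL ψ hψ e)).integrable_sq
      · exact measurable_from_prod_countable_left fun e => ((hm' e).sub ((ei_meas e).mul (hGm ψ hψ e))).pow_const 2
    choose ψ h1 h2 using this
    exact ⟨ψ, h1, h2⟩

end Perco

namespace Perco
variable {d : ℕ}

lemma ei_shift_one {e : Dir d} {x : Pt d} {ω : Config d} (h : x ∈ Sinf ω) (h' : x + dir e ∈ Sinf ω) :
    ei e (shift x ω) = 1 :=
  ei_one ((Sinf_shift x ω 0).2 (by simpa using h)) ((Sinf_shift x ω _).2 h')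

lemma ei_shift_zero {e : Dir d} {x : Pt d} {ω : Config d} (h : ¬ (x ∈ Sinf ω ∧ x + dir e ∈ Sinf ω)) :
    ei e (shift x ω) = 0 :=
  ei_zero (by rw [Sinf_shift, Sinf_shift, add_zero]; exact h)

lemma ei_opp (e : Dir d) (ω : Config d) : ei (opp e) (shift (dir e) ω) = ei e ω := by
  by_cases h : (0 : Pt d) ∈ Sinf ω ∧ dir e ∈ Sinf ω
  · rw [ei_one h.1 h.2, ei_shift_one h.2 (by rw [dir_opp, add_neg_cancel]; exact h.1)]
  · rw [ei_zero h, ei_shift_zero (by rw [dir_opp, add_neg_cancel]; tauto)]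

/-- The pathwise estimate defining good configurations for a corrector. -/
def CorrPath (h : Config d → Dir d → ℝ) (ψ : ℕ → Config d → ℝ) (ω : Config d) : Prop :=
  ∀ᶠ k in atTop, ∀ n : ℕ, 1 ≤ n → esum d n (fun x e => ei e (shift x ω) *
    (h (shift x ω) e - (ψ k (shift (x + dir e) ω) - ψ k (shift x ω)))^2) ≤ (1/2)^k * (n:ℝ)^d

lemma corr_path {mu : Measure (Config d)} [IsProbabilityMeasure mu] (hs : Stat mu)
    (h : Config d → Dir d → ℝ) (hm : ∀ e, Measurable fun ω => h ω e)
    (hL : ∀ e, MemLp (fun ω => h ω e) 2 mu) (ψ : ℕ → Config d → ℝ) (hψ : ∀ k, BM (ψ k))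
    (hle : ∀ k, ∫ ω, ∑ e, ei e ω * (h ω e - (ψ k (shift (dir e) ω) - ψ k ω))^2 ∂mu ≤ (1/4)^k) :
    ∀ᵐ ω ∂mu, CorrPath h ψ ω := by
  set G : ℕ → Config d → ℝ := fun k ω => ∑ e, ei e ω * (h ω e - (ψ k (shift (dir e) ω) - ψ k ω))^2 with hG
  have hdm : ∀ k e, Measurable fun ω => ψ k (shift (dir e) ω) - ψ k ω :=
    fun k e => ((hψ k).1.comp (measurable_shift _)).sub (hψ k).1
  have hGm : ∀ k, Measurable (G k) := fun k => Finset.measurable_fun_sum _ fun e _ =>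
    (ei_meas e).mul (((hm e).sub (hdm k e)).pow_const 2)
  have hG0 : ∀ k ω, 0 ≤ G k ω := fun k ω => Finset.sum_nonneg fun e _ =>
    mul_nonneg (ei_nonneg e ω) (sq_nonneg _)
  have hGi : ∀ k, Integrable (G k) mu := by
    intro k
    refine integrable_finsetSum _ fun e _ => ?_
    obtain ⟨B, hB⟩ := (hψ k).2
    have h1 : MemLp (fun ω => ψ k (shift (dir e) ω) - ψ k ω) 2 mu :=
      MemLp.of_bound (hdm k e).aestronglyMeasurable (B + B) (Eventually.of_forall fun ω =>
        (abs_sub _ _).trans (add_le_add (hB _) (hB _)))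
    have h2 := ((hL e).sub h1).integrable_sq
    refine h2.mono' ((ei_meas e).mul (((hm e).sub (hdm k e)).pow_const 2)).aestronglyMeasurable
      (Eventually.of_forall fun ω => ?_)
    rw [Real.norm_eq_abs, abs_mul, abs_of_nonneg (sq_nonneg (h ω e - _))]
    exact mul_le_of_le_one_left (sq_nonneg _) (ei_abs_le e ω)
  have h1 := ae_boxSum_small hs (Y := fun k ω => ENNReal.ofReal (G k ω))
    (fun k => (hGm k).ennreal_ofReal) (fun k => by
      rw [← ofReal_integral_eq_lintegral_ofReal (hGi k) (Eventually.of_forall (hG0 k))]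
      refine (ENNReal.ofReal_le_ofReal (hle k)).trans (le_of_eq ?_)
      rw [ENNReal.ofReal_pow (by norm_num)]
      congr 1
      rw [one_div, ENNReal.ofReal_inv_of_pos (by norm_num)]; norm_num)
  filter_upwards [h1] with ω hω
  refine hω.mono fun k hk n hn => ?_
  have h2 := hk n hn
  have h3 : boxSum (fun ω => ENNReal.ofReal (G k ω)) n ω = ENNReal.ofReal (∑ x ∈ box d n, G k (shift x ω)) := by
    unfold boxSum
    rw [ENNReal.ofReal_sum_of_nonneg fun x _ => hG0 k _]
  have h4 : (2⁻¹:ℝ≥0∞)^k * (n:ℝ≥0∞)^d = ENNReal.ofReal ((1/2)^k * (n:ℝ)^d) := by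
    rw [ENNReal.ofReal_mul (by positivity), ENNReal.ofReal_pow (by norm_num), ENNReal.ofReal_pow (by positivity)]
    congr 2
    · rw [one_div, ENNReal.ofReal_inv_of_pos (by norm_num)]; norm_num
    · simp
  rw [h3, h4, ENNReal.ofReal_le_ofReal_iff (by positivity)] at h2
  refine le_trans (le_of_eq ?_) h2
  unfold esum
  refine Finset.sum_congr rfl fun x _ => ?_
  simp only [hG, shift_shift]

lemma CorrPath.tendsto {h : Config d → Dir d → ℝ} {ψ : ℕ → Config d → ℝ} {ω : Config d}
    (hc : CorrPath h ψ ω) {x : Pt d} {e : Dir d} (hx : x ∈ Sinf ω) (hxe : x + dir e ∈ Sinf ω) :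
    Tendsto (fun k => ψ k (shift (x + dir e) ω) - ψ k (shift x ω)) atTop (nhds (h (shift x ω) e)) := by
  set n : ℕ := nrm x + 1
  have hlim : Tendsto (fun k : ℕ => (1/2:ℝ)^k * (n:ℝ)^d) atTop (nhds 0) := by
    have := (tendsto_pow_atTop_nhds_zero_of_lt_one (r := (1/2:ℝ)) (by norm_num) (by norm_num)).mul_const ((n:ℝ)^d)
    simpa using this
  have h1 : Tendsto (fun k => (h (shift x ω) e - (ψ k (shift (x + dir e) ω) - ψ k (shift x ω)))^2) atTop (nhds 0) := by
    refine tendsto_of_tendsto_of_tendsto_of_le_of_le' tendsto_const_nhds hlim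
      (Eventually.of_forall fun k => sq_nonneg _) (hc.mono fun k hk => ?_)
    refine le_trans ?_ (hk n (by omega))
    unfold esum
    have hnn : ∀ (y : Pt d) (e : Dir d), 0 ≤ ei e (shift y ω) *
      (h (shift y ω) e - (ψ k (shift (y + dir e) ω) - ψ k (shift y ω)))^2 :=
      fun y e => mul_nonneg (ei_nonneg _ _) (sq_nonneg _)
    refine le_trans ?_ (Finset.single_le_sum (fun y _ => Finset.sum_nonneg fun e _ => hnn y e)
      (mem_box.2 (by omega : nrm x ≤ n)))
    refine le_trans ?_ (Finset.single_le_sum (fun e _ => hnn x e) (Finset.mem_univ e))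
    rw [ei_shift_one hx hxe, one_mul]
  have h2 : Tendsto (fun k => |h (shift x ω) e - (ψ k (shift (x + dir e) ω) - ψ k (shift x ω))|) atTop (nhds 0) := by
    have := h1.sqrt
    simpa [Real.sqrt_sq_eq_abs] using this
  rw [tendsto_iff_dist_tendsto_zero]
  refine h2.congr fun k => ?_
  rw [dist_comm, Real.dist_eq]

lemma corr_anti {h : Config d → Dir d → ℝ} {ψ : ℕ → Config d → ℝ} {ω : Config d}
    (hc : CorrPath h ψ ω) (e : Dir d) : ei e ω * h (shift (dir e) ω) (opp e) = - (ei e ω * h ω e) := by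
  by_cases hI : (0 : Pt d) ∈ Sinf ω ∧ dir e ∈ Sinf ω
  · have h0 : shift (0 : Pt d) ω = ω := by funext y; simp [shift]
    have h1 := hc.tendsto (x := 0) (e := e) hI.1 (by simpa using hI.2)
    have h2 := hc.tendsto (x := dir e) (e := opp e) hI.2 (by rw [dir_opp, add_neg_cancel]; exact hI.1)
    rw [dir_opp, add_neg_cancel] at h2
    rw [zero_add, h0] at h1
    rw [h0] at h2
    have h3 : h (shift (dir e) ω) (opp e) = - h ω e :=
      tendsto_nhds_unique h2 (h1.neg.congr fun k => by ring)
    rw [h3]; ring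
  · rw [ei_zero hI]; ring

lemma Stat.integral {mu : Measure (Config d)} (hs : Stat mu) (x : Pt d) {f : Config d → ℝ}
    (hf : Measurable f) : ∫ ω, f (shift x ω) ∂mu = ∫ ω, f ω ∂mu := by
  conv_rhs => rw [← (hs x).map_eq]
  rw [integral_map (measurable_shift x).aemeasurable hf.aestronglyMeasurable]

lemma corr_harm {mu : Measure (Config d)} [IsProbabilityMeasure mu] (hs : Stat mu) (u : Dir d → ℝ)
    (hu : ∀ e, u (opp e) = - u e)
    (h : Config d → Dir d → ℝ) (hm : ∀ e, Measurable fun ω => h ω e)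
    (hL : ∀ e, MemLp (fun ω => h ω e) 2 mu) (ψ : ℕ → Config d → ℝ)
    (ho : ∀ ψ, BM ψ → ∫ ω, ∑ e, ei e ω * (u e + h ω e) * (ψ (shift (dir e) ω) - ψ ω) ∂mu = 0)
    (hp : ∀ᵐ ω ∂mu, CorrPath h ψ ω) :
    ∀ᵐ ω ∂mu, ∀ x : Pt d, ∑ e, ei e (shift x ω) * (u e + h (shift x ω) e) = 0 := by
  set D : Config d → ℝ := fun ω => ∑ e, ei e ω * (u e + h ω e) with hD
  have hFm : ∀ e, Measurable fun ω => ei e ω * (u e + h ω e) := fun e =>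
    (ei_meas e).mul ((hm e).const_add _)
  have hFi : ∀ e, Integrable (fun ω => ei e ω * (u e + h ω e)) mu := by
    intro e
    have hi : Integrable (fun ω => u e + h ω e) mu :=
      (integrable_const (u e)).add ((hL e).integrable (by norm_num))
    refine hi.norm.mono' (hFm e).aestronglyMeasurable
      (Eventually.of_forall fun ω => ?_)
    rw [norm_mul]
    exact mul_le_of_le_one_left (norm_nonneg _) (ei_abs_le e ω)
  have hDi : Integrable D mu := integrable_finsetSum _ fun e _ => hFi e
  have hz : ∀ s : Set (Config d), MeasurableSet s → mu s < ∞ → ∫ ω in s, D ω ∂mu = 0 := by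
    intro s hsm _
    set φ : Config d → ℝ := s.indicator (fun _ => 1) with hφ
    have hφb : ∀ ω, |φ ω| ≤ 1 := fun ω => by
      simp only [hφ, Set.indicator]; split_ifs <;> simp
    have hφm : Measurable φ := measurable_const.indicator hsm
    have h1 := ho φ ⟨hφm, 1, hφb⟩
    have hi1 : ∀ e, Integrable (fun ω => ei e ω * (u e + h ω e) * φ ω) mu := fun e =>
      (hFi e).mul_bdd (c := 1) hφm.aestronglyMeasurable (Eventually.of_forall hφb)
    have hi2 : ∀ e, Integrable (fun ω => ei e ω * (u e + h ω e) * φ (shift (dir e) ω)) mu := fun e =>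
      (hFi e).mul_bdd (c := 1) (hφm.comp (measurable_shift _)).aestronglyMeasurable
        (Eventually.of_forall fun ω => hφb _)
    have h2 : ∀ e, ∫ ω, ei e ω * (u e + h ω e) * φ (shift (dir e) ω) ∂mu =
        - ∫ ω, ei (opp e) ω * (u (opp e) + h ω (opp e)) * φ ω ∂mu := by
      intro e
      rw [← hs.integral (dir e) (f := fun ω => ei (opp e) ω * (u (opp e) + h ω (opp e)) * φ ω)
        ((hFm _).mul hφm), ← integral_neg]
      refine integral_congr_ae ?_
      filter_upwards [hp] with ω hω
      have h5 := corr_anti hω e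
      rw [ei_opp, hu]
      linear_combination (φ (shift (dir e) ω)) * h5
    have h4 : ∫ ω, ∑ e, ei e ω * (u e + h ω e) * (φ (shift (dir e) ω) - φ ω) ∂mu =
        - 2 * ∫ ω, D ω * φ ω ∂mu := by
      have e1 : ∫ ω, D ω * φ ω ∂mu = ∑ e, ∫ ω, ei e ω * (u e + h ω e) * φ ω ∂mu := by
        rw [← integral_finsetSum _ fun e _ => hi1 e]
        simp only [hD, Finset.sum_mul]
      simp only [mul_sub]
      rw [integral_finsetSum _ fun e _ => by exact (hi2 e).sub (hi1 e)]
      have e2 : ∀ e, ∫ ω, (ei e ω * (u e + h ω e) * φ (shift (dir e) ω) - ei e ω * (u e + h ω e) * φ ω) ∂mu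
        = - (∫ ω, ei (opp e) ω * (u (opp e) + h ω (opp e)) * φ ω ∂mu) - ∫ ω, ei e ω * (u e + h ω e) * φ ω ∂mu := by
        intro e
        rw [integral_sub (hi2 e) (hi1 e), h2]
      simp only [e2]
      rw [Finset.sum_sub_distrib, Finset.sum_neg_distrib]
      have e3 := Equiv.sum_comp (oppEquiv d) (fun e => ∫ ω, ei e ω * (u e + h ω e) * φ ω ∂mu)
      have e4 : ∑ e, ∫ ω, ei (opp e) ω * (u (opp e) + h ω (opp e)) * φ ω ∂mu = 
        ∑ e, ∫ ω, ei e ω * (u e + h ω e) * φ ω ∂mu := e3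
      rw [e4, e1]; ring
    rw [h4] at h1
    have h5 : ∫ ω, D ω * φ ω ∂mu = 0 := by linarith
    rw [← integral_indicator hsm, ← h5]
    refine integral_congr_ae (Eventually.of_forall fun ω => ?_)
    simp only [hφ, Set.indicator]; split_ifs <;> simp
  have h0 := hDi.ae_eq_zero_of_forall_setIntegral_eq_zero hz
  rw [ae_all_iff]
  intro x
  exact (hs x).quasiMeasurePreserving.ae h0

lemma corr_det {ω : Config d} {rho W : Pt d → ℕ} {K n0 : ℕ} (hg : GoodGeom ω rho W K n0)
    (h0 : (0 : Pt d) ∈ Sinf ω) {h : Config d → Dir d → ℝ} {ψ : ℕ → Config d → ℝ} (hψ : ∀ k, BM (ψ k))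
    (hc : CorrPath h ψ ω) : ∃ χ : Pt d → ℝ, χ 0 = 0 ∧ ApproxP (Sinf ω) χ ∧
      ∀ x e, x ∈ Sinf ω → x + dir e ∈ Sinf ω → χ (x + dir e) - χ x = h (shift x ω) e := by
  classical
  have hs0 : shift (0 : Pt d) ω = ω := by funext y; simp [shift]
  have hex : ∀ x ∈ Sinf ω, ∃ L, Tendsto (fun k => ψ k (shift x ω) - ψ k ω) atTop (nhds L) := by
    intro x hx
    have hcon := hg.big (max n0 (nrm x)) (le_max_left _ _) 0 h0 x hx (by rw [nrm_zero]; omega) (le_max_right _ _)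
    have hr := hcon.2.2
    generalize ballZ (0 : Pt d) (2 * max n0 (nrm x)) = T at hr
    clear hcon
    induction hr with
    | refl => exact ⟨0, by simp [hs0]⟩
    | @tail b c _ hbc ih =>
      obtain ⟨L, hL⟩ := ih hbc.2.1.1
      obtain ⟨e, rfl⟩ := (adj_iff b c).1 hbc.1
      have := hc.tendsto hbc.2.1.1 hbc.2.2.1
      exact ⟨_, (hL.add this).congr fun k => by ring⟩
  choose! χ hχ using hex
  have hgrad : ∀ x e, x ∈ Sinf ω → x + dir e ∈ Sinf ω → χ (x + dir e) - χ x = h (shift x ω) e := by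
    intro x e hx hxe
    refine tendsto_nhds_unique ((hχ _ hxe).sub (hχ _ hx)) ((hc.tendsto hx hxe).congr fun k => by ring)
  refine ⟨χ, ?_, ?_, hgrad⟩
  · refine tendsto_nhds_unique (hχ 0 h0) ?_
    simp [hs0]
  · intro ε hε
    have hlim := (tendsto_pow_atTop_nhds_zero_of_lt_one (r := (1/2:ℝ)) (by norm_num) (by norm_num)).eventually
      (gt_mem_nhds hε)
    obtain ⟨k, hk1, hk2⟩ := (hc.and hlim).exists
    obtain ⟨B, hB⟩ := (hψ k).2
    refine ⟨fun x => ψ k (shift x ω), B, fun x => hB _, fun n hn => ?_⟩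
    refine le_trans (le_of_eq ?_) ((hk1 n hn).trans (mul_le_mul_of_nonneg_right hk2.le (by positivity)))
    unfold esum
    refine Finset.sum_congr rfl fun x _ => Finset.sum_congr rfl fun e _ => ?_
    dsimp only
    by_cases hI : x ∈ Sinf ω ∧ x + dir e ∈ Sinf ω
    · rw [ei_shift_one hI.1 hI.2, ← hgrad x e hI.1 hI.2, grd, if_pos hI]; ring
    · rw [ei_shift_zero hI, grd, if_neg hI]; ring

end Perco

namespace Perco
variable {d : ℕ}

structure Corr (mu : Measure (Config d)) (h : Fin d → Config d → Dir d → ℝ)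
    (ψ : Fin d → ℕ → Config d → ℝ) : Prop where
  meas : ∀ i e, Measurable fun ω => h i ω e
  L2 : ∀ i e, MemLp (fun ω => h i ω e) 2 mu
  orth : ∀ i φ, BM φ → ∫ ω, ∑ e, ei e ω * ((dir e i : ℝ) + h i ω e) * (φ (shift (dir e) ω) - φ ω) ∂mu = 0
  bm : ∀ i k, BM (ψ i k)
  appr : ∀ i k, ∫ ω, ∑ e, ei e ω * (h i ω e - (ψ i k (shift (dir e) ω) - ψ i k ω))^2 ∂mu ≤ (1/4)^k

lemma exists_corr (mu : Measure (Config d)) [IsProbabilityMeasure mu] : ∃ h ψ, Corr mu h ψ := by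
  choose h h1 h2 h3 ψ h4 h5 using fun i : Fin d => corr_exists (mu := mu) (fun e => (dir e i : ℝ))
  exact ⟨h, ψ, h1, h2, h3, h4, h5⟩

/-- harmonic coordinates on a fixed configuration -/
structure GoodPhi (ω : Config d) (h : Fin d → Config d → Dir d → ℝ) (Φ : Fin d → Pt d → ℝ) : Prop where
  zero : ∀ i, Φ i 0 = 0
  grad : ∀ i x e, x ∈ Sinf ω → x + dir e ∈ Sinf ω →
    Φ i (x + dir e) - Φ i x = (dir e i : ℝ) + h i (shift x ω) e
  harm : ∀ i, ∀ x ∈ Sinf ω, ∑ e, grd (Sinf ω) (Φ i) x e = 0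
  subl : ∀ i, ∀ ε > 0, ∃ n1 : ℕ, ∀ n, n1 ≤ n → ∀ x ∈ Sinf ω, nrm x ≤ n → |Φ i x - x i| ≤ ε * n

lemma dir_abs (e : Dir d) (i : Fin d) : |(dir e i : ℝ)| ≤ 1 := by
  have := natAbs_le_nrm (dir e) i
  rw [nrm_dir] at this
  have h2 : |dir e i| ≤ 1 := by rw [Int.abs_eq_natAbs]; exact_mod_cast this
  exact_mod_cast h2

lemma exists_goodPhi (hd : 2 ≤ d) {mu : Measure (Config d)} [IsProbabilityMeasure mu] (hs : Stat mu)
    (ht : TailB mu) {h : Fin d → Config d → Dir d → ℝ} {ψ : Fin d → ℕ → Config d → ℝ} (hc : Corr mu h ψ) :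
    ∀ᵐ ω ∂mu, (0 : Pt d) ∈ Sinf ω → (∃ Φ, GoodPhi ω h Φ) ∧ ∃ rho W K n0, GoodGeom ω rho W K n0 := by
  have hp : ∀ᵐ ω ∂mu, ∀ i, CorrPath (h i) (ψ i) ω := ae_all_iff.2 fun i =>
    corr_path hs (h i) (hc.meas i) (hc.L2 i) (ψ i) (hc.bm i) (hc.appr i)
  have hh : ∀ᵐ ω ∂mu, ∀ i, ∀ x : Pt d, ∑ e, ei e (shift x ω) * ((dir e i : ℝ) + h i (shift x ω) e) = 0 :=
    ae_all_iff.2 fun i => corr_harm hs (fun e => (dir e i : ℝ)) (fun e => by simp [dir_opp]) (h i) (hc.meas i)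
      (hc.L2 i) (ψ i) (hc.orth i) (hp.mono fun ω hω => hω i)
  filter_upwards [hp, hh, exists_goodGeom (by omega) hs ht] with ω h1 h2 ⟨rho, W, K, n0, hg⟩ h0
  refine ⟨?_, rho, W, K, n0, hg⟩
  choose χ c1 c2 c3 using fun i => corr_det hg h0 (hc.bm i) (h1 i)
  have hgrad : ∀ i x e, x ∈ Sinf ω → x + dir e ∈ Sinf ω →
    (χ i (x + dir e) + ((x + dir e) i : ℤ)) - (χ i x + (x i : ℤ)) = (dir e i : ℝ) + h i (shift x ω) e := by
    intro i x e hx hxe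
    rw [← c3 i x e hx hxe, Pi.add_apply]; push_cast; ring
  have hharm : ∀ i, ∀ x ∈ Sinf ω, ∑ e, grd (Sinf ω) (fun y => χ i y + (y i : ℤ)) x e = 0 := by
    intro i x hx
    rw [← h2 i x]
    refine Finset.sum_congr rfl fun e _ => ?_
    by_cases hxe : x + dir e ∈ Sinf ω
    · rw [ei_shift_one hx hxe, one_mul, grd, if_pos ⟨hx, hxe⟩, hgrad i x e hx hxe]
    · rw [ei_shift_zero (fun H => hxe H.2), grd, if_neg (fun H => hxe H.2), zero_mul]
  refine ⟨fun i y => χ i y + (y i : ℤ), fun i => by simp [c1], hgrad, hharm, fun i ε hε => ?_⟩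
  obtain ⟨n1, hn1⟩ := sup_sublinear hd hg (χ i) (fun y => ((y i : ℤ) : ℝ)) (c2 i)
    (fun x e => by rw [Pi.add_apply]; push_cast; rw [add_sub_cancel_left]; exact dir_abs e i) (hharm i) h0 (c1 i) ε hε
  refine ⟨n1, fun n hn x hx hxn => ?_⟩
  rw [add_sub_cancel_right]
  exact hn1 n hn x hx hxn

/-- harmonic vector field -/
noncomputable def vf (h : Fin d → Config d → Dir d → ℝ) (i : Fin d) (ω : Config d) (e : Dir d) : ℝ :=
  ei e ω * ((dir e i : ℝ) + h i ω e)

noncomputable def gab (h : Fin d → Config d → Dir d → ℝ) (a b : Fin d) (ω : Config d) : ℝ :=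
  (2*d:ℝ)⁻¹ * ∑ e, vf h a ω e * vf h b ω e

noncomputable def CovM (mu : Measure (Config d)) (h : Fin d → Config d → Dir d → ℝ) :
    Matrix (Fin d) (Fin d) ℝ :=
  Matrix.of fun a b => (∫ ω, gab h a b ω ∂mu) / mu.real {ω | (0 : Pt d) ∈ Sinf ω}

noncomputable def Mq (mu : Measure (Config d)) (h : Fin d → Config d → Dir d → ℝ) (θ : Fin d → ℝ) : ℝ :=
  ∫ ω, ∑ e, (∑ a, θ a * vf h a ω e)^2 ∂mu

section
set_option linter.unusedSectionVars false
variable {mu : Measure (Config d)} [IsProbabilityMeasure mu] {h : Fin d → Config d → Dir d → ℝ}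
  {ψ : Fin d → ℕ → Config d → ℝ}

lemma Corr.vf_meas (hc : Corr mu h ψ) (i : Fin d) (e : Dir d) : Measurable fun ω => vf h i ω e :=
  (ei_meas e).mul ((hc.meas i e).const_add _)

lemma Corr.vf_L2 (hc : Corr mu h ψ) (i : Fin d) (e : Dir d) : MemLp (fun ω => vf h i ω e) 2 mu := by
  generalize hc0 : ((dir e i : ℤ) : ℝ) = c
  have h0 : MemLp (fun _ : Config d => c) 2 mu := memLp_const c
  have h1 : MemLp ((fun _ => c) + fun ω => h i ω e) 2 mu := h0.add (hc.L2 i e)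
  refine h1.mono (hc.vf_meas i e).aestronglyMeasurable (Eventually.of_forall fun ω => ?_)
  simp only [vf, norm_mul, Pi.add_apply, hc0]
  exact mul_le_of_le_one_left (norm_nonneg _) (ei_abs_le e ω)

lemma Corr.vf_int (hc : Corr mu h ψ) (a b : Fin d) (e : Dir d) :
    Integrable (fun ω => vf h a ω e * vf h b ω e) mu := (hc.vf_L2 a e).integrable_mul (hc.vf_L2 b e)

lemma Corr.gab_meas (hc : Corr mu h ψ) (a b : Fin d) : Measurable (gab h a b) :=
  (Finset.measurable_fun_sum _ fun e _ => (hc.vf_meas a e).mul (hc.vf_meas b e)).const_mul _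

lemma Corr.gab_int (hc : Corr mu h ψ) (a b : Fin d) : Integrable (gab h a b) mu :=
  (integrable_finsetSum _ fun e _ => hc.vf_int a b e).const_mul _

lemma Corr.comb_L2 (hc : Corr mu h ψ) (θ : Fin d → ℝ) (e : Dir d) :
    MemLp (fun ω => ∑ a, θ a * vf h a ω e) 2 mu :=
  memLp_finsetSum _ fun a _ => (hc.vf_L2 a e).const_mul (θ a)

lemma Corr.Mq_eq (hd : 0 < d) (hc : Corr mu h ψ) (hη : 0 < mu.real {ω | (0 : Pt d) ∈ Sinf ω}) (θ : Fin d → ℝ) :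
    Mq mu h θ = 2 * d * mu.real {ω | (0 : Pt d) ∈ Sinf ω} * ∑ a, ∑ b, θ a * CovM mu h a b * θ b := by
  have hd' : (0:ℝ) < d := by exact_mod_cast hd
  have h1 : ∀ a b, CovM mu h a b * (2 * d * mu.real {ω | (0 : Pt d) ∈ Sinf ω}) =
      ∫ ω, ∑ e, vf h a ω e * vf h b ω e ∂mu := by
    intro a b
    simp only [CovM, Matrix.of_apply, gab]
    rw [integral_const_mul]
    field_simp
  have h2 : ∀ ω, ∑ e, (∑ a, θ a * vf h a ω e)^2 =
      ∑ a, ∑ b, θ a * θ b * ∑ e, vf h a ω e * vf h b ω e := by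
    intro ω
    have : ∀ e, (∑ a, θ a * vf h a ω e)^2 = ∑ a, ∑ b, θ a * θ b * (vf h a ω e * vf h b ω e) := by
      intro e
      rw [sq, Finset.sum_mul_sum]
      exact Finset.sum_congr rfl fun a _ => Finset.sum_congr rfl fun b _ => by ring
    simp only [this, Finset.mul_sum]
    rw [Finset.sum_comm]
    refine Finset.sum_congr rfl fun a _ => ?_
    rw [Finset.sum_comm]
  have hintg : ∀ a b, Integrable (fun ω => ∑ e, vf h a ω e * vf h b ω e) mu :=
    fun a b => integrable_finsetSum _ fun e _ => hc.vf_int a b e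
  unfold Mq
  simp only [h2]
  rw [integral_finsetSum _ fun a _ => integrable_finsetSum _ fun b _ => (hintg a b).const_mul _, Finset.mul_sum]
  refine Finset.sum_congr rfl fun a _ => ?_
  rw [integral_finsetSum _ fun b _ => (hintg a b).const_mul _, Finset.mul_sum]
  refine Finset.sum_congr rfl fun b _ => ?_
  rw [integral_const_mul, ← h1]
  ring

lemma CovM_symm (a b : Fin d) : CovM mu h a b = CovM mu h b a := by
  simp only [CovM, Matrix.of_apply, gab, mul_comm (vf h a _ _)]

lemma Corr.posDef (hd : 2 ≤ d) (hs : Stat mu) (ht : TailB mu) (hc : Corr mu h ψ)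
    (hη : 0 < mu.real {ω | (0 : Pt d) ∈ Sinf ω}) : (CovM mu h).PosDef := by
  have hd' : (0:ℝ) < d := by exact_mod_cast (by omega : 0 < d)
  refine Matrix.PosDef.of_dotProduct_mulVec_pos (Matrix.IsHermitian.ext fun a b => ?_) fun θ hθ => ?_
  · simpa using CovM_symm b a
  have hq : star θ ⬝ᵥ (CovM mu h).mulVec θ = ∑ a, ∑ b, θ a * CovM mu h a b * θ b := by
    simp only [dotProduct, Matrix.mulVec, Pi.star_apply, star_trivial, Finset.mul_sum, mul_assoc]
  rw [hq]
  by_contra hcon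
  have hM := hc.Mq_eq (by omega) hη θ
  have hM0 : Mq mu h θ ≤ 0 := by
    rw [hM]; exact mul_nonpos_of_nonneg_of_nonpos (by positivity) (not_lt.1 hcon)
  have hnn : ∀ ω, 0 ≤ ∑ e, (∑ a, θ a * vf h a ω e)^2 := fun ω => Finset.sum_nonneg fun e _ => sq_nonneg _
  have hz : ∀ᵐ ω ∂mu, ∑ e, (∑ a, θ a * vf h a ω e)^2 = 0 := by
    have h0 : Mq mu h θ = 0 := le_antisymm hM0 (integral_nonneg hnn)
    exact (integral_eq_zero_iff_of_nonneg hnn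
      (integrable_finsetSum _ fun e _ => (hc.comb_L2 θ e).integrable_sq)).1 h0
  have hz' : ∀ᵐ ω ∂mu, ∀ x : Pt d, ∑ e, (∑ a, θ a * vf h a (shift x ω) e)^2 = 0 :=
    ae_all_iff.2 fun x => (hs x).quasiMeasurePreserving.ae hz
  have hex : ∃ ω : Config d, (0 : Pt d) ∈ Sinf ω ∧ ((∃ Φ, GoodPhi ω h Φ) ∧ ∃ rho W K n0, GoodGeom ω rho W K n0) ∧
      ∀ x : Pt d, ∑ e, (∑ a, θ a * vf h a (shift x ω) e)^2 = 0 := by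
    have hae := (exists_goodPhi hd hs ht hc).and hz'
    by_contra hno
    push Not at hno
    have : mu {ω | (0 : Pt d) ∈ Sinf ω} = 0 := by
      refine measure_eq_zero_iff_ae_notMem.2 (hae.mono fun ω hgood hω => ?_)
      obtain ⟨x, hx⟩ := hno ω hω (hgood.1 hω)
      exact hx (hgood.2 x)
    rw [Measure.real, this] at hη
    simp at hη
  obtain ⟨ω, h0, ⟨⟨Φ, hΦ⟩, rho, W, K, n0, hg⟩, hzero⟩ := hex
  -- θ·Φ vanishes on the cluster
  have hconst : ∀ x ∈ Sinf ω, ∑ a, θ a * Φ a x = 0 := by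
    intro x hx
    have hcn := hg.big (max n0 (nrm x)) (le_max_left _ _) 0 h0 x hx (by rw [nrm_zero]; omega) (le_max_right _ _)
    have hr := hcn.2.2
    generalize ballZ (0 : Pt d) (2 * max n0 (nrm x)) = T at hr
    clear hcn
    induction hr with
    | refl => simp [hΦ.zero]
    | @tail b c _ hbc ih =>
      have ih := ih hbc.2.1.1
      obtain ⟨e, rfl⟩ := (adj_iff b c).1 hbc.1
      have h1 := (Finset.sum_eq_zero_iff_of_nonneg (fun e _ => sq_nonneg _)).1 (hzero b) e (Finset.mem_univ _)
      have h2 := pow_eq_zero_iff (two_ne_zero) |>.1 h1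
      have h3 : ∑ a, θ a * Φ a (b + dir e) - ∑ a, θ a * Φ a b = ∑ a, θ a * vf h a (shift b ω) e := by
        rw [← Finset.sum_sub_distrib]
        refine Finset.sum_congr rfl fun a _ => ?_
        rw [vf, ei_shift_one hbc.2.1.1 hbc.2.2.1, one_mul, ← hΦ.grad a b e hbc.2.1.1 hbc.2.2.1]; ring
      rw [h2, ih, sub_zero] at h3
      exact h3
  choose n1 hn1 using fun i => hΦ.subl i (1/4) (by norm_num)
  set m : ℕ := max (max n0 1) (Finset.univ.sup n1) with hm
  have hmn : ∀ i, n1 i ≤ m := fun i => (Finset.le_sup (Finset.mem_univ i)).trans (le_max_right _ _)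
  set z : Pt d := fun i => (SignType.sign (θ i) : ℤ) * m with hzdef
  have hznrm : nrm z ≤ m := by
    rw [nrm_le_iff]
    intro i
    simp only [hzdef, Int.natAbs_mul, Int.natAbs_natCast]
    rcases SignType.sign (θ i) with _ | _ | _ <;> simp
  obtain ⟨p, hp, hpz⟩ := hg.near z
  have hrho := hg.small m (by omega) z (mem_box.2 hznrm)
  have hpn : nrm p ≤ 2 * m := by
    have := nrm_add (p - z) z
    rw [sub_add_cancel] at this; omega
  have hS : 0 < ∑ a, |θ a| := by
    obtain ⟨i, hi⟩ := Function.ne_iff.1 hθ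
    exact Finset.sum_pos' (fun a _ => abs_nonneg _) ⟨i, Finset.mem_univ i, abs_pos.2 hi⟩
  have hlow : ∀ a, |θ a| * (m/4) ≤ θ a * Φ a p := by
    intro a
    have b1 := hn1 a (2*m) ((hmn a).trans (by omega)) p hp hpn
    have b2 : |((p a : ℤ):ℝ) - z a| ≤ m/4 := by
      have c1 := natAbs_le_nrm (p - z) a
      have c2 : 4 * (p a - z a).natAbs ≤ m := by rw [Pi.sub_apply] at c1; omega
      have c3 : (4:ℝ) * |((p a : ℤ):ℝ) - z a| ≤ m := by
        have : ((4 * (p a - z a).natAbs : ℕ):ℝ) ≤ m := by exact_mod_cast c2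
        rw [Nat.cast_mul, Nat.cast_natAbs] at this
        push_cast at this
        exact this
      linarith
    have b3 : θ a * ((z a : ℤ):ℝ) = |θ a| * m := by
      have : ((z a : ℤ):ℝ) = (SignType.sign (θ a) : ℝ) * m := by simp [hzdef]
      rw [this, ← mul_assoc, self_mul_sign]
    push_cast at b1
    have b4 : |Φ a p - z a| ≤ 3 * m / 4 := by
      calc |Φ a p - z a| = |(Φ a p - p a) + (p a - z a)| := by ring_nf
        _ ≤ _ := (abs_add_le _ _).trans (add_le_add b1 b2)
        _ = _ := by ring
    have b5 : |θ a * (Φ a p - z a)| ≤ |θ a| * (3 * m / 4) := by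
      rw [abs_mul]; exact mul_le_mul_of_nonneg_left b4 (abs_nonneg _)
    have b6 := (abs_le.1 b5).1
    have : θ a * Φ a p = θ a * (Φ a p - z a) + |θ a| * m := by rw [← b3]; ring
    rw [this]
    linarith
  have hfin := Finset.sum_le_sum fun a (_ : a ∈ Finset.univ) => hlow a
  rw [hconst p hp, ← Finset.sum_mul] at hfin
  have hm1 : (1:ℝ) ≤ m := by exact_mod_cast (by omega : 1 ≤ m)
  have : 0 < (∑ a, |θ a|) * ((m:ℝ)/4) := by positivity
  linarith

end

end Perco

namespace Perco
variable {d : ℕ}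
section
set_option linter.unusedSectionVars false
variable {mu : Measure (Config d)} [IsProbabilityMeasure mu] {h : Fin d → Config d → Dir d → ℝ}
  {ψ : Fin d → ℕ → Config d → ℝ}

noncomputable def Qf (mu : Measure (Config d)) (θ : Fin d → ℝ) (φ : Config d → ℝ) : ℝ :=
  ∫ ω, ∑ e, ei e ω * (∑ a, θ a * (dir e a : ℝ) + (φ (shift (dir e) ω) - φ ω))^2 ∂mu

lemma BM.comb {ι : Type*} [Fintype ι] (θ : ι → ℝ) (φ : ι → Config d → ℝ) (hφ : ∀ i, BM (φ i)) :
    BM (fun ω => ∑ i, θ i * φ i ω) := by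
  choose B hB using fun i => (hφ i).2
  refine ⟨Finset.measurable_fun_sum _ fun i _ => (hφ i).1.const_mul _, ∑ i, |θ i| * B i, fun ω => ?_⟩
  refine (Finset.abs_sum_le_sum_abs _ _).trans (Finset.sum_le_sum fun i _ => ?_)
  rw [abs_mul]
  exact mul_le_mul_of_nonneg_left (hB i ω) (abs_nonneg _)

lemma Corr.dev_L2 (hc : Corr mu h ψ) (θ : Fin d → ℝ) {φ : Config d → ℝ} (hφ : BM φ) (e : Dir d) :
    MemLp (fun ω => ei e ω * (∑ a, θ a * h a ω e - (φ (shift (dir e) ω) - φ ω))) 2 mu := by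
  have hdm : Measurable fun ω => φ (shift (dir e) ω) - φ ω := (hφ.1.comp (measurable_shift _)).sub hφ.1
  obtain ⟨B, hB⟩ := hφ.2
  have h1 : MemLp (fun ω => φ (shift (dir e) ω) - φ ω) 2 mu :=
    MemLp.of_bound hdm.aestronglyMeasurable (B + B) (Eventually.of_forall fun ω =>
      (abs_sub _ _).trans (add_le_add (hB _) (hB _)))
  have h2 : MemLp (fun ω => ∑ a, θ a * h a ω e) 2 mu :=
    memLp_finsetSum _ fun a _ => (hc.L2 a e).const_mul (θ a)
  have hm : Measurable (fun ω => ∑ a, θ a * h a ω e) :=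
    Finset.measurable_fun_sum _ fun a _ => (hc.meas a e).const_mul _
  refine (h2.sub h1).mono ((ei_meas e).mul (hm.sub hdm)).aestronglyMeasurable (Eventually.of_forall fun ω => ?_)
  rw [norm_mul]
  exact mul_le_of_le_one_left (norm_nonneg _) (ei_abs_le e ω)

lemma Corr.orth_comb (hc : Corr mu h ψ) (θ : Fin d → ℝ) {φ : Config d → ℝ} (hφ : BM φ) :
    ∫ ω, ∑ e, (∑ a, θ a * vf h a ω e) * (φ (shift (dir e) ω) - φ ω) ∂mu = 0 := by
  obtain ⟨B, hB⟩ := hφ.2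
  have hdm : ∀ e, Measurable fun ω => φ (shift (dir e) ω) - φ ω :=
    fun e => (hφ.1.comp (measurable_shift _)).sub hφ.1
  have hi : ∀ a, Integrable (fun ω => ∑ e, vf h a ω e * (φ (shift (dir e) ω) - φ ω)) mu := fun a =>
    integrable_finsetSum _ fun e _ => ((hc.vf_L2 a e).integrable (by norm_num)).mul_bdd (c := B + B)
      (hdm e).aestronglyMeasurable (Eventually.of_forall fun ω => (abs_sub _ _).trans (add_le_add (hB _) (hB _)))
  have h1 : ∀ ω, ∑ e, (∑ a, θ a * vf h a ω e) * (φ (shift (dir e) ω) - φ ω) =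
      ∑ a, θ a * ∑ e, vf h a ω e * (φ (shift (dir e) ω) - φ ω) := by
    intro ω
    simp only [Finset.sum_mul, Finset.mul_sum]
    rw [Finset.sum_comm]
    exact Finset.sum_congr rfl fun a _ => Finset.sum_congr rfl fun e _ => by ring
  simp only [h1]
  rw [integral_finsetSum _ fun a _ => (hi a).const_mul _]
  refine Finset.sum_eq_zero fun a _ => ?_
  rw [integral_const_mul]
  have := hc.orth a φ hφ
  simp only [vf]
  rw [this, mul_zero]

/-- the deviation functional -/
noncomputable def Af (mu : Measure (Config d)) (h : Fin d → Config d → Dir d → ℝ) (θ : Fin d → ℝ)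
    (φ : Config d → ℝ) : ℝ :=
  ∫ ω, ∑ e, (ei e ω * (∑ a, θ a * h a ω e - (φ (shift (dir e) ω) - φ ω)))^2 ∂mu

lemma Corr.Af_small (hc : Corr mu h ψ) (θ : Fin d → ℝ) (k : ℕ) :
    Af mu h θ (fun ω => ∑ a, θ a * ψ a k ω) ≤ (d * ∑ a, (θ a)^2) * (1/4)^k := by
  have hb : ∀ a, BM (ψ a k) := fun a => hc.bm a k
  have hi : ∀ a, Integrable (fun ω => ∑ e, ei e ω * (h a ω e - (ψ a k (shift (dir e) ω) - ψ a k ω))^2) mu := by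
    intro a
    have := fun e => (hc.dev_L2 (Pi.single a 1) (hb a) e).integrable_sq
    refine (integrable_finsetSum Finset.univ fun e _ => this e).congr (Eventually.of_forall fun ω => ?_)
    refine Finset.sum_congr rfl fun e _ => ?_
    rw [mul_pow, sq (ei e ω), ei_sq]
    simp [Pi.single_apply]
  calc Af mu h θ (fun ω => ∑ a, θ a * ψ a k ω)
      ≤ ∫ ω, d * ∑ a, (θ a)^2 * ∑ e, ei e ω * (h a ω e - (ψ a k (shift (dir e) ω) - ψ a k ω))^2 ∂mu := by
        refine integral_mono_of_nonneg (Eventually.of_forall fun ω => Finset.sum_nonneg fun e _ => sq_nonneg _)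
          ((integrable_finsetSum _ fun a _ => (hi a).const_mul _).const_mul _) (Eventually.of_forall fun ω => ?_)
        dsimp only
        have : ∀ e, (ei e ω * (∑ a, θ a * h a ω e - (∑ a, θ a * ψ a k (shift (dir e) ω) - ∑ a, θ a * ψ a k ω)))^2 ≤
            d * ∑ a, (θ a)^2 * (ei e ω * (h a ω e - (ψ a k (shift (dir e) ω) - ψ a k ω))^2) := by
          intro e
          have e1 : ei e ω * (∑ a, θ a * h a ω e - (∑ a, θ a * ψ a k (shift (dir e) ω) - ∑ a, θ a * ψ a k ω)) =
            ∑ a, θ a * (ei e ω * (h a ω e - (ψ a k (shift (dir e) ω) - ψ a k ω))) := by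
            rw [← Finset.sum_sub_distrib, ← Finset.sum_sub_distrib, Finset.mul_sum]
            exact Finset.sum_congr rfl fun a _ => by ring
          rw [e1]
          refine sq_sum_le_card_mul_sum_sq.trans (le_of_eq ?_)
          rw [Finset.card_univ, Fintype.card_fin]
          congr 1
          refine Finset.sum_congr rfl fun a _ => ?_
          rw [mul_pow, mul_pow, sq (ei e ω), ei_sq]
        refine (Finset.sum_le_sum fun e _ => this e).trans (le_of_eq ?_)
        rw [← Finset.mul_sum, Finset.sum_comm]
        simp only [Finset.mul_sum]
    _ = d * ∑ a, (θ a)^2 * ∫ ω, ∑ e, ei e ω * (h a ω e - (ψ a k (shift (dir e) ω) - ψ a k ω))^2 ∂mu := by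
        rw [integral_const_mul, integral_finsetSum _ fun a _ => (hi a).const_mul _]
        simp only [integral_const_mul]
    _ ≤ d * ∑ a, (θ a)^2 * (1/4)^k := by
        gcongr with a _
        exact hc.appr a k
    _ = _ := by rw [← Finset.sum_mul]; ring

lemma Corr.cross (hc : Corr mu h ψ) (θ : Fin d → ℝ) {φ : Config d → ℝ} (hφ : BM φ) :
    ∫ ω, ∑ e, (∑ a, θ a * vf h a ω e) * (ei e ω * (∑ a, θ a * h a ω e - (φ (shift (dir e) ω) - φ ω))) ∂mu = 0 := by
  have hv : ∀ e ω, (∑ a, θ a * vf h a ω e) * ei e ω = ∑ a, θ a * vf h a ω e := by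
    intro e ω
    rw [Finset.sum_mul]
    refine Finset.sum_congr rfl fun a _ => ?_
    rw [vf]; linear_combination (θ a * ((dir e a : ℝ) + h a ω e)) * ei_sq e ω
  set T : (Config d → ℝ) → ℝ := fun φ => 
    ∫ ω, ∑ e, (∑ a, θ a * vf h a ω e) * (ei e ω * (∑ a, θ a * h a ω e - (φ (shift (dir e) ω) - φ ω))) ∂mu with hT
  have hintg : ∀ φ, BM φ → ∀ e, Integrable (fun ω => (∑ a, θ a * vf h a ω e) *
      (ei e ω * (∑ a, θ a * h a ω e - (φ (shift (dir e) ω) - φ ω)))) mu := fun φ hφ e =>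
    (hc.comb_L2 θ e).integrable_mul (hc.dev_L2 θ hφ e)
  have hTd : ∀ φ φ', BM φ → BM φ' → T φ = T φ' := by
    intro φ φ' hφ hφ'
    have hb : BM (fun ω => φ' ω - φ ω) := by
      obtain ⟨B, hB⟩ := hφ.2
      obtain ⟨B', hB'⟩ := hφ'.2
      exact ⟨hφ'.1.sub hφ.1, B' + B, fun ω => (abs_sub _ _).trans (add_le_add (hB' _) (hB _))⟩
    have h1 := hc.orth_comb θ hb
    rw [← sub_eq_zero, ← h1]
    simp only [hT]
    rw [← integral_sub (integrable_finsetSum _ fun e _ => hintg φ hφ e) (integrable_finsetSum _ fun e _ => hintg φ' hφ' e)]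
    refine integral_congr_ae (Eventually.of_forall fun ω => ?_)
    dsimp only
    rw [← Finset.sum_sub_distrib]
    refine Finset.sum_congr rfl fun e _ => ?_
    linear_combination ((φ' (shift (dir e) ω) - φ' ω) - (φ (shift (dir e) ω) - φ ω)) * hv e ω
  have hb : ∀ k, BM (fun ω => ∑ a, θ a * ψ a k ω) := fun k => BM.comb θ _ fun a => hc.bm a k
  have hbd : ∀ k : ℕ, 2 * |T φ| ≤ (Mq mu h θ + d * ∑ a, (θ a)^2) * (1/2)^k := by
    intro k
    rw [hTd φ _ hφ (hb k)]
    set φk := (fun ω => ∑ a, θ a * ψ a k ω) with hφk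
    have h1 : ∀ s : ℝ, s^2 = 1 → 2 * (s * T φk) ≤ (1/2)^k * Mq mu h θ + 2^k * Af mu h θ φk := by
      intro s hs
      simp only [hT, Mq, Af]
      rw [← integral_const_mul, ← integral_const_mul, ← integral_const_mul, ← integral_const_mul, ← integral_add]
      · refine integral_mono ?_ ?_ fun ω => ?_
        · exact (((integrable_finsetSum _ fun e _ => hintg φk (hb k) e)).const_mul _).const_mul _
        · exact ((integrable_finsetSum _ fun e _ => (hc.comb_L2 θ e).integrable_sq).const_mul _).add
            ((integrable_finsetSum _ fun e _ => (hc.dev_L2 θ (hb k) e).integrable_sq).const_mul _)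
        · dsimp only
          rw [Finset.mul_sum, Finset.mul_sum, Finset.mul_sum, Finset.mul_sum, ← Finset.sum_add_distrib]
          refine Finset.sum_le_sum fun e _ => ?_
          set X := ∑ a, θ a * vf h a ω e
          set Y := ei e ω * (∑ a, θ a * h a ω e - (φk (shift (dir e) ω) - φk ω))
          have hp : (0:ℝ) < 2^k := by positivity
          have : (1/2:ℝ)^k * X^2 + 2^k * Y^2 - 2 * (s * (X * Y)) = 2^k * ((1/2)^k * X - s * Y)^2 := by
            have e1 : (2:ℝ)^k * (1/2)^k = 1 := by rw [← mul_pow]; norm_num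
            linear_combination (-(1/2:ℝ)^k * X^2 + 2 * s * X * Y) * e1 - 2^k * Y^2 * hs
          have h3 : 0 ≤ (2:ℝ)^k * ((1/2)^k * X - s * Y)^2 := by positivity
          linarith
      · exact (integrable_finsetSum _ fun e _ => (hc.comb_L2 θ e).integrable_sq).const_mul _
      · exact (integrable_finsetSum _ fun e _ => (hc.dev_L2 θ (hb k) e).integrable_sq).const_mul _
    have h2 : 2^k * Af mu h θ φk ≤ (d * ∑ a, (θ a)^2) * (1/2)^k := by
      calc 2^k * Af mu h θ φk ≤ 2^k * ((d * ∑ a, (θ a)^2) * (1/4)^k) := by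
            gcongr; exact hc.Af_small θ k
        _ = (d * ∑ a, (θ a)^2) * (1/2)^k := by
            have : (2:ℝ)^k * (1/4)^k = (1/2)^k := by rw [← mul_pow]; norm_num
            rw [← this]; ring
    have p := h1 1 (by norm_num)
    have q := h1 (-1) (by norm_num)
    have : |T φk| ≤ ((Mq mu h θ + d * ∑ a, (θ a)^2) * (1/2)^k) / 2 := by
      rw [abs_le]; constructor <;> linarith
    linarith
  have hlim : Tendsto (fun k : ℕ => (Mq mu h θ + d * ∑ a, (θ a)^2) * (1/2:ℝ)^k) atTop
      (nhds ((Mq mu h θ + d * ∑ a, (θ a)^2) * 0)) :=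
    Tendsto.const_mul _ (tendsto_pow_atTop_nhds_zero_of_lt_one (by norm_num) (by norm_num))
  have := ge_of_tendsto' hlim hbd
  rw [mul_zero] at this
  exact abs_eq_zero.1 (le_antisymm (by linarith) (abs_nonneg _))

lemma Corr.Qf_eq (hc : Corr mu h ψ) (θ : Fin d → ℝ) {φ : Config d → ℝ} (hφ : BM φ) :
    Qf mu θ φ = Mq mu h θ + Af mu h θ φ := by
  have i1 := integrable_finsetSum Finset.univ fun e _ => (hc.comb_L2 θ e).integrable_sq
  have i2 := integrable_finsetSum Finset.univ fun e _ => (hc.dev_L2 θ hφ e).integrable_sq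
  have i3 : Integrable (fun ω => ∑ e, (∑ a, θ a * vf h a ω e) *
      (ei e ω * (∑ a, θ a * h a ω e - (φ (shift (dir e) ω) - φ ω)))) mu :=
    integrable_finsetSum Finset.univ fun e _ => (hc.comb_L2 θ e).integrable_mul (hc.dev_L2 θ hφ e)
  have h1 : Mq mu h θ + Af mu h θ φ = Mq mu h θ + Af mu h θ φ - 2 * 0 := by ring
  have i12 := i1.add i2
  simp only [Pi.add_def] at i12
  rw [h1, ← hc.cross θ hφ, Mq, Af, Qf, ← integral_const_mul, ← integral_add i1 i2, ← integral_sub i12 (i3.const_mul 2)]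
  refine integral_congr_ae (Eventually.of_forall fun ω => ?_)
  dsimp only
  rw [Finset.mul_sum, ← Finset.sum_add_distrib, ← Finset.sum_sub_distrib]
  refine Finset.sum_congr rfl fun e _ => ?_
  have hv : ∑ a, θ a * vf h a ω e = ei e ω * (∑ a, θ a * (dir e a : ℝ) + ∑ a, θ a * h a ω e) := by
    rw [← Finset.sum_add_distrib, Finset.mul_sum]
    exact Finset.sum_congr rfl fun a _ => by rw [vf]; ring
  rw [hv]
  rcases ei_cases e ω with h0 | h0 <;> rw [h0] <;> ring

end
end Perco

namespace Perco
variable {d : ℕ}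

section iso
variable (π : Equiv.Perm (Fin d)) (s : Fin d → Bool)

lemma sp_add (x y : Pt d) : signedPerm π s (x + y) = signedPerm π s x + signedPerm π s y := by
  funext i
  simp only [signedPerm, Pi.add_apply]
  split_ifs <;> ring

lemma sp_inj : Function.Injective (signedPerm π s) := by
  intro x y hxy
  funext i
  have := congrFun hxy (π.symm i)
  simp only [signedPerm, Equiv.apply_symm_apply] at this
  split_ifs at this <;> omega

lemma sp_surj : Function.Surjective (signedPerm π s) := by
  intro y
  refine ⟨fun i => if s (π.symm i) then -(y (π.symm i)) else y (π.symm i), ?_⟩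
  funext i
  simp only [signedPerm, Equiv.symm_apply_apply]
  split_ifs <;> simp

lemma sp_adj (x y : Pt d) : adj (signedPerm π s x) (signedPerm π s y) ↔ adj x y := by
  unfold adj dist1
  rw [← Equiv.sum_comp π (fun i => (x i - y i).natAbs)]
  have : ∀ i, (signedPerm π s x i - signedPerm π s y i).natAbs = (x (π i) - y (π i)).natAbs := by
    intro i
    simp only [signedPerm]
    split_ifs <;> omega
  simp only [this]

/-- the action on configurations -/
def gact (ω : Config d) : Config d := fun x => ω (signedPerm π s x)

lemma connIn_sp {ω : Config d} {y z : Pt d} :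
    connIn (SS (gact π s ω)) y z ↔ connIn (SS ω) (signedPerm π s y) (signedPerm π s z) := by
  have key : ∀ w, w ∈ SS (gact π s ω) ↔ signedPerm π s w ∈ SS ω := fun w => Iff.rfl
  constructor
  · intro h
    refine ⟨h.1, h.2.1, ?_⟩
    exact Relation.ReflTransGen.lift (signedPerm π s)
      (fun a b hab => ⟨(sp_adj π s a b).2 hab.1, hab.2.1, hab.2.2⟩) _ _ h.2.2
  · intro h
    refine ⟨h.1, h.2.1, ?_⟩
    obtain ⟨f, hf⟩ : ∃ f : Pt d → Pt d, ∀ x, signedPerm π s (f x) = x :=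
      ⟨Function.surjInv (sp_surj π s), Function.surjInv_eq (sp_surj π s)⟩
    have hf' : ∀ x, f (signedPerm π s x) = x := fun x => sp_inj π s (hf _)
    have := Relation.ReflTransGen.lift (p := stepRel (SS (gact π s ω))) f
      (fun a b (hab : stepRel (SS ω) a b) => ⟨by rw [← sp_adj π s, hf, hf]; exact hab.1,
        by rw [key, hf]; exact hab.2.1, by rw [key, hf]; exact hab.2.2⟩) _ _ h.2.2
    simpa only [hf', Function.onFun] using this

lemma Sinf_sp (ω : Config d) (x : Pt d) : x ∈ Sinf (gact π s ω) ↔ signedPerm π s x ∈ Sinf ω := by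
  have : cluster (SS ω) (signedPerm π s x) = signedPerm π s '' cluster (SS (gact π s ω)) x := by
    ext z
    constructor
    · intro hz
      obtain ⟨w, rfl⟩ := sp_surj π s z
      exact ⟨w, (connIn_sp π s).2 hz, rfl⟩
    · rintro ⟨w, hw, rfl⟩
      exact (connIn_sp π s).1 hw
  unfold Sinf
  simp only [Set.mem_ofPred_eq, this]
  rw [Set.infinite_image_iff (sp_inj π s).injOn]
  exact Iff.rfl

lemma sp_dir (e : Dir d) : ∃ e', signedPerm π s (dir e) = dir e' := by
  have h : adj (signedPerm π s 0) (signedPerm π s (dir e)) :=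
    (sp_adj π s _ _).2 ((adj_iff _ _).2 ⟨e, by simp⟩)
  obtain ⟨e', he⟩ := (adj_iff _ _).1 h
  refine ⟨e', ?_⟩
  rw [he]
  have : signedPerm π s 0 = 0 := by funext i; simp [signedPerm]
  rw [this, zero_add]

lemma sp_dirEquiv : ∃ E : Dir d ≃ Dir d, ∀ e, signedPerm π s (dir e) = dir (E e) := by
  choose f hf using sp_dir π s
  have hi : Function.Injective f := fun a b hab => by
    apply dir_injective
    apply sp_inj π s
    rw [hf, hf, hab]
  exact ⟨Equiv.ofBijective f (Finite.injective_iff_bijective.1 hi), hf⟩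

lemma gact_shift (x : Pt d) (ω : Config d) :
    gact π s (shift (signedPerm π s x) ω) = shift x (gact π s ω) := by
  funext y
  simp only [gact, shift, sp_add]

/-- the transformed direction -/
def thp (θ : Fin d → ℝ) : Fin d → ℝ := fun b => if s (π.symm b) then -θ (π.symm b) else θ (π.symm b)

lemma thp_dir (θ : Fin d → ℝ) (x : Pt d) :
    ∑ a, θ a * (signedPerm π s x a : ℝ) = ∑ b, thp π s θ b * (x b : ℝ) := by
  rw [← Equiv.sum_comp π (fun b => thp π s θ b * (x b : ℝ))]
  refine Finset.sum_congr rfl fun a _ => ?_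
  simp only [thp, signedPerm, Equiv.symm_apply_apply]
  split_ifs <;> push_cast <;> ring

lemma gact_zero : signedPerm π s 0 = 0 := by funext i; simp [signedPerm]

variable {mu : Measure (Config d)} [IsProbabilityMeasure mu] {h : Fin d → Config d → Dir d → ℝ}
  {ψ : Fin d → ℕ → Config d → ℝ}

lemma Qf_gact (hg : MeasurePreserving (gact π s) mu mu) (θ : Fin d → ℝ) {φ : Config d → ℝ} (hφ : BM φ) :
    Qf mu θ (fun ω => φ (gact π s ω)) = Qf mu (thp π s θ) φ := by
  obtain ⟨E, hE⟩ := sp_dirEquiv π s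
  set G : Config d → ℝ := fun ω => ∑ e, ei e ω * (∑ a, thp π s θ a * (dir e a : ℝ) + (φ (shift (dir e) ω) - φ ω))^2 with hG
  have hGm : Measurable G := Finset.measurable_fun_sum _ fun e _ =>
    (ei_meas e).mul ((((hφ.1.comp (measurable_shift _)).sub hφ.1).const_add _).pow_const 2)
  have h2 : Qf mu (thp π s θ) φ = ∫ ω, G (gact π s ω) ∂mu := by
    rw [← integral_map hg.measurable.aemeasurable hGm.aestronglyMeasurable, hg.map_eq]
    rfl
  rw [h2, Qf]
  refine integral_congr_ae (Eventually.of_forall fun ω => ?_)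
  simp only [hG]
  rw [← Equiv.sum_comp E]
  refine Finset.sum_congr rfl fun e _ => ?_
  rw [← hE, gact_shift, thp_dir]
  congr 1
  by_cases h0 : (0 : Pt d) ∈ Sinf ω ∧ dir (E e) ∈ Sinf ω
  · rw [ei_one h0.1 h0.2, ei_one ((Sinf_sp π s ω 0).2 (by rw [gact_zero]; exact h0.1))
      ((Sinf_sp π s ω _).2 (by rw [hE]; exact h0.2))]
  · have h1 : ¬ ((0 : Pt d) ∈ Sinf (gact π s ω) ∧ dir e ∈ Sinf (gact π s ω)) := by
      rw [Sinf_sp, Sinf_sp, gact_zero, hE]; exact h0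
    unfold ei
    rw [Set.indicator_of_notMem (by exact h0), Set.indicator_of_notMem (by exact h1)]

lemma Corr.Mq_thp (hc : Corr mu h ψ) (hg : MeasurePreserving (gact π s) mu mu) (θ : Fin d → ℝ) :
    Mq mu h θ ≤ Mq mu h (thp π s θ) := by
  set θ' := thp π s θ
  have hb : ∀ k, BM (fun ω => ∑ a, θ' a * ψ a k ω) := fun k => BM.comb θ' _ fun a => hc.bm a k
  have h1 : ∀ k : ℕ, Mq mu h θ ≤ Mq mu h θ' + (d * ∑ a, (θ' a)^2) * (1/4)^k := by
    intro k
    have hb2 : BM (fun ω => (fun ω => ∑ a, θ' a * ψ a k ω) (gact π s ω)) := by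
      obtain ⟨B, hB⟩ := (hb k).2
      exact ⟨(hb k).1.comp hg.measurable, B, fun ω => hB _⟩
    have q1 := hc.Qf_eq θ hb2
    have q2 := hc.Qf_eq θ' (hb k)
    rw [Qf_gact π s hg θ (hb k)] at q1
    have q3 := hc.Af_small θ' k
    have q4 : 0 ≤ Af mu h θ (fun ω => (fun ω => ∑ a, θ' a * ψ a k ω) (gact π s ω)) :=
      integral_nonneg fun ω => Finset.sum_nonneg fun e _ => sq_nonneg _
    linarith
  have hlim : Tendsto (fun k : ℕ => Mq mu h θ' + (d * ∑ a, (θ' a)^2) * (1/4:ℝ)^k) atTop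
      (nhds (Mq mu h θ' + (d * ∑ a, (θ' a)^2) * 0)) :=
    Tendsto.const_add _ (Tendsto.const_mul _ (tendsto_pow_atTop_nhds_zero_of_lt_one (by norm_num) (by norm_num)))
  rw [mul_zero, add_zero] at hlim
  exact ge_of_tendsto' hlim h1
end iso

section
variable {mu : Measure (Config d)} [IsProbabilityMeasure mu] {h : Fin d → Config d → Dir d → ℝ}
  {ψ : Fin d → ℕ → Config d → ℝ}

lemma Corr.iso (hd : 0 < d) (hc : Corr mu h ψ) (hη : 0 < mu.real {ω | (0 : Pt d) ∈ Sinf ω})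
    (hp : (CovM mu h).PosDef)
    (hg : ∀ (π : Equiv.Perm (Fin d)) (ε : Fin d → Bool),
            MeasurePreserving (fun ω : Config d => fun x => ω (signedPerm π ε x)) mu mu) :
    ∃ σ > (0:ℝ), CovM mu h = σ • (1 : Matrix (Fin d) (Fin d) ℝ) := by
  have key : ∀ π s θ, ∑ a, ∑ b, θ a * CovM mu h a b * θ b ≤
      ∑ a, ∑ b, thp π s θ a * CovM mu h a b * thp π s θ b := by
    intro π s θ
    have := hc.Mq_thp π s (hg π s) θ
    rw [hc.Mq_eq hd hη, hc.Mq_eq hd hη] at this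
    have hpos : 0 < 2 * (d:ℝ) * mu.real {ω | (0 : Pt d) ∈ Sinf ω} := by positivity
    exact le_of_mul_le_mul_left this hpos
  have hoff : ∀ a b, a ≠ b → CovM mu h a b = 0 := by
    intro a b hab
    have hq : ∀ x y : ℝ, ∑ i, ∑ j, (Pi.single a x + Pi.single b y : Fin d → ℝ) i * CovM mu h i j *
        (Pi.single a x + Pi.single b y : Fin d → ℝ) j =
        x * x * CovM mu h a a + y * y * CovM mu h b b + 2 * x * y * CovM mu h a b := by
      intro x y
      have hsym := CovM_symm (mu := mu) (h := h) a b
      simp only [Pi.add_apply, add_mul, mul_add, Finset.sum_add_distrib, Pi.single_apply, ite_mul, mul_ite, zero_mul, mul_zero,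
        Finset.sum_ite_eq', Finset.sum_ite_eq, Finset.mem_univ, if_true]
      rw [← hsym]
      ring
    have ht : ∀ x y : ℝ, thp 1 (fun i => decide (i = a)) (Pi.single a x + Pi.single b y) = Pi.single a (-x) + Pi.single b y := by
      intro x y
      funext i
      simp only [thp, Equiv.Perm.one_symm, Equiv.Perm.coe_one, id, Pi.add_apply, Pi.single_apply, decide_eq_true_eq]
      by_cases h1 : i = a
      · subst h1; simp [hab]
      · simp [h1]
    have k1 := key 1 (fun i => decide (i = a)) (Pi.single a 1 + Pi.single b 1)
    have k2 := key 1 (fun i => decide (i = a)) (Pi.single a (-1) + Pi.single b 1)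
    rw [ht, hq, hq] at k1 k2
    linarith
  have hdiag : ∀ a b, CovM mu h a a ≤ CovM mu h b b := by
    intro a b
    have hq : ∀ a, ∑ i, ∑ j, (Pi.single a 1 : Fin d → ℝ) i * CovM mu h i j * (Pi.single a 1 : Fin d → ℝ) j = CovM mu h a a := by
      intro a
      simp [Pi.single_apply]
    have ht : thp (Equiv.swap a b) (fun _ => false) (Pi.single a 1) = Pi.single b 1 := by
      funext i
      simp only [thp, Equiv.symm_swap, Pi.single_apply, Equiv.swap_apply_eq_iff, Equiv.swap_apply_left]
      simp
    have := key (Equiv.swap a b) (fun _ => false) (Pi.single a 1)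
    rwa [ht, hq, hq] at this
  refine ⟨CovM mu h ⟨0, hd⟩ ⟨0, hd⟩, hp.diag_pos, ?_⟩
  ext a b
  by_cases hab : a = b
  · subst hab
    simp [le_antisymm (hdiag a ⟨0, hd⟩) (hdiag ⟨0, hd⟩ a)]
  · simp [Matrix.one_apply, hab, hoff a b hab]
end
end Perco

namespace Perco
variable {d : ℕ}

/-- the cluster event -/
def E0 (d : ℕ) : Set (Config d) := {ω | (0 : Pt d) ∈ Sinf ω}

lemma E0_meas : MeasurableSet (E0 d) := measurableSet_Sinf 0

/-- one step of the environment seen from the walk -/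
def nx (e : Dir d) (ω : Config d) : Config d := if ω (dir e) then shift (dir e) ω else ω

lemma nx_meas (e : Dir d) : Measurable (nx e : Config d → Config d) := by
  unfold nx
  refine Measurable.ite ?_ (measurable_shift _) measurable_id
  have : Measurable fun ω : Config d => ω (dir e) := measurable_pi_apply (dir e)
  exact this (measurableSet_singleton true)

/-- the environment operator -/
noncomputable def Pe (f : Config d → ℝ) (ω : Config d) : ℝ := (2*d : ℝ)⁻¹ * ∑ e, f (nx e ω)

/-- the measure restricted to the cluster event -/
noncomputable def Qm (mu : Measure (Config d)) : Measure (Config d) := mu.restrict (E0 d)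

instance (mu : Measure (Config d)) [IsProbabilityMeasure mu] : IsFiniteMeasure (Qm mu) := by
  unfold Qm; infer_instance

lemma dir_mem_iff {ω : Config d} (h0 : (0 : Pt d) ∈ Sinf ω) (e : Dir d) : dir e ∈ Sinf ω ↔ ω (dir e) = true := by
  have := Sinf_dir h0 e
  rwa [zero_add] at this

lemma Qm_map {mu : Measure (Config d)} [IsProbabilityMeasure mu] (hs : Stat mu) {s : Set (Config d)} (hm : MeasurableSet s) :
    ∑ e, Qm mu (nx e ⁻¹' s) = (2 * d : ℕ) * Qm mu s := by
  have hA : ∀ e : Dir d, MeasurableSet {ω : Config d | (0 : Pt d) ∈ Sinf ω ∧ dir e ∈ Sinf ω} := fun e =>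
    (measurableSet_Sinf 0).inter (measurableSet_Sinf _)
  have h1 : ∀ e, Qm mu (nx e ⁻¹' s) = mu ({ω | (0 : Pt d) ∈ Sinf ω ∧ dir (opp e) ∈ Sinf ω} ∩ s) +
      mu ((E0 d ∩ s) \ {ω | (0 : Pt d) ∈ Sinf ω ∧ dir e ∈ Sinf ω}) := by
    intro e
    rw [Qm, Measure.restrict_apply (nx_meas e hm), ← measure_inter_add_sdiff _ (hA e)]
    congr 1
    · rw [← (hs (dir e)).measure_preimage (((hA (opp e)).inter hm).nullMeasurableSet)]
      congr 1
      ext ω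
      simp only [Set.mem_inter_iff, Set.mem_preimage, Set.mem_ofPred_eq, E0, Sinf_shift, add_zero, dir_opp, add_neg_cancel]
      constructor
      · rintro ⟨⟨h1, h2⟩, h3, h4⟩
        refine ⟨⟨h4, h3⟩, ?_⟩
        rwa [nx, if_pos ((dir_mem_iff h3 e).1 h4)] at h1
      · rintro ⟨⟨h4, h3⟩, h1⟩
        refine ⟨⟨?_, h3⟩, h3, h4⟩
        rwa [nx, if_pos ((dir_mem_iff h3 e).1 h4)]
    · congr 1
      ext ω
      simp only [Set.mem_inter_iff, Set.mem_preimage, Set.mem_ofPred_eq, E0, Set.mem_sdiff]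
      constructor
      · rintro ⟨⟨h1, h2⟩, h3⟩
        refine ⟨⟨h2, ?_⟩, h3⟩
        rwa [nx, if_neg (fun h => h3 ⟨h2, (dir_mem_iff h2 e).2 h⟩)] at h1
      · rintro ⟨⟨h2, h1⟩, h3⟩
        refine ⟨⟨?_, h2⟩, h3⟩
        rwa [nx, if_neg (fun h => h3 ⟨h2, (dir_mem_iff h2 e).2 h⟩)]
  simp only [h1]
  rw [Finset.sum_add_distrib]
  have h2 := Equiv.sum_comp (oppEquiv d) fun e => mu ({ω | (0 : Pt d) ∈ Sinf ω ∧ dir e ∈ Sinf ω} ∩ s)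
  have h3 : ∀ e, (oppEquiv d) e = opp e := fun e => rfl
  simp only [h3] at h2
  rw [h2, ← Finset.sum_add_distrib]
  have h4 : ∀ e : Dir d, mu ({ω | (0 : Pt d) ∈ Sinf ω ∧ dir e ∈ Sinf ω} ∩ s) +
      mu ((E0 d ∩ s) \ {ω | (0 : Pt d) ∈ Sinf ω ∧ dir e ∈ Sinf ω}) = Qm mu s := by
    intro e
    rw [Qm, Measure.restrict_apply hm, Set.inter_comm s, ← measure_inter_add_sdiff (E0 d ∩ s) (hA e)]
    congr 2
    ext ω
    simp only [Set.mem_inter_iff, Set.mem_ofPred_eq, E0]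
    tauto
  simp only [h4]
  rw [Finset.sum_const, Finset.card_univ, nsmul_eq_mul]
  simp [mul_comm]

section
variable {mu : Measure (Config d)} [IsProbabilityMeasure mu]

lemma Qm_sum_map (hs : Stat mu) : ∑ e : Dir d, (Qm mu).map (nx e) = ((2 * d : ℕ) : ℝ≥0∞) • Qm mu := by
  refine Measure.ext fun s hm => ?_
  rw [Measure.finsetSum_apply, Measure.smul_apply, smul_eq_mul, ← Qm_map hs hm]
  exact Finset.sum_congr rfl fun e _ => Measure.map_apply (nx_meas e) hm

lemma Qm_map_le (hs : Stat mu) (e : Dir d) : (Qm mu).map (nx e) ≤ ((2 * d : ℕ) : ℝ≥0∞) • Qm mu := by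
  rw [← Qm_sum_map hs]
  refine Measure.le_iff.2 fun s hm => ?_
  rw [Measure.finsetSum_apply]
  exact Finset.single_le_sum (f := fun e : Dir d => (Qm mu).map (nx e) s) (fun _ _ => zero_le) (Finset.mem_univ e)

lemma nx_int (hs : Stat mu) {f : Config d → ℝ} (hf : Integrable f (Qm mu)) (e : Dir d) :
    Integrable (fun ω => f (nx e ω)) (Qm mu) := by
  have h1 : Integrable f ((Qm mu).map (nx e)) :=
    (hf.smul_measure (ENNReal.natCast_ne_top _)).mono_measure (Qm_map_le hs e)
  exact h1.comp_measurable (nx_meas e)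

lemma Pe_int (hs : Stat mu) {f : Config d → ℝ} (hf : Integrable f (Qm mu)) : Integrable (Pe f) (Qm mu) :=
  (integrable_finsetSum _ fun e _ => nx_int hs hf e).const_mul _

lemma Pe_meas {f : Config d → ℝ} (hf : Measurable f) : Measurable (Pe f) :=
  (Finset.measurable_fun_sum _ fun e _ => hf.comp (nx_meas e)).const_mul _

lemma Pe_integral (hd : 0 < d) (hs : Stat mu) {f : Config d → ℝ} (hf : Integrable f (Qm mu)) :
    ∫ ω, Pe f ω ∂(Qm mu) = ∫ ω, f ω ∂(Qm mu) := by
  have h1 : ∀ e, Integrable f ((Qm mu).map (nx e)) := fun e =>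
    (hf.smul_measure (ENNReal.natCast_ne_top _)).mono_measure (Qm_map_le hs e)
  have h2 : ∫ ω, f ω ∂(∑ e : Dir d, (Qm mu).map (nx e)) = ∑ e, ∫ ω, f (nx e ω) ∂(Qm mu) := by
    rw [integral_finsetSum_measure fun e _ => h1 e]
    exact Finset.sum_congr rfl fun e _ => integral_map (nx_meas e).aemeasurable (h1 e).aestronglyMeasurable
  rw [Qm_sum_map hs, integral_smul_measure] at h2
  unfold Pe
  rw [integral_const_mul, integral_finsetSum _ fun e _ => nx_int hs hf e, ← h2]
  have : (d:ℝ) ≠ 0 := by positivity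
  simp only [ENNReal.toReal_natCast, smul_eq_mul]
  push_cast
  field_simp

lemma Pe_mono {f g : Config d → ℝ} (h : ∀ ω, f ω ≤ g ω) (ω : Config d) : Pe f ω ≤ Pe g ω := by
  unfold Pe
  gcongr
  exact h _

lemma Pe_add (f g : Config d → ℝ) : Pe (f + g) = Pe f + Pe g := by
  funext ω
  simp only [Pe, Pi.add_apply, Finset.sum_add_distrib, mul_add]

lemma Pe_zero : Pe (0 : Config d → ℝ) = 0 := by funext ω; simp [Pe]

lemma Pe_const (hd : 0 < d) (c : ℝ) : Pe (fun _ : Config d => c) = fun _ => c := by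
  funext ω
  have : (d:ℝ) ≠ 0 := by positivity
  simp only [Pe, Finset.sum_const, Finset.card_univ, Fintype.card_prod, Fintype.card_fin, Fintype.card_bool, nsmul_eq_mul]
  push_cast
  field_simp

lemma Pe_nonneg {f : Config d → ℝ} (h : ∀ ω, 0 ≤ f ω) (ω : Config d) : 0 ≤ Pe f ω := by
  unfold Pe
  have : 0 ≤ ∑ e, f (nx e ω) := Finset.sum_nonneg fun e _ => h _
  positivity

/-- Cesaro sums, by recursion -/
noncomputable def Sn (f : Config d → ℝ) : ℕ → Config d → ℝ
  | 0 => 0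
  | n+1 => f + Pe (Sn f n)

/-- Garsia's maximal functions -/
noncomputable def Mx (f : Config d → ℝ) : ℕ → Config d → ℝ
  | 0 => 0
  | n+1 => fun ω => max 0 (f ω + Pe (Mx f n) ω)

lemma Mx_nonneg (f : Config d → ℝ) (n : ℕ) (ω : Config d) : 0 ≤ Mx f n ω := by
  cases n with
  | zero => exact le_rfl
  | succ n => exact le_max_left _ _

lemma Mx_mono (f : Config d → ℝ) (n : ℕ) (ω : Config d) : Mx f n ω ≤ Mx f (n+1) ω := by
  induction n generalizing ω with
  | zero => exact Mx_nonneg f _ ω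
  | succ n ih =>
    have := Pe_mono ih ω
    exact max_le_max le_rfl (by linarith)

lemma Sn_le_Mx (f : Config d → ℝ) (n : ℕ) (ω : Config d) : Sn f n ω ≤ Mx f n ω := by
  induction n generalizing ω with
  | zero => exact le_rfl
  | succ n ih =>
    refine le_trans ?_ (le_max_right _ _)
    have := Pe_mono ih ω
    simp only [Sn, Pi.add_apply]
    linarith

lemma Mx_meas {f : Config d → ℝ} (hf : Measurable f) (n : ℕ) : Measurable (Mx f n) := by
  induction n with
  | zero => exact measurable_const
  | succ n ih => exact measurable_const.max (hf.add (Pe_meas ih))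

lemma Mx_int (hs : Stat mu) {f : Config d → ℝ} (hf : Integrable f (Qm mu)) (n : ℕ) : Integrable (Mx f n) (Qm mu) := by
  induction n with
  | zero => exact integrable_zero _ _ _
  | succ n ih => exact (integrable_zero _ _ _).sup (hf.add (Pe_int hs ih))

lemma garsia (hd : 0 < d) (hs : Stat mu) {f : Config d → ℝ} (hm : Measurable f) (hf : Integrable f (Qm mu)) (n : ℕ) :
    0 ≤ ∫ ω in {ω | 0 < Mx f (n+1) ω}, f ω ∂(Qm mu) := by
  have hA : MeasurableSet {ω | 0 < Mx f (n+1) ω} := measurableSet_lt measurable_const (Mx_meas hm _)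
  have i1 := Mx_int hs hf (n+1)
  have i2 := Pe_int hs (Mx_int hs hf n)
  have h1 : ∫ ω in {ω | 0 < Mx f (n+1) ω}, f ω ∂(Qm mu) =
      ∫ ω in {ω | 0 < Mx f (n+1) ω}, (Mx f (n+1) ω - Pe (Mx f n) ω) ∂(Qm mu) := by
    refine setIntegral_congr_fun hA fun ω hω => ?_
    have h2 : 0 < max 0 (f ω + Pe (Mx f n) ω) := hω
    have h3 : Mx f (n+1) ω = max 0 (f ω + Pe (Mx f n) ω) := rfl
    have h4 : 0 < f ω + Pe (Mx f n) ω := by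
      rcases lt_max_iff.1 h2 with h | h
      · exact absurd h (lt_irrefl _)
      · exact h
    rw [h3, max_eq_right h4.le]; ring
  rw [h1, integral_sub i1.integrableOn i2.integrableOn]
  have h2 : ∫ ω in {ω | 0 < Mx f (n+1) ω}, Mx f (n+1) ω ∂(Qm mu) = ∫ ω, Mx f (n+1) ω ∂(Qm mu) := by
    refine setIntegral_eq_integral_of_forall_compl_eq_zero fun ω hω => ?_
    exact le_antisymm (not_lt.1 hω) (Mx_nonneg _ _ _)
  have h3 : ∫ ω in {ω | 0 < Mx f (n+1) ω}, Pe (Mx f n) ω ∂(Qm mu) ≤ ∫ ω, Mx f n ω ∂(Qm mu) := by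
    rw [← Pe_integral hd hs (Mx_int hs hf n)]
    exact setIntegral_le_integral i2 (Eventually.of_forall fun ω => Pe_nonneg (Mx_nonneg f n) ω)
  have h4 : ∫ ω, Mx f n ω ∂(Qm mu) ≤ ∫ ω, Mx f (n+1) ω ∂(Qm mu) :=
    integral_mono (Mx_int hs hf n) i1 fun ω => Mx_mono f n ω
  linarith

lemma Sn_sub_const (hd : 0 < d) (f : Config d → ℝ) (c : ℝ) (n : ℕ) :
    Sn (fun ω => f ω - c) n = fun ω => Sn f n ω - n * c := by
  induction n with
  | zero => funext ω; simp [Sn]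
  | succ n ih =>
    have h1 : (fun ω => Sn f n ω - n * c) = Sn f n + fun _ => - (n * c) := by funext ω; simp [sub_eq_add_neg]
    funext ω
    simp only [Sn, Pi.add_apply, ih, h1, Pe_add, Pe_const hd]
    push_cast; ring

lemma hopf_fin (hd : 0 < d) (hs : Stat mu) {f : Config d → ℝ} (hm : Measurable f) (hf : Integrable f (Qm mu))
    (h0 : ∀ ω, 0 ≤ f ω) {lam : ℝ} (hl : 0 < lam) (N : ℕ) :
    Qm mu {ω | 0 < Mx (fun ω => f ω - lam) N ω} ≤ ENNReal.ofReal ((∫ ω, f ω ∂(Qm mu)) / lam) := by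
  cases N with
  | zero => simp [Mx]
  | succ N =>
    have hm' : Measurable fun ω => f ω - lam := hm.sub_const _
    have hf' : Integrable (fun ω => f ω - lam) (Qm mu) := hf.sub (integrable_const _)
    have h1 := garsia hd hs hm' hf' N
    set A := {ω | 0 < Mx (fun ω => f ω - lam) (N+1) ω}
    rw [integral_sub hf.integrableOn (integrable_const _).integrableOn, setIntegral_const, smul_eq_mul] at h1
    have h2 : ∫ ω in A, f ω ∂(Qm mu) ≤ ∫ ω, f ω ∂(Qm mu) :=
      setIntegral_le_integral hf (Eventually.of_forall h0)
    rw [← ofReal_measureReal]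
    apply ENNReal.ofReal_le_ofReal
    rw [le_div_iff₀ hl]
    linarith

lemma hopf (hd : 0 < d) (hs : Stat mu) {f : Config d → ℝ} (hm : Measurable f) (hf : Integrable f (Qm mu))
    (h0 : ∀ ω, 0 ≤ f ω) {lam : ℝ} (hl : 0 < lam) :
    Qm mu {ω | ∃ n : ℕ, n * lam < Sn f n ω} ≤ ENNReal.ofReal ((∫ ω, f ω ∂(Qm mu)) / lam) := by
  have h1 : {ω | ∃ n : ℕ, n * lam < Sn f n ω} ⊆ ⋃ N, {ω | 0 < Mx (fun ω => f ω - lam) N ω} := by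
    rintro ω ⟨n, hn⟩
    refine Set.mem_iUnion.2 ⟨n, ?_⟩
    have := Sn_le_Mx (fun ω => f ω - lam) n ω
    rw [Sn_sub_const hd] at this
    show 0 < Mx (fun ω => f ω - lam) n ω
    linarith
  refine (measure_mono h1).trans ?_
  rw [Monotone.measure_iUnion]
  · exact iSup_le fun N => hopf_fin hd hs hm hf h0 hl N
  · refine monotone_nat_of_le_succ fun n ω hω => ?_
    exact lt_of_lt_of_le (show 0 < Mx (fun ω => f ω - lam) n ω from hω) (Mx_mono _ n ω)

lemma hopf_bc (hd : 0 < d) (hs : Stat mu) {f : ℕ → Config d → ℝ} (hm : ∀ k, Measurable (f k))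
    (hf : ∀ k, Integrable (f k) (Qm mu)) (h0 : ∀ k ω, 0 ≤ f k ω) (hi : ∀ k, ∫ ω, f k ω ∂(Qm mu) ≤ (1/4)^k) :
    ∀ᵐ ω ∂(Qm mu), ∀ ε > 0, ∃ k, ∀ n : ℕ, Sn (f k) n ω ≤ ε * n := by
  have h1 : ∑' k, Qm mu {ω | ∃ n : ℕ, n * (1/2:ℝ)^k < Sn (f k) n ω} ≠ ∞ := by
    have : ∀ k : ℕ, Qm mu {ω | ∃ n : ℕ, n * (1/2:ℝ)^k < Sn (f k) n ω} ≤ ENNReal.ofReal ((1/2)^k) := by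
      intro k
      refine (hopf hd hs (hm k) (hf k) (h0 k) (by positivity)).trans (ENNReal.ofReal_le_ofReal ?_)
      rw [div_le_iff₀ (by positivity), ← mul_pow]
      norm_num
      simpa using hi k
    refine ne_top_of_le_ne_top ?_ (ENNReal.tsum_le_tsum this)
    rw [← ENNReal.ofReal_tsum_of_nonneg (fun k => by positivity) summable_geometric_two]
    exact ENNReal.ofReal_ne_top
  filter_upwards [ae_eventually_notMem h1] with ω hω ε hε
  have h2 : ∀ᶠ k : ℕ in atTop, (1/2:ℝ)^k < ε :=
    (tendsto_pow_atTop_nhds_zero_of_lt_one (by norm_num) (by norm_num)).eventually (gt_mem_nhds hε)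
  obtain ⟨k, hk1, hk2⟩ := (hω.and h2).exists
  refine ⟨k, fun n => ?_⟩
  have h3 : Sn (f k) n ω ≤ n * (1/2)^k := by
    by_contra h
    exact hk1 ⟨n, not_le.1 h⟩
  calc Sn (f k) n ω ≤ n * (1/2)^k := h3
    _ ≤ n * ε := by gcongr
    _ = ε * n := mul_comm _ _

end
end Perco

namespace Perco
variable {d : ℕ}
section
variable {mu : Measure (Config d)} [IsProbabilityMeasure mu]

/-- truncation -/
noncomputable def clp (K : ℕ) (x : ℝ) : ℝ := max (-(K:ℝ)) (min K x)

lemma clp_mono (K : ℕ) {x y : ℝ} (h : x ≤ y) : clp K x ≤ clp K y :=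
  max_le_max le_rfl (min_le_min le_rfl h)

lemma clp_abs (K : ℕ) (x : ℝ) : |clp K x| ≤ K := by
  have hK : (0:ℝ) ≤ K := by positivity
  rw [abs_le]
  exact ⟨le_max_left _ _, max_le (by linarith) (min_le_left _ _)⟩

lemma clp_eq {K : ℕ} {x : ℝ} (h : |x| ≤ K) : clp K x = x := by
  rw [abs_le] at h
  rw [clp, min_eq_right h.2, max_eq_right h.1]

lemma clp_mul_nonneg (K : ℕ) (x y : ℝ) : 0 ≤ (x - y) * (clp K x - clp K y) := by
  rcases le_total x y with h | h
  · exact mul_nonneg_of_nonpos_of_nonpos (by linarith) (by linarith [clp_mono K h])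
  · exact mul_nonneg (by linarith) (by linarith [clp_mono K h])

lemma clp_meas (K : ℕ) : Measurable (clp K) := measurable_const.max (measurable_const.min measurable_id)

lemma grad_zero (hs : Stat mu) {f : Config d → ℝ} (hm : Measurable f) (hf : Integrable f mu)
    (H : ∀ ψ, BM ψ → ∫ ω, ∑ e, ei e ω * (f ω * (ψ ω - ψ (shift (dir e) ω))) ∂mu = 0) :
    ∀ᵐ ω ∂mu, ∀ e, ei e ω = 1 → f (shift (dir e) ω) = f ω := by
  have key : ∀ K : ℕ, ∀ᵐ ω ∂mu, ∀ e, ei e ω * ((f ω - f (shift (dir e) ω)) *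
      (clp K (f ω) - clp K (f (shift (dir e) ω)))) = 0 := by
    intro K
    set ψ : Config d → ℝ := fun ω => clp K (f ω) with hψ
    have hψm : Measurable ψ := (clp_meas K).comp hm
    have hb : BM ψ := ⟨hψm, K, fun ω => clp_abs K _⟩
    have hdm : ∀ e, Measurable fun ω => ei e ω * (ψ ω - ψ (shift (dir e) ω)) := fun e =>
      (ei_meas e).mul (hψm.sub (hψm.comp (measurable_shift _)))
    have hdb : ∀ e ω, |ei e ω * (ψ ω - ψ (shift (dir e) ω))| ≤ K + K := by
      intro e ω
      rw [abs_mul]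
      refine (mul_le_of_le_one_left (abs_nonneg _) (ei_abs_le e ω)).trans ?_
      exact (abs_sub _ _).trans (add_le_add (clp_abs K _) (clp_abs K _))
    have i1 : ∀ e, Integrable (fun ω => ei e ω * (f ω * (ψ ω - ψ (shift (dir e) ω)))) mu := fun e =>
      (hf.mul_bdd (c := K + K) (hdm e).aestronglyMeasurable (Eventually.of_forall (hdb e))).congr
        (Eventually.of_forall fun ω => by dsimp only; ring)
    have hfs : ∀ e : Dir d, Integrable (fun ω => f (shift (dir e) ω)) mu := fun e =>
      (hs (dir e)).integrable_comp_of_integrable hf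
    have i2 : ∀ e, Integrable (fun ω => ei e ω * (f (shift (dir e) ω) * (ψ (shift (dir e) ω) - ψ ω))) mu := fun e =>
      ((hfs e).mul_bdd (c := K + K) (hdm e).neg.aestronglyMeasurable (Eventually.of_forall fun ω => by
        simpa using hdb e ω)).congr (Eventually.of_forall fun ω => by simp only [Pi.neg_apply]; ring)
    have hsym : ∫ ω, ∑ e, ei e ω * (f (shift (dir e) ω) * (ψ (shift (dir e) ω) - ψ ω)) ∂mu = 0 := by
      rw [← H ψ hb, integral_finsetSum _ fun e _ => i2 e, integral_finsetSum _ fun e _ => i1 e,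
        ← Equiv.sum_comp (oppEquiv d) (fun e => ∫ ω, ei e ω * (f ω * (ψ ω - ψ (shift (dir e) ω))) ∂mu)]
      refine Finset.sum_congr rfl fun e _ => ?_
      have hG : Measurable (fun ω => ei (opp e) ω * (f ω * (ψ ω - ψ (shift (dir (opp e)) ω)))) :=
        (ei_meas _).mul (hm.mul (hψm.sub (hψm.comp (measurable_shift _))))
      have := hs.integral (dir e) hG
      rw [show (oppEquiv d) e = opp e from rfl, ← this]
      refine integral_congr_ae (Eventually.of_forall fun ω => ?_)
      dsimp only
      rw [ei_opp, shift_shift, dir_opp, add_neg_cancel, shift_zero]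
    have hz : ∫ ω, ∑ e, ei e ω * ((f ω - f (shift (dir e) ω)) * (ψ ω - ψ (shift (dir e) ω))) ∂mu = 0 := by
      have := congrArg₂ (· + ·) (H ψ hb) hsym
      rw [← integral_add (integrable_finsetSum _ fun e _ => i1 e) (integrable_finsetSum _ fun e _ => i2 e), add_zero] at this
      rw [← this]
      refine integral_congr_ae (Eventually.of_forall fun ω => ?_)
      dsimp only
      rw [← Finset.sum_add_distrib]
      exact Finset.sum_congr rfl fun e _ => by ring
    have hnn : ∀ ω e, 0 ≤ ei e ω * ((f ω - f (shift (dir e) ω)) * (ψ ω - ψ (shift (dir e) ω))) := fun ω e =>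
      mul_nonneg (ei_nonneg e ω) (clp_mul_nonneg K _ _)
    have hii : Integrable (fun ω => ∑ e, ei e ω * ((f ω - f (shift (dir e) ω)) * (ψ ω - ψ (shift (dir e) ω)))) mu := by
      refine ((integrable_finsetSum Finset.univ fun e _ => i1 e).add (integrable_finsetSum Finset.univ fun e _ => i2 e)).congr
        (Eventually.of_forall fun ω => ?_)
      simp only [Pi.add_apply]
      rw [← Finset.sum_add_distrib]
      exact Finset.sum_congr rfl fun e _ => by ring
    have := (integral_eq_zero_iff_of_nonneg (fun ω => Finset.sum_nonneg fun e _ => hnn ω e) hii).1 hz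
    filter_upwards [this] with ω hω e
    exact (Finset.sum_eq_zero_iff_of_nonneg fun e _ => hnn ω e).1 hω e (Finset.mem_univ e)
  filter_upwards [ae_all_iff.2 key] with ω hω e he
  obtain ⟨K, hK⟩ := exists_nat_ge (max |f ω| |f (shift (dir e) ω)|)
  have h1 := hω K e
  rw [he, one_mul, clp_eq ((le_max_left _ _).trans hK), clp_eq ((le_max_right _ _).trans hK)] at h1
  have := mul_self_eq_zero.1 h1
  linarith

lemma GoodGeom.conn_all {ω : Config d} {rho W : Pt d → ℕ} {K n0 : ℕ} (hg : GoodGeom ω rho W K n0) {x y : Pt d}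
    (hx : x ∈ Sinf ω) (hy : y ∈ Sinf ω) : connIn (Sinf ω) x y := by
  have h := hg.big (max n0 (max (nrm x) (nrm y))) (le_max_left _ _) x hx y hy
    (le_trans (le_max_left _ _) (le_max_right _ _)) (le_trans (le_max_right _ _) (le_max_right _ _))
  exact ⟨hx, hy, Relation.ReflTransGen.mono (fun a b hab => ⟨hab.1, hab.2.1.1, hab.2.2.1⟩) _ _ h.2.2⟩

lemma const_of_grad (hd : 1 ≤ d) (hs : Stat mu) (ht : TailB mu) (e0 : Dir d) (he : Ergodic (shift (dir e0)) mu)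
    {f : Config d → ℝ} (hm : Measurable f)
    (hf : ∀ᵐ ω ∂mu, ∀ e, ei e ω = 1 → f (shift (dir e) ω) = f ω) :
    ∃ c, ∀ᵐ ω ∂(Qm mu), f ω = c := by
  have h1 : ∀ᵐ ω ∂mu, ∀ x : Pt d, ∀ e, ei e (shift x ω) = 1 → f (shift (x + dir e) ω) = f (shift x ω) := by
    rw [ae_all_iff]
    intro x
    filter_upwards [(hs x).quasiMeasurePreserving.ae hf] with ω hω e h
    have := hω e h
    rwa [shift_shift] at this
  have h2 : ∀ᵐ ω ∂mu, ∀ x ∈ Sinf ω, ∀ y ∈ Sinf ω, f (shift x ω) = f (shift y ω) := by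
    filter_upwards [h1, exists_goodGeom hd hs ht] with ω hω hg x hx y hy
    obtain ⟨rho, W, K, n0, hg⟩ := hg
    have hr := (hg.conn_all hx hy).2.2
    clear hy
    induction hr with
    | refl => rfl
    | @tail b c _ hbc ih =>
      rw [ih]
      obtain ⟨e, rfl⟩ := (adj_iff b c).1 hbc.1
      exact (hω b e (ei_shift_one hbc.2.1 hbc.2.2)).symm
  have h3 := exists_eventuallyEq_const_of_forall_separating (f := f) (l := ae (Qm mu)) MeasurableSet (fun U hU => ?_)
  · obtain ⟨c, hc⟩ := h3
    exact ⟨c, hc⟩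
  · set A : Set (Config d) := {ω | ∃ x : Pt d, x ∈ Sinf ω ∧ f (shift x ω) ∈ U} with hA
    have hAm : MeasurableSet A := by
      have : A = ⋃ x : Pt d, {ω | x ∈ Sinf ω} ∩ (fun ω => f (shift x ω)) ⁻¹' U := by
        ext ω; simp [hA]
      rw [this]
      exact MeasurableSet.iUnion fun x => (measurableSet_Sinf x).inter ((hm.comp (measurable_shift x)) hU)
    have hinv : shift (dir e0) ⁻¹' A = A := by
      ext ω
      simp only [hA, Set.mem_preimage, Set.mem_ofPred_eq, Sinf_shift, shift_shift]
      constructor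
      · rintro ⟨x, hx⟩; exact ⟨_, hx⟩
      · rintro ⟨x, hx⟩; exact ⟨-dir e0 + x, by simpa using hx⟩
    rcases he.toPreErgodic.measure_self_or_compl_eq_zero hAm hinv with h | h
    · right
      rw [Qm, ae_restrict_iff' E0_meas]
      filter_upwards [measure_eq_zero_iff_ae_notMem.1 h] with ω hω h0 hU
      exact hω ⟨0, h0, by rw [shift_zero]; exact hU⟩
    · left
      rw [Qm, ae_restrict_iff' E0_meas]
      filter_upwards [measure_eq_zero_iff_ae_notMem.1 h, h2] with ω hω h2 h0
      have : ω ∈ A := by simpa using hω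
      obtain ⟨x, hx, hxU⟩ := this
      have := h2 0 h0 x hx
      rw [shift_zero] at this
      rwa [this]

lemma nx_eq {ω : Config d} (h0 : (0 : Pt d) ∈ Sinf ω) (ψ : Config d → ℝ) (e : Dir d) :
    ψ (nx e ω) = ψ ω - ei e ω * (ψ ω - ψ (shift (dir e) ω)) := by
  by_cases h : dir e ∈ Sinf ω
  · rw [ei_one h0 h, nx, if_pos ((dir_mem_iff h0 e).1 h)]; ring
  · rw [ei_zero (fun h' => h h'.2), nx, if_neg (fun h' => h ((dir_mem_iff h0 e).2 h'))]; ring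

lemma sub_Pe (hd : 0 < d) {ω : Config d} (h0 : (0 : Pt d) ∈ Sinf ω) (ψ : Config d → ℝ) :
    ∑ e, ei e ω * (ψ ω - ψ (shift (dir e) ω)) = (2 * d) * (ψ ω - Pe ψ ω) := by
  have hd' : (d:ℝ) ≠ 0 := by positivity
  simp only [Pe, nx_eq h0 ψ, Finset.sum_sub_distrib, Finset.sum_const, Finset.card_univ, Fintype.card_prod,
    Fintype.card_fin, Fintype.card_bool, nsmul_eq_mul]
  push_cast
  field_simp
  ring

lemma Pe_smul (c : ℝ) (f : Config d → ℝ) : Pe (c • f) = c • Pe f := by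
  funext ω
  simp only [Pe, Pi.smul_apply, smul_eq_mul, ← Finset.mul_sum]
  ring

lemma BM.Pe {ψ : Config d → ℝ} (hd : 0 < d) (h : BM ψ) : BM (Pe ψ) := by
  obtain ⟨B, hB⟩ := h.2
  refine ⟨Pe_meas h.1, B, fun ω => ?_⟩
  have h1 := Pe_mono (g := fun _ => B) (fun ω => (abs_le.1 (hB ω)).2) ω
  have h2 := Pe_mono (f := fun _ => -B) (fun ω => (abs_le.1 (hB ω)).1) ω
  rw [Pe_const hd] at h1 h2
  exact abs_le.2 ⟨h2, h1⟩

lemma BM.sub {f g : Config d → ℝ} (hf : BM f) (hg : BM g) : BM (fun ω => f ω - g ω) := by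
  obtain ⟨B, hB⟩ := hf.2
  obtain ⟨B', hB'⟩ := hg.2
  exact ⟨hf.1.sub hg.1, B + B', fun ω => (abs_sub _ _).trans (add_le_add (hB _) (hB' _))⟩

lemma BM.int {f : Config d → ℝ} (hf : BM f) (ν : Measure (Config d)) [IsFiniteMeasure ν] : Integrable f ν := by
  obtain ⟨B, hB⟩ := hf.2
  exact Integrable.of_bound hf.1.aestronglyMeasurable B (Eventually.of_forall hB)

lemma BM.L2 {f : Config d → ℝ} (hf : BM f) (ν : Measure (Config d)) [IsFiniteMeasure ν] : MemLp f 2 ν := by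
  obtain ⟨B, hB⟩ := hf.2
  exact MemLp.of_bound hf.1.aestronglyMeasurable B (Eventually.of_forall hB)

/-- coboundaries -/
def cobd (d : ℕ) : Submodule ℝ (Config d → ℝ) where
  carrier := {v | ∃ ψ, BM ψ ∧ v = ψ - Pe ψ}
  zero_mem' := ⟨0, ⟨measurable_const, 0, fun ω => by simp⟩, by rw [Pe_zero]; simp⟩
  add_mem' := by
    rintro _ _ ⟨f, ⟨hf, B, hB⟩, rfl⟩ ⟨g, ⟨hg, B', hB'⟩, rfl⟩
    refine ⟨f + g, ⟨hf.add hg, B + B', fun ω => (abs_add_le _ _).trans (add_le_add (hB _) (hB' _))⟩, ?_⟩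
    rw [Pe_add]; abel
  smul_mem' := by
    rintro c _ ⟨f, ⟨hf, B, hB⟩, rfl⟩
    refine ⟨c • f, ⟨hf.const_smul c, |c| * B, fun ω => ?_⟩, ?_⟩
    · rw [Pi.smul_apply, smul_eq_mul, abs_mul]
      exact mul_le_mul_of_nonneg_left (hB ω) (abs_nonneg _)
    · rw [Pe_smul, smul_sub]

lemma env_dec0 (hd : 1 ≤ d) (hs : Stat mu) (ht : TailB mu) (e0 : Dir d) (he : Ergodic (shift (dir e0)) mu)
    {g : Config d → ℝ} (hg : BM g) :
    ∃ c, ∀ ε > 0, ∃ ψ, BM ψ ∧ ∫ ω, |g ω - c - (ψ ω - Pe ψ ω)| ∂(Qm mu) ≤ ε := by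
  obtain ⟨f, hfm, hf2, horth, happ⟩ := hilbert_proj (Qm mu) (cobd d) (by
    rintro _ ⟨ψ, hψ, rfl⟩
    exact (hψ.sub (hψ.Pe hd)).L2 _) g (hg.L2 _)
  have hF : Integrable (fun ω => g ω - f ω) (Qm mu) := (hg.int _).sub (hf2.integrable (by norm_num))
  have hgr := grad_zero hs (f := (E0 d).indicator fun ω => g ω - f ω) ((hg.1.sub hfm).indicator E0_meas)
    ((integrable_indicator_iff E0_meas).2 hF) (by
      intro ψ hψ
      have h1 : ∀ ω, ∑ e, ei e ω * ((E0 d).indicator (fun ω => g ω - f ω) ω * (ψ ω - ψ (shift (dir e) ω))) =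
          (E0 d).indicator (fun ω => (2 * d) * ((g ω - f ω) * (ψ ω - Pe ψ ω))) ω := by
        intro ω
        by_cases h0 : ω ∈ E0 d
        · rw [Set.indicator_of_mem h0, Set.indicator_of_mem h0]
          have := sub_Pe hd h0 ψ
          rw [mul_left_comm, ← this, Finset.mul_sum]
          exact Finset.sum_congr rfl fun e _ => by ring
        · rw [Set.indicator_of_notMem h0, Set.indicator_of_notMem h0]
          simp
      simp only [h1]
      rw [integral_indicator E0_meas, integral_const_mul]
      have := horth (ψ - Pe ψ) ⟨ψ, hψ, rfl⟩
      simp only [Pi.sub_apply] at this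
      rw [Qm] at this
      rw [this, mul_zero])
  obtain ⟨c, hc⟩ := const_of_grad hd hs ht e0 he ((hg.1.sub hfm).indicator E0_meas) hgr
  have hc' : ∀ᵐ ω ∂(Qm mu), g ω - f ω = c := by
    have : ∀ᵐ ω ∂(Qm mu), ω ∈ E0 d := ae_restrict_mem E0_meas
    filter_upwards [hc, this] with ω h1 h2
    rwa [Set.indicator_of_mem h2] at h1
  refine ⟨c, fun ε hε => ?_⟩
  obtain ⟨_, ⟨ψ, hψ, rfl⟩, hv⟩ := happ (ε^2) (by positivity)
  refine ⟨ψ, hψ, ?_⟩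
  have h2 : MemLp (fun ω => f ω - (ψ - Pe ψ) ω) 2 (Qm mu) := hf2.sub ((hψ.sub (hψ.Pe hd)).L2 _)
  have hQ : (Qm mu).real Set.univ ≤ 1 := by
    rw [Qm, measureReal_restrict_apply_univ]
    exact measureReal_le_one
  calc ∫ ω, |g ω - c - (ψ ω - Pe ψ ω)| ∂(Qm mu) ≤ ∫ ω, ((2*ε)⁻¹ * (f ω - (ψ - Pe ψ) ω)^2 + ε/2) ∂(Qm mu) := by
        refine integral_mono_of_nonneg (Eventually.of_forall fun ω => abs_nonneg _)
          ((h2.integrable_sq.const_mul _).add (integrable_const _)) ?_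
        filter_upwards [hc'] with ω hω
        have e1 : g ω - c - (ψ ω - Pe ψ ω) = f ω - (ψ - Pe ψ) ω := by
          rw [← hω, Pi.sub_apply]; ring
        rw [e1]
        set z := f ω - (ψ - Pe ψ) ω
        have e2 : (2*ε)⁻¹ * z^2 + ε/2 - |z| = (2*ε)⁻¹ * (|z| - ε)^2 := by
          rw [← sq_abs z]; field_simp; ring
        have e3 : 0 ≤ (2*ε)⁻¹ * (|z| - ε)^2 := by positivity
        linarith
    _ = (2*ε)⁻¹ * ∫ ω, (f ω - (ψ - Pe ψ) ω)^2 ∂(Qm mu) + (Qm mu).real Set.univ * (ε/2) := by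
        rw [integral_add (h2.integrable_sq.const_mul _) (integrable_const _), integral_const_mul, integral_const, smul_eq_mul]
    _ ≤ (2*ε)⁻¹ * ε^2 + 1 * (ε/2) := by gcongr
    _ = ε := by field_simp; ring

lemma cobd_integral (hd : 1 ≤ d) (hs : Stat mu) {ψ : Config d → ℝ} (hψ : BM ψ) :
    ∫ ω, (ψ ω - Pe ψ ω) ∂(Qm mu) = 0 := by
  rw [integral_sub (hψ.int _) ((hψ.Pe hd).int _), Pe_integral hd hs (hψ.int _), sub_self]

lemma env_dec (hd : 1 ≤ d) (hs : Stat mu) (ht : TailB mu) (e0 : Dir d) (he : Ergodic (shift (dir e0)) mu)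
    {g : Config d → ℝ} (hgm : Measurable g) (hg : Integrable g (Qm mu)) (hQ : 0 < (Qm mu).real Set.univ) {ε : ℝ} (hε : 0 < ε) :
    ∃ ψ, BM ψ ∧ ∫ ω, |g ω - (∫ ω, g ω ∂(Qm mu)) / (Qm mu).real Set.univ - (ψ ω - Pe ψ ω)| ∂(Qm mu) ≤ ε := by
  have hK : Tendsto (fun K : ℕ => ∫ ω, |g ω - clp K (g ω)| ∂(Qm mu)) atTop (nhds (∫ ω, (0:ℝ) ∂(Qm mu))) := by
    refine tendsto_integral_of_dominated_convergence (fun ω => |g ω| + |g ω|) (fun K => ?_) (hg.abs.add hg.abs) (fun K => ?_) ?_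
    · exact (hgm.sub ((clp_meas K).comp hgm)).abs.aestronglyMeasurable
    · refine Eventually.of_forall fun ω => ?_
      rw [Real.norm_eq_abs, abs_abs]
      refine (abs_sub _ _).trans (add_le_add le_rfl ?_)
      have hK : (0:ℝ) ≤ K := by positivity
      have := neg_abs_le (g ω)
      have := le_abs_self (g ω)
      have := abs_nonneg (g ω)
      rw [clp, abs_le]
      refine ⟨?_, max_le (by linarith) ((min_le_right _ _).trans (by linarith))⟩
      rcases le_total (K:ℝ) (g ω) with h | h
      · exact le_trans (by rw [min_eq_left h]; linarith) (le_max_right _ _)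
      · exact le_trans (by rw [min_eq_right h]; linarith) (le_max_right _ _)
    · refine Eventually.of_forall fun ω => ?_
      refine tendsto_const_nhds.congr' ?_
      filter_upwards [eventually_ge_atTop ⌈|g ω|⌉₊] with K hK
      rw [clp_eq ((Nat.le_ceil _).trans (by exact_mod_cast hK))]; simp
  simp only [integral_zero] at hK
  obtain ⟨K, hK⟩ := (hK.eventually (gt_mem_nhds (show 0 < ε/4 by positivity))).exists
  have hb : BM (fun ω => clp K (g ω)) := ⟨(clp_meas K).comp hgm, K, fun ω => clp_abs K _⟩
  obtain ⟨c, hc⟩ := env_dec0 hd hs ht e0 he hb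
  obtain ⟨ψ, hψ, h1⟩ := hc (ε/4) (by positivity)
  refine ⟨ψ, hψ, ?_⟩
  set q := (Qm mu).real Set.univ with hq
  have hcob := (hψ.sub (hψ.Pe hd)).int (Qm mu)
  have i1 : Integrable (fun ω => g ω - clp K (g ω)) (Qm mu) := hg.sub (hb.int _)
  have i2 : Integrable (fun ω => clp K (g ω) - c - (ψ ω - Pe ψ ω)) (Qm mu) := ((hb.int _).sub (integrable_const _)).sub hcob
  have i3 : Integrable (fun ω => g ω - c) (Qm mu) := hg.sub (integrable_const _)
  have i12 : Integrable (fun ω => |g ω - clp K (g ω)| + |clp K (g ω) - c - (ψ ω - Pe ψ ω)|) (Qm mu) := i1.abs.add i2.abs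
  have hcc : |c - (∫ ω, g ω ∂(Qm mu)) / q| * q ≤ ε/2 := by
    have e1 : (c - (∫ ω, g ω ∂(Qm mu)) / q) * q = - ∫ ω, ((g ω - clp K (g ω)) + (clp K (g ω) - c - (ψ ω - Pe ψ ω))) ∂(Qm mu) := by
      have e2 : ∀ ω, (g ω - clp K (g ω)) + (clp K (g ω) - c - (ψ ω - Pe ψ ω)) = (g ω - c) - (ψ ω - Pe ψ ω) := fun ω => by ring
      simp only [e2]
      rw [integral_sub i3 hcob, cobd_integral hd hs hψ, integral_sub hg (integrable_const _), integral_const,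
        smul_eq_mul, ← hq]
      field_simp; ring
    rw [← abs_of_pos hQ, ← abs_mul, abs_of_pos hQ, e1, abs_neg, integral_add i1 i2]
    refine (abs_add_le _ _).trans ?_
    have := abs_integral_le_integral_abs (f := fun ω => g ω - clp K (g ω)) (μ := Qm mu)
    have := abs_integral_le_integral_abs (f := fun ω => clp K (g ω) - c - (ψ ω - Pe ψ ω)) (μ := Qm mu)
    linarith
  calc ∫ ω, |g ω - (∫ ω, g ω ∂(Qm mu)) / q - (ψ ω - Pe ψ ω)| ∂(Qm mu)
      ≤ ∫ ω, (|g ω - clp K (g ω)| + |clp K (g ω) - c - (ψ ω - Pe ψ ω)| + |c - (∫ ω, g ω ∂(Qm mu)) / q|) ∂(Qm mu) := by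
        refine integral_mono_of_nonneg (Eventually.of_forall fun ω => abs_nonneg _)
          ((i1.abs.add i2.abs).add (integrable_const _)) (Eventually.of_forall fun ω => ?_)
        dsimp only
        have : g ω - (∫ ω, g ω ∂(Qm mu)) / q - (ψ ω - Pe ψ ω) = (g ω - clp K (g ω)) + (clp K (g ω) - c - (ψ ω - Pe ψ ω)) +
          (c - (∫ ω, g ω ∂(Qm mu)) / q) := by ring
        rw [this]
        exact (abs_add_le _ _).trans (add_le_add (abs_add_le _ _) le_rfl)
    _ = ∫ ω, |g ω - clp K (g ω)| ∂(Qm mu) + ∫ ω, |clp K (g ω) - c - (ψ ω - Pe ψ ω)| ∂(Qm mu) +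
        |c - (∫ ω, g ω ∂(Qm mu)) / q| * q := by
        rw [integral_add i12 (integrable_const _), integral_add i1.abs i2.abs, integral_const, smul_eq_mul,
          mul_comm (Measure.real _ _)]
    _ ≤ ε := by linarith

lemma env_erg (hd : 1 ≤ d) (hs : Stat mu) (ht : TailB mu) (e0 : Dir d) (he : Ergodic (shift (dir e0)) mu)
    {g : Config d → ℝ} (hgm : Measurable g) (hg : Integrable g (Qm mu)) (hQ : 0 < (Qm mu).real Set.univ) :
    ∀ᵐ ω ∂(Qm mu), ∀ ε > 0, ∃ ψ, BM ψ ∧ ∀ n : ℕ,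
      Sn (fun ω => |g ω - (∫ ω, g ω ∂(Qm mu)) / (Qm mu).real Set.univ - (ψ ω - Pe ψ ω)|) n ω ≤ ε * n := by
  choose ψ hψ h1 using fun k : ℕ => env_dec hd hs ht e0 he hgm hg hQ (ε := (1/4)^k) (by positivity)
  have := hopf_bc (mu := mu) hd hs (f := fun k ω => |g ω - (∫ ω, g ω ∂(Qm mu)) / (Qm mu).real Set.univ - (ψ k ω - Pe (ψ k) ω)|)
    (fun k => ((hgm.sub_const _).sub ((hψ k).sub ((hψ k).Pe hd)).1).abs)
    (fun k => ((hg.sub (integrable_const _)).sub (((hψ k).sub ((hψ k).Pe hd)).int _)).abs) (fun k ω => abs_nonneg _) h1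
  filter_upwards [this] with ω hω ε hε
  obtain ⟨k, hk⟩ := hω ε hε
  exact ⟨ψ k, hψ k, hk⟩

lemma env_tail (hd : 1 ≤ d) (hs : Stat mu) {g : Config d → ℝ} (hgm : Measurable g) (hg : Integrable g (Qm mu)) (h0 : ∀ ω, 0 ≤ g ω) :
    ∀ᵐ ω ∂(Qm mu), ∀ ε > 0, ∃ K : ℕ, ∀ n : ℕ, Sn (fun ω => if (K:ℝ) < g ω then g ω else 0) n ω ≤ ε * n := by
  have hgm' : ∀ K : ℕ, Measurable fun ω => if (K:ℝ) < g ω then g ω else 0 := fun K =>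
    Measurable.ite (measurableSet_lt measurable_const hgm) hgm measurable_const
  have hK : Tendsto (fun K : ℕ => ∫ ω, (if (K:ℝ) < g ω then g ω else 0) ∂(Qm mu)) atTop (nhds (∫ ω, (0:ℝ) ∂(Qm mu))) := by
    refine tendsto_integral_of_dominated_convergence g (fun K => (hgm' K).aestronglyMeasurable) hg (fun K => ?_) ?_
    · refine Eventually.of_forall fun ω => ?_
      rw [Real.norm_eq_abs]
      split_ifs
      · rw [abs_of_nonneg (h0 ω)]
      · simpa using h0 ω
    · refine Eventually.of_forall fun ω => ?_
      refine tendsto_const_nhds.congr' ?_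
      filter_upwards [eventually_ge_atTop ⌈g ω⌉₊] with K hK
      rw [if_neg (not_lt.2 ((Nat.le_ceil _).trans (by exact_mod_cast hK)))]
  simp only [integral_zero] at hK
  choose K hK' using fun k : ℕ => (hK.eventually (gt_mem_nhds (show (0:ℝ) < (1/4)^k by positivity))).exists
  have := hopf_bc (mu := mu) hd hs (f := fun k ω => if (K k:ℝ) < g ω then g ω else 0) (fun k => hgm' _)
    (fun k => hg.mono (hgm' _).aestronglyMeasurable (Eventually.of_forall fun ω => by
      rw [Real.norm_eq_abs, Real.norm_eq_abs]; split_ifs <;> simp)) (fun k ω => by split_ifs; exact h0 ω; exact le_rfl) (fun k => (hK' k).le)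
  filter_upwards [this] with ω hω ε hε
  obtain ⟨k, hk⟩ := hω ε hε
  exact ⟨K k, hk⟩
end
end Perco

namespace Perco
variable {d : ℕ}

/-- one step of the lazy walk -/
def mv (ω : Config d) (x : Pt d) (e : Dir d) : Pt d := if ω (x + dir e) then x + dir e else x

/-- position after `k` steps of the walk driven by the word `ξ` -/
def pos (ω : Config d) {N : ℕ} (ξ : Fin N → Dir d) : ℕ → Pt d
  | 0 => 0
  | k+1 => if h : k < N then mv ω (pos ω ξ k) (ξ ⟨k, h⟩) else pos ω ξ k

/-- average over words -/
noncomputable def Ex {V : Type*} [AddCommGroup V] [Module ℝ V] (N : ℕ) (f : (Fin N → Dir d) → V) : V :=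
  ((2*d:ℝ)^N)⁻¹ • ∑ ξ, f ξ

section
variable {V : Type*} [AddCommGroup V] [Module ℝ V] {N : ℕ}


lemma Ex_add (f g : (Fin N → Dir d) → V) : Ex N (fun ξ => f ξ + g ξ) = Ex N f + Ex N g := by
  simp [Ex, Finset.sum_add_distrib]
lemma Ex_sub (f g : (Fin N → Dir d) → V) : Ex N (fun ξ => f ξ - g ξ) = Ex N f - Ex N g := by
  simp [Ex, Finset.sum_sub_distrib, smul_sub]
lemma Ex_zero : Ex N (fun _ : Fin N → Dir d => (0:V)) = 0 := by simp [Ex]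
lemma Ex_sum {ι : Type*} (s : Finset ι) (f : ι → (Fin N → Dir d) → V) :
    Ex N (fun ξ => ∑ i ∈ s, f i ξ) = ∑ i ∈ s, Ex N (f i) := by
  simp only [Ex]; rw [Finset.sum_comm, Finset.smul_sum]
lemma Ex_const (hd : 0 < d) (c : V) : Ex N (fun _ : Fin N → Dir d => c) = c := by
  have : (2*d:ℝ)^N ≠ 0 := by positivity
  simp only [Ex, Finset.sum_const, Finset.card_univ, Fintype.card_fun, card_Dir, Fintype.card_fin]
  rw [← Nat.cast_smul_eq_nsmul ℝ, smul_smul]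
  push_cast
  rw [inv_mul_cancel₀ this, one_smul]
lemma Ex_mul {A : Type*} [Ring A] [Algebra ℝ A] (c : A) (f : (Fin N → Dir d) → A) : Ex N (fun ξ => c * f ξ) = c * Ex N f := by
  simp only [Ex, ← Finset.mul_sum, mul_smul_comm]
lemma Ex_mono {f g : (Fin N → Dir d) → ℝ} (h : ∀ ξ, f ξ ≤ g ξ) : Ex N f ≤ Ex N g := by
  simp only [Ex, smul_eq_mul]
  exact mul_le_mul_of_nonneg_left (Finset.sum_le_sum fun ξ _ => h ξ) (by positivity)
lemma Ex_nonneg {f : (Fin N → Dir d) → ℝ} (h : ∀ ξ, 0 ≤ f ξ) : 0 ≤ Ex N f := by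
  simpa [Ex_zero] using Ex_mono (N := N) (f := fun _ => (0:ℝ)) h
lemma Ex_norm (f : (Fin N → Dir d) → ℂ) : ‖Ex N f‖ ≤ Ex N (fun ξ => ‖f ξ‖) := by
  simp only [Ex]
  rw [norm_smul, Real.norm_of_nonneg (by positivity), smul_eq_mul]
  exact mul_le_mul_of_nonneg_left (norm_sum_le _ _) (by positivity)
lemma Ex_ofReal (f : (Fin N → Dir d) → ℝ) : Ex N (fun ξ => (f ξ : ℂ)) = ((Ex N f : ℝ) : ℂ) := by
  simp [Ex]
lemma Ex_re (f : (Fin N → Dir d) → ℂ) : (Ex N f).re = Ex N (fun ξ => (f ξ).re) := by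
  simp only [Ex, Complex.smul_re, Complex.re_sum]

/-- resampling one letter -/
lemma Ex_step (hd : 0 < d) (k : Fin N) (f : (Fin N → Dir d) → V) :
    Ex N f = Ex N (fun ξ => (2*d:ℝ)⁻¹ • ∑ e, f (Function.update ξ k e)) := by
  have h2 : (2*d:ℝ) ≠ 0 := by positivity
  have key : ∑ ξ, ∑ e, f (Function.update ξ k e) = (2*d:ℝ) • ∑ ξ, f ξ := by
    have h1 : ∑ p : (Fin N → Dir d) × Dir d, f (Function.update p.1 k p.2) = ∑ p : (Fin N → Dir d) × Dir d, f p.1 := by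
      have hi : Function.Involutive (fun p : (Fin N → Dir d) × Dir d => (Function.update p.1 k p.2, p.1 k)) := by
        intro p; simp
      exact Fintype.sum_equiv hi.toPerm _ _ (fun p => rfl)
    rw [Fintype.sum_prod_type, Fintype.sum_prod_type] at h1
    rw [h1]
    simp only [Finset.sum_const, Finset.card_univ, card_Dir]
    rw [← Finset.smul_sum, ← Nat.cast_smul_eq_nsmul ℝ]; push_cast; rfl
  simp only [Ex]
  rw [← Finset.smul_sum, key, smul_smul (2*d:ℝ)⁻¹, inv_mul_cancel₀ h2, one_smul]

variable (ω : Config d)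

lemma pos_succ (ξ : Fin N → Dir d) {k : ℕ} (h : k < N) : pos ω ξ (k+1) = mv ω (pos ω ξ k) (ξ ⟨k, h⟩) := by
  rw [pos, dif_pos h]

lemma pos_upd (ξ : Fin N → Dir d) (k : Fin N) (e : Dir d) : ∀ j : ℕ, j ≤ k → pos ω (Function.update ξ k e) j = pos ω ξ j
  | 0, _ => rfl
  | j+1, h => by
    have h' : j < N := lt_of_lt_of_le (Nat.lt_of_succ_le h) k.2.le
    rw [pos_succ ω _ h', pos_succ ω _ h', pos_upd ξ k e j (by omega), Function.update_of_ne]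
    intro h2; have := congrArg Fin.val h2; simp only at this; omega

lemma pos_upd_succ (ξ : Fin N → Dir d) (k : Fin N) (e : Dir d) :
    pos ω (Function.update ξ k e) (k+1) = mv ω (pos ω ξ k) e := by
  rw [pos_succ ω _ k.2, pos_upd ω ξ k e k le_rfl]; simp

lemma mv_mem {ω : Config d} {x : Pt d} (h : x ∈ Sinf ω) (e : Dir d) : mv ω x e ∈ Sinf ω := by
  unfold mv
  split_ifs with h1
  · exact (Sinf_dir h e).2 h1
  · exact h

lemma pos_mem {ω : Config d} (h : (0 : Pt d) ∈ Sinf ω) (ξ : Fin N → Dir d) : ∀ k, pos ω ξ k ∈ Sinf ω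
  | 0 => h
  | k+1 => by
    rw [pos]; split_ifs
    · exact mv_mem (pos_mem h ξ k) _
    · exact pos_mem h ξ k

/-- Markov property -/
lemma Ex_markov (hd : 0 < d) {k : ℕ} (hk : k < N) (f : (Fin N → Dir d) → ℂ)
    (hf : ∀ ξ e, f (Function.update ξ ⟨k, hk⟩ e) = f ξ) (F : Pt d → Pt d → ℂ) :
    Ex N (fun ξ => f ξ * F (pos ω ξ k) (pos ω ξ (k+1))) =
      Ex N (fun ξ => f ξ * ((2*d:ℂ)⁻¹ * ∑ e, F (pos ω ξ k) (mv ω (pos ω ξ k) e))) := by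
  rw [Ex_step hd ⟨k, hk⟩]
  congr 1; funext ξ
  have : ∀ e, pos ω (Function.update ξ ⟨k, hk⟩ e) (k+1) = mv ω (pos ω ξ k) e := fun e => pos_upd_succ ω ξ ⟨k, hk⟩ e
  simp only [hf, this, pos_upd ω ξ ⟨k, hk⟩ _ k le_rfl]
  rw [← Finset.mul_sum, Complex.real_smul]; push_cast; ring

lemma Ex_markovR (hd : 0 < d) {k : ℕ} (hk : k < N) (f : (Fin N → Dir d) → ℝ)
    (hf : ∀ ξ e, f (Function.update ξ ⟨k, hk⟩ e) = f ξ) (F : Pt d → Pt d → ℝ) :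
    Ex N (fun ξ => f ξ * F (pos ω ξ k) (pos ω ξ (k+1))) =
      Ex N (fun ξ => f ξ * ((2*d:ℝ)⁻¹ * ∑ e, F (pos ω ξ k) (mv ω (pos ω ξ k) e))) := by
  rw [Ex_step hd ⟨k, hk⟩]
  congr 1; funext ξ
  have : ∀ e, pos ω (Function.update ξ ⟨k, hk⟩ e) (k+1) = mv ω (pos ω ξ k) e := fun e => pos_upd_succ ω ξ ⟨k, hk⟩ e
  simp only [hf, this, pos_upd ω ξ ⟨k, hk⟩ _ k le_rfl]
  rw [← Finset.mul_sum, smul_eq_mul]; ring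

lemma nx_shift (x : Pt d) (e : Dir d) : nx e (shift x ω) = shift (mv ω x e) ω := by
  unfold nx mv
  have h0 : shift x ω (dir e) = ω (x + dir e) := rfl
  rw [h0]
  split_ifs
  · funext y; simp only [shift, add_assoc]
  · rfl

lemma Ex_Pe (hd : 0 < d) (f : Config d → ℝ) (k : ℕ) (hk : k ≤ N) : ∀ i : ℕ,
    Ex N (fun ξ : Fin N → Dir d => (Pe^[i] f) (shift (pos ω ξ k) ω)) = (Pe^[i+k] f) ω := by
  induction k with
  | zero =>
    intro i
    have : shift (0 : Pt d) ω = ω := by funext y; simp [shift]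
    simp only [pos, this]; rw [Ex_const hd]; rfl
  | succ k ih =>
    intro i
    have h1 := Ex_markovR ω hd (Nat.lt_of_succ_le hk) (fun _ => 1) (fun _ _ => rfl) (fun _ y => (Pe^[i] f) (shift y ω))
    simp only [one_mul] at h1
    rw [h1, show i + (k+1) = (i+1) + k by ring, ← ih (by omega) (i+1)]
    congr 1; funext ξ
    rw [Function.iterate_succ_apply', Pe]
    simp only [nx_shift]

lemma Sn_eq (f : Config d → ℝ) (n : ℕ) : Sn f n = fun ω => ∑ j ∈ Finset.range n, (Pe^[j] f) ω := by
  induction n with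
  | zero => funext ω; simp [Sn]
  | succ n ih =>
    funext ω
    rw [Finset.sum_range_succ', Sn, Pi.add_apply, ih, Pe]
    simp only [Function.iterate_succ_apply', Function.iterate_zero, id]
    simp only [Pe]
    rw [Finset.sum_comm, ← Finset.mul_sum, add_comm]

lemma Sn_Ex (hd : 0 < d) (f : Config d → ℝ) {n : ℕ} (hn : n ≤ N) :
    ∑ j ∈ Finset.range n, Ex N (fun ξ : Fin N → Dir d => f (shift (pos ω ξ j) ω)) = Sn f n ω := by
  rw [Sn_eq]
  refine Finset.sum_congr rfl fun j hj => ?_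
  have := Ex_Pe ω hd f j ((Finset.mem_range.1 hj).le.trans hn) 0
  simpa using this
end

/-- everything about the configuration that the walk argument uses -/
structure GoodWalk (ω : Config d) (C : Matrix (Fin d) (Fin d) ℝ) (Φ : Fin d → Pt d → ℝ) (G : Pt d → ℝ) : Prop where
  h0 : (0 : Pt d) ∈ Sinf ω
  zero : ∀ i, Φ i 0 = 0
  harm : ∀ i, ∀ x ∈ Sinf ω, ∑ e, (Φ i (mv ω x e) - Φ i x) = 0
  subl : ∀ i, ∀ ε > 0, ∃ n1 : ℕ, ∀ n, n1 ≤ n → ∀ x ∈ Sinf ω, nrm x ≤ n → |Φ i x - x i| ≤ ε * n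
  G0 : ∀ x, 0 ≤ G x
  Gb : ∀ i, ∀ x ∈ Sinf ω, ∀ e, (Φ i (mv ω x e) - Φ i x)^2 ≤ G x
  erg : ∀ a b, ∀ ε > 0, ∃ (H r : Pt d → ℝ) (B : ℝ), (∀ x, |H x| ≤ B) ∧
    (∀ x ∈ Sinf ω, |(2*d:ℝ)⁻¹ * ∑ e, (Φ a (mv ω x e) - Φ a x) * (Φ b (mv ω x e) - Φ b x) - C a b -
      (H x - (2*d:ℝ)⁻¹ * ∑ e, H (mv ω x e))| ≤ r x) ∧
    ∀ N n : ℕ, n ≤ N → ∑ j ∈ Finset.range n, Ex N (fun ξ : Fin N → Dir d => r (pos ω ξ j)) ≤ ε * n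
  tail : ∀ ε > 0, ∃ K : ℕ, ∀ N n : ℕ, n ≤ N →
    ∑ j ∈ Finset.range n, Ex N (fun ξ : Fin N → Dir d => if (K:ℝ) < G (pos ω ξ j) then G (pos ω ξ j) else 0) ≤ ε * n

variable {mu : Measure (Config d)} [IsProbabilityMeasure mu] {h : Fin d → Config d → Dir d → ℝ} {ψ : Fin d → ℕ → Config d → ℝ}

lemma GoodPhi.mv {ω : Config d} {Φ : Fin d → Pt d → ℝ} (hP : GoodPhi ω h Φ) {x : Pt d} (hx : x ∈ Sinf ω) (i : Fin d) (e : Dir d) :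
    Φ i (mv ω x e) - Φ i x = vf h i (shift x ω) e := by
  have h0 : (0 : Pt d) ∈ Sinf (shift x ω) := by rw [Sinf_shift]; simpa using hx
  have h1 : dir e ∈ Sinf (shift x ω) ↔ x + dir e ∈ Sinf ω := by rw [Sinf_shift]
  unfold Perco.mv vf
  by_cases he : x + dir e ∈ Sinf ω
  · rw [if_pos ((Sinf_dir hx e).1 he), hP.grad i x e hx he, ei_one h0 (h1.2 he), one_mul]
  · rw [if_neg (fun h' => he ((Sinf_dir hx e).2 h')), ei_zero (fun h' => he (h1.1 h'.2))]; ring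

lemma exists_goodWalk (hd : 2 ≤ d) (hs : Stat mu) (ht : TailB mu) (e0 : Dir d) (he : Ergodic (shift (dir e0)) mu)
    (hc : Corr mu h ψ) (hη : 0 < mu.real {ω | (0 : Pt d) ∈ Sinf ω}) :
    ∀ᵐ ω ∂mu, (0 : Pt d) ∈ Sinf ω → ∃ Φ G, GoodWalk ω (CovM mu h) Φ G := by
  have hq : (Qm mu).real Set.univ = mu.real {ω | (0 : Pt d) ∈ Sinf ω} := by
    simp [Qm, Measure.real, E0]
  have hi : ∀ a b, ∫ ω, gab h a b ω ∂(Qm mu) = ∫ ω, gab h a b ω ∂mu := by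
    intro a b
    refine setIntegral_eq_integral_of_forall_compl_eq_zero fun ω hω => ?_
    have : ∀ e, ei e ω = 0 := fun e => ei_zero (fun h' => hω h'.1)
    simp [gab, vf, this]
  have h1 : ∀ᵐ ω ∂(Qm mu), ∀ a b, ∀ ε > 0, ∃ ψ, BM ψ ∧ ∀ n : ℕ,
      Sn (fun ω => |gab h a b ω - CovM mu h a b - (ψ ω - Pe ψ ω)|) n ω ≤ ε * n := by
    refine ae_all_iff.2 fun a => ae_all_iff.2 fun b => ?_
    have := env_erg (by omega) hs ht e0 he (hc.gab_meas a b) ((hc.gab_int a b).mono_measure Measure.restrict_le_self) (by rw [hq]; exact hη)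
    rw [hi, hq] at this
    exact this
  have h2 := env_tail (mu := mu) (by omega) hs (g := fun ω => ∑ a, ∑ e, vf h a ω e * vf h a ω e)
    (Finset.measurable_fun_sum _ fun a _ => Finset.measurable_fun_sum _ fun e _ => (hc.vf_meas a e).mul (hc.vf_meas a e))
    ((integrable_finsetSum _ fun a _ => integrable_finsetSum _ fun e _ => hc.vf_int a a e).mono_measure Measure.restrict_le_self)
    (fun ω => Finset.sum_nonneg fun a _ => Finset.sum_nonneg fun e _ => mul_self_nonneg _)
  have h1' := ae_imp_of_ae_restrict h1
  have h2' := ae_imp_of_ae_restrict h2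
  filter_upwards [h1', h2', exists_goodPhi hd hs ht hc] with ω g1 g2 g3 h0
  obtain ⟨⟨Φ, hP⟩, -⟩ := g3 h0
  specialize g1 h0
  specialize g2 h0
  have hd0 : 0 < d := by omega
  refine ⟨Φ, fun x => ∑ a, ∑ e, vf h a (shift x ω) e * vf h a (shift x ω) e, h0, hP.zero, ?_, hP.subl, ?_, ?_, ?_, ?_⟩
  · intro i x hx
    rw [← hP.harm i x hx]
    refine Finset.sum_congr rfl fun e _ => ?_
    unfold Perco.mv grd
    by_cases he : x + dir e ∈ Sinf ω
    · rw [if_pos ((Sinf_dir hx e).1 he), if_pos ⟨hx, he⟩]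
    · rw [if_neg (fun h' => he ((Sinf_dir hx e).2 h')), if_neg (fun h' => he h'.2)]; ring
  · intro x
    exact Finset.sum_nonneg fun a _ => Finset.sum_nonneg fun e _ => mul_self_nonneg _
  · intro i x hx e
    rw [hP.mv hx, sq]
    refine le_trans ?_ (Finset.single_le_sum (f := fun a => ∑ e, vf h a (shift x ω) e * vf h a (shift x ω) e)
      (fun a _ => Finset.sum_nonneg fun e _ => mul_self_nonneg _) (Finset.mem_univ i))
    exact Finset.single_le_sum (f := fun e => vf h i (shift x ω) e * vf h i (shift x ω) e) (fun e _ => mul_self_nonneg _) (Finset.mem_univ e)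
  · intro a b ε hε
    obtain ⟨ψ, ⟨-, B, hB⟩, hψ⟩ := g1 a b ε hε
    refine ⟨fun x => ψ (shift x ω), fun x => |gab h a b (shift x ω) - CovM mu h a b - (ψ (shift x ω) - Pe ψ (shift x ω))|, B, fun x => hB _, ?_, ?_⟩
    · intro x hx
      simp only [hP.mv hx]
      refine le_of_eq ?_
      simp only [gab, Pe, nx_shift]
    · intro N n hn
      rw [Sn_Ex ω hd0 (fun ω' => |gab h a b ω' - CovM mu h a b - (ψ ω' - Pe ψ ω')|) hn]
      exact hψ n
  · intro ε hε
    obtain ⟨K, hK⟩ := g2 ε hε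
    refine ⟨K, fun N n hn => ?_⟩
    have := Sn_Ex ω hd0 (fun ω' => if (K:ℝ) < ∑ a, ∑ e, vf h a ω' e * vf h a ω' e then ∑ a, ∑ e, vf h a ω' e * vf h a ω' e else 0) hn
    rw [this]
    exact hK n
end Perco

namespace Perco
variable {d : ℕ}

/-- `e^{it}` -/
noncomputable def ce (t : ℝ) : ℂ := Complex.exp (Complex.I * t)

lemma ce_norm (t : ℝ) : ‖ce t‖ = 1 := Complex.norm_exp_I_mul_ofReal t
lemma ce_add (s t : ℝ) : ce (s + t) = ce s * ce t := by
  unfold ce; push_cast; rw [mul_add, Complex.exp_add]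
lemma ce_zero : ce 0 = 1 := by simp [ce]
lemma ce_sub_one (t : ℝ) : ‖ce t - 1‖ ≤ |t| := Real.norm_exp_I_mul_ofReal_sub_one_le
lemma ce_re (t : ℝ) : (ce t).re = Real.cos t := by
  unfold ce; rw [mul_comm, Complex.exp_ofReal_mul_I_re]

lemma ce_taylor (t : ℝ) : ‖ce t - 1 - Complex.I * t + (t^2/2 : ℝ)‖ ≤ 4 * (t^2 * min 1 |t|) := by
  rcases le_total |t| 1 with h | h
  · have hx : ‖Complex.I * (t:ℂ)‖ = |t| := by simp
    have := Complex.exp_bound (x := Complex.I * t) (by rw [hx]; exact h) (n := 3) (by norm_num)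
    rw [hx] at this
    rw [min_eq_right h]
    have e1 : ce t - 1 - Complex.I * t + (t^2/2 : ℝ) = Complex.exp (Complex.I * t) - ∑ m ∈ Finset.range 3, (Complex.I * t)^m / (m.factorial : ℂ) := by
      simp [Finset.sum_range_succ, ce, mul_pow, Nat.factorial]; ring
    rw [e1]
    refine this.trans ?_
    have h3 : |t|^3 = t^2 * |t| := by rw [← sq_abs t]; ring
    rw [h3]
    have : 0 ≤ t^2 * |t| := by positivity
    norm_num [Nat.factorial]; linarith
  · rw [min_eq_left h, mul_one]
    have h1 : ‖ce t - 1 - Complex.I * t + (t^2/2 : ℝ)‖ ≤ |t| + |t| + t^2/2 := by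
      refine (norm_add_le _ _).trans (add_le_add ((norm_sub_le _ _).trans (add_le_add (ce_sub_one t) ?_)) ?_)
      · simp
      · rw [Complex.norm_real, Real.norm_of_nonneg (by positivity)]
    have h2 : |t| ≤ t^2 := by rw [← sq_abs t]; nlinarith [abs_nonneg t]
    linarith

lemma exp_taylor {q : ℝ} (hq : 0 ≤ q) : |Real.exp (-(q/2)) - 1 + q/2| ≤ q^2 := by
  rcases le_total (q/2) 1 with h | h
  · have := Real.norm_exp_sub_one_sub_id_le (x := -(q/2)) (by rw [norm_neg, Real.norm_of_nonneg (by positivity)]; exact h)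
    rw [norm_neg, Real.norm_of_nonneg (r := q/2) (by positivity), Real.norm_eq_abs, sub_neg_eq_add] at this
    nlinarith
  · have h1 : Real.exp (-(q/2)) ≤ 1 := Real.exp_le_one_iff.2 (by linarith)
    have h2 := Real.exp_pos (-(q/2))
    rw [abs_of_nonneg (by linarith)]; nlinarith

section
variable {N : ℕ} (ω : Config d) (dl : ℕ → Pt d → Pt d → ℝ) (q : ℕ → ℝ)

/-- additive functional -/
noncomputable def Sf (ξ : Fin N → Dir d) (k : ℕ) : ℝ := ∑ j ∈ Finset.range k, dl j (pos ω ξ j) (pos ω ξ (j+1))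

lemma Sf_succ (ξ : Fin N → Dir d) (k : ℕ) : Sf ω dl ξ (k+1) = Sf ω dl ξ k + dl k (pos ω ξ k) (pos ω ξ (k+1)) :=
  Finset.sum_range_succ _ _

lemma Sf_upd (ξ : Fin N → Dir d) (k : Fin N) (e : Dir d) : Sf ω dl (Function.update ξ k e) k = Sf ω dl ξ k := by
  refine Finset.sum_congr rfl fun j hj => ?_
  have := Finset.mem_range.1 hj
  rw [pos_upd ω ξ k e j (by omega), pos_upd ω ξ k e (j+1) (by omega)]

/-- cumulated variance -/
noncomputable def Dq (k : ℕ) : ℝ := ∑ j ∈ Finset.range k, q j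

/-- the deterministic weight -/
noncomputable def wq (N k : ℕ) : ℝ := Real.exp ((Dq q (k+1) - Dq q N)/2)

variable {q} {ω} {dl}

lemma Dq_mono (hq : ∀ k, 0 ≤ q k) : Monotone (Dq q) := by
  refine monotone_nat_of_le_succ fun k => ?_
  rw [Dq, Dq, Finset.sum_range_succ]; linarith [hq k]

lemma wq_mono (hq : ∀ k, 0 ≤ q k) (k : ℕ) : wq q N k ≤ wq q N (k+1) := by
  have := Dq_mono hq (Nat.le_succ (k+1))
  exact Real.exp_le_exp.2 (by simp only [Nat.succ_eq_add_one] at this; linarith)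

lemma wq_pos (k : ℕ) : 0 < wq q N k := Real.exp_pos _

lemma wq_le (hq : ∀ k, 0 ≤ q k) (hN : ∀ k, N ≤ k → q k = 0) (k : ℕ) : wq q N k ≤ 1 := by
  refine Real.exp_le_one_iff.2 ?_
  have : Dq q (k+1) ≤ Dq q N := by
    rcases le_total (k+1) N with h | h
    · exact Dq_mono hq h
    · refine le_of_eq ?_
      unfold Dq
      rw [← Finset.sum_range_add_sum_Ico _ h, Finset.sum_eq_zero (s := Finset.Ico N (k+1)), add_zero]
      exact fun j hj => hN j (Finset.mem_Ico.1 hj).1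
  linarith

lemma clt_step (hd : 0 < d) (hq : ∀ k, 0 ≤ q k) {k : ℕ} {x : Pt d} (hz : ∑ e, dl k x (mv ω x e) = 0) :
    ‖(2*d:ℂ)⁻¹ * ∑ e, (ce (dl k x (mv ω x e)) - (Real.exp (-(q k/2)) : ℝ)) +
      (((2*d:ℝ)⁻¹ * ∑ e, (dl k x (mv ω x e))^2 - q k) / 2 : ℝ)‖ ≤
      4 * ((2*d:ℝ)⁻¹ * ∑ e, (dl k x (mv ω x e))^2 * min 1 |dl k x (mv ω x e)|) + (q k)^2 := by
  have h2 : (2*d:ℝ) ≠ 0 := by positivity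
  have h2' : (d:ℂ) ≠ 0 := by exact_mod_cast hd.ne'
  have hcd : ∑ _e : Dir d, (1:ℂ) = 2*d := by simp [mul_comm]
  set t : Dir d → ℝ := fun e => dl k x (mv ω x e) with ht
  have e1 : (2*d:ℂ)⁻¹ * ∑ e, (ce (t e) - (Real.exp (-(q k/2)) : ℝ)) + (((2*d:ℝ)⁻¹ * ∑ e, (t e)^2 - q k) / 2 : ℝ) =
      (2*d:ℂ)⁻¹ * ∑ e, (ce (t e) - 1 - Complex.I * t e + ((t e)^2/2 : ℝ)) - ((Real.exp (-(q k/2)) - 1 + q k/2 : ℝ) : ℂ) := by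
    have hz' : ∑ e, (t e : ℂ) = 0 := by exact_mod_cast hz
    simp only [Finset.sum_add_distrib, Finset.sum_sub_distrib, ← Finset.mul_sum, hz']
    have hc : ∀ c : ℂ, ∑ _e : Dir d, c = 2*d*c := fun c => by
      rw [← hcd, Finset.sum_mul]; simp
    rw [hc, hc]
    push_cast
    rw [← Finset.sum_div]
    field_simp
    ring
  rw [e1]
  refine (norm_sub_le _ _).trans (add_le_add ?_ ?_)
  · rw [norm_mul]
    have : ‖(2*d:ℂ)⁻¹‖ = (2*d:ℝ)⁻¹ := by
      rw [norm_inv, norm_mul]; simp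
    rw [this, mul_left_comm, Finset.mul_sum (a := (4:ℝ))]
    exact mul_le_mul_of_nonneg_left ((norm_sum_le _ _).trans (Finset.sum_le_sum fun e _ => ce_taylor _)) (by positivity)
  · rw [Complex.norm_real]; exact exp_taylor (hq k)

/-- telescoping bound for the characteristic function -/
lemma clt_tele (hd : 0 < d) (h0 : (0 : Pt d) ∈ Sinf ω) (hq : ∀ k, 0 ≤ q k) (hN : ∀ k, N ≤ k → q k = 0)
    (hz : ∀ k, ∀ x ∈ Sinf ω, ∑ e, dl k x (mv ω x e) = 0) :
    ‖Ex N (fun ξ : Fin N → Dir d => ce (Sf ω dl ξ N)) - (Real.exp (-(Dq q N/2)) : ℝ)‖ ≤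
      ‖∑ k ∈ Finset.range N, Ex N (fun ξ : Fin N → Dir d => ce (Sf ω dl ξ k) * wq q N k *
        (((2*d:ℝ)⁻¹ * ∑ e, (dl k (pos ω ξ k) (mv ω (pos ω ξ k) e))^2 - q k : ℝ) : ℂ))‖ +
      ∑ k ∈ Finset.range N, (4 * Ex N (fun ξ : Fin N → Dir d => (2*d:ℝ)⁻¹ * ∑ e, (dl k (pos ω ξ k) (mv ω (pos ω ξ k) e))^2 *
        min 1 |dl k (pos ω ξ k) (mv ω (pos ω ξ k) e)|) + (q k)^2) := by
  set α : ℕ → (Fin N → Dir d) → ℂ := fun k ξ => ce (Sf ω dl ξ k) * (Real.exp ((Dq q k - Dq q N)/2) : ℝ) with hα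
  have t0 : Ex N (fun ξ : Fin N → Dir d => ce (Sf ω dl ξ N)) - (Real.exp (-(Dq q N/2)) : ℝ) = ∑ k ∈ Finset.range N, (Ex N (α (k+1)) - Ex N (α k)) := by
    rw [Finset.sum_range_sub (fun k => Ex N (α k))]
    congr 1
    · simp [hα]
    · simp only [hα, Sf, Dq, Finset.range_zero, Finset.sum_empty, ce_zero, one_mul]
      rw [Ex_const hd, zero_sub, neg_div]
  have t1 : ∀ k ∈ Finset.range N, Ex N (α (k+1)) - Ex N (α k) =
      Ex N (fun ξ => (ce (Sf ω dl ξ k) * wq q N k) * ((2*d:ℂ)⁻¹ * ∑ e, (ce (dl k (pos ω ξ k) (mv ω (pos ω ξ k) e)) - (Real.exp (-(q k/2)) : ℝ)))) := by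
    intro k hk
    have hk' := Finset.mem_range.1 hk
    rw [← Ex_markov ω hd hk' (fun ξ => ce (Sf ω dl ξ k) * wq q N k) (fun ξ e => by
      rw [Sf_upd ω dl ξ ⟨k, hk'⟩ e]) (fun x y => ce (dl k x y) - (Real.exp (-(q k/2)) : ℝ)), ← Ex_sub]
    congr 1; funext ξ
    have e1 : Real.exp ((Dq q k - Dq q N)/2) = wq q N k * Real.exp (-(q k/2)) := by
      rw [wq, ← Real.exp_add, Dq, Dq, Dq, Finset.sum_range_succ]; congr 1; ring
    simp only [hα]
    rw [Sf_succ, ce_add, e1, wq]; push_cast; ring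
  rw [t0, Finset.sum_congr rfl t1]
  set P : ℕ → (Fin N → Dir d) → ℂ := fun k ξ => (ce (Sf ω dl ξ k) * wq q N k) *
    ((((2*d:ℝ)⁻¹ * ∑ e, (dl k (pos ω ξ k) (mv ω (pos ω ξ k) e))^2 - q k) : ℝ) : ℂ) with hP
  have t2 : ∀ k, Ex N (fun ξ => (ce (Sf ω dl ξ k) * wq q N k) * ((2*d:ℂ)⁻¹ * ∑ e, (ce (dl k (pos ω ξ k) (mv ω (pos ω ξ k) e)) - (Real.exp (-(q k/2)) : ℝ)))) =
      Ex N (fun ξ => (ce (Sf ω dl ξ k) * wq q N k) * ((2*d:ℂ)⁻¹ * ∑ e, (ce (dl k (pos ω ξ k) (mv ω (pos ω ξ k) e)) - (Real.exp (-(q k/2)) : ℝ)) +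
      (((2*d:ℝ)⁻¹ * ∑ e, (dl k (pos ω ξ k) (mv ω (pos ω ξ k) e))^2 - q k) / 2 : ℝ))) - (1/2:ℂ) * Ex N (P k) := by
    intro k
    rw [← Ex_mul, ← Ex_sub]
    congr 1; funext ξ
    simp only [hP]; push_cast; ring
  simp only [t2]
  rw [Finset.sum_sub_distrib, ← Finset.mul_sum]
  rw [add_comm]
  refine (norm_sub_le _ _).trans (add_le_add ?_ ?_)
  · refine (norm_sum_le _ _).trans (Finset.sum_le_sum fun k _ => ?_)
    refine (Ex_norm _).trans ?_
    rw [← Ex_mul, ← Ex_const (N := N) hd ((q k)^2), ← Ex_add]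
    refine Ex_mono fun ξ => ?_
    rw [norm_mul, norm_mul, ce_norm, one_mul, Complex.norm_real, Real.norm_of_nonneg (wq_pos k).le]
    refine (mul_le_of_le_one_left (norm_nonneg _) (wq_le hq hN k)).trans ?_
    exact clt_step hd hq (hz k _ (pos_mem h0 ξ k))
  · rw [norm_mul]
    refine mul_le_of_le_one_left (norm_nonneg _) ?_
    norm_num

/-- Abel summation -/
lemma clt_abel (hd : 0 < d) (hq : ∀ k, 0 ≤ q k) (hN : ∀ k, N ≤ k → q k = 0)
    {H : Pt d → ℝ} {B : ℝ} (hB : ∀ x, |H x| ≤ B) {K : ℕ} (hK : K ≤ N) :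
    ‖∑ k ∈ Finset.range K, Ex N (fun ξ : Fin N → Dir d => ce (Sf ω dl ξ k) * wq q N k *
        ((H (pos ω ξ k) - (2*d:ℝ)⁻¹ * ∑ e, H (mv ω (pos ω ξ k) e) : ℝ) : ℂ))‖ ≤
      B * (3 + ∑ k ∈ Finset.range N, Ex N (fun ξ : Fin N → Dir d => |dl k (pos ω ξ k) (pos ω ξ (k+1))|)) := by
  have hd2 : (d:ℂ) ≠ 0 := by exact_mod_cast hd.ne'
  have hB0 : 0 ≤ B := (abs_nonneg _).trans (hB 0)
  have t1 : ∀ k ∈ Finset.range K, Ex N (fun ξ : Fin N → Dir d => ce (Sf ω dl ξ k) * wq q N k *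
        ((H (pos ω ξ k) - (2*d:ℝ)⁻¹ * ∑ e, H (mv ω (pos ω ξ k) e) : ℝ) : ℂ)) =
      Ex N (fun ξ : Fin N → Dir d => (ce (Sf ω dl ξ k) * wq q N k) * ((H (pos ω ξ k) : ℂ) - H (pos ω ξ (k+1)))) := by
    intro k hk
    have hk' := (Finset.mem_range.1 hk).trans_le hK
    rw [Ex_markov ω hd hk' (fun ξ => ce (Sf ω dl ξ k) * wq q N k) (fun ξ e => by
      rw [Sf_upd ω dl ξ ⟨k, hk'⟩ e]) (fun x y => (H x : ℂ) - H y)]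
    congr 1; funext ξ
    congr 1
    rw [Finset.sum_sub_distrib]
    simp only [Finset.sum_const, Finset.card_univ, card_Dir]
    push_cast
    rw [nsmul_eq_mul]; push_cast
    field_simp
  rw [Finset.sum_congr rfl t1, ← Ex_sum]
  set β : (Fin N → Dir d) → ℕ → ℂ := fun ξ k => ce (Sf ω dl ξ k) * wq q N k with hβ
  have abel : ∀ ξ : Fin N → Dir d, ∀ K, ∑ k ∈ Finset.range K, β ξ k * ((H (pos ω ξ k) : ℂ) - H (pos ω ξ (k+1))) =
      β ξ 0 * H (pos ω ξ 0) - β ξ K * H (pos ω ξ K) + ∑ k ∈ Finset.range K, (β ξ (k+1) - β ξ k) * H (pos ω ξ (k+1)) := by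
    intro ξ K
    induction K with
    | zero => simp
    | succ K ih => rw [Finset.sum_range_succ, ih, Finset.sum_range_succ]; ring
  have hβn : ∀ ξ k, ‖β ξ k‖ ≤ 1 := by
    intro ξ k
    simp only [hβ]
    rw [norm_mul, ce_norm, one_mul, Complex.norm_real, Real.norm_of_nonneg (wq_pos k).le]
    exact wq_le hq hN k
  have hHn : ∀ x, ‖(H x : ℂ)‖ ≤ B := fun x => by rw [Complex.norm_real]; exact hB x
  have hβd : ∀ ξ k, ‖β ξ (k+1) - β ξ k‖ ≤ |dl k (pos ω ξ k) (pos ω ξ (k+1))| + (wq q N (k+1) - wq q N k) := by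
    intro ξ k
    have : β ξ (k+1) - β ξ k = ce (Sf ω dl ξ k) * (ce (dl k (pos ω ξ k) (pos ω ξ (k+1))) - 1) * wq q N k
      + ce (Sf ω dl ξ (k+1)) * ((wq q N (k+1) - wq q N k : ℝ) : ℂ) := by
      simp only [hβ]; rw [Sf_succ, ce_add]; push_cast; ring
    rw [this]
    refine (norm_add_le _ _).trans (add_le_add ?_ ?_)
    · rw [norm_mul, norm_mul, ce_norm, one_mul, Complex.norm_real, Real.norm_of_nonneg (wq_pos k).le]
      exact (mul_le_of_le_one_right (norm_nonneg _) (wq_le hq hN k)).trans (ce_sub_one _)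
    · rw [norm_mul, ce_norm, one_mul, Complex.norm_real, Real.norm_of_nonneg (by linarith [wq_mono (N := N) hq k])]
  refine (Ex_norm _).trans ?_
  rw [← Ex_sum, ← Ex_const (N := N) hd (3:ℝ), ← Ex_add, ← Ex_mul]
  refine Ex_mono fun ξ => ?_
  rw [abel ξ K]
  have m1 : ‖∑ k ∈ Finset.range K, (β ξ (k+1) - β ξ k) * H (pos ω ξ (k+1))‖ ≤
      B * (1 + ∑ k ∈ Finset.range N, |dl k (pos ω ξ k) (pos ω ξ (k+1))|) := by
    calc _ ≤ ∑ k ∈ Finset.range K, (|dl k (pos ω ξ k) (pos ω ξ (k+1))| + (wq q N (k+1) - wq q N k)) * B := by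
          refine (norm_sum_le _ _).trans (Finset.sum_le_sum fun k _ => ?_)
          rw [norm_mul]
          exact mul_le_mul (hβd ξ k) (hHn _) (norm_nonneg _) ((norm_nonneg _).trans (hβd ξ k))
      _ = B * ((wq q N K - wq q N 0) + ∑ k ∈ Finset.range K, |dl k (pos ω ξ k) (pos ω ξ (k+1))|) := by
          rw [← Finset.sum_mul, Finset.sum_add_distrib, Finset.sum_range_sub (wq q N)]; ring
      _ ≤ _ := by
          refine mul_le_mul_of_nonneg_left (add_le_add ?_ ?_) hB0
          · linarith [wq_le hq hN K, wq_pos (q := q) (N := N) 0]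
          · exact Finset.sum_le_sum_of_subset_of_nonneg (Finset.range_subset_range.2 hK) (fun _ _ _ => abs_nonneg _)
  have m2 : ∀ k, ‖β ξ k * H (pos ω ξ k)‖ ≤ B := fun k => by
    rw [norm_mul]; exact (mul_le_mul (hβn ξ k) (hHn _) (norm_nonneg _) zero_le_one).trans (by rw [one_mul])
  calc _ ≤ B + B + B * (1 + ∑ k ∈ Finset.range N, |dl k (pos ω ξ k) (pos ω ξ (k+1))|) :=
        (norm_add_le _ _).trans (add_le_add ((norm_sub_le _ _).trans (add_le_add (m2 0) (m2 K))) m1)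
    _ = _ := by ring
end
end Perco

namespace Perco
variable {d : ℕ}

section
variable {m : ℕ} (θ : Fin m → Fin d → ℝ) (K : Fin m → ℕ)

noncomputable def th (k : ℕ) (a : Fin d) : ℝ := ∑ j, if k < K j then θ j a else 0
noncomputable def Lth : ℝ := ∑ a, ∑ j, |θ j a|
noncomputable def dlw (Φ : Fin d → Pt d → ℝ) (n : ℕ) (k : ℕ) (x y : Pt d) : ℝ :=
  (Real.sqrt n)⁻¹ * ∑ a, th θ K k a * (Φ a y - Φ a x)
noncomputable def qw (C : Matrix (Fin d) (Fin d) ℝ) (n : ℕ) (k : ℕ) : ℝ :=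
  (n:ℝ)⁻¹ * ∑ a, ∑ b, th θ K k a * C a b * th θ K k b

variable {θ K}

lemma Lth_nonneg : 0 ≤ Lth θ := Finset.sum_nonneg fun _ _ => Finset.sum_nonneg fun _ _ => abs_nonneg _

lemma sum_ite_lt {V : Type*} [AddCommMonoid V] {k N : ℕ} (h : k ≤ N) (f : ℕ → V) :
    ∑ i ∈ Finset.range N, (if i < k then f i else 0) = ∑ i ∈ Finset.range k, f i := by
  rw [← Finset.sum_filter]
  congr 1
  ext i; simp only [Finset.mem_filter, Finset.mem_range]; omega

lemma th_abs (k : ℕ) (a : Fin d) : |th θ K k a| ≤ ∑ j, |θ j a| := by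
  refine (Finset.abs_sum_le_sum_abs _ _).trans (Finset.sum_le_sum fun j _ => ?_)
  split_ifs <;> simp

lemma th_mul (k : ℕ) (a b : Fin d) : th θ K k a * th θ K k b =
    ∑ j, ∑ j', if k < min (K j) (K j') then θ j a * θ j' b else 0 := by
  rw [th, th, Finset.sum_mul_sum]
  refine Finset.sum_congr rfl fun j _ => Finset.sum_congr rfl fun j' _ => ?_
  simp only [lt_min_iff]
  split_ifs <;> simp_all

lemma Sf_dlw (ω : Config d) {Φ : Fin d → Pt d → ℝ} (hz : ∀ i, Φ i 0 = 0) (n : ℕ) {N : ℕ} (hK : ∀ j, K j ≤ N) (ξ : Fin N → Dir d) :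
    Sf ω (dlw θ K Φ n) ξ N = (Real.sqrt n)⁻¹ * ∑ j, ∑ a, θ j a * Φ a (pos ω ξ (K j)) := by
  unfold Sf dlw th
  rw [← Finset.mul_sum]
  congr 1
  simp only [Finset.sum_mul]
  rw [Finset.sum_comm, Finset.sum_comm (s := (Finset.univ : Finset (Fin m)))]
  refine Finset.sum_congr rfl fun a _ => ?_
  rw [Finset.sum_comm]
  refine Finset.sum_congr rfl fun j _ => ?_
  simp only [ite_mul, zero_mul]
  rw [sum_ite_lt (hK j) (fun i => θ j a * (Φ a (pos ω ξ (i+1)) - Φ a (pos ω ξ i))), ← Finset.mul_sum,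
    Finset.sum_range_sub (fun i => Φ a (pos ω ξ i))]
  simp [pos, hz]

lemma Dq_qw (C : Matrix (Fin d) (Fin d) ℝ) (n : ℕ) {N : ℕ} (hK : ∀ j, K j ≤ N) :
    Dq (qw θ K C n) N = (n:ℝ)⁻¹ * ∑ j, ∑ j', ((min (K j) (K j') : ℕ) : ℝ) * ∑ a, ∑ b, θ j a * C a b * θ j' b := by
  unfold Dq qw
  rw [← Finset.mul_sum]
  congr 1
  have e1 : ∀ k, ∑ a, ∑ b, th θ K k a * C a b * th θ K k b =
      ∑ j, ∑ j', if k < min (K j) (K j') then ∑ a, ∑ b, θ j a * C a b * θ j' b else 0 := by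
    intro k
    have : ∀ a b, th θ K k a * C a b * th θ K k b = ∑ j, ∑ j', if k < min (K j) (K j') then θ j a * C a b * θ j' b else 0 := by
      intro a b
      rw [mul_right_comm, th_mul, Finset.sum_mul]
      refine Finset.sum_congr rfl fun j _ => ?_
      rw [Finset.sum_mul]
      refine Finset.sum_congr rfl fun j' _ => ?_
      split_ifs <;> ring
    simp only [this]
    have sw : ∀ F : Fin d → Fin d → Fin m → Fin m → ℝ, ∑ a, ∑ b, ∑ j, ∑ j', F a b j j' = ∑ j, ∑ j', ∑ a, ∑ b, F a b j j' := by
      intro F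
      calc _ = ∑ a, ∑ j, ∑ b, ∑ j', F a b j j' := Finset.sum_congr rfl fun a _ => Finset.sum_comm
        _ = ∑ j, ∑ a, ∑ b, ∑ j', F a b j j' := Finset.sum_comm
        _ = ∑ j, ∑ a, ∑ j', ∑ b, F a b j j' := Finset.sum_congr rfl fun j _ => Finset.sum_congr rfl fun a _ => Finset.sum_comm
        _ = _ := Finset.sum_congr rfl fun j _ => Finset.sum_comm
    rw [sw]
    refine Finset.sum_congr rfl fun j _ => Finset.sum_congr rfl fun j' _ => ?_
    split_ifs
    · rfl
    · simp
  simp only [e1]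
  rw [Finset.sum_comm]
  refine Finset.sum_congr rfl fun j _ => ?_
  rw [Finset.sum_comm]
  refine Finset.sum_congr rfl fun j' _ => ?_
  rw [sum_ite_lt ((min_le_left _ _).trans (hK j)) (fun _ => ∑ a, ∑ b, θ j a * C a b * θ j' b)]
  simp

variable {ω : Config d} {C : Matrix (Fin d) (Fin d) ℝ} {Φ : Fin d → Pt d → ℝ} {G : Pt d → ℝ}

lemma dlw_sum (hW : GoodWalk ω C Φ G) (n k : ℕ) {x : Pt d} (hx : x ∈ Sinf ω) : ∑ e, dlw θ K Φ n k x (mv ω x e) = 0 := by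
  unfold dlw
  rw [← Finset.mul_sum, Finset.sum_comm]
  simp only [← Finset.mul_sum]
  rw [Finset.sum_eq_zero, mul_zero]
  intro a _
  rw [hW.harm a x hx, mul_zero]

lemma dlw_abs (hW : GoodWalk ω C Φ G) (n k : ℕ) {x : Pt d} (hx : x ∈ Sinf ω) (e : Dir d) :
    |dlw θ K Φ n k x (mv ω x e)| ≤ (Real.sqrt n)⁻¹ * (Lth θ * Real.sqrt (G x)) := by
  unfold dlw Lth
  rw [abs_mul, abs_of_nonneg (inv_nonneg.2 (Real.sqrt_nonneg _))]
  refine mul_le_mul_of_nonneg_left ?_ (inv_nonneg.2 (Real.sqrt_nonneg _))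
  rw [Finset.sum_mul]
  refine (Finset.abs_sum_le_sum_abs _ _).trans (Finset.sum_le_sum fun a _ => ?_)
  rw [abs_mul]
  refine mul_le_mul (th_abs k a) ?_ (abs_nonneg _) (Finset.sum_nonneg fun _ _ => abs_nonneg _)
  exact Real.abs_le_sqrt (hW.Gb a x hx e)

lemma dlw_sq (hW : GoodWalk ω C Φ G) (n k : ℕ) {x : Pt d} (hx : x ∈ Sinf ω) (e : Dir d) :
    (dlw θ K Φ n k x (mv ω x e))^2 ≤ (n:ℝ)⁻¹ * Lth θ^2 * G x := by
  have h1 := dlw_abs (θ := θ) (K := K) hW n k hx e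
  rw [← sq_abs]
  calc _ ≤ ((Real.sqrt n)⁻¹ * (Lth θ * Real.sqrt (G x)))^2 := pow_le_pow_left₀ (abs_nonneg _) h1 2
    _ = _ := by
      rw [mul_pow, mul_pow, inv_pow, Real.sq_sqrt (Nat.cast_nonneg n), Real.sq_sqrt (hW.G0 x)]; ring

lemma qw_abs (n k : ℕ) : |qw θ K C n k| ≤ (n:ℝ)⁻¹ * (Lth θ^2 * ∑ a, ∑ b, |C a b|) := by
  unfold qw
  rw [abs_mul, abs_of_nonneg (by positivity : (0:ℝ) ≤ (n:ℝ)⁻¹)]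
  refine mul_le_mul_of_nonneg_left ?_ (by positivity)
  have ht : ∀ a, |th θ K k a| ≤ Lth θ := fun a => (th_abs k a).trans
    (Finset.single_le_sum (f := fun a => ∑ j, |θ j a|) (fun _ _ => Finset.sum_nonneg fun _ _ => abs_nonneg _) (Finset.mem_univ a))
  rw [Finset.mul_sum]
  refine (Finset.abs_sum_le_sum_abs _ _).trans (Finset.sum_le_sum fun a _ => ?_)
  rw [Finset.mul_sum]
  refine (Finset.abs_sum_le_sum_abs _ _).trans (Finset.sum_le_sum fun b _ => ?_)
  rw [abs_mul, abs_mul]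
  calc _ ≤ Lth θ * |C a b| * Lth θ := mul_le_mul (mul_le_mul_of_nonneg_right (ht a) (abs_nonneg _)) (ht b) (abs_nonneg _)
        (mul_nonneg Lth_nonneg (abs_nonneg _))
    _ = _ := by ring

/-- second moment sums -/
lemma G_sum (hd : 0 < d) (hW : GoodWalk ω C Φ G) {ε : ℝ} {Kt : ℕ} (hT : ∀ N n : ℕ, n ≤ N →
    ∑ j ∈ Finset.range n, Ex N (fun ξ : Fin N → Dir d => if (Kt:ℝ) < G (pos ω ξ j) then G (pos ω ξ j) else 0) ≤ ε * n) (N : ℕ) :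
    ∑ j ∈ Finset.range N, Ex N (fun ξ : Fin N → Dir d => G (pos ω ξ j)) ≤ (Kt + ε) * N := by
  have h1 : ∑ j ∈ Finset.range N, Ex N (fun ξ : Fin N → Dir d => G (pos ω ξ j)) ≤
      ∑ j ∈ Finset.range N, ((Kt:ℝ) + Ex N (fun ξ : Fin N → Dir d => if (Kt:ℝ) < G (pos ω ξ j) then G (pos ω ξ j) else 0)) := by
    refine Finset.sum_le_sum fun j _ => ?_
    rw [← Ex_const (N := N) hd (Kt:ℝ), ← Ex_add]
    refine Ex_mono fun ξ => ?_
    have : (0:ℝ) ≤ Kt := by positivity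
    simp only [Ex_const hd]
    split_ifs with h <;> linarith
  refine h1.trans ?_
  rw [Finset.sum_add_distrib]
  have := hT N N le_rfl
  simp only [Finset.sum_const, Finset.card_range, nsmul_eq_mul]
  linarith

lemma dlw_l1 (hd : 0 < d) (hW : GoodWalk ω C Φ G) {ε : ℝ} {Kt : ℕ} (hT : ∀ N n : ℕ, n ≤ N →
    ∑ j ∈ Finset.range n, Ex N (fun ξ : Fin N → Dir d => if (Kt:ℝ) < G (pos ω ξ j) then G (pos ω ξ j) else 0) ≤ ε * n) (N : ℕ)
    {n : ℕ} (hn : 0 < n) :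
    ∑ k ∈ Finset.range N, Ex N (fun ξ : Fin N → Dir d => |dlw θ K Φ n k (pos ω ξ k) (pos ω ξ (k+1))|) ≤
      (Real.sqrt n)⁻¹ * (Lth θ^2 * (Kt + ε) + 1) * N := by
  have hn' : (0:ℝ) < n := by exact_mod_cast hn
  set s := Real.sqrt n with hs
  have hs0 : 0 < s := Real.sqrt_pos.2 hn'
  have hss : s * s = n := Real.mul_self_sqrt hn'.le
  have h1 : ∀ k ∈ Finset.range N, Ex N (fun ξ : Fin N → Dir d => |dlw θ K Φ n k (pos ω ξ k) (pos ω ξ (k+1))|) ≤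
      s⁻¹ * Lth θ^2 * Ex N (fun ξ : Fin N → Dir d => G (pos ω ξ k)) + s⁻¹ := by
    intro k hk
    rw [← Ex_mul, ← Ex_const (N := N) hd s⁻¹, ← Ex_add]
    refine Ex_mono fun ξ => ?_
    rw [pos_succ ω ξ (Finset.mem_range.1 hk)]
    have h2 := dlw_sq (θ := θ) (K := K) hW n k (pos_mem hW.h0 ξ k) (ξ ⟨k, Finset.mem_range.1 hk⟩)
    set t := dlw θ K Φ n k (pos ω ξ k) (mv ω (pos ω ξ k) (ξ ⟨k, Finset.mem_range.1 hk⟩))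
    rw [Ex_const hd]
    have h3 : |t| ≤ s * t^2 + s⁻¹ := by
      have : s * t^2 + s⁻¹ - |t| = s * ((|t| - s⁻¹/2)^2 + 3/4 * (s⁻¹)^2) := by
        rw [← sq_abs t]; field_simp; ring
      have h4 : 0 ≤ s * ((|t| - s⁻¹/2)^2 + 3/4 * (s⁻¹)^2) := by positivity
      linarith
    refine h3.trans (add_le_add ?_ le_rfl)
    calc s * t^2 ≤ s * ((n:ℝ)⁻¹ * Lth θ^2 * G (pos ω ξ k)) := mul_le_mul_of_nonneg_left h2 hs0.le
      _ = _ := by rw [← hss]; field_simp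
  refine (Finset.sum_le_sum h1).trans ?_
  rw [Finset.sum_add_distrib, ← Finset.mul_sum]
  have h2 := G_sum hd hW hT N
  have h3 : s⁻¹ * Lth θ^2 * ∑ j ∈ Finset.range N, Ex N (fun ξ : Fin N → Dir d => G (pos ω ξ j)) ≤ s⁻¹ * Lth θ^2 * ((Kt + ε) * N) :=
    mul_le_mul_of_nonneg_left h2 (by positivity)
  simp only [Finset.sum_const, Finset.card_range, nsmul_eq_mul]
  linarith

lemma dlw_lind (hd : 0 < d) (hW : GoodWalk ω C Φ G) {ε : ℝ} {Kt : ℕ} (hT : ∀ N n : ℕ, n ≤ N →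
    ∑ j ∈ Finset.range n, Ex N (fun ξ : Fin N → Dir d => if (Kt:ℝ) < G (pos ω ξ j) then G (pos ω ξ j) else 0) ≤ ε * n) (N : ℕ)
    (n : ℕ) :
    ∑ k ∈ Finset.range N, Ex N (fun ξ : Fin N → Dir d => (2*d:ℝ)⁻¹ * ∑ e, (dlw θ K Φ n k (pos ω ξ k) (mv ω (pos ω ξ k) e))^2 *
        min 1 |dlw θ K Φ n k (pos ω ξ k) (mv ω (pos ω ξ k) e)|) ≤
      (n:ℝ)⁻¹ * Lth θ^2 * (Kt * (Lth θ * Real.sqrt Kt * (Real.sqrt n)⁻¹) + ε) * N := by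
  have hL := Lth_nonneg (θ := θ)
  have hd2 : (2*d:ℝ) ≠ 0 := by positivity
  set c := (n:ℝ)⁻¹ * Lth θ^2 with hc
  have hc0 : 0 ≤ c := by positivity
  set z := (Kt:ℝ) * (Lth θ * Real.sqrt Kt * (Real.sqrt n)⁻¹) with hz
  have hz0 : 0 ≤ z := by positivity
  have h1 : ∀ k, Ex N (fun ξ : Fin N → Dir d => (2*d:ℝ)⁻¹ * ∑ e, (dlw θ K Φ n k (pos ω ξ k) (mv ω (pos ω ξ k) e))^2 *
        min 1 |dlw θ K Φ n k (pos ω ξ k) (mv ω (pos ω ξ k) e)|) ≤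
      c * z + c * Ex N (fun ξ : Fin N → Dir d => if (Kt:ℝ) < G (pos ω ξ k) then G (pos ω ξ k) else 0) := by
    intro k
    rw [← Ex_mul, ← Ex_const (N := N) hd (c * z), ← Ex_add]
    refine Ex_mono fun ξ => ?_
    set x := pos ω ξ k
    have hx : x ∈ Sinf ω := pos_mem hW.h0 ξ k
    have h2 : ∀ e : Dir d, (dlw θ K Φ n k x (mv ω x e))^2 * min 1 |dlw θ K Φ n k x (mv ω x e)| ≤
        c * z + c * (if (Kt:ℝ) < G x then G x else 0) := by
      intro e
      have hsq := dlw_sq (θ := θ) (K := K) hW n k hx e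
      rw [← hc] at hsq
      split_ifs with hG
      · have : (dlw θ K Φ n k x (mv ω x e))^2 * min 1 |dlw θ K Φ n k x (mv ω x e)| ≤ (dlw θ K Φ n k x (mv ω x e))^2 * 1 :=
          mul_le_mul_of_nonneg_left (min_le_left _ _) (sq_nonneg _)
        have : 0 ≤ c * z := by positivity
        linarith
      · have hab := dlw_abs (θ := θ) (K := K) hW n k hx e
        have hG' := Real.sqrt_le_sqrt (not_lt.1 hG)
        have h3 : |dlw θ K Φ n k x (mv ω x e)| ≤ Lth θ * Real.sqrt Kt * (Real.sqrt n)⁻¹ := by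
          refine hab.trans ?_
          rw [mul_comm]
          exact mul_le_mul_of_nonneg_right (mul_le_mul_of_nonneg_left hG' hL) (by positivity)
        rw [mul_zero, add_zero, hz, ← mul_assoc]
        exact mul_le_mul (hsq.trans (mul_le_mul_of_nonneg_left (not_lt.1 hG) hc0)) ((min_le_right _ _).trans h3)
          (le_min zero_le_one (abs_nonneg _)) (by positivity)
    calc _ ≤ (2*d:ℝ)⁻¹ * ∑ _e : Dir d, (c * z + c * (if (Kt:ℝ) < G x then G x else 0)) :=
          mul_le_mul_of_nonneg_left (Finset.sum_le_sum fun e _ => h2 e) (by positivity)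
      _ = _ := by
        rw [Finset.sum_const, Finset.card_univ, card_Dir, nsmul_eq_mul]
        push_cast
        rw [← mul_assoc, inv_mul_cancel₀ hd2, one_mul]
  refine (Finset.sum_le_sum fun k _ => h1 k).trans ?_
  rw [Finset.sum_add_distrib]
  simp only [← Finset.mul_sum]
  have := mul_le_mul_of_nonneg_left (hT N N le_rfl) hc0
  simp only [Finset.sum_const, Finset.card_range, nsmul_eq_mul]
  linarith
end
end Perco

namespace Perco
variable {d : ℕ}

section
variable {m : ℕ} {θ : Fin m → Fin d → ℝ} {K : Fin m → ℕ}
variable {ω : Config d} {C : Matrix (Fin d) (Fin d) ℝ} {Φ : Fin d → Pt d → ℝ} {G : Pt d → ℝ}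

/-- local covariance -/
noncomputable def gl (ω : Config d) (Φ : Fin d → Pt d → ℝ) (a b : Fin d) (x : Pt d) : ℝ :=
  (2*d:ℝ)⁻¹ * ∑ e, (Φ a (mv ω x e) - Φ a x) * (Φ b (mv ω x e) - Φ b x)

lemma dlw_var (n k : ℕ) (x : Pt d) :
    (2*d:ℝ)⁻¹ * ∑ e, (dlw θ K Φ n k x (mv ω x e))^2 - qw θ K C n k =
      (n:ℝ)⁻¹ * ∑ a, ∑ b, th θ K k a * th θ K k b * (gl ω Φ a b x - C a b) := by
  have h1 : ∀ e, (dlw θ K Φ n k x (mv ω x e))^2 = (n:ℝ)⁻¹ * ∑ a, ∑ b, th θ K k a * th θ K k b *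
      ((Φ a (mv ω x e) - Φ a x) * (Φ b (mv ω x e) - Φ b x)) := by
    intro e
    rw [dlw, mul_pow, inv_pow, Real.sq_sqrt (Nat.cast_nonneg n), sq, Finset.sum_mul_sum]
    congr 1
    refine Finset.sum_congr rfl fun a _ => Finset.sum_congr rfl fun b _ => by ring
  have h2 : (2*d:ℝ)⁻¹ * ∑ e, (dlw θ K Φ n k x (mv ω x e))^2 = (n:ℝ)⁻¹ * ∑ a, ∑ b, th θ K k a * th θ K k b * gl ω Φ a b x := by
    simp only [h1, ← Finset.mul_sum]
    rw [mul_left_comm, Finset.sum_comm]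
    congr 1
    rw [Finset.mul_sum]
    refine Finset.sum_congr rfl fun a _ => ?_
    rw [Finset.sum_comm, Finset.mul_sum]
    refine Finset.sum_congr rfl fun b _ => ?_
    rw [← Finset.mul_sum, gl]; ring
  rw [h2, qw, ← mul_sub, ← Finset.sum_sub_distrib]
  congr 1
  refine Finset.sum_congr rfl fun a _ => ?_
  rw [← Finset.sum_sub_distrib]
  refine Finset.sum_congr rfl fun b _ => by ring

lemma sum4_norm (Z : Fin d → Fin d → Fin m → Fin m → ℂ) {z : ℝ} (hz : ∀ a b j j', ‖Z a b j j'‖ ≤ z) :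
    ‖∑ a, ∑ b, ∑ j, ∑ j', ((θ j a * θ j' b : ℝ) : ℂ) * Z a b j j'‖ ≤ Lth θ^2 * z := by
  have e : Lth θ^2 * z = ∑ a, ∑ b, ∑ j, ∑ j', (|θ j a| * |θ j' b|) * z := by
    rw [Lth, sq, Finset.sum_mul_sum, Finset.sum_mul]
    refine Finset.sum_congr rfl fun a _ => ?_
    rw [Finset.sum_mul]
    refine Finset.sum_congr rfl fun b _ => ?_
    rw [Finset.sum_mul_sum, Finset.sum_mul]
    refine Finset.sum_congr rfl fun j _ => ?_
    rw [Finset.sum_mul]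
  rw [e]
  refine (norm_sum_le _ _).trans (Finset.sum_le_sum fun a _ => (norm_sum_le _ _).trans (Finset.sum_le_sum fun b _ =>
    (norm_sum_le _ _).trans (Finset.sum_le_sum fun j _ => (norm_sum_le _ _).trans (Finset.sum_le_sum fun j' _ => ?_))))
  rw [norm_mul, Complex.norm_real, Real.norm_eq_abs, abs_mul]
  exact mul_le_mul_of_nonneg_left (hz a b j j') (by positivity)

lemma clt_drift (hd : 0 < d) (hW : GoodWalk ω C Φ G) {N n : ℕ} (hK : ∀ j, K j ≤ N) (hq : ∀ k, 0 ≤ qw θ K C n k)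
    (hN : ∀ k, N ≤ k → qw θ K C n k = 0) {B ε : ℝ} (H r : Fin d → Fin d → Pt d → ℝ) (hB : ∀ a b x, |H a b x| ≤ B)
    (hr : ∀ a b, ∀ x ∈ Sinf ω, |gl ω Φ a b x - C a b - (H a b x - (2*d:ℝ)⁻¹ * ∑ e, H a b (mv ω x e))| ≤ r a b x)
    (hR : ∀ a b, ∑ j ∈ Finset.range N, Ex N (fun ξ : Fin N → Dir d => r a b (pos ω ξ j)) ≤ ε * N) :
    ‖∑ k ∈ Finset.range N, Ex N (fun ξ : Fin N → Dir d => ce (Sf ω (dlw θ K Φ n) ξ k) * wq (qw θ K C n) N k *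
        (((2*d:ℝ)⁻¹ * ∑ e, (dlw θ K Φ n k (pos ω ξ k) (mv ω (pos ω ξ k) e))^2 - qw θ K C n k : ℝ) : ℂ))‖ ≤
    (n:ℝ)⁻¹ * (Lth θ^2 * (B * (3 + ∑ k ∈ Finset.range N, Ex N (fun ξ : Fin N → Dir d =>
      |dlw θ K Φ n k (pos ω ξ k) (pos ω ξ (k+1))|)) + ε * N)) := by
  set β : ℕ → (Fin N → Dir d) → ℂ := fun k ξ => ce (Sf ω (dlw θ K Φ n) ξ k) * wq (qw θ K C n) N k with hβ
  set Y : Fin d → Fin d → ℕ → ℂ := fun a b k => Ex N (fun ξ => β k ξ * ((gl ω Φ a b (pos ω ξ k) - C a b : ℝ) : ℂ)) with hY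
  have e1 : ∀ k, Ex N (fun ξ : Fin N → Dir d => β k ξ *
        (((2*d:ℝ)⁻¹ * ∑ e, (dlw θ K Φ n k (pos ω ξ k) (mv ω (pos ω ξ k) e))^2 - qw θ K C n k : ℝ) : ℂ)) =
      ((n:ℝ)⁻¹ : ℝ) * ∑ a, ∑ b, ∑ j, ∑ j', if k < min (K j) (K j') then ((θ j a * θ j' b : ℝ) : ℂ) * Y a b k else 0 := by
    intro k
    have h1 : ∀ a b, ∑ j, ∑ j', (if k < min (K j) (K j') then ((θ j a * θ j' b : ℝ) : ℂ) * Y a b k else 0) =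
        ((th θ K k a * th θ K k b : ℝ) : ℂ) * Y a b k := by
      intro a b
      rw [th_mul]
      push_cast
      rw [Finset.sum_mul]
      refine Finset.sum_congr rfl fun j _ => ?_
      rw [Finset.sum_mul]
      refine Finset.sum_congr rfl fun j' _ => ?_
      split_ifs <;> simp
    rw [Finset.sum_congr rfl fun a _ => Finset.sum_congr rfl fun b _ => h1 a b]
    simp only [hY, ← Ex_mul, ← Ex_sum]
    congr 1; funext ξ
    rw [dlw_var]
    push_cast
    simp only [Finset.mul_sum]
    refine Finset.sum_congr rfl fun a _ => Finset.sum_congr rfl fun b _ => by ring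
  rw [Finset.sum_congr rfl fun k _ => e1 k]
  rw [← Finset.mul_sum, norm_mul, Complex.norm_real, Real.norm_of_nonneg (by positivity)]
  refine mul_le_mul_of_nonneg_left ?_ (by positivity)
  have e2 : ∑ k ∈ Finset.range N, ∑ a, ∑ b, ∑ j, ∑ j', (if k < min (K j) (K j') then ((θ j a * θ j' b : ℝ) : ℂ) * Y a b k else 0) =
      ∑ a, ∑ b, ∑ j, ∑ j', ((θ j a * θ j' b : ℝ) : ℂ) * ∑ k ∈ Finset.range (min (K j) (K j')), Y a b k := by
    rw [Finset.sum_comm]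
    refine Finset.sum_congr rfl fun a _ => ?_
    rw [Finset.sum_comm]
    refine Finset.sum_congr rfl fun b _ => ?_
    rw [Finset.sum_comm]
    refine Finset.sum_congr rfl fun j _ => ?_
    rw [Finset.sum_comm]
    refine Finset.sum_congr rfl fun j' _ => ?_
    rw [sum_ite_lt ((min_le_left _ _).trans (hK j)) (fun k => ((θ j a * θ j' b : ℝ) : ℂ) * Y a b k), Finset.mul_sum]
  rw [e2]
  refine sum4_norm _ fun a b j j' => ?_
  set K' := min (K j) (K j')
  have hK' : K' ≤ N := (min_le_left _ _).trans (hK j)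
  have e3 : ∀ k, Y a b k = Ex N (fun ξ => β k ξ * ((H a b (pos ω ξ k) - (2*d:ℝ)⁻¹ * ∑ e, H a b (mv ω (pos ω ξ k) e) : ℝ) : ℂ)) +
      Ex N (fun ξ => β k ξ * ((gl ω Φ a b (pos ω ξ k) - C a b - (H a b (pos ω ξ k) - (2*d:ℝ)⁻¹ * ∑ e, H a b (mv ω (pos ω ξ k) e)) : ℝ) : ℂ)) := by
    intro k
    rw [← Ex_add]
    simp only [hY]
    congr 1; funext ξ; push_cast; ring
  simp only [e3]
  rw [Finset.sum_add_distrib]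
  refine (norm_add_le _ _).trans (add_le_add (clt_abel hd hq hN (hB a b) hK') ?_)
  have hr0 : ∀ k ξ, 0 ≤ r a b (pos ω (N := N) ξ k) := fun k ξ => (abs_nonneg _).trans (hr a b _ (pos_mem hW.h0 ξ k))
  calc _ ≤ ∑ k ∈ Finset.range K', Ex N (fun ξ => r a b (pos ω ξ k)) := by
        refine (norm_sum_le _ _).trans (Finset.sum_le_sum fun k _ => (Ex_norm _).trans (Ex_mono fun ξ => ?_))
        simp only [hβ]
        rw [norm_mul, norm_mul, ce_norm, one_mul, Complex.norm_real, Real.norm_of_nonneg (wq_pos k).le, Complex.norm_real]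
        exact (mul_le_of_le_one_left (norm_nonneg _) (wq_le hq hN k)).trans (hr a b _ (pos_mem hW.h0 ξ k))
    _ ≤ ∑ k ∈ Finset.range N, Ex N (fun ξ => r a b (pos ω ξ k)) :=
        Finset.sum_le_sum_of_subset_of_nonneg (Finset.range_subset_range.2 hK') (fun k _ _ => Ex_nonneg fun ξ => hr0 k ξ)
    _ ≤ _ := hR a b

/-- uniform central limit theorem for the harmonic coordinates along the walk -/
lemma clt_unif (hd : 0 < d) (hW : GoodWalk ω C Φ G) (hC : ∀ v : Fin d → ℝ, 0 ≤ ∑ a, ∑ b, v a * C a b * v b)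
    (θ : Fin m → Fin d → ℝ) {A : ℝ} (hA : 0 ≤ A) {δ : ℝ} (hδ : 0 < δ) :
    ∃ n0 : ℕ, ∀ n, n0 ≤ n → ∀ N : ℕ, (N:ℝ) ≤ A * n → ∀ K : Fin m → ℕ, (∀ j, K j ≤ N) →
      ‖Ex N (fun ξ : Fin N → Dir d => ce ((Real.sqrt n)⁻¹ * ∑ j, ∑ a, θ j a * Φ a (pos ω ξ (K j)))) -
        (Real.exp (-(((n:ℝ)⁻¹ * ∑ j, ∑ j', ((min (K j) (K j') : ℕ) : ℝ) * ∑ a, ∑ b, θ j a * C a b * θ j' b)/2)) : ℝ)‖ ≤ δ := by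
  set L := Lth θ with hL
  have hL0 : 0 ≤ L := Lth_nonneg
  obtain ⟨ε, hε, hε1, hεδ⟩ : ∃ ε : ℝ, 0 < ε ∧ ε ≤ 1 ∧ ε * (5 * L^2 * A) ≤ δ/2 := by
    refine ⟨min 1 (δ / (2 * (5*L^2*A + 1))), by positivity, min_le_left _ _, ?_⟩
    have h0 : 0 ≤ 5*L^2*A := by positivity
    calc _ ≤ (δ / (2 * (5*L^2*A + 1))) * (5*L^2*A + 1) := mul_le_mul (min_le_right _ _) (by linarith) h0 (by positivity)
      _ = δ/2 := by field_simp
  obtain ⟨Kt, hT⟩ := hW.tail ε hε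
  choose H r B hB hr hR using fun a b => hW.erg a b ε hε
  set BB := ∑ a, ∑ b, B a b with hBB
  have hB0 : ∀ a b, 0 ≤ B a b := fun a b => (abs_nonneg _).trans (hB a b 0)
  have hB' : ∀ a b x, |H a b x| ≤ BB := fun a b x => (hB a b x).trans
    ((Finset.single_le_sum (f := fun b => B a b) (fun b _ => hB0 a b) (Finset.mem_univ b)).trans
      (Finset.single_le_sum (f := fun a => ∑ b, B a b) (fun a _ => Finset.sum_nonneg fun b _ => hB0 a b) (Finset.mem_univ a)))
  have hBB0 : 0 ≤ BB := Finset.sum_nonneg fun a _ => Finset.sum_nonneg fun b _ => hB0 a b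
  set c := ∑ a, ∑ b, |C a b| with hc
  have hc0 : 0 ≤ c := Finset.sum_nonneg fun a _ => Finset.sum_nonneg fun b _ => abs_nonneg _
  set Z := L^2 * BB * (3 + A * (L^2 * (Kt + 1) + 1)) + 4 * L^2 * A * (Kt * (L * Real.sqrt Kt)) + A * (L^2 * c)^2 with hZ
  have hZ0 : 0 ≤ Z := by positivity
  have hlim : Tendsto (fun n : ℕ => (Real.sqrt n)⁻¹ * Z) atTop (nhds (0 * Z)) :=
    ((tendsto_inv_atTop_zero.comp (Real.tendsto_sqrt_atTop.comp tendsto_natCast_atTop_atTop))).mul_const Z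
  rw [zero_mul] at hlim
  obtain ⟨n0, hn0⟩ := eventually_atTop.1 (hlim.eventually (gt_mem_nhds (half_pos hδ)))
  refine ⟨max n0 1, fun n hn N hNA K hK => ?_⟩
  have hn1 : 1 ≤ n := (le_max_right _ _).trans hn
  have hs := hn0 n ((le_max_left _ _).trans hn)
  have hnp : (0:ℝ) < n := by exact_mod_cast hn1
  have hth : ∀ k, N ≤ k → ∀ a, th θ K k a = 0 := by
    intro k hk a
    refine Finset.sum_eq_zero fun j _ => if_neg ?_
    have := hK j; omega
  have hq : ∀ k, 0 ≤ qw θ K C n k := fun k => mul_nonneg (by positivity) (hC _)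
  have hN : ∀ k, N ≤ k → qw θ K C n k = 0 := by
    intro k hk; simp [qw, hth k hk]
  have main := clt_tele (N := N) (ω := ω) (dl := dlw θ K Φ n) (q := qw θ K C n) hd hW.h0 hq hN (fun k x hx => dlw_sum hW n k hx)
  have p1 := clt_drift (θ := θ) (K := K) (n := n) hd hW hK hq hN H r hB' hr (fun a b => hR a b N N le_rfl)
  have p2 := dlw_l1 (θ := θ) (K := K) hd hW hT N (n := n) hn1
  have p3 := dlw_lind (θ := θ) (K := K) hd hW hT N n
  have p4 : ∑ k ∈ Finset.range N, (qw θ K C n k)^2 ≤ N * ((n:ℝ)⁻¹ * (L^2 * c))^2 := by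
    calc _ ≤ ∑ k ∈ Finset.range N, ((n:ℝ)⁻¹ * (L^2 * c))^2 := by
          refine Finset.sum_le_sum fun k _ => ?_
          rw [← sq_abs]
          exact pow_le_pow_left₀ (abs_nonneg _) (qw_abs n k) 2
      _ = _ := by simp
  simp only [Sf_dlw ω hW.zero n hK] at main
  rw [Dq_qw C n hK] at main
  refine main.trans ?_
  rw [Finset.sum_add_distrib, ← Finset.mul_sum]
  set X := ∑ k ∈ Finset.range N, Ex N (fun ξ : Fin N → Dir d => |dlw θ K Φ n k (pos ω ξ k) (pos ω ξ (k+1))|)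
  rw [← hL] at p1 p2 p3
  set s := (Real.sqrt n)⁻¹ with hsd
  have hs0 : 0 ≤ s := by positivity
  have hs1 : s ≤ 1 := by
    refine inv_le_one_of_one_le₀ ?_
    rw [Real.one_le_sqrt]; exact_mod_cast hn1
  have hss : s^2 = (n:ℝ)⁻¹ := by rw [hsd, inv_pow, Real.sq_sqrt hnp.le]
  have hss1 : s^2 ≤ s := by nlinarith
  have hsN : s^2 * N ≤ A := by
    rw [hss, inv_mul_le_iff₀ hnp]; linarith
  rw [← hss] at p1 p3 p4
  have hNn : (0:ℝ) ≤ N := by positivity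
  have hKt : (0:ℝ) ≤ Kt := by positivity
  have hb1 : s^2 * X ≤ s * (A * (L^2 * (Kt + 1) + 1)) := by
    calc s^2 * X ≤ s^2 * (s * (L^2 * (Kt + ε) + 1) * N) := mul_le_mul_of_nonneg_left p2 (by positivity)
      _ = s * ((s^2 * N) * (L^2 * (Kt + ε) + 1)) := by ring
      _ ≤ _ := by
        refine mul_le_mul_of_nonneg_left (mul_le_mul hsN ?_ (by positivity) hA) hs0
        gcongr
  have hb2 : s^2 * (L^2 * (BB * (3 + X) + ε * N)) ≤ s * (L^2 * BB * (3 + A * (L^2 * (Kt + 1) + 1))) + ε * (L^2 * A) := by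
    calc _ = L^2 * BB * (3 * s^2 + s^2 * X) + ε * (L^2 * (s^2 * N)) := by ring
      _ ≤ L^2 * BB * (3 * s + s * (A * (L^2 * (Kt + 1) + 1))) + ε * (L^2 * A) := by gcongr
      _ = _ := by ring
  have hb3 : s^2 * L^2 * (Kt * (L * Real.sqrt Kt * s) + ε) * N ≤ s * (L^2 * A * (Kt * (L * Real.sqrt Kt))) + ε * (L^2 * A) := by
    calc _ = (s^2 * N) * (L^2 * (Kt * (L * Real.sqrt Kt * s) + ε)) := by ring
      _ ≤ A * (L^2 * (Kt * (L * Real.sqrt Kt * s) + ε)) := mul_le_mul_of_nonneg_right hsN (by positivity)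
      _ = _ := by ring
  have hb4 : N * (s^2 * (L^2 * c))^2 ≤ s * (A * (L^2*c)^2) := by
    calc _ = (s^2 * N) * s^2 * (L^2*c)^2 := by ring
      _ ≤ A * s * (L^2*c)^2 := by gcongr
      _ = _ := by ring
  have htot : s * Z = s * (L^2 * BB * (3 + A * (L^2 * (Kt + 1) + 1))) + 4 * (s * (L^2 * A * (Kt * (L * Real.sqrt Kt)))) + s * (A * (L^2*c)^2) := by
    rw [hZ]; ring
  linarith
end
end Perco

namespace Perco
variable {d : ℕ}

/-- convex truncation of the square -/
noncomputable def fi (c z : ℝ) : ℝ := z^2 - 2*(1 - Real.cos (c*z))/c^2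

lemma fi_nonneg {c : ℝ} (hc : 0 < c) (z : ℝ) : 0 ≤ fi c z := by
  have h := Real.one_sub_sq_div_two_le_cos (x := c*z)
  have : 2*(1 - Real.cos (c*z))/c^2 ≤ z^2 := by
    rw [div_le_iff₀ (by positivity)]; nlinarith
  unfold fi; linarith

lemma fi_convex {c : ℝ} (hc : 0 < c) : ConvexOn ℝ Set.univ (fi c) := by
  have hD : ∀ z, HasDerivAt (fi c) (2*z - 2*Real.sin (c*z)/c) z := by
    intro z
    have h0 : HasDerivAt (fun z : ℝ => c*z) c z := by simpa using (hasDerivAt_id z).const_mul c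
    have h1 := (Real.hasDerivAt_cos (c*z)).comp z h0
    have h2 := ((((h1.const_sub 1).const_mul 2).div_const (c^2)))
    have h3 := (hasDerivAt_pow 2 z).sub h2
    refine h3.congr_deriv ?_
    field_simp; simp; ring
  refine Monotone.convexOn_univ_of_deriv (fun z => (hD z).differentiableAt) ?_
  rw [show deriv (fi c) = fun z => 2*z - 2*Real.sin (c*z)/c from funext fun z => (hD z).deriv]
  intro x y hxy
  have h1 := (abs_le.1 (Real.abs_sin_sub_sin_le (c*y) (c*x))).2
  rw [abs_of_nonneg (by nlinarith)] at h1
  have h2 : 2*Real.sin (c*y)/c - 2*Real.sin (c*x)/c ≤ 2*y - 2*x := by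
    rw [← sub_div, div_le_iff₀ hc]; nlinarith
  simp only; linarith

lemma fi_big {l z : ℝ} (hl : 0 < l) (h : l ≤ |z|) : 3/4*l^2 ≤ fi (4/l) z := by
  have h1 := Real.neg_one_le_cos (4/l*z)
  have h2 : 2*(1 - Real.cos (4/l*z))/(4/l)^2 ≤ l^2/4 := by
    rw [div_le_iff₀ (by positivity)]
    have : l^2/4*(4/l)^2 = 4 := by field_simp
    rw [this]; linarith
  have h3 : l^2 ≤ z^2 := by rw [← sq_abs z]; exact pow_le_pow_left₀ hl.le h 2
  unfold fi; linarith

section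
variable {ω : Config d} {C : Matrix (Fin d) (Fin d) ℝ} {Φ : Fin d → Pt d → ℝ} {G : Pt d → ℝ} {N : ℕ}

lemma Ex_stepF (hd : 0 < d) {k : ℕ} (hk : k < N) (F : (Fin N → Dir d) → Pt d → ℝ)
    (hF : ∀ ξ e x, F (Function.update ξ ⟨k, hk⟩ e) x = F ξ x) :
    Ex N (fun ξ => F ξ (pos ω ξ (k+1))) = Ex N (fun ξ => (2*d:ℝ)⁻¹ * ∑ e, F ξ (mv ω (pos ω ξ k) e)) := by
  rw [Ex_step hd ⟨k, hk⟩]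
  congr 1; funext ξ
  rw [smul_eq_mul]
  congr 1
  refine Finset.sum_congr rfl fun e _ => ?_
  rw [hF]
  exact congrArg _ (pos_upd_succ ω ξ ⟨k, hk⟩ e)

/-- increment since time `k0` -/
noncomputable def inc (ω : Config d) (Φ : Fin d → Pt d → ℝ) (a : Fin d) (s : ℝ) (k0 k : ℕ) {N : ℕ} (ξ : Fin N → Dir d) : ℝ :=
  s * (Φ a (pos ω ξ k) - Φ a (pos ω ξ k0))

open scoped Classical in
noncomputable def hit (ω : Config d) (Φ : Fin d → Pt d → ℝ) (a : Fin d) (s l : ℝ) (k0 k : ℕ) {N : ℕ} (ξ : Fin N → Dir d) : ℝ :=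
  if ∃ j, k0 ≤ j ∧ j ≤ k ∧ l ≤ |inc ω Φ a s k0 j ξ| then 1 else 0

lemma hit_upd (a : Fin d) (s l : ℝ) {k0 k : ℕ} (h0 : k0 ≤ k) (hk : k < N) (ξ : Fin N → Dir d) (e : Dir d) :
    hit ω Φ a s l k0 k (Function.update ξ ⟨k, hk⟩ e) = hit ω Φ a s l k0 k ξ := by
  have h : ∀ j, (k0 ≤ j ∧ j ≤ k ∧ l ≤ |inc ω Φ a s k0 j (Function.update ξ ⟨k, hk⟩ e)|) ↔
      (k0 ≤ j ∧ j ≤ k ∧ l ≤ |inc ω Φ a s k0 j ξ|) := by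
    intro j
    refine and_congr_right fun _ => and_congr_right fun hj => ?_
    rw [inc, inc, pos_upd ω ξ ⟨k, hk⟩ e j hj, pos_upd ω ξ ⟨k, hk⟩ e k0 h0]
  have h' := exists_congr h
  by_cases hh : ∃ j, k0 ≤ j ∧ j ≤ k ∧ l ≤ |inc ω Φ a s k0 j ξ|
  · rw [hit, hit, if_pos hh, if_pos (h'.2 hh)]
  · rw [hit, hit, if_neg hh, if_neg (fun h2 => hh (h'.1 h2))]

lemma fi_sub (hd : 0 < d) (hW : GoodWalk ω C Φ G) (a : Fin d) (s : ℝ) {c : ℝ} (hc : 0 < c) {k0 k : ℕ} (h0 : k0 ≤ k) (hk : k < N)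
    (f : (Fin N → Dir d) → ℝ) (hf0 : ∀ ξ, 0 ≤ f ξ) (hf : ∀ ξ e, f (Function.update ξ ⟨k, hk⟩ e) = f ξ) :
    Ex N (fun ξ => f ξ * fi c (inc ω Φ a s k0 k ξ)) ≤ Ex N (fun ξ => f ξ * fi c (inc ω Φ a s k0 (k+1) ξ)) := by
  have e1 := Ex_stepF (ω := ω) hd hk (fun ξ x => f ξ * fi c (s * (Φ a x - Φ a (pos ω ξ k0)))) (by
    intro ξ e x
    simp only [hf]
    rw [pos_upd ω ξ ⟨k, hk⟩ e k0 h0])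
  simp only [inc] at e1 ⊢
  rw [e1]
  refine Ex_mono fun ξ => ?_
  rw [← Finset.mul_sum, mul_left_comm]
  refine mul_le_mul_of_nonneg_left ?_ (hf0 ξ)
  have hcx := (fi_convex hc).map_sum_le (t := Finset.univ) (w := fun _ : Dir d => (2*d:ℝ)⁻¹)
    (p := fun e => s * (Φ a (mv ω (pos ω ξ k) e) - Φ a (pos ω ξ k0))) (fun _ _ => by positivity)
    (by rw [Finset.sum_const, Finset.card_univ, card_Dir, nsmul_eq_mul]; push_cast; field_simp) (fun _ _ => Set.mem_univ _)
  simp only [smul_eq_mul] at hcx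
  rw [← Finset.mul_sum, ← Finset.mul_sum, ← Finset.mul_sum] at hcx
  have h2 := hW.harm a _ (pos_mem hW.h0 ξ k)
  rw [Finset.sum_sub_distrib, Finset.sum_const, Finset.card_univ, card_Dir, nsmul_eq_mul] at h2
  rw [Finset.sum_sub_distrib, Finset.sum_const, Finset.card_univ, card_Dir, nsmul_eq_mul] at hcx
  convert hcx using 2
  have h3 : ∑ e, Φ a (mv ω (pos ω ξ k) e) = ((2*d:ℕ):ℝ) * Φ a (pos ω ξ k) := by linarith
  rw [h3]; push_cast; field_simp

lemma doob (hd : 0 < d) (hW : GoodWalk ω C Φ G) (a : Fin d) (s : ℝ) {l : ℝ} (hl : 0 < l) {k0 k : ℕ} (h0 : k0 ≤ k) (hk : k ≤ N) :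
    3/4*l^2 * Ex N (fun ξ : Fin N → Dir d => hit ω Φ a s l k0 k ξ) ≤ Ex N (fun ξ : Fin N → Dir d => fi (4/l) (inc ω Φ a s k0 k ξ)) := by
  have hc : 0 < 4/l := by positivity
  have h01 : ∀ k (ξ : Fin N → Dir d), 0 ≤ hit ω Φ a s l k0 k ξ := by
    intro k ξ; unfold hit; split_ifs <;> norm_num
  have key : 0 ≤ Ex N (fun ξ : Fin N → Dir d => hit ω Φ a s l k0 k ξ * (fi (4/l) (inc ω Φ a s k0 k ξ) - 3/4*l^2)) := by
    induction k, h0 using Nat.le_induction with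
    | base =>
      refine Ex_nonneg fun ξ => ?_
      unfold hit
      split_ifs with h
      · obtain ⟨j, h1, h2, h3⟩ := h
        have := fi_big hl h3
        obtain rfl : j = k0 := by omega
        linarith
      · simp
    | succ k h0 ih =>
      have hk' : k < N := hk
      have hsub := fi_sub hd hW a s hc h0 hk' (fun ξ => hit ω Φ a s l k0 k ξ) (h01 k) (hit_upd a s l h0 hk')
      have h1 : Ex N (fun ξ : Fin N → Dir d => hit ω Φ a s l k0 k ξ * (fi (4/l) (inc ω Φ a s k0 (k+1) ξ) - 3/4*l^2)) ≤
          Ex N (fun ξ : Fin N → Dir d => hit ω Φ a s l k0 (k+1) ξ * (fi (4/l) (inc ω Φ a s k0 (k+1) ξ) - 3/4*l^2)) := by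
        refine Ex_mono fun ξ => ?_
        by_cases h : ∃ j, k0 ≤ j ∧ j ≤ k ∧ l ≤ |inc ω Φ a s k0 j ξ|
        · have h' : ∃ j, k0 ≤ j ∧ j ≤ k+1 ∧ l ≤ |inc ω Φ a s k0 j ξ| := by
            obtain ⟨j, h1, h2, h3⟩ := h; exact ⟨j, h1, by omega, h3⟩
          rw [hit, hit, if_pos h, if_pos h']
        · rw [hit, if_neg h, zero_mul, hit]
          split_ifs with h'
          · obtain ⟨j, h1, h2, h3⟩ := h'
            have hj : j = k+1 := by
              by_contra hne
              exact h ⟨j, h1, by omega, h3⟩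
            subst hj
            have := fi_big hl h3
            linarith
          · simp
      have ih' := ih hk'.le
      simp only [mul_sub] at ih' h1 ⊢
      rw [Ex_sub] at ih' h1
      linarith
  simp only [mul_sub] at key
  rw [Ex_sub] at key
  have h2 : Ex N (fun ξ : Fin N → Dir d => hit ω Φ a s l k0 k ξ * fi (4/l) (inc ω Φ a s k0 k ξ)) ≤
      Ex N (fun ξ : Fin N → Dir d => fi (4/l) (inc ω Φ a s k0 k ξ)) := by
    refine Ex_mono fun ξ => mul_le_of_le_one_left (fi_nonneg hc _) ?_
    unfold hit; split_ifs <;> norm_num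
  rw [← Ex_mul]
  simp only [mul_comm (3/4*l^2)]
  linarith

lemma second_moment (hd : 0 < d) (hW : GoodWalk ω C Φ G) (a : Fin d) {ε : ℝ} (hε : 0 < ε) : ∃ B : ℝ, 0 ≤ B ∧ ∀ N k0 k : ℕ, k0 ≤ k → k ≤ N →
    Ex N (fun ξ : Fin N → Dir d => (Φ a (pos ω ξ k) - Φ a (pos ω ξ k0))^2) ≤ C a a * (k - k0) + B + ε * N := by
  obtain ⟨H, r, B, hB, hr, hR⟩ := hW.erg a a ε hε
  have hB0 : 0 ≤ B := (abs_nonneg _).trans (hB 0)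
  refine ⟨2*B, by positivity, fun N k0 k h0 hk => ?_⟩
  have hr0 : ∀ k ξ, 0 ≤ r (pos ω (N := N) ξ k) := fun k ξ => (abs_nonneg _).trans (hr _ (pos_mem hW.h0 ξ k))
  have key : Ex N (fun ξ : Fin N → Dir d => (Φ a (pos ω ξ k) - Φ a (pos ω ξ k0))^2) ≤ C a a * (k - k0) +
      (Ex N (fun ξ : Fin N → Dir d => H (pos ω ξ k0)) - Ex N (fun ξ : Fin N → Dir d => H (pos ω ξ k))) +
      ∑ j ∈ Finset.range k, Ex N (fun ξ : Fin N → Dir d => r (pos ω ξ j)) := by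
    induction k, h0 using Nat.le_induction with
    | base =>
      simp only [sub_self, mul_zero, zero_add]
      simp only [ne_eq, OfNat.ofNat_ne_zero, not_false_eq_true, zero_pow, Ex_zero]
      exact Finset.sum_nonneg fun j _ => Ex_nonneg (hr0 j)
    | succ k h0 ih =>
      have hk' : k < N := hk
      have ih' := ih hk'.le
      have e1 := Ex_stepF (ω := ω) hd hk' (fun ξ x => (Φ a x - Φ a (pos ω ξ k0))^2 + H x) (by
        intro ξ e x
        rw [pos_upd ω ξ ⟨k, hk'⟩ e k0 h0])
      rw [Ex_add] at e1
      have h2 : Ex N (fun ξ : Fin N → Dir d => (2*d:ℝ)⁻¹ * ∑ e, ((Φ a (mv ω (pos ω ξ k) e) - Φ a (pos ω ξ k0))^2 + H (mv ω (pos ω ξ k) e))) ≤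
          Ex N (fun ξ : Fin N → Dir d => (Φ a (pos ω ξ k) - Φ a (pos ω ξ k0))^2 + (C a a + (H (pos ω ξ k) + r (pos ω ξ k)))) := by
        refine Ex_mono fun ξ => ?_
        set x := pos ω ξ k
        set y := Φ a (pos ω ξ k0)
        have hx : x ∈ Sinf ω := pos_mem hW.h0 ξ k
        have h3 := (abs_le.1 (hr x hx)).2
        have h4 : ∑ e, (Φ a (mv ω x e) - y)^2 = ∑ e, (Φ a (mv ω x e) - Φ a x) * (Φ a (mv ω x e) - Φ a x) + (2*d) * (Φ a x - y)^2 := by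
          have : ∀ e, (Φ a (mv ω x e) - y)^2 = (Φ a (mv ω x e) - Φ a x) * (Φ a (mv ω x e) - Φ a x) +
            2 * (Φ a x - y) * (Φ a (mv ω x e) - Φ a x) + (Φ a x - y)^2 := fun e => by ring
          simp only [this, Finset.sum_add_distrib, ← Finset.mul_sum, hW.harm a x hx]
          rw [Finset.sum_const, Finset.card_univ, card_Dir, nsmul_eq_mul]; push_cast; ring
        rw [Finset.sum_add_distrib, h4, mul_add, mul_add, inv_mul_cancel_left₀ (by positivity)]
        linarith
      rw [Ex_add, Ex_add, Ex_const hd, Ex_add] at h2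
      rw [Finset.sum_range_succ]
      push_cast
      linarith
  have h1 := hR N k hk
  have h2 : Ex N (fun ξ : Fin N → Dir d => H (pos ω ξ k0)) ≤ B := by
    calc _ ≤ Ex N (fun _ : Fin N → Dir d => B) := Ex_mono fun ξ => (abs_le.1 (hB _)).2
      _ = B := Ex_const hd B
  have h3 : -B ≤ Ex N (fun ξ : Fin N → Dir d => H (pos ω ξ k)) := by
    calc -B = Ex N (fun _ : Fin N → Dir d => -B) := (Ex_const hd _).symm
      _ ≤ _ := Ex_mono fun ξ => (abs_le.1 (hB _)).1
  have h4 : ε * k ≤ ε * N := mul_le_mul_of_nonneg_left (by exact_mod_cast hk) hε.le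
  linarith

lemma exp_quad {x : ℝ} (hx : 0 ≤ x) : Real.exp (-x) ≤ 1 - x + x^2/2 := by
  have h := Real.quadratic_le_exp_of_nonneg hx
  rw [Real.exp_neg, inv_le_iff_one_le_mul₀ (Real.exp_pos x)]
  have h0 : 0 ≤ 1 - x + x^2/2 := by nlinarith [sq_nonneg (x-1)]
  calc (1:ℝ) ≤ (1 - x + x^2/2) * (1 + x + x^2/2) := by nlinarith [sq_nonneg (x^2)]
    _ ≤ _ := mul_le_mul_of_nonneg_left h h0

/-- maximal inequality over a block of times -/
lemma block (hd : 0 < d) (hW : GoodWalk ω C Φ G) (hC : ∀ v : Fin d → ℝ, 0 ≤ ∑ a, ∑ b, v a * C a b * v b) (a : Fin d)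
    {A : ℝ} (hA : 0 ≤ A) {l : ℝ} (hl : 0 < l) {η : ℝ} (hη : 0 < η) :
    ∃ n0 : ℕ, ∀ n, n0 ≤ n → ∀ N : ℕ, (N:ℝ) ≤ A * n → ∀ k0 k : ℕ, k0 ≤ k → k ≤ N →
      Ex N (fun ξ : Fin N → Dir d => hit ω Φ a (Real.sqrt n)⁻¹ l k0 k ξ) ≤ 16/(3*l^4) * (C a a * (k - k0)/n)^2 + η := by
  set c := 4/l with hcd
  have hc : 0 < c := by positivity
  obtain ⟨n0, hn0⟩ : ∃ n0 : ℕ, ∀ n, n0 ≤ n → ∀ N : ℕ, (N:ℝ) ≤ A * n → ∀ k0 k : ℕ, k0 ≤ k → k ≤ N →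
      Ex N (fun ξ : Fin N → Dir d => Real.cos (c * inc ω Φ a (Real.sqrt n)⁻¹ k0 k ξ)) ≤
        Real.exp (-(c^2 * (C a a * (k-k0)/n)/2)) + η * l^2/4 * c^2/2 := by
    obtain ⟨n0, h⟩ := clt_unif (m := 2) hd hW hC (fun j b => if b = a then (if j = 0 then c else -c) else 0) hA
      (δ := η * l^2/4 * c^2/2) (by positivity)
    refine ⟨n0, fun n hn N hN k0 k h0 hk => ?_⟩
    have h1 := h n hn N hN (fun j => if j = 0 then k else k0) (by intro j; split_ifs <;> omega)
    have h2 := (Complex.re_le_norm _).trans h1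
    rw [Complex.sub_re, Ex_re, Complex.ofReal_re] at h2
    simp only [ce_re] at h2
    have e1 : ∀ ξ : Fin N → Dir d, (Real.sqrt n)⁻¹ * ∑ j : Fin 2, ∑ b, (if b = a then (if j = 0 then c else -c) else 0) *
        Φ b (pos ω ξ (if j = 0 then k else k0)) = c * inc ω Φ a (Real.sqrt n)⁻¹ k0 k ξ := by
      intro ξ
      simp [inc, Fin.sum_univ_two]; ring
    have e1' : Ex N (fun ξ : Fin N → Dir d => Real.cos ((Real.sqrt n)⁻¹ * ∑ j : Fin 2, ∑ b, (if b = a then (if j = 0 then c else -c) else 0) *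
        Φ b (pos ω ξ (if j = 0 then k else k0)))) = Ex N (fun ξ : Fin N → Dir d => Real.cos (c * inc ω Φ a (Real.sqrt n)⁻¹ k0 k ξ)) := by
      congr 1; funext ξ; rw [e1]
    have e2 : ∀ s t : ℝ, ∑ b, ∑ b', (if b = a then s else 0) * C b b' * (if b' = a then t else 0) = s * t * C a a := by
      intro s t
      rw [Finset.sum_eq_single a, Finset.sum_eq_single a]
      · simp; ring
      · intro b _ hb; simp [hb]
      · simp
      · intro b _ hb; simp [hb]
      · simp
    rw [e1'] at h2
    have e3 : (n:ℝ)⁻¹ * ∑ j : Fin 2, ∑ j' : Fin 2, ((min (if j = 0 then k else k0) (if j' = 0 then k else k0) : ℕ) : ℝ) *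
        ∑ b, ∑ b', (if b = a then (if j = 0 then c else -c) else 0) * C b b' * (if b' = a then (if j' = 0 then c else -c) else 0) =
        c^2 * (C a a * (k-k0)/n) := by
      simp only [e2, Fin.sum_univ_two]
      simp only [if_pos, one_ne_zero, if_neg, not_false_eq_true, Fin.isValue, min_self, min_eq_left h0, min_eq_right h0]
      ring
    rw [e3] at h2
    linarith
  obtain ⟨B, hB0, hB⟩ := second_moment hd hW a (ε := η * l^2/8/(A+1)) (by positivity)
  obtain ⟨n1, hn1⟩ := exists_nat_gt (B / (η * l^2/8))
  refine ⟨max n0 (n1 + 1), fun n hn N hN k0 k h0 hk => ?_⟩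
  have hnn0 : n0 ≤ n := (le_max_left _ _).trans hn
  have hnn1 : n1 + 1 ≤ n := (le_max_right _ _).trans hn
  have hnp : (0:ℝ) < n := by exact_mod_cast (by omega : 0 < n)
  set s := C a a * (k - k0)/n with hs
  have hCa : 0 ≤ C a a := by
    have := hC (fun b => if b = a then 1 else 0)
    rwa [Finset.sum_eq_single a (fun b _ hb => by simp [hb]) (by simp), Finset.sum_eq_single a (fun b _ hb => by simp [hb]) (by simp),
      if_pos rfl, one_mul, mul_one] at this
  have hs0 : 0 ≤ s := by
    have : (0:ℝ) ≤ k - k0 := by rw [sub_nonneg]; exact_mod_cast h0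
    positivity
  have h1 := hn0 n hnn0 N hN k0 k h0 hk
  have h2 : Ex N (fun ξ : Fin N → Dir d => (inc ω Φ a (Real.sqrt n)⁻¹ k0 k ξ)^2) ≤ s + η*l^2/4 := by
    have e : ∀ ξ : Fin N → Dir d, (inc ω Φ a (Real.sqrt n)⁻¹ k0 k ξ)^2 = (n:ℝ)⁻¹ * (Φ a (pos ω ξ k) - Φ a (pos ω ξ k0))^2 := by
      intro ξ; rw [inc, mul_pow, inv_pow, Real.sq_sqrt hnp.le]
    rw [show (fun ξ : Fin N → Dir d => (inc ω Φ a (Real.sqrt n)⁻¹ k0 k ξ)^2) = fun ξ => (n:ℝ)⁻¹ * (Φ a (pos ω ξ k) - Φ a (pos ω ξ k0))^2 from funext e,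
      Ex_mul, inv_mul_le_iff₀ hnp]
    refine (hB N k0 k h0 hk).trans ?_
    have g1 : B ≤ n * (η * l^2/8) := by
      have : B / (η * l^2/8) ≤ n := hn1.le.trans (by exact_mod_cast (by omega : n1 ≤ n))
      rwa [div_le_iff₀ (by positivity)] at this
    have g2 : η * l^2/8/(A+1) * N ≤ n * (η * l^2/8) := by
      calc _ ≤ η * l^2/8/(A+1) * ((A+1)*n) := mul_le_mul_of_nonneg_left (by nlinarith) (by positivity)
        _ = _ := by field_simp
    have g3 : n * s = C a a * (k - k0) := by rw [hs]; field_simp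
    linarith
  have h3 := doob (N := N) hd hW a (Real.sqrt n)⁻¹ hl h0 hk
  rw [← hcd] at h3
  have h4 : Ex N (fun ξ : Fin N → Dir d => fi c (inc ω Φ a (Real.sqrt n)⁻¹ k0 k ξ)) ≤ c^2*s^2/4 + η*l^2/2 := by
    have e : ∀ ξ : Fin N → Dir d, fi c (inc ω Φ a (Real.sqrt n)⁻¹ k0 k ξ) = (inc ω Φ a (Real.sqrt n)⁻¹ k0 k ξ)^2 +
        ((2/c^2) * Real.cos (c * inc ω Φ a (Real.sqrt n)⁻¹ k0 k ξ) + (-(2/c^2))) := by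
      intro ξ; rw [fi]; ring
    rw [show (fun ξ : Fin N → Dir d => fi c (inc ω Φ a (Real.sqrt n)⁻¹ k0 k ξ)) = fun ξ => (inc ω Φ a (Real.sqrt n)⁻¹ k0 k ξ)^2 +
        ((2/c^2) * Real.cos (c * inc ω Φ a (Real.sqrt n)⁻¹ k0 k ξ) + (-(2/c^2))) from funext e, Ex_add, Ex_add, Ex_mul, Ex_const hd]
    have g1 := exp_quad (x := c^2*s/2) (by positivity)
    have g2 : (2/c^2) * Ex N (fun ξ : Fin N → Dir d => Real.cos (c * inc ω Φ a (Real.sqrt n)⁻¹ k0 k ξ)) ≤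
        (2/c^2) * (1 - c^2*s/2 + (c^2*s/2)^2/2 + η * l^2/4 * c^2/2) := mul_le_mul_of_nonneg_left (by linarith) (by positivity)
    have g3 : (2/c^2) * (1 - c^2*s/2 + (c^2*s/2)^2/2 + η * l^2/4 * c^2/2) = 2/c^2 - s + c^2*s^2/4 + η*l^2/4 := by
      field_simp; ring
    linarith
  have h5 : 3/4*l^2 * (16/(3*l^4) * s^2) = c^2*s^2/4 := by rw [hcd]; field_simp; ring
  have h6 : 3/4*l^2 * Ex N (fun ξ : Fin N → Dir d => hit ω Φ a (Real.sqrt n)⁻¹ l k0 k ξ) ≤ 3/4*l^2 * (16/(3*l^4) * s^2 + η) := by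
    rw [mul_add, h5]; nlinarith [mul_pos hη (pow_pos hl 2)]
  exact le_of_mul_le_mul_left h6 (by positivity)
end
end Perco

namespace Perco
variable {d : ℕ}

lemma stepP_eq (hd : 0 < d) (ω : Config d) (y z : Pt d) :
    stepP d ω y z = (2*d:ℝ)⁻¹ * ∑ e : Dir d, if mv ω y e = z then (1:ℝ) else 0 := by
  classical
  have hne : ∀ e : Dir d, y + dir e ≠ y := fun e h => dir_ne_zero e (by simpa using h)
  unfold stepP
  split_ifs with h h2
  · obtain ⟨h1, h2⟩ := h
    obtain ⟨e, rfl⟩ := (adj_iff y z).1 h1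
    have h2' : ω (y + dir e) = true := h2
    rw [Finset.sum_eq_single e]
    · rw [mv, if_pos h2']; simp
    · intro e' _ hne'
      rw [if_neg]
      unfold mv
      split_ifs
      · intro h3; exact hne' (dir_injective (by simpa using h3))
      · exact (hne e).symm
    · simp
  · subst h2
    have h3 : degS ω z = (Finset.univ.filter fun e : Dir d => ω (z + dir e) = true).card := by
      have : {w | adj z w ∧ w ∈ SS ω} = ((Finset.univ.filter fun e : Dir d => ω (z + dir e) = true).image fun e => z + dir e : Finset (Pt d)) := by
        ext w
        simp only [Set.mem_ofPred_eq, Finset.coe_image, Finset.coe_filter, Finset.mem_univ, true_and, Set.mem_image]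
        constructor
        · rintro ⟨h1, h2⟩
          obtain ⟨e, rfl⟩ := (adj_iff z w).1 h1
          exact ⟨e, h2, rfl⟩
        · rintro ⟨e, h1, rfl⟩
          exact ⟨(adj_iff _ _).2 ⟨e, rfl⟩, h1⟩
      unfold degS
      rw [this, Set.ncard_coe_finset, Finset.card_image_of_injective]
      intro e e' h
      exact dir_injective (by simpa using h)
    have h4 : ∀ e : Dir d, (if mv ω z e = z then (1:ℝ) else 0) = 1 - if ω (z + dir e) = true then 1 else 0 := by
      intro e
      unfold mv
      by_cases h5 : ω (z + dir e) = true
      · rw [if_pos h5, if_pos h5, if_neg (hne e)]; simp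
      · rw [if_neg h5, if_neg h5, if_pos rfl]; simp
    simp only [h4]
    rw [Finset.sum_sub_distrib, Finset.sum_boole, h3, Finset.sum_const, Finset.card_univ, card_Dir]
    push_cast
    field_simp
    simp
  · rw [Finset.sum_eq_zero, mul_zero]
    intro e _
    rw [if_neg]
    unfold mv
    split_ifs with h5
    · intro h6
      exact h ⟨(adj_iff _ _).2 ⟨e, h6.symm⟩, by rw [← h6]; exact h5⟩
    · exact fun h6 => h2 h6.symm

/-- the path driven by a word -/
def wpath (ω : Config d) {m : ℕ} (ξ : Fin m → Dir d) : Fin (m+1) → Pt d := fun k => pos ω ξ k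

lemma wpath_iff (ω : Config d) {m : ℕ} (ξ : Fin m → Dir d) (p : Fin (m+1) → Pt d) :
    wpath ω ξ = p ↔ p 0 = 0 ∧ ∀ k : Fin m, mv ω (p k.castSucc) (ξ k) = p k.succ := by
  constructor
  · rintro rfl
    refine ⟨rfl, fun k => ?_⟩
    simp only [wpath, Fin.val_castSucc, Fin.val_succ]
    rw [pos_succ ω ξ k.2]
  · rintro ⟨h0, h⟩
    funext k
    induction k using Fin.induction with
    | zero => rw [h0]; rfl
    | succ k ih =>
      rw [← h k, ← ih]
      simp only [wpath, Fin.val_castSucc, Fin.val_succ]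
      rw [pos_succ ω ξ k.2]

lemma pathProb_eq (hd : 0 < d) (ω : Config d) (m : ℕ) (p : Fin (m+1) → Pt d) [Decidable (∃ ξ : Fin m → Dir d, wpath ω ξ = p)] :
    pathProb d ω m p = Ex m (fun ξ : Fin m → Dir d => if wpath ω ξ = p then (1:ℝ) else 0) := by
  classical
  unfold pathProb Ex
  simp only [stepP_eq hd, smul_eq_mul]
  rw [Finset.prod_mul_distrib, Finset.prod_const, Finset.card_univ, Fintype.card_fin, Finset.prod_univ_sum, mul_left_comm, inv_pow]
  congr 1
  rw [Finset.mul_sum, Fintype.piFinset_univ]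
  refine Finset.sum_congr rfl fun ξ _ => ?_
  rw [Finset.prod_ite_zero]
  simp only [wpath_iff, Finset.mem_univ, true_implies, Finset.prod_const_one]
  split_ifs <;> simp_all

lemma walk_tsum (hd : 0 < d) (ω : Config d) (m : ℕ) (g : (Fin (m+1) → Pt d) → ℝ) :
    ∑' p, pathProb d ω m p * g p = Ex m (fun ξ : Fin m → Dir d => g (wpath ω ξ)) := by
  classical
  have h1 : ∀ p, pathProb d ω m p * g p = ∑ ξ : Fin m → Dir d, if p = wpath ω ξ then ((2*d:ℝ)^m)⁻¹ * g (wpath ω ξ) else 0 := by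
    intro p
    rw [pathProb_eq hd, Ex, smul_eq_mul, mul_assoc, Finset.sum_mul, Finset.mul_sum]
    refine Finset.sum_congr rfl fun ξ _ => ?_
    by_cases h : wpath ω ξ = p
    · simp [h]
    · rw [if_neg h, if_neg (Ne.symm h)]; simp
  simp only [h1]
  rw [Summable.tsum_finsetSum (fun ξ _ => (hasSum_ite_eq _ _).summable)]
  simp only [tsum_ite_eq]
  rw [Ex, smul_eq_mul, Finset.mul_sum]

lemma walkExpct_eq (hd : 0 < d) (ω : Config d) (T : ℝ) (n : ℕ) (F : PathSp d T → ℝ) :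
    walkExpct d ω T n F = Ex (⌊T * n⌋.toNat + 1) (fun ξ : Fin (⌊T * n⌋.toNat + 1) → Dir d =>
      F (interpPath d T n (⌊T * n⌋.toNat + 1) (wpath ω ξ))) := 
  walk_tsum hd ω _ (fun p => F (interpPath d T n (⌊T * n⌋.toNat + 1) p))
end Perco

namespace Perco
variable {d : ℕ}

open scoped Classical in
/-- probability of an event on words -/
noncomputable def Pr (N : ℕ) (p : (Fin N → Dir d) → Prop) : ℝ := Ex N (fun ξ => if p ξ then (1:ℝ) else 0)

section
variable {N : ℕ}
lemma Pr_mono {p q : (Fin N → Dir d) → Prop} (h : ∀ ξ, p ξ → q ξ) : Pr N p ≤ Pr N q := by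
  refine Ex_mono fun ξ => ?_
  by_cases hp : p ξ
  · rw [if_pos hp, if_pos (h ξ hp)]
  · rw [if_neg hp]; split_ifs <;> norm_num
lemma Pr_or (p q : (Fin N → Dir d) → Prop) : Pr N (fun ξ => p ξ ∨ q ξ) ≤ Pr N p + Pr N q := by
  unfold Pr
  rw [← Ex_add]
  refine Ex_mono fun ξ => ?_
  by_cases hp : p ξ <;> by_cases hq : q ξ <;> simp [hp, hq]
open scoped Classical in
lemma Pr_exists {ι : Type*} (s : Finset ι) (p : ι → (Fin N → Dir d) → Prop) : Pr N (fun ξ => ∃ i ∈ s, p i ξ) ≤ ∑ i ∈ s, Pr N (p i) := by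
  unfold Pr
  rw [← Ex_sum]
  refine Ex_mono fun ξ => ?_
  split_ifs with h
  · obtain ⟨i, hi, hp⟩ := h
    refine le_trans ?_ (Finset.single_le_sum (f := fun i => if p i ξ then (1:ℝ) else 0) (fun i _ => by split_ifs <;> norm_num) hi)
    simp [hp]
  · exact Finset.sum_nonneg fun i _ => by split_ifs <;> norm_num
lemma Pr_nonneg (p : (Fin N → Dir d) → Prop) : 0 ≤ Pr N p := Ex_nonneg fun ξ => by split_ifs <;> norm_num

variable {ω : Config d} {C : Matrix (Fin d) (Fin d) ℝ} {Φ : Fin d → Pt d → ℝ} {G : Pt d → ℝ}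

lemma diag_nonneg (hC : ∀ v : Fin d → ℝ, 0 ≤ ∑ a, ∑ b, v a * C a b * v b) (a : Fin d) : 0 ≤ C a a := by
  have := hC (fun b => if b = a then 1 else 0)
  rwa [Finset.sum_eq_single a (fun b _ hb => by simp [hb]) (by simp), Finset.sum_eq_single a (fun b _ hb => by simp [hb]) (by simp),
    if_pos rfl, one_mul, mul_one] at this

lemma Pr_block (hd : 0 < d) (hW : GoodWalk ω C Φ G) (hC : ∀ v : Fin d → ℝ, 0 ≤ ∑ a, ∑ b, v a * C a b * v b)
    {A : ℝ} (hA : 0 ≤ A) {l : ℝ} (hl : 0 < l) {η : ℝ} (hη : 0 < η) :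
    ∃ n0 : ℕ, ∀ n, n0 ≤ n → ∀ N : ℕ, (N:ℝ) ≤ A * n → ∀ k0 k : ℕ, k0 ≤ k → k ≤ N →
      Pr N (fun ξ : Fin N → Dir d => ∃ a j, k0 ≤ j ∧ j ≤ k ∧ l ≤ |inc ω Φ a (Real.sqrt n)⁻¹ k0 j ξ|) ≤
        d * (16/(3*l^4)) * ((∑ a, C a a) * (k - k0)/n)^2 + η := by
  have hCa := diag_nonneg hC
  have hCM : ∀ a, C a a ≤ ∑ a, C a a := fun a => Finset.single_le_sum (f := fun a => C a a) (fun a _ => hCa a) (Finset.mem_univ a)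
  set M := ∑ a, C a a
  choose n0 h0 using fun a => block hd hW hC a hA hl (η := η/d) (by positivity)
  refine ⟨∑ a, n0 a, fun n hn N hN k0 k hk0 hk => ?_⟩
  have h1 : Pr N (fun ξ : Fin N → Dir d => ∃ a j, k0 ≤ j ∧ j ≤ k ∧ l ≤ |inc ω Φ a (Real.sqrt n)⁻¹ k0 j ξ|) ≤
      ∑ a, Pr N (fun ξ : Fin N → Dir d => ∃ j, k0 ≤ j ∧ j ≤ k ∧ l ≤ |inc ω Φ a (Real.sqrt n)⁻¹ k0 j ξ|) := by
    refine le_trans (Pr_mono fun ξ => ?_) (Pr_exists Finset.univ _)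
    rintro ⟨a, h⟩; exact ⟨a, Finset.mem_univ a, h⟩
  refine h1.trans ?_
  have hkk : (0:ℝ) ≤ k - k0 := by rw [sub_nonneg]; exact_mod_cast hk0
  calc _ ≤ ∑ a : Fin d, (16/(3*l^4) * (M * (k - k0)/n)^2 + η/d) := by
        refine Finset.sum_le_sum fun a _ => ?_
        refine (h0 a n ((Finset.single_le_sum (f := n0) (fun _ _ => Nat.zero_le _) (Finset.mem_univ a)).trans hn) N hN k0 k hk0 hk).trans ?_
        have := hCa a
        have := hCM a
        gcongr
    _ = _ := by
        rw [Finset.sum_const, Finset.card_univ, Fintype.card_fin, nsmul_eq_mul]; field_simp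

lemma far (hd : 0 < d) (hW : GoodWalk ω C Φ G) (hC : ∀ v : Fin d → ℝ, 0 ≤ ∑ a, ∑ b, v a * C a b * v b)
    {A : ℝ} (hA : 0 ≤ A) {ε : ℝ} (hε : 0 < ε) {η : ℝ} (hη : 0 < η) :
    ∃ n0 : ℕ, ∀ n, n0 ≤ n → ∀ N : ℕ, (N:ℝ) ≤ A * n →
      Pr N (fun ξ : Fin N → Dir d => ∃ k ≤ N, ∃ a, ε * Real.sqrt n < |Φ a (pos ω ξ k) - pos ω ξ k a|) ≤ η := by
  set M := ∑ a, C a a with hMd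
  have hM0 : 0 ≤ M := Finset.sum_nonneg fun a _ => diag_nonneg hC a
  obtain ⟨L, hL1, hL⟩ : ∃ L : ℝ, 1 ≤ L ∧ d * (16/(3*L^4)) * (M * A)^2 ≤ η/2 := by
    set X := d * 16/3 * (M*A)^2 with hX
    have hX0 : 0 ≤ X := by positivity
    refine ⟨1 + X/(η/2), by linarith [show 0 ≤ X/(η/2) by positivity], ?_⟩
    set L := 1 + X/(η/2) with hL
    have hL1 : 1 ≤ L := by linarith [show 0 ≤ X/(η/2) by positivity]
    have h1 : X ≤ η/2 * L := by
      rw [hL, mul_add, mul_div_cancel₀ _ (by positivity)]; linarith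
    have h2 : L ≤ L^4 := le_self_pow₀ hL1 (by norm_num)
    have e : d * (16/(3*L^4)) * (M * A)^2 = X / L^4 := by rw [hX]; field_simp
    rw [e, div_le_iff₀ (by positivity)]
    exact h1.trans (mul_le_mul_of_nonneg_left h2 (by positivity))
  have hL0 : 0 < L := by linarith
  obtain ⟨n2, hn2⟩ := Pr_block hd hW hC hA hL0 (half_pos hη)
  set ε' := min (1/2) (ε/(4*L)) with hε'
  have hε'0 : 0 < ε' := by positivity
  choose n1 hn1 using fun a => hW.subl a ε' hε'0
  set m1 := ∑ a, n1 a with hm1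
  have hm1' : ∀ a, n1 a ≤ m1 := fun a => Finset.single_le_sum (f := n1) (fun _ _ => Nat.zero_le _) (Finset.mem_univ a)
  refine ⟨max n2 (m1^2 + 1), fun n hn N hN => ?_⟩
  have hnn2 : n2 ≤ n := (le_max_left _ _).trans hn
  have hnn1 : m1^2 + 1 ≤ n := (le_max_right _ _).trans hn
  have hnp : (0:ℝ) < n := by exact_mod_cast (by omega : 0 < n)
  have hsq : (m1:ℝ) ≤ Real.sqrt n := by
    refine Real.le_sqrt_of_sq_le ?_
    exact_mod_cast (by omega : m1^2 ≤ n)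
  have hs0 : 0 < Real.sqrt n := Real.sqrt_pos.2 hnp
  have hb := hn2 n hnn2 N hN 0 N (Nat.zero_le _) le_rfl
  refine le_trans (Pr_mono fun ξ => ?_) (hb.trans ?_)
  · rintro ⟨k, hk, a, hfar⟩
    by_contra hcon
    push Not at hcon
    set x := pos ω ξ k with hx
    have hxS : x ∈ Sinf ω := pos_mem hW.h0 ξ k
    have h1 : ∀ a, |Φ a x| ≤ L * Real.sqrt n := by
      intro a
      have := (hcon a k (Nat.zero_le _) hk).le
      rw [inc, show pos ω ξ 0 = 0 from rfl, hW.zero, sub_zero, abs_mul, abs_of_nonneg (by positivity), inv_mul_le_iff₀ hs0] at this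
      rwa [mul_comm]
    set r := nrm x with hr
    have h2 : ∀ a, |Φ a x - x a| ≤ ε' * (r + m1) := by
      intro a
      refine (hn1 a (max r m1) ((hm1' a).trans (le_max_right _ _)) x hxS (le_max_left _ _)).trans ?_
      refine mul_le_mul_of_nonneg_left ?_ hε'0.le
      have : max r m1 ≤ r + m1 := by omega
      exact_mod_cast this
    have h3 : (r:ℝ) ≤ L * Real.sqrt n + ε' * (r + m1) := by
      haveI : Nonempty (Fin d) := ⟨⟨0, hd⟩⟩
      obtain ⟨i, -, hi⟩ := Finset.exists_mem_eq_sup (Finset.univ : Finset (Fin d)) Finset.univ_nonempty (fun i => (x i).natAbs)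
      have hi' : (r:ℝ) = |(x i : ℝ)| := by
        rw [hr, nrm, hi, Nat.cast_natAbs]; simp
      rw [hi']
      have := abs_le.1 (h1 i)
      have := abs_le.1 (h2 i)
      rw [hi'] at this
      exact abs_le.2 ⟨by linarith, by linarith⟩
    have h4 : ε' ≤ 1/2 := min_le_left _ _
    have h5 : ε' ≤ ε/(4*L) := min_le_right _ _
    have hr0 : (0:ℝ) ≤ r := by positivity
    have hm0 : (0:ℝ) ≤ m1 := by positivity
    have h6 : (r:ℝ) + m1 ≤ 4 * L * Real.sqrt n := by nlinarith
    have h7 : ε' * (r + m1) ≤ ε * Real.sqrt n := by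
      calc _ ≤ ε/(4*L) * (4 * L * Real.sqrt n) := mul_le_mul h5 h6 (by positivity) (by positivity)
        _ = _ := by field_simp
    exact absurd (h2 a) (not_le.2 (h7.trans_lt hfar))
  · have h1 : (N:ℝ)/n ≤ A := by rw [div_le_iff₀ hnp]; exact hN
    have h2 : (M * ((N:ℝ) - (0:ℕ))/n)^2 ≤ (M*A)^2 := by
      rw [Nat.cast_zero, sub_zero, mul_div_assoc]
      gcongr
    have h3 : d * (16/(3*L^4)) * (M * ((N:ℝ) - (0:ℕ))/n)^2 ≤ d * (16/(3*L^4)) * (M*A)^2 := by gcongr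
    linarith

/-- discrete modulus of continuity of the walk -/
lemma modl (hd : 0 < d) (hW : GoodWalk ω C Φ G) (hC : ∀ v : Fin d → ℝ, 0 ≤ ∑ a, ∑ b, v a * C a b * v b)
    {A : ℝ} (hA : 0 ≤ A) {l : ℝ} (hl : 0 < l) {η : ℝ} (hη : 0 < η) :
    ∃ δ : ℝ, 0 < δ ∧ ∃ n0 : ℕ, ∀ n, n0 ≤ n → ∀ N : ℕ, (N:ℝ) ≤ A * n →
      Pr N (fun ξ : Fin N → Dir d => ∃ j j', j ≤ j' ∧ j' ≤ N ∧ (j':ℝ) ≤ j + δ * n ∧ ∃ a, l * Real.sqrt n < |(pos ω ξ j' a : ℝ) - pos ω ξ j a|) ≤ η := by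
  set M := ∑ a, C a a with hMd
  have hM0 : 0 ≤ M := Finset.sum_nonneg fun a _ => diag_nonneg hC a
  set l' := l/5 with hl'
  have hl'0 : 0 < l' := by positivity
  set X := (A+1) * (d * (16/(3*l'^4)) * (M*2)^2) with hX
  have hX0 : 0 ≤ X := by positivity
  obtain ⟨δ, hδ0, hδ1, hδ⟩ : ∃ δ : ℝ, 0 < δ ∧ δ ≤ 1 ∧ X * δ ≤ η/3 := by
    refine ⟨min 1 (η/3/(X+1)), by positivity, min_le_left _ _, ?_⟩
    calc X * min 1 (η/3/(X+1)) ≤ (X+1) * (η/3/(X+1)) := mul_le_mul (by linarith) (min_le_right _ _) (by positivity) (by positivity)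
      _ = η/3 := by field_simp
  set J := ⌊A/δ⌋₊ + 1 with hJ
  have hJ1 : (J:ℝ) * δ ≤ A + 1 := by
    rw [hJ]; push_cast
    have := Nat.floor_le (a := A/δ) (by positivity)
    calc (↑⌊A/δ⌋₊ + 1) * δ ≤ (A/δ + 1) * δ := by gcongr
      _ = A + δ := by field_simp
      _ ≤ _ := by linarith
  have hJ0 : (0:ℝ) < J := by rw [hJ]; positivity
  obtain ⟨n1, hn1⟩ := Pr_block hd hW hC hA hl'0 (η := η/3/J) (by positivity)
  obtain ⟨n2, hn2⟩ := far hd hW hC hA hl'0 (η := η/3) (by positivity)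
  obtain ⟨n3, hn3⟩ := exists_nat_gt (1/δ)
  refine ⟨δ, hδ0, max n1 (max n2 (n3+1)), fun n hn N hN => ?_⟩
  have hnn1 : n1 ≤ n := by omega
  have hnn2 : n2 ≤ n := by omega
  have hnn3 : n3 + 1 ≤ n := by omega
  have hnp : (0:ℝ) < n := by exact_mod_cast (by omega : 0 < n)
  have hs0 : 0 < Real.sqrt n := Real.sqrt_pos.2 hnp
  set q := ⌈δ * n⌉₊ with hq
  have hq1 : δ * n ≤ q := Nat.le_ceil _
  have hδn : 1 ≤ δ * n := by
    have : (n3:ℝ) ≤ n := by exact_mod_cast (by omega : n3 ≤ n)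
    have := hn3.le.trans this
    rw [div_le_iff₀ hδ0] at this; linarith
  have hq2 : (q:ℝ) ≤ 2 * (δ * n) := by
    have := Nat.ceil_lt_add_one (a := δ*n) (by positivity)
    linarith
  have hq0 : 0 < q := Nat.ceil_pos.2 (by positivity)
  set k0 : ℕ → ℕ := fun i => min (i*q) N with hk0
  have hk01 : ∀ i, k0 i ≤ k0 (i+1) := fun i => min_le_min_right _ (Nat.mul_le_mul_right _ (Nat.le_succ i))
  have hk02 : ∀ i, ((k0 (i+1) : ℕ):ℝ) - k0 i ≤ q := by
    intro i
    have : k0 (i+1) ≤ q + k0 i := by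
      simp only [hk0, Nat.add_mul, one_mul]; omega
    have : ((k0 (i+1) : ℕ):ℝ) ≤ q + k0 i := by exact_mod_cast this
    linarith
  have hB : Pr N (fun ξ : Fin N → Dir d => ∃ i ∈ Finset.range J, ∃ a j, k0 i ≤ j ∧ j ≤ k0 (i+1) ∧ l' ≤ |inc ω Φ a (Real.sqrt n)⁻¹ (k0 i) j ξ|) ≤ 2*(η/3) := by
    refine (Pr_exists _ _).trans ?_
    calc _ ≤ ∑ i ∈ Finset.range J, (d * (16/(3*l'^4)) * (M * 2 * δ)^2 + η/3/J) := by
          refine Finset.sum_le_sum fun i _ => (hn1 n hnn1 N hN (k0 i) (k0 (i+1)) (hk01 i) (min_le_right _ _)).trans ?_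
          have h1 : (0:ℝ) ≤ (k0 (i+1) : ℕ) - (k0 i : ℕ) := by rw [sub_nonneg]; exact_mod_cast hk01 i
          have h2 : M * (((k0 (i+1) : ℕ):ℝ) - k0 i)/n ≤ M * 2 * δ := by
            rw [div_le_iff₀ hnp]
            nlinarith [hk02 i]
          gcongr
      _ = (J*δ) * (d * (16/(3*l'^4)) * (M*2)^2) * δ + η/3 := by
          rw [Finset.sum_const, Finset.card_range, nsmul_eq_mul]; field_simp
      _ ≤ X * δ + η/3 := by
          rw [hX]; gcongr
      _ ≤ _ := by linarith
  have hF := hn2 n hnn2 N hN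
  refine le_trans (Pr_mono fun ξ => ?_) ((Pr_or _ _).trans ((add_le_add hB hF).trans (by linarith)))
  rintro ⟨j, j', hjj, hj', hδj, a, hbig⟩
  by_contra hcon
  push Not at hcon
  obtain ⟨hc1, hc2⟩ := hcon
  have hq' : j' ≤ j + q := by
    have : (j':ℝ) ≤ j + q := by linarith
    exact_mod_cast this
  have hJb : ∀ i, i ≤ N → i / q < J := by
    intro i hi
    rw [hJ, Nat.lt_succ_iff]
    refine Nat.le_floor ?_
    have h1 : (((i/q : ℕ):ℝ)) * q ≤ i := by exact_mod_cast Nat.div_mul_le_self i q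
    rw [le_div_iff₀ hδ0]
    have h2 : (i:ℝ) ≤ N := by exact_mod_cast hi
    have h3 : ((i/q : ℕ):ℝ) * (δ * n) ≤ ((i/q : ℕ):ℝ) * q := mul_le_mul_of_nonneg_left hq1 (by positivity)
    have h4 : ((i/q : ℕ):ℝ) * δ * n ≤ A * n := by linarith
    exact le_of_mul_le_mul_right h4 hnp
  have hinc : ∀ i, i < J → ∀ m, i*q ≤ m → m ≤ (i+1)*q → m ≤ N → |Φ a (pos ω ξ m) - Φ a (pos ω ξ (i*q))| ≤ l' * Real.sqrt n := by
    intro i hi m h1 h2 h3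
    have e : k0 i = i*q := min_eq_left (h1.trans h3)
    have := (hc1 i (Finset.mem_range.2 hi) a m (e.le.trans h1) (le_min h2 h3)).le
    rwa [inc, e, abs_mul, abs_of_nonneg (by positivity : 0 ≤ (Real.sqrt n)⁻¹), inv_mul_le_iff₀ hs0, mul_comm (Real.sqrt n)] at this
  have hf1 := abs_le.1 (hc2 j (hjj.trans hj') a)
  have hf2 := abs_le.1 (hc2 j' hj' a)
  have hmain : |Φ a (pos ω ξ j') - Φ a (pos ω ξ j)| ≤ 3 * (l' * Real.sqrt n) := by
    have hdj := Nat.div_mul_le_self j q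
    have hdj2 : j < (j/q+1)*q := (Nat.div_lt_iff_lt_mul hq0).1 (Nat.lt_succ_self _)
    have hdj' := Nat.div_mul_le_self j' q
    have hdj2' : j' < (j'/q+1)*q := (Nat.div_lt_iff_lt_mul hq0).1 (Nat.lt_succ_self _)
    have g1 := abs_le.1 (hinc (j/q) (hJb j (hjj.trans hj')) j hdj hdj2.le (hjj.trans hj'))
    have g2 := abs_le.1 (hinc (j'/q) (hJb j' hj') j' hdj' hdj2'.le hj')
    have hi1 : j/q ≤ j'/q := Nat.div_le_div_right hjj
    have hi2 : j'/q ≤ j/q + 1 := by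
      rw [← Nat.add_div_right _ hq0]; exact Nat.div_le_div_right hq'
    have hpos : 0 < l' * Real.sqrt n := by positivity
    rcases Nat.lt_or_ge (j/q) (j'/q) with h | h
    · have he : j'/q = j/q + 1 := by omega
      rw [he] at g2 hdj'
      have g3 := abs_le.1 (hinc (j/q) (hJb j (hjj.trans hj')) ((j/q+1)*q) (Nat.mul_le_mul_right _ (Nat.le_succ _)) le_rfl (hdj'.trans hj'))
      exact abs_le.2 ⟨by linarith, by linarith⟩
    · have he : j'/q = j/q := by omega
      rw [he] at g2
      exact abs_le.2 ⟨by linarith, by linarith⟩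
  have hmain' := abs_le.1 hmain
  have h5 : l * Real.sqrt n = 5 * (l' * Real.sqrt n) := by rw [hl']; ring
  refine absurd hbig (not_lt.2 ?_)
  rw [h5]
  exact abs_le.2 ⟨by linarith, by linarith⟩
end
end Perco

namespace Perco
variable {d : ℕ}

/-- linear interpolation of a sequence -/
noncomputable def li (x : ℕ → ℝ) (s : ℝ) : ℝ := x ⌊s⌋₊ + (s - ⌊s⌋₊) * (x (⌊s⌋₊ + 1) - x ⌊s⌋₊)

section
variable {x : ℕ → ℝ}
lemma li_near (hx : ∀ k, |x (k+1) - x k| ≤ 1) {s : ℝ} (hs : 0 ≤ s) : |li x s - x ⌊s⌋₊| ≤ 1 := by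
  have h1 := Nat.floor_le hs
  have h2 := Nat.lt_floor_add_one s
  rw [li, add_sub_cancel_left, abs_mul, abs_of_nonneg (by linarith)]
  exact mul_le_one₀ (by linarith) (abs_nonneg _) (hx _)
lemma li_steps (hx : ∀ k, |x (k+1) - x k| ≤ 1) (i k : ℕ) : |x (i+k) - x i| ≤ k := by
  induction k with
  | zero => simp
  | succ k ih =>
    have := abs_le.1 (hx (i+k)); have := abs_le.1 ih
    rw [abs_le, ← add_assoc]; push_cast; constructor <;> linarith
lemma li_mono_lip (hx : ∀ k, |x (k+1) - x k| ≤ 1) {s t : ℝ} (hs : 0 ≤ s) (hst : s ≤ t) : |li x t - li x s| ≤ t - s := by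
  have h1 := Nat.floor_le hs
  have h2 := Nat.lt_floor_add_one s
  have h3 := Nat.floor_le (hs.trans hst)
  have h4 := Nat.lt_floor_add_one t
  rcases (Nat.floor_mono hst : ⌊s⌋₊ ≤ ⌊t⌋₊).eq_or_lt with h | h
  · rw [li, li, ← h, show x ⌊s⌋₊ + (t - ⌊s⌋₊) * (x (⌊s⌋₊ + 1) - x ⌊s⌋₊) - (x ⌊s⌋₊ + (s - ⌊s⌋₊) * (x (⌊s⌋₊ + 1) - x ⌊s⌋₊))
      = (t - s) * (x (⌊s⌋₊ + 1) - x ⌊s⌋₊) by ring, abs_mul, abs_of_nonneg (by linarith)]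
    exact mul_le_of_le_one_right (by linarith) (hx _)
  · obtain ⟨k, hk⟩ := Nat.exists_eq_add_of_le (Nat.succ_le_of_lt h)
    have g1 := li_steps hx (⌊s⌋₊ + 1) k
    rw [← hk] at g1
    have hk' : (⌊t⌋₊ : ℝ) = ⌊s⌋₊ + 1 + k := by rw [hk]; push_cast; ring
    have g2 : |(t - ⌊t⌋₊) * (x (⌊t⌋₊ + 1) - x ⌊t⌋₊)| ≤ t - ⌊t⌋₊ := by
      rw [abs_mul, abs_of_nonneg (by linarith)]; exact mul_le_of_le_one_right (by linarith) (hx _)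
    have g3 : |(⌊s⌋₊ + 1 - s) * (x (⌊s⌋₊ + 1) - x ⌊s⌋₊)| ≤ ⌊s⌋₊ + 1 - s := by
      rw [abs_mul, abs_of_nonneg (by linarith)]; exact mul_le_of_le_one_right (by linarith) (hx _)
    rw [show li x t - li x s = (t - ⌊t⌋₊) * (x (⌊t⌋₊ + 1) - x ⌊t⌋₊) + (x ⌊t⌋₊ - x (⌊s⌋₊ + 1)) + (⌊s⌋₊ + 1 - s) * (x (⌊s⌋₊ + 1) - x ⌊s⌋₊) by
      unfold li; ring]
    refine (abs_add_three _ _ _).trans ?_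
    linarith
lemma li_lip (hx : ∀ k, |x (k+1) - x k| ≤ 1) {s t : ℝ} (hs : 0 ≤ s) (ht : 0 ≤ t) : |li x t - li x s| ≤ |t - s| := by
  rcases le_total s t with h | h
  · rw [abs_of_nonneg (sub_nonneg.2 h)]; exact li_mono_lip hx hs h
  · rw [abs_sub_comm, abs_sub_comm t, abs_of_nonneg (sub_nonneg.2 h)]; exact li_mono_lip hx ht h
end

section
variable {N : ℕ} (ω : Config d) (ξ : Fin N → Dir d)

lemma pos_step (i : Fin d) (k : ℕ) : |(pos ω ξ (k+1) i : ℝ) - pos ω ξ k i| ≤ 1 := by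
  by_cases h : k < N
  · rw [pos_succ ω ξ h, mv]
    split_ifs
    · have := dir_natAbs (ξ ⟨k, h⟩) i
      rw [Pi.add_apply, Int.cast_add, add_sub_cancel_left, ← Int.cast_abs, Int.abs_eq_natAbs, this]
      split_ifs <;> simp
    · simp
  · rw [pos, dif_neg h]; simp

lemma pos_min (k : ℕ) : pos ω ξ (min k N) = pos ω ξ k := by
  rcases le_total k N with h | h
  · rw [min_eq_left h]
  · rw [min_eq_right h]
    induction k, h using Nat.le_induction with
    | base => rfl
    | succ k hk ih => rw [ih, pos, dif_neg (by omega)]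

lemma inv_sqrt_le_one (n : ℕ) : (Real.sqrt n)⁻¹ ≤ 1 := by
  rcases Nat.eq_zero_or_pos n with rfl | h
  · simp
  · exact inv_le_one_of_one_le₀ (Real.one_le_sqrt.2 (by exact_mod_cast h))

/-- rescaled path value -/
noncomputable def bval (n : ℕ) (t : ℝ) (i : Fin d) : ℝ := (Real.sqrt n)⁻¹ * li (fun k => (pos ω ξ k i : ℝ)) (t * n)

lemma bval_lip (n : ℕ) (i : Fin d) {s t : ℝ} (hs : 0 ≤ s) (ht : 0 ≤ t) : |bval ω ξ n t i - bval ω ξ n s i| ≤ n * |t - s| := by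
  rw [bval, bval, ← mul_sub, abs_mul, abs_of_nonneg (by positivity)]
  have h := li_lip (x := fun k => (pos ω ξ k i : ℝ)) (pos_step ω ξ i) (mul_nonneg hs (Nat.cast_nonneg n)) (mul_nonneg ht (Nat.cast_nonneg n))
  rw [← sub_mul, abs_mul, Nat.abs_cast, mul_comm |t - s|] at h
  exact (mul_le_of_le_one_left (abs_nonneg _) (inv_sqrt_le_one n)).trans h

lemma bval_near (n : ℕ) (i : Fin d) {t : ℝ} (ht : 0 ≤ t) : |bval ω ξ n t i - (Real.sqrt n)⁻¹ * pos ω ξ ⌊t * n⌋₊ i| ≤ (Real.sqrt n)⁻¹ := by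
  rw [bval, ← mul_sub, abs_mul, abs_of_nonneg (by positivity)]
  exact mul_le_of_le_one_right (by positivity) (li_near (pos_step ω ξ i) (by positivity))

lemma bval_zero (n : ℕ) (i : Fin d) : bval ω ξ n 0 i = 0 := by
  simp [bval, li, pos]

/-- rescaled path as a continuous map -/
noncomputable def bpath (T : ℝ) (n : ℕ) : C(Set.Icc (0:ℝ) T, Fin d → ℝ) where
  toFun t := bval ω ξ n t.1
  continuous_toFun := by
    refine continuous_pi fun i => ?_
    refine (LipschitzWith.of_dist_le_mul (K := (n : NNReal)) fun s t => ?_).continuous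
    rw [Real.dist_eq, Subtype.dist_eq, Real.dist_eq]
    exact bval_lip ω ξ n i t.2.1 s.2.1

lemma bpath_eq (T : ℝ) (n : ℕ) : interpPath d T n N (wpath ω ξ) = UniformFun.ofFun (bpath ω ξ T n) := by
  unfold interpPath
  congr 1
  funext t i
  have h : 0 ≤ t.1 * n := mul_nonneg t.2.1 (Nat.cast_nonneg n)
  have e : ∀ k, extPath N (wpath ω ξ) k = pos ω ξ k := fun k => pos_min ω ξ k
  simp only [e, Int.floor_toNat, ← natCast_floor_eq_intCast_floor h]
  rfl
end

/-- number of steps -/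
noncomputable def Nn (T : ℝ) (n : ℕ) : ℕ := ⌊T * n⌋.toNat + 1

lemma Nn_le {T : ℝ} (hT : 0 < T) {n : ℕ} (hn : 1 ≤ n) : (Nn T n : ℝ) ≤ (T+1) * n := by
  have h := Nat.floor_le (by positivity : 0 ≤ T * (n:ℝ))
  have : (1:ℝ) ≤ n := by exact_mod_cast hn
  rw [Nn, Int.floor_toNat]; push_cast; linarith

lemma floor_le_Nn {T : ℝ} (n : ℕ) (t : Set.Icc (0:ℝ) T) : ⌊t.1 * n⌋₊ ≤ Nn T n := by
  rw [Nn, Int.floor_toNat]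
  exact (Nat.floor_mono (mul_le_mul_of_nonneg_right t.2.2 (Nat.cast_nonneg n))).trans (Nat.le_succ _)

variable {ω : Config d} {C : Matrix (Fin d) (Fin d) ℝ} {Φ : Fin d → Pt d → ℝ} {G : Pt d → ℝ} {T : ℝ}

lemma modB (hd : 0 < d) (hW : GoodWalk ω C Φ G) (hC : ∀ v : Fin d → ℝ, 0 ≤ ∑ a, ∑ b, v a * C a b * v b) (hT : 0 < T)
    {l : ℝ} (hl : 0 < l) {η : ℝ} (hη : 0 < η) :
    ∃ δ : ℝ, 0 < δ ∧ ∀ n : ℕ, Pr (Nn T n) (fun ξ : Fin (Nn T n) → Dir d => ∃ s t : Set.Icc (0:ℝ) T, |t.1 - s.1| ≤ δ ∧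
      ∃ a, l < |bval ω ξ n t a - bval ω ξ n s a|) ≤ η := by
  obtain ⟨δ, hδ, n0, h⟩ := modl hd hW hC (by linarith : 0 ≤ T+1) (half_pos hl) hη
  obtain ⟨n1, hn1⟩ := exists_nat_ge (2/δ + 16/l^2 + 1)
  set n2 := max n0 n1
  have hnn : ∀ n, n2 ≤ n → Pr (Nn T n) (fun ξ : Fin (Nn T n) → Dir d => ∃ s t : Set.Icc (0:ℝ) T, |t.1 - s.1| ≤ δ/2 ∧
      ∃ a, l < |bval ω ξ n t a - bval ω ξ n s a|) ≤ η := by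
    intro n hn
    have hn' : 2/δ + 16/l^2 + 1 ≤ (n:ℝ) := hn1.trans (by exact_mod_cast (le_max_right _ _).trans hn)
    have p1 : 0 < 2/δ := by positivity
    have p2 : 0 < 16/l^2 := by positivity
    have hn1' : 1 ≤ n := by exact_mod_cast (by linarith : (1:ℝ) ≤ n)
    refine le_trans (Pr_mono fun ξ => ?_) (h n ((le_max_left _ _).trans hn) _ (Nn_le hT hn1'))
    have key : ∀ s t : Set.Icc (0:ℝ) T, s.1 ≤ t.1 → t.1 - s.1 ≤ δ/2 → ∀ a, l < |bval ω ξ n t a - bval ω ξ n s a| →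
        ∃ j j', j ≤ j' ∧ j' ≤ Nn T n ∧ (j':ℝ) ≤ j + δ * n ∧ ∃ a, l/2 * Real.sqrt n < |(pos ω ξ j' a : ℝ) - pos ω ξ j a| := by
      intro s t hst hδ' a hla
      have hs0 : 0 < Real.sqrt n := Real.sqrt_pos.2 (by exact_mod_cast hn1')
      refine ⟨⌊s.1 * n⌋₊, ⌊t.1 * n⌋₊, Nat.floor_mono (by gcongr), floor_le_Nn n t, ?_, a, ?_⟩
      · have e1 := Nat.floor_le (mul_nonneg t.2.1 (Nat.cast_nonneg n) : 0 ≤ t.1 * (n:ℝ))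
        have e2 := Nat.lt_floor_add_one (s.1 * (n:ℝ))
        have e3 : 2 ≤ δ * n := by
          have : δ * (2/δ) ≤ δ * n := mul_le_mul_of_nonneg_left (by linarith) hδ.le
          rwa [mul_div_cancel₀ _ hδ.ne'] at this
        have e4 : (t.1 - s.1) * n ≤ δ/2 * n := mul_le_mul_of_nonneg_right hδ' (Nat.cast_nonneg n)
        linarith
      · have b1 := abs_le.1 (bval_near ω ξ n a t.2.1)
        have b2 := abs_le.1 (bval_near ω ξ n a s.2.1)
        have e5 : 4 ≤ l * Real.sqrt n := by
          refine le_of_sq_le_sq ?_ (by positivity) 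
          rw [mul_pow, Real.sq_sqrt (Nat.cast_nonneg n)]
          have : l^2 * (16/l^2) ≤ l^2 * n := mul_le_mul_of_nonneg_left (by linarith) (by positivity)
          rw [mul_div_cancel₀ _ (by positivity)] at this
          linarith
        have e6 : |(Real.sqrt n)⁻¹ * ((pos ω ξ ⌊t.1 * n⌋₊ a : ℝ) - pos ω ξ ⌊s.1 * n⌋₊ a)| > l - 2 * (Real.sqrt n)⁻¹ := by
          rw [mul_sub]
          rcases lt_abs.1 hla with h' | h'
          · exact lt_of_lt_of_le (by linarith) (le_abs_self _)
          · exact lt_of_lt_of_le (by linarith) (neg_le_abs _)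
        rw [abs_mul, abs_of_nonneg (by positivity)] at e6
        have e7 := mul_lt_mul_of_pos_left e6 hs0
        rw [mul_inv_cancel_left₀ hs0.ne', mul_sub, mul_left_comm, mul_inv_cancel₀ hs0.ne'] at e7
        linarith
    rintro ⟨s, t, hst, a, hla⟩
    rcases le_total s.1 t.1 with h' | h'
    · rw [abs_of_nonneg (sub_nonneg.2 h')] at hst; exact key s t h' hst a hla
    · rw [abs_sub_comm, abs_of_nonneg (sub_nonneg.2 h')] at hst
      rw [abs_sub_comm] at hla; exact key t s h' hst a hla
  refine ⟨min (δ/2) (l/(n2+1)), by positivity, fun n => ?_⟩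
  rcases le_or_gt n2 n with hn | hn
  · refine le_trans (Pr_mono fun ξ => ?_) (hnn n hn)
    rintro ⟨s, t, hst, hh⟩
    exact ⟨s, t, hst.trans (min_le_left _ _), hh⟩
  · refine le_trans (Pr_mono (q := fun _ => False) fun ξ => ?_) (by simp [Pr, Ex_zero, hη.le])
    rintro ⟨s, t, hst, a, hla⟩
    have h1 := bval_lip ω ξ n a s.2.1 t.2.1
    have h2 := hst.trans (min_le_right _ _)
    have h3 : (n:ℝ) * |t.1 - s.1| ≤ n2 * (l/(n2+1)) := mul_le_mul (by exact_mod_cast hn.le) h2 (abs_nonneg _) (by positivity)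
    have h4 : (n2:ℝ) * (l/(n2+1)) ≤ l := by
      rw [mul_div_assoc', div_le_iff₀ (by positivity)]; nlinarith
    linarith

lemma ce_sub (s t : ℝ) : ‖ce s - ce t‖ ≤ |s - t| := by
  have : ce s - ce t = ce t * (ce (s - t) - 1) := by rw [mul_sub, ← ce_add]; simp
  rw [this, norm_mul, ce_norm, one_mul]; exact ce_sub_one _

lemma fdd (hd : 0 < d) (hW : GoodWalk ω C Φ G) (hC : ∀ v : Fin d → ℝ, 0 ≤ ∑ a, ∑ b, v a * C a b * v b) (hT : 0 < T)
    {m : ℕ} (t : Fin m → Set.Icc (0:ℝ) T) (θ : Fin m → Fin d → ℝ) :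
    Tendsto (fun n => Ex (Nn T n) (fun ξ : Fin (Nn T n) → Dir d => ce (∑ j, ∑ a, θ j a * bval ω ξ n (t j) a))) atTop
      (nhds ((Real.exp (-((∑ j, ∑ j', min (t j).1 (t j').1 * ∑ a, ∑ b, θ j a * C a b * θ j' b)/2)) : ℝ) : ℂ)) := by
  set K : ℕ → Fin m → ℕ := fun n j => ⌊(t j).1 * n⌋₊
  have hlim : Tendsto (fun n : ℕ => ((Real.exp (-(((n:ℝ)⁻¹ * ∑ j, ∑ j', ((min (K n j) (K n j') : ℕ) : ℝ) * ∑ a, ∑ b, θ j a * C a b * θ j' b)/2)) : ℝ) : ℂ)) atTop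
      (nhds ((Real.exp (-((∑ j, ∑ j', min (t j).1 (t j').1 * ∑ a, ∑ b, θ j a * C a b * θ j' b)/2)) : ℝ) : ℂ)) := by
    refine (Complex.continuous_ofReal.tendsto _).comp ((Real.continuous_exp.tendsto _).comp ((Tendsto.div_const ?_ 2).neg))
    simp only [Finset.mul_sum _ _ (_ : ℝ)⁻¹]
    refine tendsto_finsetSum _ fun j _ => tendsto_finsetSum _ fun j' _ => ?_
    simp only [← mul_assoc (_ : ℝ)⁻¹]
    refine Tendsto.mul_const _ ?_
    have hk : ∀ j, Tendsto (fun n : ℕ => (K n j : ℝ) / n) atTop (nhds (t j).1) := fun j =>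
      (tendsto_nat_floor_mul_div_atTop (t j).2.1).comp tendsto_natCast_atTop_atTop
    refine ((hk j).min (hk j')).congr fun n => ?_
    rw [Nat.cast_min, inv_mul_eq_div, min_div_div_right (Nat.cast_nonneg n)]
  have hdiff : Tendsto (fun n : ℕ => Ex (Nn T n) (fun ξ : Fin (Nn T n) → Dir d => ce (∑ j, ∑ a, θ j a * bval ω ξ n (t j) a)) -
      ((Real.exp (-(((n:ℝ)⁻¹ * ∑ j, ∑ j', ((min (K n j) (K n j') : ℕ) : ℝ) * ∑ a, ∑ b, θ j a * C a b * θ j' b)/2)) : ℝ) : ℂ)) atTop (nhds 0) := by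
    rw [Metric.tendsto_atTop]
    intro δ hδ
    set M := ∑ j, ∑ a, |θ j a| with hM
    have hM0 : 0 ≤ M := Finset.sum_nonneg fun j _ => Finset.sum_nonneg fun a _ => abs_nonneg _
    have hA : 0 ≤ T + 1 := by linarith
    obtain ⟨n0, h0⟩ := clt_unif hd hW hC θ hA (by positivity : 0 < δ/5)
    obtain ⟨n1, h1⟩ := far hd hW hC hA (by positivity : 0 < δ/(5*(M+1))) (by positivity : 0 < δ/10)
    obtain ⟨n2, h2⟩ := exists_nat_ge ((5*(M+1)/δ)^2 + 1)
    refine ⟨max n0 (max n1 n2), fun n hn => ?_⟩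
    have hn0 := (le_max_left _ _).trans hn
    have hn1 := ((le_max_left _ _).trans (le_max_right _ _)).trans hn
    have hn2 : (5*(M+1)/δ)^2 + 1 ≤ (n:ℝ) := h2.trans (by exact_mod_cast ((le_max_right _ _).trans (le_max_right _ _)).trans hn)
    have hnp : 1 ≤ n := by
      have : (1:ℝ) ≤ n := by linarith [sq_nonneg (5*(M+1)/δ)]
      exact_mod_cast this
    have hs0 : 0 < Real.sqrt n := Real.sqrt_pos.2 (by exact_mod_cast hnp)
    have hs : (Real.sqrt n)⁻¹ ≤ δ/(5*(M+1)) := by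
      rw [← inv_div]
      exact inv_anti₀ (by positivity) (Real.le_sqrt_of_sq_le (by linarith))
    have c := h0 n hn0 _ (Nn_le hT hnp) (K n) (fun j => floor_le_Nn n (t j))
    have f := h1 n hn1 _ (Nn_le hT hnp)
    have hmid : ‖Ex (Nn T n) (fun ξ : Fin (Nn T n) → Dir d => ce (∑ j, ∑ a, θ j a * bval ω ξ n (t j) a)) -
        Ex (Nn T n) (fun ξ : Fin (Nn T n) → Dir d => ce ((Real.sqrt n)⁻¹ * ∑ j, ∑ a, θ j a * Φ a (pos ω ξ (K n j))))‖ ≤ 2 * (δ/10) + 2*δ/5 := by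
      rw [← Ex_sub]
      refine (Ex_norm _).trans ?_
      refine le_trans (b := 2 * Pr (Nn T n) _ + 2*δ/5) ?_ (by gcongr)
      rw [Pr, ← Ex_mul, ← Ex_const (N := Nn T n) hd (2*δ/5), ← Ex_add]
      refine Ex_mono fun ξ => ?_
      by_cases hp : ∃ k ≤ Nn T n, ∃ a, δ/(5*(M+1)) * Real.sqrt n < |Φ a (pos ω ξ k) - pos ω ξ k a|
      · rw [if_pos hp]
        refine (norm_sub_le _ _).trans ?_
        rw [ce_norm, ce_norm]; linarith
      · rw [if_neg hp, mul_zero, zero_add]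
        push Not at hp
        refine (ce_sub _ _).trans ?_
        rw [Finset.mul_sum, ← Finset.sum_sub_distrib]
        have hb : ∀ j a, |bval ω ξ n (t j) a - (Real.sqrt n)⁻¹ * Φ a (pos ω ξ (K n j))| ≤ 2 * (δ/(5*(M+1))) := by
          intro j a
          have g1 := abs_le.1 ((bval_near ω ξ n a (t j).2.1).trans hs)
          have g2 : |(Real.sqrt n)⁻¹ * (Φ a (pos ω ξ (K n j)) - pos ω ξ (K n j) a)| ≤ δ/(5*(M+1)) := by
            rw [abs_mul, abs_of_nonneg (by positivity), inv_mul_le_iff₀ hs0, mul_comm]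
            exact hp _ (floor_le_Nn n (t j)) a
          rw [mul_sub] at g2
          have g2 := abs_le.1 g2
          rw [abs_le]; constructor <;> linarith
        calc _ ≤ ∑ j, ∑ a, |θ j a| * (2 * (δ/(5*(M+1)))) := by
              refine (Finset.abs_sum_le_sum_abs _ _).trans (Finset.sum_le_sum fun j _ => ?_)
              rw [Finset.mul_sum, ← Finset.sum_sub_distrib]
              refine (Finset.abs_sum_le_sum_abs _ _).trans (Finset.sum_le_sum fun a _ => ?_)
              rw [mul_left_comm, ← mul_sub, abs_mul]
              exact mul_le_mul_of_nonneg_left (hb j a) (abs_nonneg _)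
          _ = M * (2 * (δ/(5*(M+1)))) := by simp only [hM, Finset.sum_mul]
          _ ≤ (M+1) * (2 * (δ/(5*(M+1)))) := by gcongr; linarith
          _ = 2*δ/5 := by field_simp
    rw [dist_zero_right]
    refine lt_of_le_of_lt (norm_sub_le_norm_sub_add_norm_sub _ _ _) (lt_of_le_of_lt (add_le_add hmid c) ?_)
    linarith
  simpa using hdiff.add hlim
end Perco

namespace Perco
variable {d : ℕ} {T : ℝ}

/-- continuous paths -/
abbrev CE (d : ℕ) (T : ℝ) := C(Set.Icc (0:ℝ) T, Fin d → ℝ)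
noncomputable instance : MeasurableSpace (CE d T) := borel _
instance : BorelSpace (CE d T) := ⟨rfl⟩
instance : BorelSpace (PathSp d T) := ⟨rfl⟩

/-- paths with a prescribed modulus of continuity -/
def Kset (hT : 0 < T) (δ : ℕ → ℝ) : Set (Set.Icc (0:ℝ) T → Fin d → ℝ) :=
  {f | f ⟨0, le_rfl, hT.le⟩ = 0 ∧ ∀ j : ℕ, ∀ s t : Set.Icc (0:ℝ) T, |t.1 - s.1| ≤ δ j → ∀ a, |f t a - f s a| ≤ 1/((j:ℝ)+1)}

lemma Kset_closed (hT : 0 < T) (δ : ℕ → ℝ) : IsClosed (Kset (d := d) hT δ) := by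
  refine IsClosed.and (isClosed_eq (continuous_apply _) continuous_const) ?_
  simp only [isClosed_iff_clusterPt, Set.ofPred_forall] 
  rw [← isClosed_iff_clusterPt]
  refine isClosed_iInter fun j => isClosed_iInter fun s => isClosed_iInter fun t => isClosed_iInter fun _ => isClosed_iInter fun a => ?_
  exact isClosed_le (by fun_prop) continuous_const

lemma Kset_bdd (hT : 0 < T) {δ : ℕ → ℝ} (hδ : ∀ j, 0 < δ j) {f : Set.Icc (0:ℝ) T → Fin d → ℝ} (hf : f ∈ Kset hT δ) (k : ℕ) :
    ∀ t : Set.Icc (0:ℝ) T, t.1 ≤ k * δ 0 → ∀ a, |f t a| ≤ k := by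
  induction k with
  | zero =>
    intro t ht a
    have : t = ⟨0, le_rfl, hT.le⟩ := Subtype.ext (le_antisymm (by simpa using ht) t.2.1)
    rw [this, hf.1]; simp
  | succ k ih =>
    intro t ht a
    push_cast at ht ⊢
    set s : Set.Icc (0:ℝ) T := ⟨max (t.1 - δ 0) 0, le_max_right _ _, max_le (by linarith [t.2.2, hδ 0]) hT.le⟩
    have h1 := ih s (max_le (by linarith) (by have := hδ 0; positivity)) a
    have h2 := hf.2 0 s t (by
      have : s.1 = max (t.1 - δ 0) 0 := rfl
      rw [this, abs_le]
      constructor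
      · linarith [max_le (by linarith [hδ 0] : t.1 - δ 0 ≤ t.1 + δ 0) (by linarith [hδ 0, t.2.1] : 0 ≤ t.1 + δ 0)]
      · linarith [le_max_left (t.1 - δ 0) 0]) a
    norm_num at h2
    have h1 := abs_le.1 h1
    have h2 := abs_le.1 h2
    rw [abs_le]; constructor <;> linarith

lemma Kset_mod (hT : 0 < T) {δ : ℕ → ℝ} (hδ : ∀ j, 0 < δ j) {ε : ℝ} (hε : 0 < ε) : ∃ δ' > 0, ∀ f ∈ Kset (d := d) hT δ,
    ∀ s t, dist s t < δ' → dist (f t) (f s) < ε := by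
  obtain ⟨j, hj⟩ := exists_nat_one_div_lt hε
  refine ⟨δ j, hδ j, fun f hf s t hst => ?_⟩
  rw [dist_pi_lt_iff hε]
  intro a
  refine lt_of_le_of_lt (hf.2 j s t ?_ a) hj
  rw [dist_comm, Subtype.dist_eq, Real.dist_eq] at hst
  exact hst.le

lemma Kset_compact (hT : 0 < T) {δ : ℕ → ℝ} (hδ : ∀ j, 0 < δ j) : IsCompact {f : CE d T | (f : Set.Icc (0:ℝ) T → Fin d → ℝ) ∈ Kset hT δ} := by
  refine ArzelaAscoli.isCompact_of_equicontinuous _ ?_ ?_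
  · have : ContinuousMap.toFun '' {f : CE d T | (f : Set.Icc (0:ℝ) T → Fin d → ℝ) ∈ Kset hT δ} = Kset hT δ := by
      ext g
      constructor
      · rintro ⟨f, hf, rfl⟩; exact hf
      · intro hg
        refine ⟨⟨g, ?_⟩, hg, rfl⟩
        rw [Metric.continuous_iff]
        intro s ε hε
        obtain ⟨δ', h1, h2⟩ := Kset_mod (d := d) hT hδ hε
        exact ⟨δ', h1, fun t ht => h2 g hg s t (by rwa [dist_comm])⟩
    rw [this]
    obtain ⟨k, hk⟩ := exists_nat_ge (T / δ 0)
    rw [div_le_iff₀ (hδ 0)] at hk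
    refine IsCompact.of_isClosed_subset (isCompact_univ_pi fun _ => isCompact_univ_pi fun _ : Fin d => isCompact_Icc (a := -(k:ℝ)) (b := k))
      (Kset_closed hT δ) fun f hf t _ a _ => ?_
    exact Set.mem_Icc.2 (abs_le.1 (Kset_bdd hT hδ hf k t (t.2.2.trans hk) a))
  · intro s
    rw [Metric.equicontinuousAt_iff]
    intro ε hε
    obtain ⟨δ', h1, h2⟩ := Kset_mod (d := d) hT hδ hε
    exact ⟨δ', h1, fun t ht f => h2 f.1 f.2 t s ht⟩

/-- law of the rescaled path -/
noncomputable def lawM (ω : Config d) (T : ℝ) (n : ℕ) : Measure (CE d T) :=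
  ∑ ξ : Fin (Nn T n) → Dir d, ENNReal.ofReal (((2*d:ℝ)^(Nn T n))⁻¹) • Measure.dirac (bpath ω ξ T n)

lemma lawM_apply (ω : Config d) (n : ℕ) (A : Set (CE d T)) : lawM ω T n A = ENNReal.ofReal (Pr (Nn T n) (fun ξ => bpath ω ξ T n ∈ A)) := by
  classical
  rw [lawM, Measure.finsetSum_apply, Pr, Ex, smul_eq_mul, Finset.mul_sum, ENNReal.ofReal_sum_of_nonneg (fun ξ _ => by positivity)]
  refine Finset.sum_congr rfl fun ξ _ => ?_
  rw [Measure.smul_apply, Measure.dirac_apply, smul_eq_mul]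
  by_cases h : bpath ω ξ T n ∈ A
  · rw [if_pos h, Set.indicator_of_mem h]; simp
  · rw [if_neg h, Set.indicator_of_notMem h]; simp

lemma lawM_prob (hd : 0 < d) (ω : Config d) (n : ℕ) : IsProbabilityMeasure (lawM ω T n) := ⟨by
  rw [lawM_apply, Pr]; simp [Ex_const hd]⟩

lemma lawM_integral {V : Type*} [NormedAddCommGroup V] [NormedSpace ℝ V] [CompleteSpace V] (ω : Config d) (n : ℕ) (g : CE d T → V) :
    ∫ f, g f ∂(lawM ω T n) = Ex (Nn T n) (fun ξ : Fin (Nn T n) → Dir d => g (bpath ω ξ T n)) := by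
  rw [lawM, integral_finsetSum_measure (fun ξ _ => (integrable_dirac (by simp)).smul_measure (by simp)), Ex, Finset.smul_sum]
  refine Finset.sum_congr rfl fun ξ _ => ?_
  rw [integral_smul_measure, integral_dirac, ENNReal.toReal_ofReal (by positivity)]

variable {ω : Config d} {C : Matrix (Fin d) (Fin d) ℝ} {Φ : Fin d → Pt d → ℝ} {G : Pt d → ℝ}

lemma law_tight (hd : 0 < d) (hW : GoodWalk ω C Φ G) (hC : ∀ v : Fin d → ℝ, 0 ≤ ∑ a, ∑ b, v a * C a b * v b) (hT : 0 < T) :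
    IsTightMeasureSet {μ | ∃ n, lawM ω T n = μ} := by
  rw [isTightMeasureSet_iff_exists_isCompact_measure_compl_le]
  intro ε hε
  obtain ⟨η, hη, hs⟩ := ENNReal.exists_pos_sum_of_countable hε.ne' ℕ
  have h : ∀ j : ℕ, ∃ δ : ℝ, 0 < δ ∧ ∀ n : ℕ, Pr (Nn T n) (fun ξ : Fin (Nn T n) → Dir d => ∃ s t : Set.Icc (0:ℝ) T, |t.1 - s.1| ≤ δ ∧
      ∃ a, 1/((j:ℝ)+1) < |bval ω ξ n t a - bval ω ξ n s a|) ≤ η j := fun j => modB hd hW hC hT (by positivity) (hη j)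
  choose δ hδ hm using h
  refine ⟨_, Kset_compact hT hδ, ?_⟩
  rintro _ ⟨n, rfl⟩
  have hsub : {f : CE d T | (f : Set.Icc (0:ℝ) T → Fin d → ℝ) ∈ Kset hT δ}ᶜ ⊆ {f : CE d T | f ⟨0, le_rfl, hT.le⟩ ≠ 0} ∪
      ⋃ j : ℕ, {f : CE d T | ∃ s t : Set.Icc (0:ℝ) T, |t.1 - s.1| ≤ δ j ∧ ∃ a, 1/((j:ℝ)+1) < |f t a - f s a|} := by
    intro f hf
    by_contra hcon
    refine hf ?_
    simp only [Set.mem_union, Set.mem_ofPred_eq, Set.mem_iUnion, not_or, not_not] at hcon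
    refine ⟨hcon.1, fun j s t hst a => ?_⟩
    by_contra hlt
    exact hcon.2 ⟨j, s, t, hst, a, not_le.1 hlt⟩
  refine (measure_mono hsub).trans ((measure_union_le _ _).trans ?_)
  have h0 : lawM ω T n {f : CE d T | f ⟨0, le_rfl, hT.le⟩ ≠ 0} = 0 := by
    rw [lawM_apply, ENNReal.ofReal_eq_zero]
    refine le_trans (Pr_mono (q := fun _ => False) fun ξ hξ => hξ (funext fun i => bval_zero ω ξ n i)) (by simp [Pr, Ex_zero])
  rw [h0, zero_add]
  refine (measure_iUnion_le _).trans ((ENNReal.tsum_le_tsum fun j => ?_).trans hs.le)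
  rw [lawM_apply]
  exact ENNReal.ofReal_le_of_le_toReal (hm j n)

/-- test space -/
abbrev Tst (d : ℕ) (T : ℝ) := (Set.Icc (0:ℝ) T × Fin d) →₀ ℝ

/-- duality between paths and finite measures -/
noncomputable def Lp (d : ℕ) (T : ℝ) : CE d T →ₗ[ℝ] Tst d T →ₗ[ℝ] ℝ :=
  LinearMap.mk₂ ℝ (fun f w => w.sum fun p c => c * f p.1 p.2)
    (fun f g w => by simp [mul_add, Finsupp.sum, Finset.sum_add_distrib])
    (fun c f w => by simp [Finsupp.sum, Finset.mul_sum, mul_left_comm])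
    (fun f w w' => Finsupp.sum_add_index' (by simp) (fun p b c => by ring))
    (fun c f w => by rw [Finsupp.sum_smul_index' (by simp)]; simp [Finsupp.sum, Finset.mul_sum, mul_assoc])

lemma Lp_apply (f : CE d T) (w : Tst d T) : Lp d T f w = w.sum fun p c => c * f p.1 p.2 := rfl

lemma Lp_cont (w : Tst d T) : Continuous (fun f : CE d T => Lp d T f w) := by
  simp only [Lp_apply, Finsupp.sum]
  refine continuous_finsetSum _ fun p _ => continuous_const.mul ?_
  exact (continuous_apply p.2).comp (continuous_eval_const p.1)

/-- weak limits: identification -/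
lemma conv_of_char {μ : ℕ → ProbabilityMeasure (CE d T)} (ht : IsTightMeasureSet {(μ n : Measure (CE d T)) | n}) {μ₀ : ProbabilityMeasure (CE d T)}
    (h : ∀ w, Tendsto (fun n => ∫ f, ce (Lp d T f w) ∂(μ n : Measure (CE d T))) atTop (nhds (∫ f, ce (Lp d T f w) ∂(μ₀ : Measure (CE d T))))) :
    Tendsto μ atTop (nhds μ₀) := by
  let _ : TopologicalSpace (Tst d T) := ⊥
  have : DiscreteTopology (Tst d T) := ⟨rfl⟩
  have hL : Continuous fun p : CE d T × Tst d T => Lp d T p.1 p.2 := by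
    rw [continuous_prod_of_discrete_right]
    exact Lp_cont
  have he : ∀ x : ℝ, ((Real.probChar x : Circle) : ℂ) = ce x := fun x => by rw [Real.probChar_apply, ce, mul_comm]
  refine ProbabilityMeasure.tendsto_of_tight_of_separatesPoints ℂ ht (A := BoundedContinuousFunction.charPoly Real.continuous_probChar hL) ?_ ?_
  · refine BoundedContinuousFunction.separatesPoints_charPoly _ Real.probChar_ne_one _ fun f hf h0 => hf ?_
    ext t a
    have := LinearMap.congr_fun h0 (Finsupp.single (t, a) 1)
    simpa [Lp_apply] using this
  · intro g hg
    rw [BoundedContinuousFunction.mem_charPoly] at hg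
    obtain ⟨w, hw⟩ := hg
    have h_eq (ν : Measure (CE d T)) (hν : IsProbabilityMeasure ν) :
        ∫ x, g x ∂ν = w.coeff.sum (fun a z => z * ∫ x, ce (Lp d T x a) ∂ν) := by
      simp_rw [hw, Finsupp.sum, he]
      rw [integral_finsetSum]
      · congr with y
        rw [integral_const_mul]
      · refine fun i _ => Integrable.const_mul ?_ _
        refine Integrable.of_bound (C := 1) ?_ (ae_of_all _ fun f => (ce_norm _).le)
        exact Continuous.aestronglyMeasurable (Complex.continuous_exp.comp (continuous_const.mul (Complex.continuous_ofReal.comp (Lp_cont i))))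
    simp_rw [h_eq (μ _ : Measure (CE d T)) inferInstance, h_eq (μ₀ : Measure (CE d T)) inferInstance]
    exact tendsto_finsetSum _ fun y _ => Tendsto.const_mul _ (h y)

/-- weak limits: existence -/
lemma exists_lim {μ : ℕ → ProbabilityMeasure (CE d T)} (ht : IsTightMeasureSet {(μ n : Measure (CE d T)) | n}) {ψ : Tst d T → ℂ}
    (h : ∀ w, Tendsto (fun n => ∫ f, ce (Lp d T f w) ∂(μ n : Measure (CE d T))) atTop (nhds (ψ w))) :
    ∃ μ₀ : ProbabilityMeasure (CE d T), ∀ w, ∫ f, ce (Lp d T f w) ∂(μ₀ : Measure (CE d T)) = ψ w := by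
  have h_compact : IsCompact (closure {μ n | n}) := isCompact_closure_of_isTightMeasureSet (by simpa using ht)
  obtain ⟨μ', -, hμ'⟩ := h_compact.ultrafilter_le_nhds ((hyperfilter ℕ).map μ)
    (le_trans (by simp) (monotone_principal subset_closure))
  have hμ' : Tendsto μ (hyperfilter ℕ : Filter ℕ) (nhds μ') := hμ'
  rw [ProbabilityMeasure.tendsto_iff_forall_integral_rclike_tendsto ℂ] at hμ'
  refine ⟨μ', fun w => ?_⟩
  let g : BoundedContinuousFunction (CE d T) ℂ := BoundedContinuousFunction.ofNormedAddCommGroup (fun f => ce (Lp d T f w))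
    (Complex.continuous_exp.comp (continuous_const.mul (Complex.continuous_ofReal.comp (Lp_cont w)))) 1 (fun f => (ce_norm _).le)
  exact tendsto_nhds_unique (hμ' g) ((h w).mono_left Nat.hyperfilter_le_atTop)

end Perco

namespace Perco
variable {d : ℕ} {T : ℝ}

lemma Lp_rep (w : Tst d T) : ∃ (m : ℕ) (t : Fin m → Set.Icc (0:ℝ) T) (θ : Fin m → Fin d → ℝ),
    ∀ f : CE d T, Lp d T f w = ∑ j, ∑ a, θ j a * f (t j) a := by
  classical
  let e := w.support.equivFin
  refine ⟨w.support.card, fun j => (e.symm j).1.1, fun j a => if a = (e.symm j).1.2 then w (e.symm j).1 else 0, fun f => ?_⟩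
  rw [Lp_apply, Finsupp.sum, ← Finset.sum_coe_sort, ← e.symm.sum_comp]
  refine Finset.sum_congr rfl fun j _ => ?_
  simp

/-- limiting Gaussian value -/
noncomputable def gv (C : Matrix (Fin d) (Fin d) ℝ) {m : ℕ} (t : Fin m → Set.Icc (0:ℝ) T) (θ : Fin m → Fin d → ℝ) : ℂ :=
  ((Real.exp (-((∑ j, ∑ j', min (t j).1 (t j').1 * ∑ a, ∑ b, θ j a * C a b * θ j' b)/2)) : ℝ) : ℂ)

variable {C : Matrix (Fin d) (Fin d) ℝ}

lemma law_fdd {ω : Config d} {Φ : Fin d → Pt d → ℝ} {G : Pt d → ℝ} (hd : 0 < d) (hW : GoodWalk ω C Φ G)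
    (hC : ∀ v : Fin d → ℝ, 0 ≤ ∑ a, ∑ b, v a * C a b * v b) (hT : 0 < T)
    {w : Tst d T} {m : ℕ} {t : Fin m → Set.Icc (0:ℝ) T} {θ : Fin m → Fin d → ℝ} (hw : ∀ f : CE d T, Lp d T f w = ∑ j, ∑ a, θ j a * f (t j) a) :
    Tendsto (fun n => ∫ f, ce (Lp d T f w) ∂(lawM ω T n)) atTop (nhds (gv C t θ)) := by
  refine (fdd hd hW hC hT t θ).congr fun n => ?_
  rw [lawM_integral]
  congr 1
  funext ξ
  rw [hw]
  rfl

/-- paths as elements of the path space -/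
noncomputable def iot (d : ℕ) (T : ℝ) (f : CE d T) : PathSp d T := UniformFun.ofFun f

lemma iot_cont : Continuous (iot d T) := by
  rw [continuous_iff_continuousAt]
  intro f
  rw [ContinuousAt, UniformFun.tendsto_iff_tendstoUniformly]
  exact ContinuousMap.tendsto_iff_tendstoUniformly.1 (tendsto_id (x := nhds f))

/-- law as a probability measure -/
noncomputable def lawP (hd : 0 < d) (T : ℝ) (ω : Config d) (n : ℕ) : ProbabilityMeasure (CE d T) := ⟨lawM ω T n, lawM_prob hd ω n⟩

lemma law_walk (hd : 0 < d) (ω : Config d) (n : ℕ) (F : PathSp d T → ℝ) :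
    ∫ f, F (iot d T f) ∂(lawM ω T n) = walkExpct d ω T n F := by
  rw [walkExpct_eq hd, lawM_integral]
  unfold Nn
  congr 1
  funext ξ
  rw [bpath_eq]
  rfl

lemma exists_W (hd : 0 < d) (hC : ∀ v : Fin d → ℝ, 0 ≤ ∑ a, ∑ b, v a * C a b * v b) (hT : 0 < T)
    (hex : ∃ (ω : Config d) (Φ : Fin d → Pt d → ℝ) (G : Pt d → ℝ), GoodWalk ω C Φ G) :
    ∃ W : Measure (PathSp d T), IsBMLaw d T C W ∧ ∀ (ω : Config d) (Φ : Fin d → Pt d → ℝ) (G : Pt d → ℝ), GoodWalk ω C Φ G →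
      ∀ F : BoundedContinuousFunction (PathSp d T) ℝ, Tendsto (fun n => walkExpct d ω T n (fun f => F f)) atTop (nhds (∫ f, F f ∂W)) := by
  choose m t θ hrep using Lp_rep (d := d) (T := T)
  obtain ⟨ω₀, Φ₀, G₀, h₀⟩ := hex
  obtain ⟨μ₀, hμ₀⟩ := exists_lim (μ := lawP hd T ω₀) (law_tight hd h₀ hC hT) (ψ := fun w => gv C (t w) (θ w))
    (fun w => law_fdd hd h₀ hC hT (hrep w))
  have hmeas : AEMeasurable (iot d T) (μ₀ : Measure (CE d T)) := iot_cont.measurable.aemeasurable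
  refine ⟨(μ₀ : Measure (CE d T)).map (iot d T), ⟨Measure.isProbabilityMeasure_map hmeas, ?_, ?_⟩, ?_⟩
  · rw [ae_map_iff hmeas (UniformFun.isClosed_setOfPred_continuous _).measurableSet]
    exact ae_of_all _ fun f => f.continuous
  · intro n s c
    have hev : ∀ k i, Continuous fun f : PathSp d T => UniformFun.toFun f (s k) i := fun k i =>
      (continuous_apply i).comp (UniformFun.uniformContinuous_eval _ (s k)).continuous
    have hcont : Continuous fun f : PathSp d T => Complex.exp (Complex.I * ((∑ k, ∑ i, c k i * (UniformFun.toFun f (s k) i) : ℝ) : ℂ)) := by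
      fun_prop
    rw [integral_map hmeas hcont.aestronglyMeasurable]
    set w : Tst d T := ∑ k, ∑ i, Finsupp.single (s k, i) (c k i) with hw
    have hwf : ∀ f : CE d T, Lp d T f w = ∑ j, ∑ a, c j a * f (s j) a := by
      intro f
      simp only [hw, map_sum]
      simp [Lp_apply]
    have h1 := tendsto_nhds_unique (law_fdd hd h₀ hC hT (hrep w)) (law_fdd hd h₀ hC hT hwf)
    have h2 := (hμ₀ w).trans h1
    simp only [hwf] at h2
    refine h2.trans ?_
    rw [gv, Complex.ofReal_exp]
    congr 1
    push_cast
    ring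
  · intro ω Φ G hW F
    have hlim : Tendsto (lawP hd T ω) atTop (nhds μ₀) := by
      refine conv_of_char (μ := lawP hd T ω) (μ₀ := μ₀) (law_tight hd hW hC hT) fun w => ?_
      rw [hμ₀ w]
      exact law_fdd hd hW hC hT (hrep w)
    rw [ProbabilityMeasure.tendsto_iff_forall_integral_tendsto] at hlim
    rw [integral_map hmeas F.continuous.aestronglyMeasurable]
    exact (hlim (F.compContinuous ⟨iot d T, iot_cont⟩)).congr fun n => law_walk hd ω n F
end Perco

namespace Perco
variable {d : ℕ}

theorem stmt0 (d : ℕ) (hd : 2 ≤ d) (a b : ℝ) (ha : 0 ≤ a) (hab : a < b)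
    (P : ℝ → Measure (Config d)) (Ax : Axioms d a b P) :
    ∀ u ∈ Set.Ioo a b,
      ∃ Cov : Matrix (Fin d) (Fin d) ℝ, Cov.PosDef ∧
        ((∀ (π : Equiv.Perm (Fin d)) (ε : Fin d → Bool),
            MeasurePreserving (fun ω : Config d => fun x => ω (signedPerm π ε x))
              (P u) (P u)) →
          ∃ σ > (0:ℝ), Cov = σ • (1 : Matrix (Fin d) (Fin d) ℝ)) ∧
        ∀ T : ℝ, 0 < T →
          ∃ W : Measure (PathSp d T), IsBMLaw d T Cov W ∧
            ∀ᵐ ω ∂(ProbabilityTheory.cond (P u) {ω | (0 : Pt d) ∈ Sinf ω}),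
              ∀ F : BoundedContinuousFunction (PathSp d T) ℝ,
                Filter.Tendsto (fun n => walkExpct d ω T n (fun f => F f))
                  Filter.atTop (nhds (∫ f, F f ∂W)) := by
  intro u hu
  have hd0 : 0 < d := by omega
  have := Ax.prob u hu
  have ht := tail_bad Ax hu
  have hη : 0 < (P u).real {ω | (0 : Pt d) ∈ Sinf ω} := Ax.S2pos u hu
  have hs : Stat (P u) := by
    intro x
    by_cases hx : x = 0
    · have : shift x = (id : Config d → Config d) := by
        funext ω y; simp [shift, hx]
      rw [this]; exact MeasurePreserving.id _
    · exact (Ax.ergodic u hu x hx).toMeasurePreserving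
  obtain ⟨h, ψ, hc⟩ := exists_corr (P u)
  have hp := Corr.posDef hd hs ht hc hη
  have hC : ∀ v : Fin d → ℝ, 0 ≤ ∑ a, ∑ b, v a * CovM (P u) h a b * v b := by
    intro v
    have := hp.posSemidef.dotProduct_mulVec_nonneg v
    simpa [dotProduct, Matrix.mulVec, Finset.mul_sum, mul_assoc] using this
  have hg := exists_goodWalk hd hs ht (⟨0, hd0⟩, true) (Ax.ergodic u hu _ (dir_ne_zero _)) hc hη
  have hg' : ∀ᵐ ω ∂(ProbabilityTheory.cond (P u) {ω | (0 : Pt d) ∈ Sinf ω}), ∃ Φ G, GoodWalk ω (CovM (P u) h) Φ G := by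
    have h1 : ∀ᵐ ω ∂(ProbabilityTheory.cond (P u) {ω | (0 : Pt d) ∈ Sinf ω}), (0 : Pt d) ∈ Sinf ω :=
      ProbabilityTheory.ae_cond_mem (measurableSet_Sinf 0)
    filter_upwards [h1, ProbabilityTheory.cond_absolutelyContinuous.ae_le hg] with ω h1 h2
    exact h2 h1
  have hne : (P u) {ω | (0 : Pt d) ∈ Sinf ω} ≠ 0 := fun h0 => by simp [Measure.real, h0] at hη
  have := ProbabilityTheory.cond_isProbabilityMeasure hne
  have hex := hg'.exists
  refine ⟨CovM (P u) h, hp, fun hg => Corr.iso hd0 hc hη hp hg, fun T hT => ?_⟩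
  obtain ⟨W, hW, hW'⟩ := exists_W hd0 hC hT hex
  refine ⟨W, hW, ?_⟩
  filter_upwards [hg'] with ω hω
  obtain ⟨Φ, G, hgw⟩ := hω
  exact hW' ω Φ G hgw
end Perco
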